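/- Suppose L(T) → ∞ as T → ∞ and limsup_{T→∞} π·L(T)/log T < 1. Then the second moment of S_{L(T)} is asymptotic to σ_{L(T)}²: ⟨(S_{L(T)})²⟩_{w,T} / σ_{L(T)}² → 1 as T → ∞. -/

import Mathlib

open MeasureTheory Filter

/-- `N(n) = ((n + √(n²−4))/2)²`, the norm of a hyperbolic class of trace `n`. -/
noncomputable def Nnorm (n : ℕ) : ℝ := (((n : ℝ) + Real.sqrt ((n : ℝ) ^ 2 - 4)) / 2) ^ 2
/-- Value of the integral binary quadratic form `(a,b,c)` at `(x,y)`. -/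
def formVal (f : ℤ × ℤ × ℤ) (x y : ℤ) : ℤ := f.1 * x ^ 2 + f.2.1 * x * y + f.2.2 * y ^ 2

/-- A form `ax² + bxy + cy²` is primitive if `gcd(a,b,c) = 1`. -/
def IsPrimitiveForm (f : ℤ × ℤ × ℤ) : Prop := Int.gcd f.1 (Int.gcd f.2.1 f.2.2) = 1

/-- Discriminant `b² − 4ac` of the form `(a,b,c)`. -/
def formDisc (f : ℤ × ℤ × ℤ) : ℤ := f.2.1 ^ 2 - 4 * f.1 * f.2.2

/-- `SL(2,ℤ)`-equivalence of binary quadratic forms: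
`Q'(x,y) = Q(αx + βy, γx + δy)` for some `[[α,β],[γ,δ]] ∈ SL(2,ℤ)`. -/
def formEquiv (f g : ℤ × ℤ × ℤ) : Prop :=
  ∃ M : Matrix.SpecialLinearGroup (Fin 2) ℤ,
    ∀ x y : ℤ, formVal g x y =
      formVal f (M.1 0 0 * x + M.1 0 1 * y) (M.1 1 0 * x + M.1 1 1 * y)

/-- The class number `h(d)`: the number of `SL(2,ℤ)`-equivalence classes of
primitive integral binary quadratic forms of discriminant `d`. -/
noncomputable def classNumber (d : ℤ) : ℕ :=
  Nat.card (Quot (fun f g : {f : ℤ × ℤ × ℤ // IsPrimitiveForm f ∧ formDisc f = d} =>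
    formEquiv f.1 g.1))
/-- `t_d`: the least `t ≥ 1` such that `t² − d u² = 4` has a solution with `u ≥ 1`. -/
noncomputable def td (d : ℤ) : ℕ :=
  sInf {t : ℕ | 0 < t ∧ ∃ u : ℕ, 0 < u ∧ (t : ℤ) ^ 2 - d * (u : ℤ) ^ 2 = 4}

/-- `u_d`: the positive `u` corresponding to `t_d`. -/
noncomputable def ud (d : ℤ) : ℕ :=
  sInf {u : ℕ | 0 < u ∧ (td d : ℤ) ^ 2 - d * (u : ℤ) ^ 2 = 4}

/-- `ε_d = (t_d + u_d √d)/2`, the fundamental solution of `t² − d u² = 4`. -/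
noncomputable def eps (d : ℤ) : ℝ := ((td d : ℝ) + (ud d : ℝ) * Real.sqrt (d : ℝ)) / 2
/-- `A(n) = Σ h(d)·log(ε_d)/(u·√d)`, summed over pairs `(d,u)` of positive integers with
`d ≡ 0, 1 (mod 4)` and `d·u² = n² − 4`. -/
noncomputable def ampA (n : ℕ) : ℝ :=
  ∑ p ∈ (Finset.range (n ^ 2) ×ˢ Finset.range (n ^ 2)).filter
      (fun p => 0 < p.1 ∧ 0 < p.2 ∧ (p.1 % 4 = 0 ∨ p.1 % 4 = 1) ∧ p.1 * p.2 ^ 2 = n ^ 2 - 4),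
    (classNumber (p.1 : ℤ) : ℝ) * Real.log (eps (p.1 : ℤ)) /
      ((p.2 : ℝ) * Real.sqrt (p.1 : ℝ))
/-- `κ = (1015/864)·∏_{p ≠ 2 prime} (1 + (p⁴ − 2p³ + 1)/(p² − 1)³)`. -/
noncomputable def kappa : ℝ :=
  (1015 / 864) * ∏' p : {p : ℕ // p.Prime ∧ p ≠ 2},
    (1 + ((p.1 : ℝ) ^ 4 - 2 * (p.1 : ℝ) ^ 3 + 1) / ((p.1 : ℝ) ^ 2 - 1) ^ 3)
/-- The hyperbolic-class sum
`S_L(τ) = (1/(πL)) Σ_{n>2} A(n)·g(log N(n)/(2πL))·2cos(τ·log N(n))`. -/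
noncomputable def SL (g : ℝ → ℝ) (L τ : ℝ) : ℝ :=
  (1 / (Real.pi * L)) * ∑' n : ℕ,
    if 2 < n then
      ampA n * g (Real.log (Nnorm n) / (2 * Real.pi * L)) *
        (2 * Real.cos (τ * Real.log (Nnorm n)))
    else 0
/-- `σ_L² = (2κ/(πL))·∫₀^∞ g(u)²·e^{πLu} du`. -/
noncomputable def sigmaSq (g : ℝ → ℝ) (L : ℝ) : ℝ :=
  (2 * kappa / (Real.pi * L)) * ∫ u in Set.Ioi (0 : ℝ), g u ^ 2 * Real.exp (Real.pi * L * u)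

section
namespace VA

/-- the odd quadratic symbol -/
def chi (d : ℤ) (q : ℕ) : ℤ := if Odd q then jacobiSym d q else 0

lemma chi_one (d : ℤ) : chi d 1 = 1 := by simp [chi]

lemma chi_zero (d : ℤ) : chi d 0 = 0 := by simp [chi]

lemma chi_mul (d : ℤ) (a b : ℕ) : chi d (a * b) = chi d a * chi d b := by
  unfold chi
  by_cases ha : Odd a <;> by_cases hb : Odd b
  · have h1 : a ≠ 0 := by rintro rfl; simp at ha
    have h2 : b ≠ 0 := by rintro rfl; simp at hb
    have := NeZero.mk h1
    have := NeZero.mk h2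
    simp [ha, hb, Nat.odd_mul, jacobiSym.mul_right]
  all_goals simp [ha, hb, Nat.odd_mul]

lemma chi_mul_left (d e : ℤ) (q : ℕ) : chi (d * e) q = chi d q * chi e q := by
  unfold chi
  split_ifs
  · exact jacobiSym.mul_left _ _ _
  · simp

lemma chi_abs_le (d : ℤ) (q : ℕ) : |chi d q| ≤ 1 := by
  unfold chi
  split_ifs
  · rcases jacobiSym.trichotomy d q with h | h | h <;> simp [h]
  · simp

lemma chi_periodic (d : ℤ) (q : ℕ) : chi d (q + 4 * d.natAbs) = chi d q := by
  have hpar : Odd (q + 4 * d.natAbs) ↔ Odd q := by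
    have : Even (4 * d.natAbs) := ⟨2 * d.natAbs, by ring⟩
    rw [Nat.odd_add]
    simp [this]
  unfold chi
  by_cases h : Odd q
  · simp only [h, hpar, if_true]
    rw [jacobiSym.mod_right d (hpar.2 h), jacobiSym.mod_right d h, Nat.add_mod_right]
  · simp [h, hpar]

/-- congruence in the top argument -/
lemma chi_congr {d e : ℤ} {q : ℕ} (h : d ≡ e [ZMOD q]) : chi d q = chi e q := by
  unfold chi
  split_ifs
  · exact jacobiSym.mod_left' h
  · rfl

lemma chi_eq_zero_of_not_coprime {d : ℤ} {q : ℕ} (h : ¬ Nat.Coprime d.natAbs q) :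
    chi d q = 0 := by
  unfold chi
  split_ifs with ho
  · rw [jacobiSym.eq_zero_iff]
    refine ⟨by rintro rfl; simp at ho, ?_⟩
    simpa [Int.gcd] using h
  · rfl

lemma chi_sq_mul {d : ℤ} {q : ℕ} {u : ℤ} (h : Nat.Coprime u.natAbs q) :
    chi (u ^ 2 * d) q = chi d q := by
  unfold chi
  split_ifs with ho
  · have : Int.gcd u q = 1 := by simpa [Int.gcd] using h
    rw [jacobiSym.mul_left, jacobiSym.pow_left, jacobiSym.sq_one this, one_mul]
  · rfl

/-- a nonsquare has a prime of odd valuation -/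
lemma exists_prime_odd_val {d : ℕ} (h0 : d ≠ 0) (h : ¬ IsSquare d) :
    ∃ p v m : ℕ, p.Prime ∧ Odd v ∧ ¬ p ∣ m ∧ d = p ^ v * m ∧ m ≠ 0 := by
  by_contra hcon
  push Not at hcon
  apply h
  have key : ∀ p : ℕ, p.Prime → Even (d.factorization p) := by
    intro p hp
    by_contra hodd
    rw [Nat.not_even_iff_odd] at hodd
    have := hcon p (d.factorization p) (d / p ^ d.factorization p) hp hodd
      (Nat.not_dvd_ordCompl hp h0) (Nat.ordProj_mul_ordCompl_eq_self d p).symm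
    exact (Nat.ordCompl_pos p h0).ne' this
  rw [← Nat.prod_factorization_pow_eq_self h0]
  unfold Finsupp.prod
  apply Finset.isSquare_prod
  intro p hp
  exact (key p (Nat.prime_of_mem_primeFactors (by simpa using hp))).isSquare_pow _

lemma exists_chi_neg {d : ℤ} (h0 : 0 < d) (h : ¬ IsSquare d) : ∃ q : ℕ, chi d q = -1 := by
  obtain ⟨d, rfl⟩ := Int.eq_ofNat_of_zero_le h0.le
  have hd0 : d ≠ 0 := by rintro rfl; simp at h0
  have hns : ¬ IsSquare d := by
    rintro ⟨r, hr⟩; exact h ⟨r, by exact_mod_cast hr⟩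
  obtain ⟨p, v, m, hp, hv, hpm, hdm, hm0⟩ := exists_prime_odd_val hd0 hns
  have hmne : NeZero m := ⟨hm0⟩
  by_cases hp2 : p = 2
  · subst hp2
    have hmodd : Odd m := by
      rw [← Nat.not_even_iff_odd, even_iff_two_dvd]; exact hpm
    have hcop : Nat.Coprime 8 m := by
      have : Nat.Coprime 2 m := (Nat.prime_two.coprime_iff_not_dvd).2 hpm
      exact Nat.Coprime.pow_left 3 this
    obtain ⟨q, hq1, hq2⟩ := Nat.chineseRemainder hcop 5 1
    have hq8 : q % 8 = 5 := hq1
    have hqodd : Odd q := by rw [Nat.odd_iff]; omega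
    refine ⟨q, ?_⟩
    rw [chi, if_pos hqodd, hdm]
    push_cast
    rw [jacobiSym.mul_left, jacobiSym.pow_left]
    have e1 : jacobiSym 2 q = -1 := by
      rw [jacobiSym.at_two hqodd, ZMod.χ₈_nat_eq_if_mod_eight]
      have : q % 2 = 1 := by omega
      simp [this, hq8]
    have e2 : jacobiSym m q = 1 := by
      rw [jacobiSym.quadratic_reciprocity_one_mod_four' hmodd (by omega)]
      rw [jacobiSym.mod_left' (show (q : ℤ) ≡ 1 [ZMOD m] from by
        exact_mod_cast (Int.natCast_modEq_iff.2 hq2))]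
      simp
    rw [e1, e2, hv.neg_one_pow]; norm_num
  · have : Fact p.Prime := ⟨hp⟩
    have hpodd : Odd p := hp.odd_of_ne_two hp2
    obtain ⟨r, hr⟩ : ∃ r : ZMod p, quadraticChar (ZMod p) r = -1 :=
      quadraticChar_exists_neg_one (by rwa [ZMod.ringChar_zmod_n])
    have hcop : Nat.Coprime p (4 * m) := by
      rw [hp.coprime_iff_not_dvd]
      intro hdiv
      rcases (hp.dvd_mul).1 hdiv with h4 | h4
      · have : p ∣ 2 := hp.dvd_of_dvd_pow (show p ∣ 2 ^ 2 from h4)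
        exact hp2 ((Nat.prime_dvd_prime_iff_eq hp Nat.prime_two).1 this)
      · exact hpm h4
    obtain ⟨q, hq1, hq2⟩ := Nat.chineseRemainder hcop r.val 1
    have hq4 : q % 4 = 1 := (Nat.ModEq.of_mul_right m hq2)
    have hqodd : Odd q := by rw [Nat.odd_iff]; omega
    refine ⟨q, ?_⟩
    rw [chi, if_pos hqodd, hdm]
    push_cast
    rw [jacobiSym.mul_left, jacobiSym.pow_left]
    have e1 : jacobiSym p q = -1 := by
      rw [jacobiSym.quadratic_reciprocity_one_mod_four' hpodd hq4, ← jacobiSym.legendreSym.to_jacobiSym]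
      rw [legendreSym, ← hr]
      congr 1
      have : ((q : ℕ) : ZMod p) = ((r.val : ℕ) : ZMod p) := (ZMod.natCast_eq_natCast_iff _ _ _).2 hq1
      rw [ZMod.natCast_zmod_val] at this
      exact_mod_cast this
    have e2 : jacobiSym m q = 1 := by
      rw [jacobiSym.mod_right _ hqodd, Int.natAbs_natCast]
      have : q % (4 * m) = 1 % (4 * m) := hq2
      rw [this, Nat.mod_eq_of_lt (by omega)]
      simp
    rw [e1, e2, hv.neg_one_pow]; norm_num

end VA
end

section
namespace VA

lemma abel_identity (w s : ℕ → ℝ) (n : ℕ) :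
    ∑ i ∈ Finset.range n, w i * s i = w n * ∑ i ∈ Finset.range n, s i +
      ∑ i ∈ Finset.range n, (w i - w (i + 1)) * ∑ j ∈ Finset.range (i + 1), s j := by
  induction n with
  | zero => simp
  | succ n ih =>
    rw [Finset.sum_range_succ, ih, Finset.sum_range_succ (fun i => (w i - w (i + 1)) * _),
      Finset.sum_range_succ s]
    ring

/-- Abel bound with total variation -/
lemma abel_variation (w s : ℕ → ℝ) (n : ℕ) (K : ℝ)
    (hs : ∀ m ≤ n, |∑ i ∈ Finset.range m, s i| ≤ K) :
    |∑ i ∈ Finset.range n, w i * s i| ≤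
      K * (|w n| + ∑ i ∈ Finset.range n, |w i - w (i + 1)|) := by
  rw [abel_identity]
  calc _ ≤ |w n * ∑ i ∈ Finset.range n, s i| +
      |∑ i ∈ Finset.range n, (w i - w (i + 1)) * ∑ j ∈ Finset.range (i + 1), s j| := abs_add_le _ _
    _ ≤ K * |w n| + ∑ i ∈ Finset.range n, K * |w i - w (i + 1)| := by
      apply add_le_add
      · rw [abs_mul, mul_comm]
        exact mul_le_mul_of_nonneg_right (hs n le_rfl) (abs_nonneg _)
      · refine (Finset.abs_sum_le_sum_abs _ _).trans (Finset.sum_le_sum fun i hi => ?_)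
        rw [abs_mul, mul_comm]
        exact mul_le_mul_of_nonneg_right (hs _ (by simpa using hi)) (abs_nonneg _)
    _ = _ := by rw [← Finset.mul_sum]; ring

/-- Abel bound for antitone weights, on `Ico a b`. -/
lemma abel_antitone (w s : ℕ → ℝ) (a b : ℕ) (K : ℝ) (hw : ∀ i, a ≤ i → w (i + 1) ≤ w i)
    (hw0 : ∀ i, a ≤ i → 0 ≤ w i)
    (hs : ∀ m, |∑ i ∈ Finset.Ico a m, s i| ≤ K) :
    |∑ i ∈ Finset.Ico a b, w i * s i| ≤ K * w a := by
  rw [Finset.sum_Ico_eq_sum_range]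
  refine (abel_variation (fun i => w (a + i)) (fun i => s (a + i)) (b - a) K ?_).trans ?_
  · intro m _
    have := hs (a + m)
    rwa [Finset.sum_Ico_eq_sum_range, Nat.add_sub_cancel_left] at this
  · have hK : 0 ≤ K := (abs_nonneg _).trans (hs a)
    refine mul_le_mul_of_nonneg_left (le_of_eq ?_) hK
    have : ∀ i ∈ Finset.range (b - a), |w (a + i) - w (a + (i + 1))| = w (a + i) - w (a + (i + 1)) :=
      fun i _ => abs_of_nonneg (sub_nonneg.2 (hw (a + i) (Nat.le_add_right a i)))
    rw [Finset.sum_congr rfl this, Finset.sum_range_sub' (fun i => w (a + i)),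
      abs_of_nonneg (hw0 (a + (b - a)) (Nat.le_add_right _ _))]
    simp

/-- mean of a function over `range P` -/
noncomputable def avg (P : ℕ) (f : ℕ → ℝ) : ℝ := (∑ n ∈ Finset.range P, f n) / P

lemma sum_range_periodic_shift {M : Type*} [AddCommGroup M] (f : ℕ → M) (P : ℕ)
    (hf : ∀ n, f (n + P) = f n) (a : ℕ) :
    ∑ n ∈ Finset.range P, f (a + n) = ∑ n ∈ Finset.range P, f n := by
  induction a with
  | zero => simp
  | succ a ih =>
    rw [← ih]
    have h1 := Finset.sum_range_succ (fun n => f (a + n)) P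
    have h2 := Finset.sum_range_succ' (fun n => f (a + n)) P
    have h3 : f (a + P) = f (a + 0) := by rw [hf]; simp
    rw [h1, h3] at h2
    have := add_right_cancel h2
    rw [this]
    refine Finset.sum_congr rfl fun n _ => ?_
    congr 1; ring

lemma sum_range_mul_period (f : ℕ → ℝ) (P : ℕ) (hf : ∀ n, f (n + P) = f n) (k : ℕ) :
    ∑ n ∈ Finset.range (P * k), f n = k * ∑ n ∈ Finset.range P, f n := by
  induction k with
  | zero => simp
  | succ k ih =>
    rw [mul_add, mul_one, Finset.sum_range_add, ih, sum_range_periodic_shift f P hf]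
    push_cast; ring

lemma avg_mul_period (f : ℕ → ℝ) (P : ℕ) (hf : ∀ n, f (n + P) = f n) (k : ℕ) (hk : k ≠ 0) :
    avg (P * k) f = avg P f := by
  unfold avg
  rw [sum_range_mul_period f P hf]
  push_cast
  have : (k : ℝ) ≠ 0 := by exact_mod_cast hk
  rw [mul_comm (P : ℝ), mul_div_mul_left _ _ this]

lemma periodic_sum_bound (f : ℕ → ℝ) (P : ℕ) (hP : 0 < P) (hf : ∀ n, f (n + P) = f n) (C : ℝ)
    (hC : ∀ n, |f n| ≤ C) (N : ℕ) :
    |∑ n ∈ Finset.range N, (f n - avg P f)| ≤ 2 * C * P := by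
  have hPr : (0 : ℝ) < P := by exact_mod_cast hP
  have hC0 : 0 ≤ C := (abs_nonneg _).trans (hC 0)
  have havg : |avg P f| ≤ C := by
    unfold avg
    rw [abs_div, abs_of_pos hPr, div_le_iff₀ hPr]
    refine (Finset.abs_sum_le_sum_abs _ _).trans ?_
    refine (Finset.sum_le_sum fun n _ => hC n).trans ?_
    simp [mul_comm]
  have hg : ∀ n, (fun n => f n - avg P f) (n + P) = (fun n => f n - avg P f) n := by
    intro n; simp [hf]
  rw [← Nat.div_add_mod N P, Finset.sum_range_add, sum_range_mul_period _ P hg]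
  have hz : ∑ n ∈ Finset.range P, (f n - avg P f) = 0 := by
    rw [Finset.sum_sub_distrib]
    simp only [avg, Finset.sum_const, Finset.card_range, nsmul_eq_mul]
    field_simp
    simp
  rw [hz, mul_zero, zero_add]
  refine (Finset.abs_sum_le_sum_abs _ _).trans ?_
  refine (Finset.sum_le_sum (g := fun _ => 2 * C) fun n _ => ?_).trans ?_
  · refine (abs_sub _ _).trans ?_
    linarith [hC (P * (N / P) + n)]
  · simp only [Finset.sum_const, Finset.card_range, nsmul_eq_mul]
    rw [mul_comm]
    refine mul_le_mul_of_nonneg_left ?_ (by positivity)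
    exact_mod_cast (Nat.mod_lt _ hP).le

lemma chi_sum_period {d : ℤ} (h0 : 0 < d) (h : ¬ IsSquare d) :
    ∑ q ∈ Finset.range (4 * d.natAbs), (chi d q : ℝ) = 0 := by
  obtain ⟨q0, hq0⟩ := exists_chi_neg h0 h
  set P := 4 * d.natAbs with hP
  have hPpos : 0 < P := by omega
  have hodd : Odd q0 := by
    by_contra hc
    simp [chi, hc] at hq0
  have hcop : Nat.Coprime q0 P := by
    rw [hP]
    apply Nat.Coprime.mul_right
    · exact Nat.Coprime.pow_right 2 ((Nat.coprime_two_right).2 hodd)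
    · by_contra hc
      rw [chi_eq_zero_of_not_coprime (fun hh => hc hh.symm)] at hq0
      norm_num at hq0
  have hmod : ∀ q, chi d (q % P) = chi d q := by
    intro q
    conv_rhs => rw [← Nat.mod_add_div q P]
    generalize q / P = k
    induction k with
    | zero => simp
    | succ k ih => rw [mul_add, mul_one, ← add_assoc, hP, chi_periodic, ← hP, ← ih]
  have key : ∑ q ∈ Finset.range P, chi d q = ∑ q ∈ Finset.range P, chi d (q0 * q) := by
    symm
    refine Finset.sum_bij (fun q _ => (q0 * q) % P) ?_ ?_ ?_ ?_
    · intro q _; simpa using Nat.mod_lt _ hPpos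
    · intro a ha b hb hab
      have : a ≡ b [MOD P] := Nat.ModEq.cancel_left_of_coprime hcop.symm hab
      rw [Finset.mem_range] at ha hb
      exact Nat.ModEq.eq_of_lt_of_lt this ha hb
    · have hinj : Set.InjOn (fun q => (q0 * q) % P) (Finset.range P) := by
        intro a ha b hb hab
        have : a ≡ b [MOD P] := Nat.ModEq.cancel_left_of_coprime hcop.symm hab
        exact Nat.ModEq.eq_of_lt_of_lt this (by simpa using ha) (by simpa using hb)
      have := Finset.surj_on_of_inj_on_of_card_le (s := Finset.range P) (t := Finset.range P)
        (fun q _ => (q0 * q) % P) (fun q _ => by simpa using Nat.mod_lt _ hPpos)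
        (fun a b ha hb hab => hinj (by simpa using ha) (by simpa using hb) hab) le_rfl
      intro b hb
      obtain ⟨a, ha, hab⟩ := this b hb
      exact ⟨a, ha, hab.symm⟩
    · intro q _; rw [hmod]
  have : ∑ q ∈ Finset.range P, chi d q = - ∑ q ∈ Finset.range P, chi d q := by
    conv_lhs => rw [key]
    rw [← Finset.sum_neg_distrib]
    refine Finset.sum_congr rfl fun q _ => ?_
    rw [chi_mul, hq0]; ring
  have h2 : ∑ q ∈ Finset.range P, chi d q = 0 := by omega
  exact_mod_cast h2

lemma chi_abs_le_real (d : ℤ) (q : ℕ) : |(chi d q : ℝ)| ≤ 1 := by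
  exact_mod_cast chi_abs_le d q

lemma chi_sum_range_le {d : ℤ} (h0 : 0 < d) (h : ¬ IsSquare d) (N : ℕ) :
    |∑ q ∈ Finset.range N, (chi d q : ℝ)| ≤ 8 * d := by
  have := periodic_sum_bound (fun q => (chi d q : ℝ)) (4 * d.natAbs) (by omega)
    (fun n => by simp [chi_periodic]) 1 (chi_abs_le_real d) N
  have ha : avg (4 * d.natAbs) (fun q => (chi d q : ℝ)) = 0 := by
    simp [avg, chi_sum_period h0 h]
  simp only [ha, sub_zero] at this
  refine this.trans (le_of_eq ?_)
  have : ((d.natAbs : ℕ) : ℝ) = (d : ℝ) := by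
    rw [Nat.cast_natAbs, abs_of_pos h0]
  push_cast
  rw [← this]
  simp; ring

lemma chi_sum_Ico_le {d : ℤ} (h0 : 0 < d) (h : ¬ IsSquare d) (a b : ℕ) :
    |∑ q ∈ Finset.Ico a b, (chi d q : ℝ)| ≤ 16 * d := by
  have hd : (0 : ℝ) < d := by exact_mod_cast h0
  rcases le_total a b with hab | hab
  · rw [Finset.sum_Ico_eq_sub _ hab]
    refine (abs_sub _ _).trans ?_
    linarith [chi_sum_range_le h0 h a, chi_sum_range_le h0 h b]
  · rw [Finset.Ico_eq_empty_of_le hab]; simp; positivity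

lemma chi_sum_div_Ico_le {d : ℤ} (h0 : 0 < d) (h : ¬ IsSquare d) (a b : ℕ) (ha : 0 < a) :
    |∑ q ∈ Finset.Ico a b, (chi d q : ℝ) / q| ≤ 16 * d / a := by
  have := abel_antitone (fun q => 1 / (q : ℝ)) (fun q => (chi d q : ℝ)) a b (16 * d)
    (fun i hi => by
      have : (0 : ℝ) < i := by exact_mod_cast (lt_of_lt_of_le ha hi)
      apply one_div_le_one_div_of_le this; push_cast; linarith)
    (fun i _ => by positivity) (fun m => chi_sum_Ico_le h0 h a m)
  simp only [one_div_mul_eq_div] at this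
  rw [mul_one_div] at this
  exact this

/-- partial sums of the odd L-series -/
noncomputable def Lpart (d : ℤ) (N : ℕ) : ℝ := ∑ q ∈ Finset.range N, (chi d q : ℝ) / q

/-- the L-value -/
noncomputable def Lodd (d : ℤ) : ℝ := limUnder atTop (Lpart d)

lemma Lpart_sub {d : ℤ} (h0 : 0 < d) (h : ¬ IsSquare d) (a b : ℕ) (ha : 0 < a) (hab : a ≤ b) :
    |Lpart d b - Lpart d a| ≤ 16 * d / a := by
  unfold Lpart
  rw [← Finset.sum_Ico_eq_sub _ hab]
  exact chi_sum_div_Ico_le h0 h a b ha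

lemma Lpart_tendsto {d : ℤ} (h0 : 0 < d) (h : ¬ IsSquare d) :
    Tendsto (Lpart d) atTop (nhds (Lodd d)) := by
  apply CauchySeq.tendsto_limUnder
  have hd : (0 : ℝ) < d := by exact_mod_cast h0
  rw [Metric.cauchySeq_iff']
  intro ε hε
  obtain ⟨N, hN⟩ := exists_nat_gt (16 * d / ε)
  have hNpos : (0 : ℝ) < N := lt_trans (by positivity) hN
  refine ⟨N, fun n hn => ?_⟩
  rw [Real.dist_eq]
  refine (Lpart_sub h0 h N n (by exact_mod_cast hNpos) hn).trans_lt ?_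
  rw [div_lt_iff₀ hNpos]
  rw [div_lt_iff₀ hε] at hN
  linarith

lemma Lodd_sub_Lpart {d : ℤ} (h0 : 0 < d) (h : ¬ IsSquare d) (a : ℕ) (ha : 0 < a) :
    |Lodd d - Lpart d a| ≤ 16 * d / a := by
  have := ((Lpart_tendsto h0 h).sub_const (Lpart d a)).abs
  refine le_of_tendsto this ?_
  filter_upwards [eventually_ge_atTop a] with b hb
  exact Lpart_sub h0 h a b ha hb

end VA
end

section
namespace VA

/-- Hyperbola-type bound. -/
lemma hyperbola_bound (f g : ArithmeticFunction ℝ) (K C ρ Lf : ℝ)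
    (hf : ∀ q, |f q| ≤ 1) (hg : ∀ q, |g q| ≤ 1)
    (hfs : ∀ a b, |∑ q ∈ Finset.Ioc a b, f q| ≤ K)
    (hL : ∀ s : ℕ, 0 < s → |Lf - ∑ q ∈ Finset.Ioc 0 s, f q / q| ≤ K / s)
    (hgs : ∀ N : ℕ, |∑ k ∈ Finset.Ioc 0 N, g k - ρ * N| ≤ C) (s M : ℕ) (hs : 0 < s) :
    |∑ m ∈ Finset.Ioc 0 M, (f * g) m - ρ * M * Lf| ≤
      (C + |ρ|) * s + (K + |ρ| * K) * M / s := by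
  have hsr : (0:ℝ) < s := by exact_mod_cast hs
  have hK : 0 ≤ K := (abs_nonneg _).trans (hfs 0 0)
  have hC : 0 ≤ C := (abs_nonneg _).trans (hgs 0)
  rw [ArithmeticFunction.sum_Ioc_mul_eq_sum_sum]
  -- split
  have hsplit : ∑ n ∈ Finset.Ioc 0 M, f n * ∑ m ∈ Finset.Ioc 0 (M / n), g m =
      ∑ n ∈ Finset.Ioc 0 s, f n * ∑ m ∈ Finset.Ioc 0 (M / n), g m +
      ∑ n ∈ Finset.Ioc s M, f n * ∑ m ∈ Finset.Ioc 0 (M / n), g m := by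
    rcases le_total s M with h | h
    · rw [Finset.sum_Ioc_consecutive _ (Nat.zero_le _) h]
    · rw [Finset.Ioc_eq_empty_of_le h, Finset.sum_empty, add_zero]
      rw [← Finset.sum_Ioc_consecutive _ (Nat.zero_le M) h]
      rw [left_eq_add]
      refine Finset.sum_eq_zero fun n hn => ?_
      rw [Finset.mem_Ioc] at hn
      rw [Nat.div_eq_of_lt hn.1]; simp
  have h1 : |∑ n ∈ Finset.Ioc 0 s, f n * ∑ m ∈ Finset.Ioc 0 (M / n), g m -
      ρ * M * ∑ q ∈ Finset.Ioc 0 s, f q / q| ≤ (C + |ρ|) * s := by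
    rw [Finset.mul_sum, ← Finset.sum_sub_distrib]
    refine (Finset.abs_sum_le_sum_abs _ _).trans ?_
    refine (Finset.sum_le_sum (g := fun _ => C + |ρ|) fun n hn => ?_).trans ?_
    · rw [Finset.mem_Ioc] at hn
      have hn0 : (0:ℝ) < n := by exact_mod_cast hn.1
      have : f n * ∑ m ∈ Finset.Ioc 0 (M / n), g m - ρ * M * (f n / n) =
        f n * ((∑ m ∈ Finset.Ioc 0 (M / n), g m - ρ * (M / n : ℕ)) -
          ρ * ((M:ℝ) / n - (M / n : ℕ))) := by field_simp; ring
      rw [this, abs_mul]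
      have hfr : |(M:ℝ) / n - (M / n : ℕ)| ≤ 1 := by
        rw [abs_le]
        have e1 : ((M / n : ℕ) : ℝ) ≤ (M:ℝ) / n := Nat.cast_div_le
        have e2 : (M:ℝ) / n < (M / n : ℕ) + 1 := by
          rw [div_lt_iff₀ hn0]
          have := Nat.lt_div_mul_add (a := M) hn.1
          have h' : M < (M / n + 1) * n := by rw [add_mul, one_mul]; exact this
          exact_mod_cast h'
        constructor <;> linarith
      calc _ ≤ 1 * |(∑ m ∈ Finset.Ioc 0 (M / n), g m - ρ * (M / n : ℕ)) -
          ρ * ((M:ℝ) / n - (M / n : ℕ))| := mul_le_mul_of_nonneg_right (hf n) (abs_nonneg _)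
        _ ≤ C + |ρ| * 1 := by
          rw [one_mul]
          refine (abs_sub _ _).trans (add_le_add (hgs _) ?_)
          rw [abs_mul]
          exact mul_le_mul_of_nonneg_left hfr (abs_nonneg _)
        _ = _ := by ring
    · simp; linarith
  have h2 : |∑ n ∈ Finset.Ioc s M, f n * ∑ m ∈ Finset.Ioc 0 (M / n), g m| ≤ K * M / s := by
    have : ∑ n ∈ Finset.Ioc s M, f n * ∑ m ∈ Finset.Ioc 0 (M / n), g m =
        ∑ m ∈ Finset.Ioc 0 (M / s), g m * ∑ n ∈ Finset.Ioc s (M / m), f n := by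
      simp_rw [Finset.mul_sum]
      rw [Finset.sum_comm' (s' := fun m => Finset.Ioc s (M / m)) (t' := Finset.Ioc 0 (M / s))]
      · simp_rw [mul_comm]
      · intro x y
        simp only [Finset.mem_Ioc]
        constructor
        · rintro ⟨⟨h1, h2⟩, h3, h4⟩
          have hx : 0 < x := by omega
          have := (Nat.le_div_iff_mul_le hx).1 h4
          refine ⟨⟨h1, (Nat.le_div_iff_mul_le h3).2 (by rwa [mul_comm])⟩, h3,
            (Nat.le_div_iff_mul_le hs).2 (le_trans (Nat.mul_le_mul_left _ h1.le) this)⟩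
        · rintro ⟨⟨h1, h2⟩, h3, h4⟩
          have := (Nat.le_div_iff_mul_le h3).1 h2
          refine ⟨⟨h1, le_trans (Nat.le_mul_of_pos_right _ h3) this⟩, h3,
            (Nat.le_div_iff_mul_le (by omega)).2 (by rwa [mul_comm])⟩
    rw [this]
    refine (Finset.abs_sum_le_sum_abs _ _).trans ?_
    refine (Finset.sum_le_sum (g := fun _ => K) fun n hn => ?_).trans ?_
    · rw [abs_mul]
      calc _ ≤ 1 * K := mul_le_mul (hg n) (hfs _ _) (abs_nonneg _) zero_le_one
        _ = K := one_mul _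
    · simp only [Finset.sum_const, Nat.card_Ioc, nsmul_eq_mul, Nat.sub_zero]
      rw [mul_comm, mul_div_assoc]
      exact mul_le_mul_of_nonneg_left Nat.cast_div_le hK
  have h3 : |ρ * M * ∑ q ∈ Finset.Ioc 0 s, f q / q - ρ * M * Lf| ≤ |ρ| * K * M / s := by
    rw [← mul_sub, abs_mul, abs_mul, abs_sub_comm, Nat.abs_cast]
    calc _ ≤ |ρ| * M * (K / s) := mul_le_mul_of_nonneg_left (hL s hs) (by positivity)
      _ = _ := by ring
  rw [hsplit]
  have e : ∀ a b c e : ℝ, a + b - e = (a - c) + b + (c - e) := fun a b c e => by ring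
  rw [e _ _ (ρ * M * ∑ q ∈ Finset.Ioc 0 s, f q / q)]
  refine (abs_add_three _ _ _).trans ?_
  calc _ ≤ (C + |ρ|) * s + K * M / s + |ρ| * K * M / s := add_le_add_three h1 h2 h3
    _ = _ := by ring

lemma hyperbola_tendsto (f g : ArithmeticFunction ℝ) (K C ρ Lf : ℝ)
    (hf : ∀ q, |f q| ≤ 1) (hg : ∀ q, |g q| ≤ 1)
    (hfs : ∀ a b, |∑ q ∈ Finset.Ioc a b, f q| ≤ K)
    (hL : ∀ s : ℕ, 0 < s → |Lf - ∑ q ∈ Finset.Ioc 0 s, f q / q| ≤ K / s)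
    (hgs : ∀ N : ℕ, |∑ k ∈ Finset.Ioc 0 N, g k - ρ * N| ≤ C) :
    Tendsto (fun M : ℕ => (∑ m ∈ Finset.Ioc 0 M, (f * g) m) / M) atTop (nhds (ρ * Lf)) := by
  have hK : 0 ≤ K := (abs_nonneg _).trans (hfs 0 0)
  have hC : 0 ≤ C := (abs_nonneg _).trans (hgs 0)
  rw [Metric.tendsto_atTop]
  intro ε hε
  obtain ⟨s, hs⟩ := exists_nat_gt ((K + |ρ| * K) * 2 / ε)
  have hs0 : (0:ℝ) < s := lt_of_le_of_lt (by positivity) hs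
  obtain ⟨M0, hM0⟩ := exists_nat_gt ((C + |ρ|) * s * 2 / ε)
  have hM00 : (0:ℝ) < M0 := lt_of_le_of_lt (by positivity) hM0
  refine ⟨M0, fun M hM => ?_⟩
  have hMM : (M0:ℝ) ≤ M := by exact_mod_cast hM
  have hMp : (0:ℝ) < M := by linarith
  rw [Real.dist_eq]
  have := hyperbola_bound f g K C ρ Lf hf hg hfs hL hgs s M (by exact_mod_cast hs0)
  have e : (∑ m ∈ Finset.Ioc 0 M, (f * g) m) / M - ρ * Lf =
    (∑ m ∈ Finset.Ioc 0 M, (f * g) m - ρ * M * Lf) / M := by field_simp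
  rw [e, abs_div, abs_of_pos hMp, div_lt_iff₀ hMp]
  refine this.trans_lt ?_
  rw [div_lt_iff₀ hε] at hs hM0
  have h1 : (K + |ρ| * K) * M / s < ε / 2 * M := by
    rw [div_lt_iff₀ hs0]
    nlinarith
  nlinarith

/-- `chi d` as an arithmetic function -/
noncomputable def chiA (d : ℤ) : ArithmeticFunction ℝ := ⟨fun q => (chi d q : ℝ), by simp [chi_zero]⟩

/-- indicator of coprimality with `P` -/
noncomputable def copA (P : ℕ) : ArithmeticFunction ℝ :=
  ⟨fun q => if q ≠ 0 ∧ Nat.Coprime q P then 1 else 0, by simp⟩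

lemma sum_Ioc_zero (f : ArithmeticFunction ℝ) (N : ℕ) :
    ∑ q ∈ Finset.Ioc 0 N, f q = ∑ q ∈ Finset.range (N + 1), f q := by
  rw [Finset.range_eq_Ico, Finset.sum_eq_sum_Ico_succ_bot (by omega)]
  simp only [ArithmeticFunction.map_zero, zero_add]
  apply Finset.sum_congr _ (fun _ _ => rfl)
  ext; simp only [Finset.mem_Ioc, Finset.mem_Ico]; omega

lemma copA_sum (P : ℕ) (hP : 1 < P) :
    ∑ q ∈ Finset.range P, copA P q = Nat.totient P := by
  simp only [copA, ArithmeticFunction.coe_mk]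
  rw [Finset.sum_boole, Nat.totient]
  norm_cast
  congr 1
  apply Finset.filter_congr
  intro x _
  rw [Nat.coprime_comm]
  constructor
  · exact fun h => h.2
  · intro h
    refine ⟨?_, h⟩
    rintro rfl
    rw [Nat.coprime_zero_right] at h; omega

lemma class_sum_tendsto {d : ℤ} (h0 : 0 < d) (h : ¬ IsSquare d) :
    Tendsto (fun M : ℕ => (∑ m ∈ Finset.Ioc 0 M, (chiA d * copA (2 * d.natAbs)) m) / M) atTop
      (nhds ((Nat.totient (2 * d.natAbs) / (2 * d.natAbs : ℕ) : ℝ) * Lodd d)) := by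
  have hd : (0:ℝ) < d := by exact_mod_cast h0
  set P := 2 * d.natAbs with hP
  have hP1 : 1 < P := by omega
  have hcop1 : ∀ q, |copA P q| ≤ 1 := by
    intro q; simp only [copA, ArithmeticFunction.coe_mk]; split_ifs <;> simp
  apply hyperbola_tendsto (K := 16 * d) (C := 2 * 1 * P + 1)
  · exact fun q => chi_abs_le_real d q
  · exact hcop1
  · intro a b
    have : Finset.Ioc a b = Finset.Ico (a + 1) (b + 1) := by
      ext; simp only [Finset.mem_Ioc, Finset.mem_Ico]; omega
    rw [this]
    exact chi_sum_Ico_le h0 h _ _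
  · intro s hs
    have e : ∑ q ∈ Finset.Ioc 0 s, chiA d q / q = Lpart d (s + 1) := by
      rw [Lpart, Finset.range_eq_Ico, Finset.sum_eq_sum_Ico_succ_bot (by omega)]
      simp only [CharP.cast_eq_zero, div_zero, zero_add]
      apply Finset.sum_congr _ (fun _ _ => rfl)
      ext; simp only [Finset.mem_Ioc, Finset.mem_Ico]; omega
    rw [e]
    refine (Lodd_sub_Lpart h0 h (s + 1) (by omega)).trans ?_
    have : (0:ℝ) < s := by exact_mod_cast hs
    apply div_le_div_of_nonneg_left (by positivity) this (by push_cast; linarith)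
  · intro N
    have := periodic_sum_bound (fun q => if Nat.Coprime q P then (1:ℝ) else 0) P (by omega)
      (fun n => by simp) 1 (fun n => by split_ifs <;> simp) (N + 1)
    have heq : ∀ q, (if Nat.Coprime q P then (1:ℝ) else 0) = copA P q := by
      intro q
      simp only [copA, ArithmeticFunction.coe_mk]
      congr 1
      apply propext
      refine ⟨fun h => ⟨?_, h⟩, fun h => h.2⟩
      rintro rfl
      rw [Nat.coprime_zero_left] at h; omega
    simp_rw [heq] at this
    rw [avg, copA_sum P hP1, Finset.sum_sub_distrib, ← sum_Ioc_zero] at this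
    simp only [Finset.sum_const, Finset.card_range, nsmul_eq_mul] at this
    have hle : (Nat.totient P / (P:ℝ)) ≤ 1 := by
      apply div_le_one_of_le₀ _ (by positivity)
      exact_mod_cast Nat.totient_le P
    have hge : 0 ≤ (Nat.totient P / (P:ℝ)) := by positivity
    rw [abs_le] at this ⊢
    push_cast at this ⊢
    constructor <;> nlinarith [this.1, this.2]

end VA
end

section
namespace VA

/-- number of square roots of `d` mod `a` -/
noncomputable def rho (d : ℤ) (a : ℕ) : ℕ := Nat.card {x : ZMod a // x ^ 2 = (d : ZMod a)}

lemma rho_mul (d : ℤ) {a b : ℕ} (h : Nat.Coprime a b) : rho d (a * b) = rho d a * rho d b := by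
  unfold rho
  rw [← Nat.card_prod]
  let e := ZMod.chineseRemainder h
  have key : ∀ x : ZMod (a * b), x ^ 2 = (d : ZMod (a * b)) ↔
      (e x).1 ^ 2 = (d : ZMod a) ∧ (e x).2 ^ 2 = (d : ZMod b) := by
    intro x
    rw [← e.injective.eq_iff, map_pow, map_intCast, Prod.ext_iff]
    simp
  refine Nat.card_congr
    { toFun := fun x => (⟨(e x.1).1, ((key x.1).1 x.2).1⟩, ⟨(e x.1).2, ((key x.1).1 x.2).2⟩)
      invFun := fun y => ⟨e.symm (y.1.1, y.2.1), (key _).2 (by simpa using ⟨y.1.2, y.2.2⟩)⟩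
      left_inv := fun x => by ext; simp
      right_inv := fun y => by ext <;> simp }

lemma sqrt_lift (d : ℤ) (p : ℕ) (hp : p.Prime) (hp2 : p ≠ 2) (hd : ¬ (p : ℤ) ∣ d) (x : ℤ)
    (hx : (p : ℤ) ∣ x ^ 2 - d) (k : ℕ) : ∃ y : ℤ, (p : ℤ) ^ (k + 1) ∣ y ^ 2 - d := by
  have hpi : Prime (p : ℤ) := Nat.prime_iff_prime_int.1 hp
  induction k with
  | zero => exact ⟨x, by simpa using hx⟩
  | succ k ih =>
    obtain ⟨y, c, hc⟩ := ih
    have hy : ¬ (p : ℤ) ∣ 2 * y := by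
      intro h
      rcases hpi.dvd_or_dvd h with h | h
      · have : p ∣ 2 := by exact_mod_cast h
        exact hp2 ((Nat.prime_dvd_prime_iff_eq hp Nat.prime_two).1 this)
      · apply hd
        have h2 : (p : ℤ) ∣ y ^ 2 := dvd_pow h two_ne_zero
        have h3 : (p : ℤ) ∣ y ^ 2 - d := by rw [hc, pow_succ]; exact Dvd.intro_left (↑p ^ k * c) (by ring)
        have := dvd_sub h2 h3
        simpa using this
    have hcop : IsCoprime (2 * y) (p : ℤ) := ((Prime.coprime_iff_not_dvd hpi).2 hy).symm
    obtain ⟨u, v, huv⟩ := hcop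
    refine ⟨y - u * c * p ^ (k + 1), ?_⟩
    have : (y - u * c * p ^ (k + 1)) ^ 2 - d =
      (p:ℤ) ^ (k + 1 + 1) * (v * c + u ^ 2 * c ^ 2 * p ^ k) := by
      have h1 : (y - u * c * p ^ (k + 1)) ^ 2 - d = (y ^ 2 - d) - 2 * y * u * c * p ^ (k + 1) +
        u ^ 2 * c ^ 2 * (p:ℤ) ^ (k+1) * p ^ (k+1) := by ring
      rw [h1, hc]
      have h2 : v * p = 1 - u * (2 * y) := by linarith
      have h3 : (p:ℤ) ^ (k + 1 + 1) * (v * c + u ^ 2 * c ^ 2 * p ^ k) =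
        (p:ℤ)^(k+1) * c * (v * p) + u ^ 2 * c ^ 2 * (p:ℤ) ^ (k+1) * p ^ (k+1) := by ring
      rw [h3, h2]; ring
    exact ⟨_, this⟩

lemma rho_prime_pow (d : ℤ) (p : ℕ) (hp : p.Prime) (hp2 : p ≠ 2) (hd : ¬ (p : ℤ) ∣ d) (k : ℕ) :
    (rho d (p ^ (k + 1)) : ℤ) = 1 + chi d p := by
  have hpi : Prime (p : ℤ) := Nat.prime_iff_prime_int.1 hp
  haveI : Fact p.Prime := ⟨hp⟩
  have hodd : Odd p := hp.odd_of_ne_two hp2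
  have hchi : chi d p = legendreSym p d := by
    rw [chi, if_pos hodd, ← jacobiSym.legendreSym.to_jacobiSym]
  have hd0 : (d : ZMod p) ≠ 0 := by
    rwa [Ne, ZMod.intCast_zmod_eq_zero_iff_dvd]
  haveI : NeZero (p ^ (k + 1)) := ⟨pow_ne_zero _ hp.ne_zero⟩
  by_cases hs : ∃ y : ℤ, (p : ℤ) ^ (k + 1) ∣ y ^ 2 - d
  · obtain ⟨y, hy⟩ := hs
    have hyp : (p : ℤ) ∣ y ^ 2 - d := (dvd_pow_self _ (Nat.succ_ne_zero k)).trans hy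
    have hchi1 : chi d p = 1 := by
      rw [hchi, legendreSym.eq_one_iff p hd0]
      refine ⟨y, ?_⟩
      rw [← ZMod.intCast_zmod_eq_zero_iff_dvd] at hyp
      push_cast at hyp
      rw [← sq]; exact (sub_eq_zero.1 hyp).symm
    have hny : ¬ (p : ℤ) ∣ y := by
      intro h
      apply hd
      have := dvd_sub (dvd_pow h two_ne_zero) hyp
      simpa using this
    have hset : {x : ZMod (p ^ (k + 1)) | x ^ 2 = (d : ZMod (p ^ (k + 1)))} =
        {(y : ZMod (p ^ (k + 1))), -(y : ZMod (p ^ (k + 1)))} := by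
      have hyd : (y : ZMod (p ^ (k + 1))) ^ 2 = d := by
        have : ((p ^ (k + 1) : ℕ) : ℤ) ∣ y ^ 2 - d := by push_cast; exact hy
        rw [← ZMod.intCast_zmod_eq_zero_iff_dvd] at this
        push_cast at this
        exact sub_eq_zero.1 this
      ext x
      simp only [Set.mem_setOf_eq, Set.mem_insert_iff, Set.mem_singleton_iff]
      constructor
      · intro hx
        obtain ⟨z, rfl⟩ := ZMod.intCast_surjective x
        have h1 : ((p ^ (k + 1) : ℕ) : ℤ) ∣ (z - y) * (z + y) := by
          rw [← ZMod.intCast_zmod_eq_zero_iff_dvd]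
          push_cast
          have : ((z:ZMod (p ^ (k+1))) - y) * (z + y) = z ^ 2 - y ^ 2 := by ring
          rw [this, hx, hyd, sub_self]
        push_cast at h1
        by_cases h2 : (p : ℤ) ∣ z - y
        · have h3 : ¬ (p : ℤ) ∣ z + y := by
            intro h3
            have h4 : (p:ℤ) ∣ 2 * y := by
              have := dvd_sub h3 h2
              have e : z + y - (z - y) = 2 * y := by ring
              rwa [e] at this
            rcases hpi.dvd_or_dvd h4 with h | h
            · have : p ∣ 2 := by exact_mod_cast h
              exact hp2 ((Nat.prime_dvd_prime_iff_eq hp Nat.prime_two).1 this)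
            · exact hny h
          left
          have h5 : IsCoprime ((p:ℤ) ^ (k+1)) (z + y) :=
            IsCoprime.pow_left ((Prime.coprime_iff_not_dvd hpi).2 h3)
          have := h5.dvd_of_dvd_mul_right h1
          have h6 : ((p ^ (k + 1) : ℕ) : ℤ) ∣ z - y := by push_cast; exact this
          rw [← ZMod.intCast_zmod_eq_zero_iff_dvd] at h6
          push_cast at h6
          exact sub_eq_zero.1 h6
        · right
          have h5 : IsCoprime ((p:ℤ) ^ (k+1)) (z - y) :=
            IsCoprime.pow_left ((Prime.coprime_iff_not_dvd hpi).2 h2)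
          have := h5.dvd_of_dvd_mul_left h1
          have h6 : ((p ^ (k + 1) : ℕ) : ℤ) ∣ z + y := by push_cast; exact this
          rw [← ZMod.intCast_zmod_eq_zero_iff_dvd] at h6
          push_cast at h6
          exact eq_neg_of_add_eq_zero_left h6
      · rintro (rfl | rfl)
        · exact hyd
        · rw [neg_sq, hyd]
    have hne : (y : ZMod (p ^ (k + 1))) ≠ -(y : ZMod (p ^ (k + 1))) := by
      intro h
      have h1 : ((2 * y : ℤ) : ZMod (p ^ (k + 1))) = 0 := by
        push_cast
        have h' := eq_neg_iff_add_eq_zero.1 h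
        rw [← h']; ring
      rw [ZMod.intCast_zmod_eq_zero_iff_dvd] at h1
      push_cast at h1
      have h2 : (p:ℤ) ∣ 2 * y := (dvd_pow_self _ (Nat.succ_ne_zero k)).trans h1
      rcases hpi.dvd_or_dvd h2 with h | h
      · have : p ∣ 2 := by exact_mod_cast h
        exact hp2 ((Nat.prime_dvd_prime_iff_eq hp Nat.prime_two).1 this)
      · exact hny h
    have : rho d (p ^ (k + 1)) = 2 := by
      unfold rho
      change Nat.card ({x : ZMod (p ^ (k + 1)) | x ^ 2 = (d : ZMod (p ^ (k + 1)))} : Set _) = 2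
      rw [hset, Nat.card_coe_set_eq, Set.ncard_pair hne]
    rw [this, hchi1]; norm_num
  · have h0 : rho d (p ^ (k + 1)) = 0 := by
      unfold rho
      haveI : IsEmpty {x : ZMod (p ^ (k + 1)) // x ^ 2 = (d : ZMod (p ^ (k + 1)))} := by
        constructor
        rintro ⟨x, hx⟩
        apply hs
        obtain ⟨z, rfl⟩ := ZMod.intCast_surjective x
        refine ⟨z, ?_⟩
        have : ((p ^ (k + 1) : ℕ) : ℤ) ∣ z ^ 2 - d := by
          rw [← ZMod.intCast_zmod_eq_zero_iff_dvd]
          push_cast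
          rw [hx, sub_self]
        push_cast at this; exact this
      exact Nat.card_of_isEmpty
    have h1 : legendreSym p d = -1 := by
      rw [legendreSym.eq_neg_one_iff]
      rintro ⟨x, hx⟩
      obtain ⟨z, rfl⟩ := ZMod.intCast_surjective x
      apply hs
      refine sqrt_lift d p hp hp2 hd z ?_ k
      rw [← ZMod.intCast_zmod_eq_zero_iff_dvd]
      push_cast
      rw [hx]; ring
    rw [h0, hchi, h1]; norm_num

/-- `rho` restricted to integers coprime to `P` -/
noncomputable def rhoA (d : ℤ) (P : ℕ) : ArithmeticFunction ℝ :=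
  ⟨fun a => if a ≠ 0 ∧ Nat.Coprime a P then (rho d a : ℝ) else 0, by simp⟩

/-- indicator of squares coprime to `P` -/
noncomputable def sqA (P : ℕ) : ArithmeticFunction ℝ :=
  ⟨fun a => if a ≠ 0 ∧ Nat.Coprime a P ∧ IsSquare a then 1 else 0, by simp⟩

lemma rho_one (d : ℤ) : rho d 1 = 1 := by
  unfold rho
  rw [Nat.card_eq_one_iff_unique]
  exact ⟨⟨fun a b => Subtype.ext (Subsingleton.elim _ _)⟩, ⟨⟨0, Subsingleton.elim _ _⟩⟩⟩

lemma rhoA_mult (d : ℤ) (P : ℕ) : (rhoA d P).IsMultiplicative := by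
  constructor
  · simp [rhoA, rho_one]
  · intro m n h
    simp only [rhoA, ArithmeticFunction.coe_mk, rho_mul d h, Nat.coprime_mul_iff_left]
    by_cases h1 : m ≠ 0 ∧ Nat.Coprime m P <;> by_cases h2 : n ≠ 0 ∧ Nat.Coprime n P
    · rw [if_pos h1, if_pos h2, if_pos ⟨mul_ne_zero h1.1 h2.1, h1.2, h2.2⟩]; push_cast; ring
    · rw [if_neg h2, mul_zero, if_neg (fun hh => h2 ⟨right_ne_zero_of_mul hh.1, hh.2.2⟩)]
    · rw [if_neg h1, zero_mul, if_neg (fun hh => h1 ⟨left_ne_zero_of_mul hh.1, hh.2.1⟩)]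
    · rw [if_neg h1, zero_mul, if_neg (fun hh => h1 ⟨left_ne_zero_of_mul hh.1, hh.2.1⟩)]

lemma isSquare_mul_coprime {m n : ℕ} (h : Nat.Coprime m n) :
    IsSquare (m * n) ↔ IsSquare m ∧ IsSquare n := by
  constructor
  · rintro ⟨r, hr⟩
    have h1 := exists_eq_pow_of_mul_eq_pow (k := 2) (c := r) (Nat.isUnit_iff.2 h)
      (by rw [hr, sq])
    have h2 := exists_eq_pow_of_mul_eq_pow (k := 2) (c := r) (Nat.isUnit_iff.2 h.symm)
      (by rw [mul_comm, hr, sq])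
    obtain ⟨a, ha⟩ := h1
    obtain ⟨b, hb⟩ := h2
    exact ⟨⟨a, by rw [ha, sq]⟩, ⟨b, by rw [hb, sq]⟩⟩
  · rintro ⟨h1, h2⟩; exact h1.mul h2

lemma sqA_mult (P : ℕ) : (sqA P).IsMultiplicative := by
  constructor
  · simp [sqA]
  · intro m n h
    simp only [sqA, ArithmeticFunction.coe_mk, Nat.coprime_mul_iff_left, isSquare_mul_coprime h,
      mul_ne_zero_iff, ← ite_and, mul_ite, mul_one, mul_zero]
    congr 1
    apply propext; tauto

lemma copA_mult (P : ℕ) : (copA P).IsMultiplicative := by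
  constructor
  · simp [copA]
  · intro m n h
    simp only [copA, ArithmeticFunction.coe_mk, Nat.coprime_mul_iff_left,
      mul_ne_zero_iff, ← ite_and, mul_ite, mul_one, mul_zero]
    congr 1
    apply propext; tauto

lemma chiA_mult (d : ℤ) : (chiA d).IsMultiplicative := by
  constructor
  · simp [chiA, chi_one]
  · intro m n _
    simp [chiA, chi_mul]

lemma mul_prime_pow (f g : ArithmeticFunction ℝ) (p : ℕ) (hp : p.Prime) (k : ℕ) :
    (f * g) (p ^ k) = ∑ i ∈ Finset.range (k + 1), f (p ^ i) * g (p ^ (k - i)) := by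
  rw [ArithmeticFunction.mul_apply,
    Nat.sum_divisorsAntidiagonal (fun i j => f i * g j), Nat.sum_divisors_prime_pow hp]
  refine Finset.sum_congr rfl fun i hi => ?_
  rw [Nat.pow_div (by simpa [Nat.lt_succ_iff] using hi) hp.pos]

theorem rho_conv (d : ℤ) (hd : d ≠ 0) :
    rhoA d (2 * d.natAbs) * sqA (2 * d.natAbs) = chiA d * copA (2 * d.natAbs) := by
  set P := 2 * d.natAbs with hP
  rw [ArithmeticFunction.IsMultiplicative.eq_iff_eq_on_prime_powers _
    ((rhoA_mult d P).mul (sqA_mult P)) _ ((chiA_mult d).mul (copA_mult P))]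
  intro p k hp
  rw [mul_prime_pow _ _ _ hp, mul_prime_pow _ _ _ hp]
  by_cases hpP : p ∣ P
  · -- everything vanishes unless k = 0
    have hnc : ∀ i, i ≠ 0 → ¬ Nat.Coprime (p ^ i) P := by
      intro i hi h
      rw [Nat.coprime_pow_left_iff (Nat.pos_of_ne_zero hi)] at h
      exact (Nat.Prime.coprime_iff_not_dvd hp).1 h hpP
    rcases Nat.eq_zero_or_pos k with rfl | hk
    · simp [rhoA, rho_one, sqA, chiA, chi_one, copA]
    · rw [Finset.sum_eq_zero, Finset.sum_eq_zero]
      · intro i hi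
        rcases Nat.eq_zero_or_pos i with rfl | hi0
        · simp [copA, hnc k hk.ne']
        · have : chi d (p ^ i) = 0 := by
            rcases (Nat.Prime.dvd_mul hp).1 hpP with h | h
            · have : p = 2 := (Nat.prime_dvd_prime_iff_eq hp Nat.prime_two).1 h
              subst this
              simp [chi, Nat.odd_pow_iff hi0.ne']
            · apply chi_eq_zero_of_not_coprime
              intro hc
              rw [Nat.coprime_comm, Nat.coprime_pow_left_iff hi0] at hc
              exact (Nat.Prime.coprime_iff_not_dvd hp).1 hc h
          simp [chiA, this]
      · intro i hi
        rcases Nat.eq_zero_or_pos i with rfl | hi0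
        · simp [sqA, hnc k hk.ne']
        · simp [rhoA, hnc i hi0.ne']
  · have hcop : ∀ i, Nat.Coprime (p ^ i) P := fun i =>
      Nat.Coprime.pow_left i ((Nat.Prime.coprime_iff_not_dvd hp).2 hpP)
    have hp2 : p ≠ 2 := by rintro rfl; exact hpP ⟨_, hP⟩
    have hpd : ¬ (p : ℤ) ∣ d := by
      intro h
      exact hpP ((Int.natCast_dvd.1 h).mul_left 2)
    have hrho : ∀ i, (rho d (p ^ (i + 1)) : ℝ) = 1 + chi d p := by
      intro i
      exact_mod_cast rho_prime_pow d p hp hp2 hpd i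
    have hchi2 : (chi d p : ℝ) ^ 2 = 1 := by
      haveI : Fact p.Prime := ⟨hp⟩
      have hodd : Odd p := hp.odd_of_ne_two hp2
      have hchi : chi d p = legendreSym p d := by
        rw [chi, if_pos hodd, ← jacobiSym.legendreSym.to_jacobiSym]
      rw [hchi]
      have : legendreSym p d ^ 2 = 1 := by
        apply legendreSym.sq_one
        rwa [Ne, ZMod.intCast_zmod_eq_zero_iff_dvd]
      exact_mod_cast this
    have hsq : ∀ i, sqA P (p ^ i) = if Even i then 1 else 0 := by
      intro i
      simp only [sqA, ArithmeticFunction.coe_mk]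
      have : IsSquare (p ^ i) ↔ Even i := by
        constructor
        · rintro ⟨r, hr⟩
          obtain ⟨j, hj, rfl⟩ := (Nat.dvd_prime_pow hp).1 ⟨r, hr⟩
          rw [← pow_add] at hr
          exact ⟨j, Nat.pow_right_injective hp.two_le hr⟩
        · rintro ⟨j, rfl⟩; exact ⟨p ^ j, by rw [pow_add]⟩
      exact if_congr ⟨fun h => this.1 h.2.2, fun h => ⟨pow_ne_zero i hp.ne_zero, hcop i, this.2 h⟩⟩ rfl rfl
    have hra : ∀ i, rhoA d P (p ^ i) = if i = 0 then (1:ℝ) else 1 + (chi d p : ℝ) := by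
      intro i
      simp only [rhoA, ArithmeticFunction.coe_mk]
      rw [if_pos ⟨pow_ne_zero _ hp.ne_zero, hcop i⟩]
      rcases Nat.eq_zero_or_pos i with rfl | hi
      · simp [rho_one]
      · obtain ⟨j, rfl⟩ := Nat.exists_eq_succ_of_ne_zero hi.ne'
        rw [hrho j]; simp
    have hco : ∀ i, copA P (p ^ i) = 1 := by
      intro i
      simp [copA, hp.ne_zero, hcop i]
    have hch : ∀ i, chiA d (p ^ i) = (chi d p : ℝ) ^ i := by
      intro i
      simp only [chiA, ArithmeticFunction.coe_mk]
      induction i with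
      | zero => simp [chi_one]
      | succ i ih => rw [pow_succ, chi_mul]; push_cast; rw [ih]; ring
    simp_rw [hsq, hra, hco, hch, mul_one]
    generalize (chi d p : ℝ) = c at hchi2
    induction k using Nat.twoStepInduction with
    | zero => simp
    | one => simp [Finset.sum_range_succ]
    | more k ih _ =>
      rw [Finset.sum_range_succ (n := k + 2), Finset.sum_range_succ (n := k + 1),
        Finset.sum_range_succ (n := k + 2), Finset.sum_range_succ (n := k + 1)]
      have e1 : k + 2 - (k + 1) = 1 := by omega
      have e2 : ∑ x ∈ Finset.range (k + 1), (if x = 0 then 1 else 1 + c) *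
          (if Even (k + 2 - x) then (1:ℝ) else 0) =
          ∑ x ∈ Finset.range (k + 1), (if x = 0 then 1 else 1 + c) *
          (if Even (k - x) then (1:ℝ) else 0) := by
        refine Finset.sum_congr rfl fun x hx => ?_
        have hx' : x ≤ k := by simpa [Nat.lt_succ_iff] using hx
        have : k + 2 - x = (k - x) + 2 := by omega
        rw [this]
        simp [Nat.even_add]
      rw [e2, ih, e1]
      simp only [Nat.not_even_one, if_false, mul_zero, add_zero, Nat.sub_self, Even.zero, if_true, mul_one]
      rw [if_neg (by omega), add_assoc]
      congr 1
      rcases Nat.even_or_odd k with ⟨j, rfl⟩ | ⟨j, rfl⟩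
      · have : c ^ (j + j) = 1 := by rw [← two_mul, pow_mul, hchi2, one_pow]
        rw [pow_add _ (j + j) 1, pow_add _ (j + j) 2, this, hchi2]; ring
      · have : c ^ (2 * j) = 1 := by rw [pow_mul, hchi2, one_pow]
        have h1 : c ^ (2 * j + 1 + 1) = 1 := by rw [add_assoc, pow_add, this, hchi2]; ring
        have h2 : c ^ (2 * j + 1 + 2) = c := by
          rw [add_assoc, pow_add, this]
          have : c ^ (1 + 2) = c * c ^ 2 := by ring
          rw [this, hchi2]; ring
        rw [h1, h2]

end VA
end

section
namespace VA

/-- the form `f ∘ M`, `M = (p q; r s)` -/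
def fe (f : ℤ × ℤ × ℤ) (p q r s : ℤ) : ℤ × ℤ × ℤ :=
  (formVal f p r, 2 * f.1 * p * q + f.2.1 * (p * s + q * r) + 2 * f.2.2 * r * s, formVal f q s)

lemma formVal_fe (f : ℤ × ℤ × ℤ) (p q r s x y : ℤ) :
    formVal (fe f p q r s) x y = formVal f (p * x + q * y) (r * x + s * y) := by
  simp only [formVal, fe]; ring

lemma form_ext {f g : ℤ × ℤ × ℤ} (h : ∀ x y, formVal f x y = formVal g x y) : f = g := by
  obtain ⟨a, b, c⟩ := f
  obtain ⟨a', b', c'⟩ := g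
  have h1 := h 1 0
  have h2 := h 0 1
  have h3 := h 1 1
  simp [formVal] at h1 h2 h3
  subst h1 h2
  have : b = b' := by linarith
  rw [this]

lemma fe_fe (f : ℤ × ℤ × ℤ) (p q r s p' q' r' s' : ℤ) :
    fe (fe f p q r s) p' q' r' s' =
      fe f (p * p' + q * r') (p * q' + q * s') (r * p' + s * r') (r * q' + s * s') := by
  apply form_ext
  intro x y
  simp only [formVal_fe]
  congr 1 <;> ring

lemma fe_id (f : ℤ × ℤ × ℤ) : fe f 1 0 0 1 = f := by
  apply form_ext; intro x y; rw [formVal_fe]; simp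

lemma formEquiv_iff (f g : ℤ × ℤ × ℤ) :
    formEquiv f g ↔ ∃ p q r s : ℤ, p * s - q * r = 1 ∧ g = fe f p q r s := by
  constructor
  · rintro ⟨M, hM⟩
    refine ⟨M.1 0 0, M.1 0 1, M.1 1 0, M.1 1 1, ?_, ?_⟩
    · have := M.2; rw [Matrix.det_fin_two] at this; exact this
    · apply form_ext; intro x y; rw [hM, formVal_fe]
  · rintro ⟨p, q, r, s, h, rfl⟩
    refine ⟨⟨!![p, q; r, s], by rw [Matrix.det_fin_two]; simpa using h⟩, ?_⟩
    intro x y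
    rw [formVal_fe]; simp

lemma formEquiv_refl (f : ℤ × ℤ × ℤ) : formEquiv f f :=
  (formEquiv_iff f f).2 ⟨1, 0, 0, 1, by norm_num, (fe_id f).symm⟩

lemma fe_inv (f : ℤ × ℤ × ℤ) (p q r s : ℤ) (h : p * s - q * r = 1) :
    fe (fe f p q r s) s (-q) (-r) p = f := by
  rw [fe_fe]
  have e1 : p * s + q * -r = 1 := by linarith
  have e2 : p * -q + q * p = 0 := by ring
  have e3 : r * s + s * -r = 0 := by ring
  have e4 : r * -q + s * p = 1 := by linarith
  rw [e1, e2, e3, e4, fe_id]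

lemma formEquiv_symm {f g : ℤ × ℤ × ℤ} (h : formEquiv f g) : formEquiv g f := by
  rw [formEquiv_iff] at *
  obtain ⟨p, q, r, s, h, rfl⟩ := h
  exact ⟨s, -q, -r, p, by linarith, (fe_inv f p q r s h).symm⟩

lemma formEquiv_trans {f g k : ℤ × ℤ × ℤ} (h : formEquiv f g) (h' : formEquiv g k) :
    formEquiv f k := by
  rw [formEquiv_iff] at *
  obtain ⟨p, q, r, s, h, rfl⟩ := h
  obtain ⟨p', q', r', s', h', rfl⟩ := h'
  refine ⟨_, _, _, _, ?_, fe_fe _ _ _ _ _ _ _ _ _⟩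
  linear_combination h * (p' * s' - q' * r') + h'

lemma formDisc_fe (f : ℤ × ℤ × ℤ) (p q r s : ℤ) (h : p * s - q * r = 1) :
    formDisc (fe f p q r s) = formDisc f := by
  simp only [formDisc, fe, formVal]
  linear_combination (f.2.1 ^ 2 - 4 * f.1 * f.2.2) * (p * s - q * r + 1) * h

lemma isPrimitive_iff (f : ℤ × ℤ × ℤ) :
    IsPrimitiveForm f ↔ ∀ k : ℕ, k.Prime → ¬ ((k:ℤ) ∣ f.1 ∧ (k:ℤ) ∣ f.2.1 ∧ (k:ℤ) ∣ f.2.2) := by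
  unfold IsPrimitiveForm
  constructor
  · rintro h k hk ⟨h1, h2, h3⟩
    have h4 : (k:ℤ) ∣ (Int.gcd f.2.1 f.2.2 : ℤ) := Int.dvd_coe_gcd h2 h3
    have h5 : (k:ℤ) ∣ (Int.gcd f.1 (Int.gcd f.2.1 f.2.2) : ℤ) := Int.dvd_coe_gcd h1 h4
    rw [h] at h5
    have : k ∣ 1 := by exact_mod_cast h5
    exact hk.one_lt.ne' (Nat.dvd_one.1 this)
  · intro h
    by_contra hc
    obtain ⟨k, hk, hkd⟩ := Nat.exists_prime_and_dvd hc
    have h0 : (k:ℤ) ∣ (Int.gcd f.1 (Int.gcd f.2.1 f.2.2) : ℤ) := by exact_mod_cast hkd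
    have h1 := h0.trans (Int.gcd_dvd_left ..)
    have h2 := h0.trans (Int.gcd_dvd_right ..)
    exact h k hk ⟨h1, h2.trans (Int.gcd_dvd_left ..), h2.trans (Int.gcd_dvd_right ..)⟩

lemma dvd_fe (f : ℤ × ℤ × ℤ) (p q r s k : ℤ) (h : k ∣ f.1 ∧ k ∣ f.2.1 ∧ k ∣ f.2.2) :
    k ∣ (fe f p q r s).1 ∧ k ∣ (fe f p q r s).2.1 ∧ k ∣ (fe f p q r s).2.2 := by
  obtain ⟨⟨a, ha⟩, ⟨b, hb⟩, ⟨c, hc⟩⟩ := h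
  simp only [fe, formVal, ha, hb, hc]
  exact ⟨⟨a * p ^ 2 + b * p * r + c * r ^ 2, by ring⟩,
    ⟨2 * a * p * q + b * (p * s + q * r) + 2 * c * r * s, by ring⟩,
    ⟨a * q ^ 2 + b * q * s + c * s ^ 2, by ring⟩⟩

lemma isPrimitive_fe (f : ℤ × ℤ × ℤ) (p q r s : ℤ) (h : p * s - q * r = 1)
    (hf : IsPrimitiveForm f) : IsPrimitiveForm (fe f p q r s) := by
  rw [isPrimitive_iff] at *
  intro k hk hd
  apply hf k hk
  have := dvd_fe _ s (-q) (-r) p k hd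
  rwa [fe_inv f p q r s h] at this

/-- structure of automorphs -/
lemma automorph_struct {a b c p q r s : ℤ} (ha : a ≠ 0) (hprim : IsPrimitiveForm (a, b, c))
    (hdet : p * s - q * r = 1) (h : fe (a, b, c) p q r s = (a, b, c)) :
    ∃ u : ℤ, r = a * u ∧ p - s = - b * u ∧ q = - c * u ∧
      (p + s) ^ 2 - formDisc (a, b, c) * u ^ 2 = 4 := by
  simp only [fe, formVal, Prod.mk.injEq] at h
  obtain ⟨h1, h2, h3⟩ := h
  have e1 : a * (p - s) = - b * r := by
    have : 2 * (a * (p - s)) = 2 * (- b * r) := by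
      linear_combination 2 * s * h1 - r * h2 - (2 * a * p + b * r) * hdet
    exact mul_left_cancel₀ two_ne_zero this
  have e2 : a * q = - c * r := by
    have : 2 * (a * q) = 2 * (- c * r) := by
      linear_combination s * h2 - 2 * r * h3 - (2 * a * q + b * s) * hdet
    exact mul_left_cancel₀ two_ne_zero this
  have hdvd : a ∣ r := by
    have g1 : a ∣ r * a := Dvd.intro_left r rfl
    have g2 : a ∣ r * b := ⟨-(p - s), by linear_combination e1⟩
    have g3 : a ∣ r * c := ⟨-q, by linear_combination e2⟩
    have g4 : a ∣ r * (Int.gcd b c : ℤ) := by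
      rw [Int.gcd_eq_gcd_ab b c, mul_add, ← mul_assoc, ← mul_assoc]
      exact dvd_add (g2.mul_right _) (g3.mul_right _)
    have g5 : a ∣ r * (Int.gcd a (Int.gcd b c) : ℤ) := by
      rw [Int.gcd_eq_gcd_ab a _, mul_add, ← mul_assoc, ← mul_assoc]
      exact dvd_add (g1.mul_right _) (g4.mul_right _)
    have hp : Int.gcd a (Int.gcd b c) = 1 := hprim
    rw [hp] at g5
    simpa using g5
  obtain ⟨u, rfl⟩ := hdvd
  have e3 : p - s = - b * u := by
    apply mul_left_cancel₀ ha; linear_combination e1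
  have e4 : q = - c * u := by
    apply mul_left_cancel₀ ha; linear_combination e2
  refine ⟨u, rfl, e3, e4, ?_⟩
  simp only [formDisc]
  have : (p + s) ^ 2 = (p - s) ^ 2 + 4 * (p * s) := by ring
  rw [this, e3]
  rw [e4] at hdet
  linear_combination 4 * hdet

/-! ### Pell solution -/

lemma pell_exists {d : ℤ} (h0 : 0 < d) (h : ¬ IsSquare d) :
    ∃ t u : ℕ, 0 < t ∧ 0 < u ∧ (t:ℤ) ^ 2 - d * (u:ℤ) ^ 2 = 4 := by
  obtain ⟨x, y, hxy, hy⟩ := Pell.exists_of_not_isSquare h0 h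
  refine ⟨(2 * x).natAbs, (2 * y).natAbs, ?_, by omega, ?_⟩
  · have : x ≠ 0 := by
      rintro rfl
      nlinarith [mul_pos h0 (sq_pos_of_ne_zero hy)]
    omega
  · rw [Int.natAbs_sq, Int.natAbs_sq]; linear_combination 4 * hxy

lemma td_ud_spec {d : ℤ} (h0 : 0 < d) (h : ¬ IsSquare d) :
    0 < td d ∧ 0 < ud d ∧ (td d : ℤ) ^ 2 - d * (ud d : ℤ) ^ 2 = 4 := by
  obtain ⟨t, u, ht, hu, htu⟩ := pell_exists h0 h
  have h1 : td d ∈ {t : ℕ | 0 < t ∧ ∃ u : ℕ, 0 < u ∧ (t : ℤ) ^ 2 - d * (u : ℤ) ^ 2 = 4} :=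
    Nat.sInf_mem ⟨t, ht, u, hu, htu⟩
  obtain ⟨h2, u', hu', htu'⟩ := h1
  have h3 : ud d ∈ {u : ℕ | 0 < u ∧ (td d : ℤ) ^ 2 - d * (u : ℤ) ^ 2 = 4} :=
    Nat.sInf_mem ⟨u', hu', htu'⟩
  exact ⟨h2, h3.1, h3.2⟩

lemma td_min {d : ℤ} {t u : ℤ} (ht : 0 < t) (hu : 0 < u) (htu : t ^ 2 - d * u ^ 2 = 4) :
    (td d : ℤ) ≤ t := by
  lift t to ℕ using ht.le
  lift u to ℕ using hu.le
  have : td d ≤ t := Nat.sInf_le ⟨by exact_mod_cast ht, u, by exact_mod_cast hu, htu⟩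
  exact_mod_cast this

end VA
end

section
namespace VA

/-- the fundamental cone for `f = (a,b,c)` -/
def cone (d : ℤ) (f : ℤ × ℤ × ℤ) (v : ℤ × ℤ) : Prop :=
  0 ≤ v.2 ∧ (td d : ℤ) * v.2 < (ud d : ℤ) * (2 * f.1 * v.1 + f.2.1 * v.2)

/-- the second vector is the image of the first under an automorph -/
def autRel (f : ℤ × ℤ × ℤ) (v v' : ℤ × ℤ) : Prop :=
  ∃ p q r s : ℤ, p * s - q * r = 1 ∧ fe f p q r s = f ∧
    v'.1 = p * v.1 + q * v.2 ∧ v'.2 = r * v.1 + s * v.2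

lemma autRel_refl (f : ℤ × ℤ × ℤ) (v : ℤ × ℤ) : autRel f v v :=
  ⟨1, 0, 0, 1, by norm_num, fe_id f, by ring, by ring⟩

lemma autRel_trans {f : ℤ × ℤ × ℤ} {u v w : ℤ × ℤ} (h : autRel f u v) (h' : autRel f v w) :
    autRel f u w := by
  obtain ⟨p, q, r, s, hd, hf, h1, h2⟩ := h
  obtain ⟨p', q', r', s', hd', hf', h1', h2'⟩ := h'
  refine ⟨p' * p + q' * r, p' * q + q' * s, r' * p + s' * r, r' * q + s' * s, ?_, ?_, ?_, ?_⟩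
  · linear_combination hd * (p' * s' - q' * r') + hd'
  · rw [← fe_fe, hf', hf]
  · rw [h1', h1, h2]; ring
  · rw [h2', h1, h2]; ring

lemma autRel_val {f : ℤ × ℤ × ℤ} {v v' : ℤ × ℤ} (h : autRel f v v') :
    formVal f v'.1 v'.2 = formVal f v.1 v.2 := by
  obtain ⟨p, q, r, s, hd, hf, h1, h2⟩ := h
  rw [h1, h2, ← formVal_fe, hf]

lemma autRel_neg (f : ℤ × ℤ × ℤ) (v : ℤ × ℤ) : autRel f v (-v.1, -v.2) :=
  ⟨-1, 0, 0, -1, by norm_num, by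
    apply form_ext; intro x y; rw [formVal_fe]; simp [formVal], by ring, by ring⟩

/-- parity -/
lemma pell_parity {b d t u a c : ℤ} (hd : b ^ 2 - 4 * a * c = d) (h : t ^ 2 - d * u ^ 2 = 4) :
    ∃ k, t = b * u + 2 * k := by
  have h1 : (2:ℤ) ∣ (t - b * u) ^ 2 := by
    refine ⟨2 + b^2 * u^2 - 2 * a * c * u ^ 2 - t * b * u, ?_⟩
    subst hd
    linear_combination h
  have h2 := Int.prime_two.dvd_of_dvd_pow h1
  obtain ⟨k, hk⟩ := h2
  exact ⟨k, by linarith⟩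

/-- action of a unit `(t,u)` -/
lemma autRel_unit {a b c d t u : ℤ} (hd : formDisc (a, b, c) = d) (h : t ^ 2 - d * u ^ 2 = 4)
    (v : ℤ × ℤ) : ∃ v' : ℤ × ℤ, autRel (a, b, c) v v' ∧
      2 * (2 * a * v'.1 + b * v'.2) = t * (2 * a * v.1 + b * v.2) + d * u * v.2 ∧
      2 * v'.2 = u * (2 * a * v.1 + b * v.2) + t * v.2 := by
  simp only [formDisc] at hd
  obtain ⟨k, hk⟩ := pell_parity hd h
  -- p = k, s = k + b u, r = a u, q = - c u
  refine ⟨(k * v.1 + (-c * u) * v.2, (a * u) * v.1 + (k + b * u) * v.2),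
    ⟨k, -c * u, a * u, k + b * u, ?_, ?_, rfl, rfl⟩, ?_, ?_⟩
  · subst hk; subst hd
    have : 4 * (k * (k + b * u) - -c * u * (a * u)) = 4 * 1 := by linear_combination h
    exact mul_left_cancel₀ (by norm_num) this
  · have hdet : k * (k + b * u) + c * a * u ^ 2 = 1 := by
      subst hk; subst hd
      have : 4 * (k * (k + b * u) + c * a * u ^ 2) = 4 * 1 := by linear_combination h
      exact mul_left_cancel₀ (by norm_num) this
    simp only [fe, formVal, Prod.mk.injEq]
    refine ⟨?_, ?_, ?_⟩
    · linear_combination a * hdet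
    · linear_combination b * hdet
    · linear_combination c * hdet
  · subst hk; subst hd; simp only; ring
  · subst hk; simp only; ring

lemma formVal_X (a b c x y : ℤ) : 4 * a * formVal (a, b, c) x y =
    (2 * a * x + b * y) ^ 2 - formDisc (a, b, c) * y ^ 2 := by
  simp only [formVal, formDisc]; ring


lemma sq_dom {d : ℤ} (h0 : 0 < d) {X y t u : ℤ} (hX : 0 < X) (hXy : d * y ^ 2 < X ^ 2) (ht : 0 < t)
    (htu : t ^ 2 - d * u ^ 2 = 4) : |d * u * y| < t * X := by
  apply abs_lt_of_sq_lt_sq _ (by positivity)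
  have h1 : d * u ^ 2 < t ^ 2 := by linarith
  have e : (d * u * y) ^ 2 = (d * u ^ 2) * (d * y ^ 2) := by ring
  rw [e, mul_pow]
  have h2 : 0 ≤ d * y ^ 2 := by positivity
  have h3 : 0 ≤ d * u ^ 2 := by positivity
  nlinarith

lemma increase {d X y t u : ℤ} (hX : 0 < X) (hXy : d * y ^ 2 < X ^ 2) (ht : 2 < t) (hu : 0 < u)
    (htu : t ^ 2 - d * u ^ 2 = 4) : (t - 2) * |y| < u * X := by
  apply lt_of_pow_lt_pow_left₀ 2 (by positivity)
  rw [mul_pow, sq_abs, mul_pow]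
  have h1 : (t - 2) ^ 2 ≤ d * u ^ 2 := by nlinarith
  have h2 : 0 ≤ y ^ 2 := by positivity
  have h3 : 0 < u ^ 2 := by positivity
  nlinarith

lemma td_gt_two {d : ℤ} (h0 : 0 < d) (hns : ¬ IsSquare d) : 2 < (td d : ℤ) := by
  obtain ⟨h1, h2, h3⟩ := td_ud_spec h0 hns
  have : 0 < (ud d : ℤ) := by exact_mod_cast h2
  have h4 : 0 < d * (ud d : ℤ) ^ 2 := by positivity
  have h5 : 0 < (td d : ℤ) := by exact_mod_cast h1
  nlinarith

lemma cone_exists_pos {d : ℤ} (h0 : 0 < d) (hns : ¬ IsSquare d) {a b c : ℤ} (ha : 0 < a) (hd : formDisc (a, b, c) = d) (n : ℕ) :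
    ∀ v : ℤ × ℤ, v.2.natAbs = n → 0 < formVal (a, b, c) v.1 v.2 →
      0 < 2 * a * v.1 + b * v.2 → ∃ v', autRel (a, b, c) v v' ∧ cone d (a, b, c) v' := by
  obtain ⟨ht0, hu0, htu⟩ := td_ud_spec h0 hns
  have ht2 := td_gt_two h0 hns
  have hu : 0 < (ud d : ℤ) := by exact_mod_cast hu0
  generalize htt : (td d : ℤ) = t at *
  generalize huu : (ud d : ℤ) = u at *
  induction n using Nat.strong_induction_on with
  | _ n ih =>
    intro v hv hpos hX
    have hXy : d * v.2 ^ 2 < (2 * a * v.1 + b * v.2) ^ 2 := by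
      have := formVal_X a b c v.1 v.2
      rw [hd] at this
      nlinarith [mul_pos ha hpos]
    have hinc := increase hX hXy ht2 hu htu
    have hdom := sq_dom h0 hX hXy (by linarith : 0 < t) htu
    rw [abs_lt] at hdom
    rcases le_or_gt 0 v.2 with hy | hy
    · by_cases hc : t * v.2 < u * (2 * a * v.1 + b * v.2)
      · exact ⟨v, autRel_refl _ _, hy, by rw [htt, huu]; exact hc⟩
      · obtain ⟨v', hv', hX', hy'⟩ := autRel_unit (t := t) (u := -u) hd (by rw [neg_sq]; exact htu) v
        push Not at hc
        rw [abs_of_nonneg hy] at hinc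
        have hy'0 : 0 ≤ v'.2 := by nlinarith
        have hlt : v'.2 < v.2 := by nlinarith
        obtain ⟨w, hw, hwc⟩ := ih v'.2.natAbs (by omega) v' rfl
          (by rw [autRel_val hv']; exact hpos) (by nlinarith [hdom.1, hdom.2])
        exact ⟨w, autRel_trans hv' hw, hwc⟩
    · obtain ⟨v', hv', hX', hy'⟩ := autRel_unit hd htu v
      rw [abs_of_neg hy] at hinc
      have hlt : v.2 < v'.2 := by nlinarith
      have hXp : 0 < 2 * a * v'.1 + b * v'.2 := by nlinarith [hdom.1, hdom.2]
      rcases le_or_gt 0 v'.2 with hy2 | hy2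
      · refine ⟨v', hv', hy2, ?_⟩
        rw [htt, huu]
        -- y = (-u X' + t y')/2
        have : 2 * (t * v'.2 - u * (2 * a * v'.1 + b * v'.2)) = 2 * (2 * v.2) := by
          linear_combination t * hy' - u * hX' + v.2 * htu
        show t * v'.2 < u * (2 * a * v'.1 + b * v'.2)
        linarith
      · obtain ⟨w, hw, hwc⟩ := ih v'.2.natAbs (by omega) v' rfl
          (by rw [autRel_val hv']; exact hpos) hXp
        exact ⟨w, autRel_trans hv' hw, hwc⟩

lemma cone_exists {d : ℤ} (h0 : 0 < d) (hns : ¬ IsSquare d) {a b c : ℤ} (ha : 0 < a) (hd : formDisc (a, b, c) = d)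
    (v : ℤ × ℤ) (hpos : 0 < formVal (a, b, c) v.1 v.2) :
    ∃ v', autRel (a, b, c) v v' ∧ cone d (a, b, c) v' := by
  rcases lt_trichotomy 0 (2 * a * v.1 + b * v.2) with hX | hX | hX
  · exact cone_exists_pos h0 hns ha hd _ v rfl hpos hX
  · exfalso
    have := formVal_X a b c v.1 v.2
    rw [← hX, hd] at this
    nlinarith [mul_pos ha hpos, mul_nonneg h0.le (sq_nonneg v.2)]
  · obtain ⟨v', h1, h2⟩ := cone_exists_pos h0 hns ha hd _ (-v.1, -v.2) rfl
      (by rw [autRel_val (autRel_neg _ v)]; exact hpos) (by simp only; linarith)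
    exact ⟨v', autRel_trans (autRel_neg _ v) h1, h2⟩

/-- key: an automorph with positive second entry does not map cone into cone -/
lemma cone_aux {d : ℤ} (h0 : 0 < d) (hns : ¬ IsSquare d) {t' u' y y' X' : ℤ} (hu' : 0 < u') (ht' : 0 < t')
    (htu' : t' ^ 2 - d * u' ^ 2 = 4)
    (hy : 0 ≤ y) (hy' : 0 ≤ y') (hc' : (td d : ℤ) * y' < ud d * X')
    (e : 2 * y = - u' * X' + t' * y') : False := by
  obtain ⟨ht0, hu0, htu⟩ := td_ud_spec h0 hns
  have hu : 0 < (ud d : ℤ) := by exact_mod_cast hu0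
  have ht : 0 < (td d : ℤ) := by exact_mod_cast ht0
  have hmin := td_min ht' hu' htu'
  generalize (td d : ℤ) = t at *
  generalize (ud d : ℤ) = u at *
  have huu : u ≤ u' := by
    by_contra hlt
    push Not at hlt
    have : u' ^ 2 < u ^ 2 := by nlinarith
    nlinarith
  -- t' u ≤ t u'
  have hle : t' * u ≤ t * u' := by
    apply le_of_sq_le_sq _ (by positivity)
    have : (t' * u) ^ 2 = d * u' ^ 2 * u ^ 2 + 4 * u ^ 2 := by
      linear_combination u ^ 2 * htu'
    have h2 : (t * u') ^ 2 = d * u ^ 2 * u' ^ 2 + 4 * u' ^ 2 := by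
      linear_combination u' ^ 2 * htu
    rw [this, h2]
    nlinarith
  have h1 : u' * X' ≤ t' * y' := by linarith
  have h2 : u * (u' * X') ≤ t * u' * y' := by nlinarith
  have h3 : u' * (t * y') < u' * (u * X') := mul_lt_mul_of_pos_left hc' hu'
  nlinarith

lemma cone_unique {d : ℤ} (h0 : 0 < d) (hns : ¬ IsSquare d) {a b c : ℤ} (ha : 0 < a) (hd : formDisc (a, b, c) = d)
    (hprim : IsPrimitiveForm (a, b, c)) {v v' : ℤ × ℤ}
    (hpos : 0 < formVal (a, b, c) v.1 v.2) (h : autRel (a, b, c) v v')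
    (hc : cone d (a, b, c) v) (hc' : cone d (a, b, c) v') : v = v' := by
  have hval := autRel_val h
  obtain ⟨p, q, r, s, hdet, hf, h1, h2⟩ := h
  obtain ⟨u', hr, hps, hq, htu'⟩ := automorph_struct ha.ne' hprim hdet hf
  rw [hd] at htu'
  obtain ⟨hy, hX⟩ := hc
  obtain ⟨hy', hX'⟩ := hc'
  have hu : 0 < (ud d : ℤ) := by exact_mod_cast (td_ud_spec h0 hns).2.1
  have ht : 0 < (td d : ℤ) := by exact_mod_cast (td_ud_spec h0 hns).1
  simp only at hX hX'
  have hXp : 0 < 2 * a * v.1 + b * v.2 := by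
    by_contra hn; push Not at hn; nlinarith [mul_nonneg ht.le hy]
  have hXp' : 0 < 2 * a * v'.1 + b * v'.2 := by
    by_contra hn; push Not at hn; nlinarith [mul_nonneg ht.le hy']
  have hXy : d * v.2 ^ 2 < (2 * a * v.1 + b * v.2) ^ 2 := by
    have := formVal_X a b c v.1 v.2
    rw [hd] at this
    nlinarith [mul_pos ha hpos]
  generalize htt : p + s = t' at *
  have hd' : b ^ 2 - 4 * a * c = d := hd
  have eX : 2 * (2 * a * v'.1 + b * v'.2) = t' * (2 * a * v.1 + b * v.2) + d * u' * v.2 := by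
    rw [h1, h2, ← htt, ← hd']
    subst hr hq
    linear_combination (2 * a * v.1 - b * v.2) * hps
  have ey : 2 * v'.2 = u' * (2 * a * v.1 + b * v.2) + t' * v.2 := by
    rw [h2, ← htt]
    subst hr
    linear_combination (- v.2) * hps
  have ht'pos : 0 < t' := by
    by_contra hn
    push Not at hn
    have hne : t' ≠ 0 := by
      rintro rfl
      nlinarith [mul_nonneg h0.le (sq_nonneg u')]
    have hlt : 0 < -t' := by omega
    have := sq_dom h0 (u := u') hXp hXy hlt (by rw [neg_sq]; exact htu')
    rw [abs_lt] at this
    nlinarith [this.1, this.2]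
  rcases lt_trichotomy u' 0 with hneg | hz | hpos'
  · exfalso
    refine cone_aux h0 hns (t' := t') (u' := -u') (by omega) ht'pos (by rw [neg_sq]; exact htu')
      hy' hy hX ?_
    rw [ey]; ring
  · subst hz
    have : t' = 2 := by
      have h5 : (t' - 2) * (t' + 2) = 0 := by linear_combination htu'
      rcases mul_eq_zero.1 h5 with h6 | h6 <;> linarith
    subst this
    have e2 : v.2 = v'.2 := by linarith
    have e1 : v.1 = v'.1 := by
      have : 2 * a * v'.1 = 2 * a * v.1 := by rw [← e2] at eX; linarith
      exact (mul_left_cancel₀ (by positivity) this).symm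
    exact Prod.ext e1 e2
  · exfalso
    refine cone_aux h0 hns hpos' ht'pos htu' hy hy' hX' ?_
    have : 2 * (t' * v'.2 - u' * (2 * a * v'.1 + b * v'.2)) = 2 * (2 * v.2) := by
      linear_combination t' * ey - u' * eX + v.2 * htu'
    linarith

end VA
end

section
namespace VA

lemma exists_bezout {x y : ℤ} (h : Int.gcd x y = 1) : ∃ q s : ℤ, x * s - q * y = 1 := by
  refine ⟨-Int.gcdB x y, Int.gcdA x y, ?_⟩
  have := Int.gcd_eq_gcd_ab x y
  rw [h] at this
  push_cast at this
  linarith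

lemma exists_coprime_value {f : ℤ × ℤ × ℤ} (hf : IsPrimitiveForm f) (N : ℕ) :
    ∃ x y : ℤ, ∀ p : ℕ, p.Prime → p ∣ N → N ≠ 0 → ¬ (p:ℤ) ∣ formVal f x y := by
  classical
  obtain ⟨a, b, c⟩ := f
  let S1 : Finset ℕ := N.primeFactors.filter (fun p : ℕ => (p:ℤ) ∣ a ∧ ¬ (p:ℤ) ∣ c)
  let S2 : Finset ℕ := N.primeFactors.filter (fun p : ℕ => ¬ (p:ℤ) ∣ a)
  refine ⟨((S1.prod (fun l : ℕ => l) : ℕ) : ℤ), ((S2.prod (fun l : ℕ => l) : ℕ) : ℤ), ?_⟩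
  intro p hp hpN hN0 hdvd
  have hpi : Prime (p : ℤ) := Nat.prime_iff_prime_int.1 hp
  have hmem : p ∈ N.primeFactors := Nat.mem_primeFactors.2 ⟨hp, hpN, hN0⟩
  have hS : ∀ S ⊆ N.primeFactors, ((p:ℤ) ∣ ((S.prod (fun l : ℕ => l) : ℕ) : ℤ) ↔ p ∈ S) := by
    intro S hS
    rw [Int.natCast_dvd_natCast, Prime.dvd_finset_prod_iff (Nat.prime_iff.1 hp)]
    constructor
    · rintro ⟨q, hq, hpq⟩
      have := (Nat.prime_dvd_prime_iff_eq hp (Nat.prime_of_mem_primeFactors (hS hq))).1 hpq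
      rwa [this]
    · intro h; exact ⟨p, h, dvd_rfl⟩
  have h1 := hS S1 (Finset.filter_subset _ _)
  have h2 := hS S2 (Finset.filter_subset _ _)
  generalize ((S1.prod (fun l : ℕ => l) : ℕ) : ℤ) = x at *
  generalize ((S2.prod (fun l : ℕ => l) : ℕ) : ℤ) = y at *
  simp only [S1, S2, Finset.mem_filter, hmem, true_and] at h1 h2
  have hprim := (isPrimitive_iff _).1 hf p hp
  simp only at hprim
  simp only [formVal] at hdvd
  by_cases ha : (p:ℤ) ∣ a
  · have hy : ¬ (p:ℤ) ∣ y := by rw [h2]; simpa using ha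
    by_cases hc : (p:ℤ) ∣ c
    · have hx : ¬ (p:ℤ) ∣ x := by rw [h1]; tauto
      have hb : ¬ (p:ℤ) ∣ b := by tauto
      have : (p:ℤ) ∣ b * x * y := by
        have e : b * x * y = (a * x ^ 2 + b * x * y + c * y ^ 2) - a * x ^ 2 - c * y ^ 2 := by ring
        rw [e]
        exact dvd_sub (dvd_sub hdvd (ha.mul_right _)) (hc.mul_right _)
      rcases hpi.dvd_or_dvd this with h | h
      · rcases hpi.dvd_or_dvd h with h | h <;> tauto
      · tauto
    · have hx : (p:ℤ) ∣ x := by rw [h1]; exact ⟨ha, hc⟩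
      have : (p:ℤ) ∣ c * y ^ 2 := by
        have e : c * y ^ 2 = (a * x ^ 2 + b * x * y + c * y ^ 2) - a * x ^ 2 - b * x * y := by ring
        rw [e]
        exact dvd_sub (dvd_sub hdvd (ha.mul_right _)) ((hx.mul_left _).mul_right _)
      rcases hpi.dvd_or_dvd this with h | h
      · exact hc h
      · exact hy (hpi.dvd_of_dvd_pow h)
  · have hy : (p:ℤ) ∣ y := by rw [h2]; exact ha
    have hx : ¬ (p:ℤ) ∣ x := by rw [h1]; tauto
    have : (p:ℤ) ∣ a * x ^ 2 := by
      have e : a * x ^ 2 = (a * x ^ 2 + b * x * y + c * y ^ 2) - b * x * y - c * y ^ 2 := by ring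
      rw [e]
      exact dvd_sub (dvd_sub hdvd (hy.mul_left _)) ((dvd_pow hy two_ne_zero).mul_left _)
    rcases hpi.dvd_or_dvd this with h | h
    · exact ha h
    · exact hx (hpi.dvd_of_dvd_pow h)

lemma isCoprime_of_primes {z : ℤ} {N : ℕ} (hN : N ≠ 0)
    (h : ∀ p : ℕ, p.Prime → p ∣ N → N ≠ 0 → ¬ (p:ℤ) ∣ z) : IsCoprime z (N:ℤ) := by
  rw [Int.isCoprime_iff_gcd_eq_one]
  by_contra hc
  obtain ⟨k, hk, hkd⟩ := Nat.exists_prime_and_dvd hc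
  have h0 : (k:ℤ) ∣ (Int.gcd z N : ℤ) := by exact_mod_cast hkd
  have h1 := h0.trans (Int.gcd_dvd_left ..)
  have h2 := h0.trans (Int.gcd_dvd_right ..)
  exact h k hk (by exact_mod_cast h2) hN h1

lemma exists_pos_value {f : ℤ × ℤ × ℤ} {d : ℤ} (h0 : 0 < d) (hns : ¬ IsSquare d)
    (hd : formDisc f = d) : ∃ x y : ℤ, 0 < formVal f x y := by
  obtain ⟨a, b, c⟩ := f
  rcases lt_trichotomy a 0 with ha | ha | ha
  · refine ⟨-b, 2 * a, ?_⟩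
    have : formVal (a, b, c) (-b) (2 * a) = (-a) * d := by
      rw [← hd]; simp only [formVal, formDisc]; ring
    rw [this]; exact mul_pos (by omega) h0
  · exfalso; apply hns; subst ha; rw [← hd]; simp only [formDisc]
    exact ⟨b, by ring⟩
  · exact ⟨1, 0, by simpa [formVal] using ha⟩

lemma exists_good_value {f : ℤ × ℤ × ℤ} {d : ℤ} (h0 : 0 < d) (hns : ¬ IsSquare d)
    (hd : formDisc f = d) (hf : IsPrimitiveForm f) :
    ∃ x y : ℤ, 0 < formVal f x y ∧ IsCoprime (formVal f x y) (2 * d) := by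
  obtain ⟨x1, y1, h1⟩ := exists_coprime_value hf (2 * d.natAbs)
  have hc := isCoprime_of_primes (by omega) h1
  have e2 : ((2 * d.natAbs : ℕ) : ℤ) = 2 * d := by omega
  rw [e2] at hc
  obtain ⟨x0, y0, h2⟩ := exists_pos_value h0 hns hd
  set B := 2 * f.1 * x1 * x0 + f.2.1 * (x1 * y0 + x0 * y1) + 2 * f.2.2 * y1 * y0 with hB
  have key : ∀ k : ℤ, formVal f (x1 + 2 * d * k * x0) (y1 + 2 * d * k * y0) =
      formVal f x1 y1 + 2 * d * (k * B + 2 * d * k ^ 2 * formVal f x0 y0) := by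
    intro k; simp only [formVal, hB]; ring
  set k : ℤ := |B| + |formVal f x1 y1| with hk
  refine ⟨x1 + 2 * d * (k + 1) * x0, y1 + 2 * d * (k + 1) * y0, ?_, ?_⟩
  · rw [key]
    have hk0 : |B| ≤ k := by rw [hk]; linarith [abs_nonneg (formVal f x1 y1)]
    have hk1 : |formVal f x1 y1| ≤ k := by rw [hk]; linarith [abs_nonneg B]
    have hB1 := (abs_le.1 hk0).1
    have hF1 := (abs_le.1 hk1).1
    have hkk : 0 ≤ k := (abs_nonneg _).trans hk0
    have g1 : (k + 1) * B ≥ - ((k + 1) * k) := by nlinarith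
    have g2 : 2 * d * (k + 1) ^ 2 * formVal f x0 y0 ≥ 2 * (k + 1) ^ 2 := by
      have : 1 ≤ d * formVal f x0 y0 := by nlinarith
      nlinarith [sq_nonneg (k + 1)]
    have g3 : (k + 1) * B + 2 * d * (k + 1) ^ 2 * formVal f x0 y0 ≥ k + 1 := by nlinarith
    nlinarith
  · rw [key]
    exact (IsCoprime.add_mul_left_left_iff).2 hc

lemma exists_rep {f : ℤ × ℤ × ℤ} {d : ℤ} (h0 : 0 < d) (hns : ¬ IsSquare d)
    (hd : formDisc f = d) (hf : IsPrimitiveForm f) :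
    ∃ g : ℤ × ℤ × ℤ, formEquiv f g ∧ IsPrimitiveForm g ∧ formDisc g = d ∧ 0 < g.1 ∧
      IsCoprime g.1 (2 * d) := by
  obtain ⟨x, y, hpos, hcop⟩ := exists_good_value h0 hns hd hf
  have hg : 0 < Int.gcd x y := by
    rw [Nat.pos_iff_ne_zero]
    intro h
    rw [Int.gcd_eq_zero_iff] at h
    rw [h.1, h.2] at hpos
    simp [formVal] at hpos
  obtain ⟨x', y', hxy, hx, hy⟩ := Int.exists_gcd_one hg
  have e : formVal f x y = (Int.gcd x y : ℤ) ^ 2 * formVal f x' y' := by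
    have e : ∀ g : ℤ, x = x' * g → y = y' * g → formVal f x y = g ^ 2 * formVal f x' y' := by
      rintro g rfl rfl; simp only [formVal]; ring
    exact e _ hx hy
  rw [e] at hpos hcop
  obtain ⟨q, s, hqs⟩ := exists_bezout hxy
  refine ⟨fe f x' q y' s, (formEquiv_iff _ _).2 ⟨_, _, _, _, hqs, rfl⟩,
    isPrimitive_fe _ _ _ _ _ hqs hf, (formDisc_fe _ _ _ _ _ hqs).trans hd, ?_, ?_⟩
  · exact pos_of_mul_pos_right hpos (by positivity)
  · exact hcop.of_mul_left_right

/-- the class set -/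
abbrev Cl (d : ℤ) := Quot (fun f g : {f : ℤ × ℤ × ℤ // IsPrimitiveForm f ∧ formDisc f = d} =>
    formEquiv f.1 g.1)

lemma Cl_eq_iff {d : ℤ} (f g : {f : ℤ × ℤ × ℤ // IsPrimitiveForm f ∧ formDisc f = d}) :
    (Quot.mk _ f : Cl d) = Quot.mk _ g ↔ formEquiv f.1 g.1 := by
  constructor
  · intro h
    have h1 := Quot.eqvGen_exact h
    have heq : Equivalence (fun f g : {f : ℤ × ℤ × ℤ // IsPrimitiveForm f ∧ formDisc f = d} =>
      formEquiv f.1 g.1) :=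
      ⟨fun f => formEquiv_refl _, fun h => formEquiv_symm h, fun h h' => formEquiv_trans h h'⟩
    exact heq.eqvGen_iff.1 h1
  · intro h; exact Quot.sound h

lemma exists_reps {d : ℤ} (h0 : 0 < d) (hns : ¬ IsSquare d) :
    ∃ rep : Cl d → ℤ × ℤ × ℤ, (∀ c, IsPrimitiveForm (rep c) ∧ formDisc (rep c) = d ∧
      0 < (rep c).1 ∧ IsCoprime (rep c).1 (2 * d)) ∧
      (∀ c c', formEquiv (rep c) (rep c') → c = c') ∧
      (∀ f, IsPrimitiveForm f → formDisc f = d → ∃ c, formEquiv f (rep c)) := by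
  have : ∀ c : Cl d, ∃ g : {f : ℤ × ℤ × ℤ // IsPrimitiveForm f ∧ formDisc f = d},
      Quot.mk _ g = c ∧ 0 < g.1.1 ∧ IsCoprime g.1.1 (2 * d) := by
    intro c
    induction c using Quot.ind with
    | _ f =>
      obtain ⟨g, h1, h2, h3, h4, h5⟩ := exists_rep h0 hns f.2.2 f.2.1
      exact ⟨⟨g, h2, h3⟩, (Cl_eq_iff _ _).2 (formEquiv_symm h1), h4, h5⟩
  choose rep hrep using this
  refine ⟨fun c => (rep c).1, fun c => ⟨(rep c).2.1, (rep c).2.2, (hrep c).2.1, (hrep c).2.2⟩,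
    ?_, ?_⟩
  · intro c c' h
    rw [← (hrep c).1, ← (hrep c').1]
    exact (Cl_eq_iff _ _).2 h
  · intro f hf hd
    refine ⟨Quot.mk _ ⟨f, hf, hd⟩, ?_⟩
    exact formEquiv_symm ((Cl_eq_iff _ ⟨f, hf, hd⟩).1 (hrep _).1)

end VA
end

section
namespace VA

def Rel (f : ℤ × ℤ × ℤ) (v : ℤ × ℤ) (t : ℤ × ℤ × ℤ) : Prop :=
  ∃ p q r s : ℤ, p * s - q * r = 1 ∧ v = (p * t.2.1, r * t.2.1) ∧ 0 < t.2.1 ∧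
    (fe f p q r s).1 = t.1 ∧ (fe f p q r s).2.1 = t.2.2

def Tset (d m : ℤ) : Set (ℤ × ℤ × ℤ) :=
  {t | 0 < t.1 ∧ 0 < t.2.1 ∧ t.1 * t.2.1 ^ 2 = m ∧ 0 ≤ t.2.2 ∧ t.2.2 < 2 * t.1 ∧
    4 * t.1 ∣ t.2.2 ^ 2 - d}

lemma Rel_exists {f : ℤ × ℤ × ℤ} {d m : ℤ} (hd : formDisc f = d) (hm : 0 < m) (v : ℤ × ℤ)
    (hv : formVal f v.1 v.2 = m) : ∃ t, t ∈ Tset d m ∧ Rel f v t := by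
  obtain ⟨x, y⟩ := v
  simp only at hv
  have hg : 0 < Int.gcd x y := by
    rw [Nat.pos_iff_ne_zero]
    intro h
    rw [Int.gcd_eq_zero_iff] at h
    rw [h.1, h.2] at hv
    simp [formVal] at hv
    omega
  obtain ⟨x', y', hxy, hx, hy⟩ := Int.exists_gcd_one hg
  have hg' : (0:ℤ) < (Int.gcd x y : ℤ) := by exact_mod_cast hg
  generalize (Int.gcd x y : ℤ) = g at *
  obtain ⟨q, s, hqs⟩ := exists_bezout hxy
  have hval : formVal f x y = formVal f x' y' * g ^ 2 := by
    rw [hx, hy]; simp only [formVal]; ring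
  have ha : 0 < formVal f x' y' := by
    have : 0 < formVal f x' y' * g ^ 2 := by rw [← hval, hv]; exact hm
    exact pos_of_mul_pos_left this (by positivity)
  set b0 := (fe f x' q y' s).2.1 with hb0
  set a := formVal f x' y' with haa
  set k := -(b0 / (2 * a)) with hk
  have hdet : x' * (s + k * y') - (q + k * x') * y' = 1 := by linear_combination hqs
  have hb : (fe f x' (q + k * x') y' (s + k * y')).2.1 = b0 % (2 * a) := by
    rw [Int.emod_def, hb0]
    have : b0 / (2 * a) = -k := by rw [hk]; ring
    rw [← hb0, this, hb0]
    simp only [fe, haa, formVal]; ring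
  have ha1 : (fe f x' (q + k * x') y' (s + k * y')).1 = a := by simp only [fe, haa]
  refine ⟨(a, g, b0 % (2 * a)), ⟨ha, hg', ?_, ?_, ?_, ?_⟩, x', q + k * x', y', s + k * y', hdet,
    ?_, hg', ha1, hb⟩
  · simp only; rw [← hval, hv]
  · exact Int.emod_nonneg _ (by omega)
  · exact Int.emod_lt_of_pos _ (by omega)
  · have h1 := formDisc_fe f _ _ _ _ hdet
    rw [hd] at h1
    refine ⟨(fe f x' (q + k * x') y' (s + k * y')).2.2, ?_⟩
    simp only
    rw [← hb, ← h1, formDisc, ha1]; ring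
  · simp only; rw [hx, hy]

lemma gcd_of_det {p q r s : ℤ} (h : p * s - q * r = 1) : Int.gcd p r = 1 := by
  rw [← Int.isCoprime_iff_gcd_eq_one]
  exact ⟨s, -q, by linear_combination h⟩

lemma Rel_unique {f : ℤ × ℤ × ℤ} {d m : ℤ} {v : ℤ × ℤ} {t t' : ℤ × ℤ × ℤ}
    (ht : t ∈ Tset d m) (ht' : t' ∈ Tset d m) (h : Rel f v t) (h' : Rel f v t') : t = t' := by
  obtain ⟨p, q, r, s, hdet, hv, hg, h1, h2⟩ := h
  obtain ⟨p', q', r', s', hdet', hv', hg', h1', h2'⟩ := h'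
  obtain ⟨a, g, b⟩ := t
  obtain ⟨a', g', b'⟩ := t'
  obtain ⟨ha, -, -, hb0, hb1, -⟩ := ht
  obtain ⟨ha', -, -, hb0', hb1', -⟩ := ht'
  simp only at *
  have e1 := gcd_of_det hdet
  have e2 := gcd_of_det hdet'
  have G1 : Int.gcd v.1 v.2 = g.natAbs := by
    rw [hv]; simp only; rw [Int.gcd_mul_right, e1, one_mul]
  have G2 : Int.gcd v.1 v.2 = g'.natAbs := by
    rw [hv']; simp only; rw [Int.gcd_mul_right, e2, one_mul]
  have hgg : g = g' := by omega
  subst hgg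
  rw [hv, Prod.mk.injEq] at hv'
  have hp : p = p' := mul_right_cancel₀ hg.ne' hv'.1
  have hr : r = r' := mul_right_cancel₀ hg.ne' hv'.2
  subst hp hr
  have haa : a = a' := by rw [← h1, ← h1']; rfl
  subst haa
  have hk : b' = b + 2 * a * (s * q' - q * s') := by
    rw [← h2, ← h2', ← h1]
    simp only [fe, formVal]
    linear_combination (2 * f.1 * p * q' + f.2.1 * (r * q' + p * s') + 2 * f.2.2 * r * s') * (-hdet) +
      (2 * f.1 * p * q + f.2.1 * (r * q + p * s) + 2 * f.2.2 * r * s) * hdet'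
  have : s * q' - q * s' = 0 := by
    by_contra hne
    rcases lt_or_gt_of_ne hne with hlt | hlt
    · nlinarith
    · nlinarith
  rw [this] at hk
  simp at hk
  rw [hk]

lemma form_eq_of {F G : ℤ × ℤ × ℤ} (h1 : F.1 = G.1) (h2 : F.2.1 = G.2.1) (hd : formDisc F = formDisc G)
    (ha : F.1 ≠ 0) : F = G := by
  obtain ⟨a, b, c⟩ := F
  obtain ⟨a', b', c'⟩ := G
  simp only [formDisc] at *
  subst h1 h2
  have : a * (4 * (c - c')) = 0 := by linarith
  rcases mul_eq_zero.1 this with h | h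
  · exact absurd h ha
  · have : c = c' := by omega
    rw [this]

lemma Rel_fe_eq {f f' : ℤ × ℤ × ℤ} {d m : ℤ} {t : ℤ × ℤ × ℤ} (hd : formDisc f = d)
    (hd' : formDisc f' = d) (ht : t ∈ Tset d m) {v v' : ℤ × ℤ} (h : Rel f v t) (h' : Rel f' v' t) :
    ∃ p q r s : ℤ, p * s - q * r = 1 ∧ f = fe f' p q r s ∧ v'.1 = p * v.1 + q * v.2 ∧
      v'.2 = r * v.1 + s * v.2 := by
  obtain ⟨p, q, r, s, hdet, hv, hg, h1, h2⟩ := h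
  obtain ⟨p', q', r', s', hdet', hv', hg', h1', h2'⟩ := h'
  have e := form_eq_of (h1.trans h1'.symm) (h2.trans h2'.symm)
    (by rw [formDisc_fe _ _ _ _ _ hdet, formDisc_fe _ _ _ _ _ hdet', hd, hd'])
    (by rw [h1]; exact ht.1.ne')
  have e2 := fe_inv f p q r s hdet
  rw [e, fe_fe] at e2
  refine ⟨_, _, _, _, ?_, e2.symm, ?_, ?_⟩
  · linear_combination hdet * (p' * s' - q' * r') + hdet'
  · rw [hv, hv']; simp only
    linear_combination (-p' * t.2.1) * hdet
  · rw [hv, hv']; simp only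
    linear_combination (-r' * t.2.1) * hdet

/-- points of the cone representing `m` -/
def Kset (d : ℤ) (f : ℤ × ℤ × ℤ) (m : ℤ) : Set (ℤ × ℤ) :=
  {v | cone d f v ∧ formVal f v.1 v.2 = m}

structure GoodRep (d : ℤ) (rep : Cl d → ℤ × ℤ × ℤ) : Prop where
  prim : ∀ c, IsPrimitiveForm (rep c)
  disc : ∀ c, formDisc (rep c) = d
  pos : ∀ c, 0 < (rep c).1
  cop : ∀ c, IsCoprime (rep c).1 (2 * d)
  inj : ∀ c c', formEquiv (rep c) (rep c') → c = c'
  surj : ∀ f, IsPrimitiveForm f → formDisc f = d → ∃ c, formEquiv f (rep c)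

lemma exists_goodRep {d : ℤ} (h0 : 0 < d) (hns : ¬ IsSquare d) : ∃ rep, GoodRep d rep := by
  obtain ⟨rep, h1, h2, h3⟩ := exists_reps h0 hns
  exact ⟨rep, fun c => (h1 c).1, fun c => (h1 c).2.1, fun c => (h1 c).2.2.1, fun c => (h1 c).2.2.2, h2, h3⟩

lemma Rel_surj {d m : ℤ} (h0 : 0 < d) (hns : ¬ IsSquare d) {rep : Cl d → ℤ × ℤ × ℤ}
    (hrep : GoodRep d rep) (hm : 0 < m) (hcop : IsCoprime m d) {t : ℤ × ℤ × ℤ} (ht : t ∈ Tset d m) :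
    ∃ c v, v ∈ Kset d (rep c) m ∧ Rel (rep c) v t := by
  obtain ⟨a, g, b⟩ := t
  obtain ⟨ha, hg, hag, hb0, hb1, e, he⟩ := ht
  simp only at *
  have hF : formDisc (a, b, e) = d := by simp only [formDisc]; linarith
  have hprim : IsPrimitiveForm (a, b, e) := by
    rw [isPrimitive_iff]
    rintro k hk ⟨k1, k2, k3⟩
    simp only at k1 k2 k3
    have kd : (k:ℤ) ∣ d := by
      rw [← hF]; simp only [formDisc]
      exact dvd_sub (dvd_pow k2 two_ne_zero) (k3.mul_left _)
    have km : (k:ℤ) ∣ m := by rw [← hag]; exact k1.mul_right _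
    have := hcop.isUnit_of_dvd' km kd
    exact (Nat.prime_iff_prime_int.1 hk).not_unit this
  obtain ⟨c, hc⟩ := hrep.surj _ hprim hF
  have hc' := formEquiv_symm hc
  rw [formEquiv_iff] at hc'
  obtain ⟨p, q, r, s, hdet, hFe⟩ := hc'
  have hpos := hrep.pos c
  have hdc := hrep.disc c
  have hv0 : formVal (rep c) (p * g) (r * g) = m := by
    have : formVal (rep c) p r = a := by
      have := congrArg Prod.fst hFe
      simpa [fe] using this.symm
    rw [← hag, ← this]; simp only [formVal]; ring
  rcases hfeq : rep c with ⟨fa, fb, fc⟩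
  rw [hfeq] at hpos hdc hv0 hFe
  obtain ⟨v', hv', hcone⟩ := cone_exists h0 hns hpos hdc (p * g, r * g) (by rw [hv0]; exact hm)
  have hval := autRel_val hv'
  simp only at hval
  obtain ⟨p1, q1, r1, s1, hdet1, hf1, e1, e2⟩ := hv'
  simp only at e1 e2
  refine ⟨c, v', ?_, ?_⟩
  · rw [hfeq]; exact ⟨hcone, hval.trans hv0⟩
  · rw [hfeq]
    have e3 : fe (fa, fb, fc) (p1 * p + q1 * r) (p1 * q + q1 * s) (r1 * p + s1 * r)
        (r1 * q + s1 * s) = (a, b, e) := by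
      rw [← fe_fe, hf1, ← hFe]
    refine ⟨_, _, _, _, ?_, ?_, hg, by rw [e3], by rw [e3]⟩
    · linear_combination hdet * (p1 * s1 - q1 * r1) + hdet1
    · apply Prod.ext
      · simp only; rw [e1]; ring
      · simp only; rw [e2]; ring

/-- the counting bijection -/
lemma card_bij {d m : ℤ} (h0 : 0 < d) (hns : ¬ IsSquare d) {rep : Cl d → ℤ × ℤ × ℤ}
    (hrep : GoodRep d rep) (hm : 0 < m) (hcop : IsCoprime m d) :
    ∃ φ : (Σ c : Cl d, Kset d (rep c) m) → Tset d m, Function.Bijective φ := by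
  have h1 : ∀ x : (Σ c : Cl d, Kset d (rep c) m), ∃ t : Tset d m, Rel (rep x.1) x.2.1 t.1 := by
    rintro ⟨c, v, hv⟩
    obtain ⟨t, ht, hR⟩ := Rel_exists (hrep.disc c) hm v hv.2
    exact ⟨⟨t, ht⟩, hR⟩
  choose φ hφ using h1
  refine ⟨φ, ?_, ?_⟩
  · rintro ⟨c, v, hv⟩ ⟨c', v', hv'⟩ heq
    have H1 := hφ ⟨c, v, hv⟩
    have H2 := hφ ⟨c', v', hv'⟩
    rw [← heq] at H2
    simp only at H1 H2
    obtain ⟨p, q, r, s, hdet, hf, e1, e2⟩ := Rel_fe_eq (hrep.disc c) (hrep.disc c') (φ ⟨c, v, hv⟩).2 H1 H2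
    have hcc : c = c' := by
      apply hrep.inj
      apply formEquiv_symm
      rw [formEquiv_iff]
      exact ⟨p, q, r, s, hdet, hf⟩
    subst hcc
    have : v = v' := by
      have hpos := hrep.pos c
      have hdc := hrep.disc c
      have hpr := hrep.prim c
      have hv1 := hv
      have hv2 := hv'
      rcases hfeq : rep c with ⟨fa, fb, fc⟩
      rw [hfeq] at hpos hdc hf hpr hv1 hv2
      exact cone_unique h0 hns hpos hdc hpr (by rw [hv1.2]; exact hm)
        ⟨p, q, r, s, hdet, hf.symm, e1, e2⟩ hv1.1 hv2.1
    subst this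
    rfl
  · rintro ⟨t, ht⟩
    obtain ⟨c, v, hv, hR⟩ := Rel_surj h0 hns hrep hm hcop ht
    refine ⟨⟨c, v, hv⟩, ?_⟩
    exact Subtype.ext (Rel_unique (φ ⟨c, v, hv⟩).2 ht (hφ ⟨c, v, hv⟩) hR)

/-- residues -/
def Bset (d : ℤ) (a : ℕ) : Finset ℕ := (Finset.range (2 * a)).filter (fun b : ℕ => (4 * a : ℤ) ∣ (b:ℤ) ^ 2 - d)

lemma sq_mod_four {b d : ℤ} (hd : d % 4 = 0 ∨ d % 4 = 1) : (4:ℤ) ∣ b ^ 2 - d ↔ b % 2 = d % 2 := by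
  have hb : b % 4 = 0 ∨ b % 4 = 1 ∨ b % 4 = 2 ∨ b % 4 = 3 := by omega
  have e : b ^ 2 % 4 = (b % 4) ^ 2 % 4 := by simp [pow_two, Int.mul_emod]
  have h4 : b ^ 2 % 4 = b % 2 := by
    rcases hb with h | h | h | h <;> rw [e, h] <;> omega
  omega

lemma Bset_card {d : ℤ} (hd : d % 4 = 0 ∨ d % 4 = 1) {a : ℕ} (ha : 0 < a) (hodd : a % 2 = 1) :
    (Bset d a).card = rho d a := by
  haveI : NeZero a := ⟨ha.ne'⟩
  rw [rho, Nat.card_eq_fintype_card, Fintype.card_subtype]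
  have hmem : ∀ b : ℕ, b ∈ Bset d a ↔ b < 2 * a ∧ (b:ℤ) % 2 = d % 2 ∧ (a:ℤ) ∣ (b:ℤ) ^ 2 - d := by
    intro b
    rw [Bset, Finset.mem_filter, Finset.mem_range, ← sq_mod_four hd]
    have hc : IsCoprime (4:ℤ) (a:ℤ) := by
      rw [Int.isCoprime_iff_gcd_eq_one]
      have : Nat.Coprime 4 a := by
        rw [show 4 = 2 ^ 2 by norm_num]
        exact Nat.Coprime.pow_left _ ((Nat.coprime_two_left).2 (Nat.odd_iff.2 hodd))
      exact_mod_cast this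
    constructor
    · rintro ⟨h1, h2⟩
      exact ⟨h1, (dvd_mul_right _ _).trans h2, (dvd_mul_left _ _).trans h2⟩
    · rintro ⟨h1, h2, h3⟩
      exact ⟨h1, hc.mul_dvd h2 h3⟩
  have hsq : ∀ b : ℕ, (a:ℤ) ∣ (b:ℤ) ^ 2 - d ↔ (b : ZMod a) ^ 2 = (d : ZMod a) := by
    intro b
    rw [← ZMod.intCast_zmod_eq_zero_iff_dvd]
    push_cast
    rw [sub_eq_zero]
  apply Finset.card_bij (fun (b : ℕ) (_ : b ∈ Bset d a) => (b : ZMod a))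
  · intro b hb
    rw [hmem] at hb
    simp only [Finset.mem_filter, Finset.mem_univ, true_and]
    exact (hsq b).1 hb.2.2
  · intro b hb b' hb' heq
    rw [hmem] at hb hb'
    rw [ZMod.natCast_eq_natCast_iff'] at heq
    have h2 : b % 2 = b' % 2 := by omega
    have hab : b ≡ b' [MOD (2 * a)] := by
      rw [← Nat.modEq_and_modEq_iff_modEq_mul ((Nat.coprime_two_left).2 (Nat.odd_iff.2 hodd))]
      exact ⟨h2, heq⟩
    exact Nat.ModEq.eq_of_lt_of_lt hab hb.1 hb'.1
  · intro x hx
    simp only [Finset.mem_filter, Finset.mem_univ, true_and] at hx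
    have hlt := ZMod.val_lt x
    by_cases hpar : ((x.val : ℕ) : ℤ) % 2 = d % 2
    · refine ⟨x.val, ?_, ?_⟩
      · rw [hmem, hsq]
        refine ⟨by omega, hpar, ?_⟩
        rw [ZMod.natCast_zmod_val, hx]
      · simp
    · refine ⟨x.val + a, ?_, ?_⟩
      · rw [hmem, hsq]
        refine ⟨by omega, by push_cast; omega, ?_⟩
        push_cast
        rw [ZMod.natCast_zmod_val, ZMod.natCast_self, add_zero, hx]
      · simp

lemma mem_Tset {d m a g b : ℤ} : (a, g, b) ∈ Tset d m ↔ 0 < a ∧ 0 < g ∧ a * g ^ 2 = m ∧ 0 ≤ b ∧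
    b < 2 * a ∧ 4 * a ∣ b ^ 2 - d := Iff.rfl

/-- index set -/
def S1 (d : ℤ) (m : ℕ) : Finset (Σ _ : ℕ × ℕ, ℕ) :=
  ((Nat.divisorsAntidiagonal m).filter (fun e => IsSquare e.2)).sigma (fun e => Bset d e.1)

lemma Tset_card_S1 {d : ℤ} {m : ℕ} (hm : 0 < m) :
    Nat.card (Tset d m) = (S1 d m).card ∧ Finite (Tset d m) := by
  have hb : ∃ φ : Tset d m → (S1 d m : Set (Σ _ : ℕ × ℕ, ℕ)), Function.Bijective φ := by
    refine ⟨fun t => ⟨⟨(t.1.1.toNat, (t.1.2.1 ^ 2).toNat), t.1.2.2.toNat⟩, ?_⟩, ?_, ?_⟩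
    · obtain ⟨⟨a, g, b⟩, ht⟩ := t
      obtain ⟨ha, hg, hag, hb0, hb1, hdv⟩ := mem_Tset.1 ht
      simp only
      clear ht
      lift a to ℕ using ha.le
      lift g to ℕ using hg.le
      lift b to ℕ using hb0
      rw [Finset.mem_coe, S1, Finset.mem_sigma, Finset.mem_filter, Nat.mem_divisorsAntidiagonal, Bset,
        Finset.mem_filter, Finset.mem_range]
      have e1 : ((g:ℤ) ^ 2).toNat = g ^ 2 := by
        rw [← Nat.cast_pow, Int.toNat_natCast]
      simp only [Int.toNat_natCast, e1]
      refine ⟨⟨⟨by exact_mod_cast hag, hm.ne'⟩, ⟨g, by ring⟩⟩, by omega, hdv⟩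
    · rintro ⟨⟨a, g, b⟩, ht⟩ ⟨⟨a', g', b'⟩, ht'⟩ h
      obtain ⟨ha, hg, hag, hb0, hb1, hdv⟩ := mem_Tset.1 ht
      obtain ⟨ha', hg', hag', hb0', hb1', hdv'⟩ := mem_Tset.1 ht'
      simp only [Subtype.mk.injEq, Sigma.mk.injEq, Prod.mk.injEq, heq_eq_eq] at h ⊢
      have e0 : g ^ 2 = g' ^ 2 := by
        have := h.1.2
        have k1 : 0 ≤ g ^ 2 := by positivity
        have k2 : 0 ≤ g' ^ 2 := by positivity
        omega
      have e1 : g = g' := by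
        rcases sq_eq_sq_iff_eq_or_eq_neg.1 e0 with h | h <;> omega
      refine ⟨by omega, e1, by omega⟩
    · rintro ⟨⟨⟨a, e⟩, b⟩, h⟩
      rw [Finset.mem_coe, S1, Finset.mem_sigma, Finset.mem_filter, Nat.mem_divisorsAntidiagonal, Bset,
        Finset.mem_filter, Finset.mem_range] at h
      obtain ⟨⟨⟨h1, -⟩, g, hg⟩, h2, h3⟩ := h
      simp only at *
      subst hg
      have ha0 : 0 < a := by
        rcases Nat.eq_zero_or_pos a with h | h
        · rw [h] at h1; omega
        · exact h
      have hg0 : 0 < g := by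
        rcases Nat.eq_zero_or_pos g with h | h
        · rw [h] at h1; omega
        · exact h
      refine ⟨⟨((a:ℤ), (g:ℤ), (b:ℤ)), ?_⟩, ?_⟩
      · rw [mem_Tset]
        refine ⟨by exact_mod_cast ha0, by exact_mod_cast hg0, ?_, by positivity, by exact_mod_cast h2, h3⟩
        rw [← h1]; push_cast; ring
      · have e1 : ((g:ℤ) ^ 2).toNat = g * g := by
          rw [← Nat.cast_pow, Int.toNat_natCast]; ring
        simp only [Int.toNat_natCast, e1]
  obtain ⟨φ, hφ⟩ := hb
  refine ⟨?_, ?_⟩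
  · rw [Nat.card_congr (Equiv.ofBijective φ hφ)]
    simp
  · exact Finite.of_injective φ hφ.1

lemma S1_card {d : ℤ} (hd : d % 4 = 0 ∨ d % 4 = 1) {m : ℕ} (hm : 0 < m)
    (hcop : Nat.Coprime m (2 * d.natAbs)) :
    ((S1 d m).card : ℝ) = (rhoA d (2 * d.natAbs) * sqA (2 * d.natAbs)) m := by
  rw [ArithmeticFunction.mul_apply, S1, Finset.card_sigma, Finset.sum_filter]
  push_cast
  apply Finset.sum_congr rfl
  rintro ⟨x, y⟩ hxy
  rw [Nat.mem_divisorsAntidiagonal] at hxy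
  simp only at *
  obtain ⟨hxy, -⟩ := hxy
  have hx0 : x ≠ 0 := by rintro rfl; omega
  have hy0 : y ≠ 0 := by rintro rfl; omega
  have hx : Nat.Coprime x (2 * d.natAbs) := Nat.Coprime.coprime_dvd_left ⟨y, hxy.symm⟩ hcop
  have hy : Nat.Coprime y (2 * d.natAbs) := Nat.Coprime.coprime_dvd_left ⟨x, by rw [← hxy]; ring⟩ hcop
  have hodd : x % 2 = 1 := by
    have := Nat.Coprime.coprime_dvd_right (dvd_mul_right 2 _) hx
    rw [Nat.coprime_two_right] at this
    exact Nat.odd_iff.1 this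
  rw [Bset_card hd (Nat.pos_of_ne_zero hx0) hodd]
  simp only [rhoA, sqA, ArithmeticFunction.coe_mk]
  rw [if_pos (show x ≠ 0 ∧ Nat.Coprime x (2 * d.natAbs) from ⟨hx0, hx⟩)]
  by_cases hsq : IsSquare y
  · rw [if_pos hsq, if_pos ⟨hy0, hy, hsq⟩, mul_one]
  · rw [if_neg hsq, if_neg (fun h => hsq h.2.2), mul_zero]

/-- main counting identity -/
lemma count_identity {d : ℤ} (h0 : 0 < d) (hns : ¬ IsSquare d) (hd : d % 4 = 0 ∨ d % 4 = 1)
    {rep : Cl d → ℤ × ℤ × ℤ} (hrep : GoodRep d rep) {m : ℕ} (hm : 0 < m)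
    (hcop : Nat.Coprime m (2 * d.natAbs)) :
    Finite (Σ c : Cl d, Kset d (rep c) m) ∧
    (Nat.card (Σ c : Cl d, Kset d (rep c) m) : ℝ) = (chiA d * copA (2 * d.natAbs)) m := by
  have hc : IsCoprime (m:ℤ) d := by
    rw [Int.isCoprime_iff_gcd_eq_one]
    exact Nat.Coprime.coprime_dvd_right (dvd_mul_left _ 2) hcop
  obtain ⟨φ, hφ⟩ := card_bij h0 hns hrep (by exact_mod_cast hm : (0:ℤ) < m) hc
  obtain ⟨h1, h2⟩ := Tset_card_S1 (d := d) hm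
  refine ⟨Finite.of_injective φ hφ.1, ?_⟩
  rw [Nat.card_congr (Equiv.ofBijective φ hφ), h1, S1_card hd hm hcop, rho_conv d h0.ne']

end VA
end

section
namespace VA

noncomputable def len (δ t u a M y : ℝ) : ℝ := (√(δ * y ^ 2 + 4 * a * M) - t / u * y) / (2 * a)

section
variable {δ t u a M : ℝ}

lemma len_antitone (hδ : 0 < δ) (ht : 0 < t) (hu : 0 < u) (htu : t ^ 2 = δ * u ^ 2 + 4) (ha : 0 < a) (hM : 0 < M) :
    AntitoneOn (len δ t u a M) (Set.Ici 0) := by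
  intro y hy y' hy' hyy
  simp only [Set.mem_Ici] at hy hy'
  unfold len
  apply div_le_div_of_nonneg_right _ (by positivity)
  have hs : √δ * u ≤ t := by
    apply abs_le_of_sq_le_sq' _ ht.le |>.2
    rw [mul_pow, Real.sq_sqrt hδ.le]; linarith
  have hs2 : √δ ≤ t / u := by rw [le_div_iff₀ hu]; exact hs
  have key : √(δ * y' ^ 2 + 4 * a * M) ≤ √(δ * y ^ 2 + 4 * a * M) + √δ * (y' - y) := by
    apply Real.sqrt_le_iff.2
    constructor
    · have := sub_nonneg.2 hyy; positivity
    · have h1 : √δ * y ≤ √(δ * y ^ 2 + 4 * a * M) := by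
        apply Real.le_sqrt_of_sq_le
        rw [mul_pow, Real.sq_sqrt hδ.le]
        have : 0 < 4 * a * M := by positivity
        linarith
      have h2 := Real.sq_sqrt (show 0 ≤ δ * y ^ 2 + 4 * a * M by positivity)
      have h3 := Real.sq_sqrt hδ.le
      have h4 : 0 ≤ √δ * (y' - y) := by have := sub_nonneg.2 hyy; positivity
      nlinarith [mul_le_mul_of_nonneg_right h1 h4]
  have : √δ * (y' - y) ≤ t / u * (y' - y) := mul_le_mul_of_nonneg_right hs2 (by linarith)
  linarith

lemma len_end (hδ : 0 < δ) (ht : 0 < t) (hu : 0 < u) (htu : t ^ 2 = δ * u ^ 2 + 4) (ha : 0 < a) (hM : 0 < M) :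
    √(δ * (u * √(a * M)) ^ 2 + 4 * a * M) = t * √(a * M) := by
  rw [Real.sqrt_eq_iff_mul_self_eq (by positivity) (by positivity)]
  have := Real.sq_sqrt (show 0 ≤ a * M by positivity)
  have e : t * √(a * M) * (t * √(a * M)) = t ^ 2 * √(a * M) ^ 2 := by ring
  rw [mul_pow, this]
  first
    | rw [e, this, htu]; ring
    | (rw [eq_comm, e, this, htu]; ring)

lemma len_integral (hδ : 0 < δ) (ht : 0 < t) (hu : 0 < u) (htu : t ^ 2 = δ * u ^ 2 + 4) (ha : 0 < a) (hM : 0 < M) :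
    ∫ y in (0:ℝ)..(u * √(a * M)), len δ t u a M y = M * Real.log ((t + u * √δ) / 2) / √δ := by
  set B := 4 * a * M with hB
  have hB0 : 0 < B := by positivity
  have hδ' : 0 < √δ := Real.sqrt_pos.2 hδ
  have hder : ∀ y : ℝ, HasDerivAt (fun y => (y * √(δ * y ^ 2 + B) / 2 + B / (2 * √δ) *
      Real.log (√δ * y + √(δ * y ^ 2 + B)) - t / u * y ^ 2 / 2) / (2 * a)) (len δ t u a M y) y := by
    intro y
    have hq : 0 < δ * y ^ 2 + B := by positivity
    set s := √(δ * y ^ 2 + B) with hs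
    have hs0 : 0 < s := Real.sqrt_pos.2 hq
    have hs2 : s ^ 2 = δ * y ^ 2 + B := Real.sq_sqrt hq.le
    have hd1 : HasDerivAt (fun y => √(δ * y ^ 2 + B)) (δ * y / s) y := by
      have := (((hasDerivAt_pow 2 y).const_mul δ).add_const B).sqrt hq.ne'
      convert this using 1
      rw [← hs]; field_simp; ring
    have hpos : 0 < √δ * y + s := by
      have : |√δ * y| < s := by
        rw [hs]
        apply Real.lt_sqrt_of_sq_lt
        rw [sq_abs, mul_pow, Real.sq_sqrt hδ.le]; linarith
      linarith [neg_abs_le (√δ * y)]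
    have hd2 : HasDerivAt (fun y => Real.log (√δ * y + √(δ * y ^ 2 + B))) (√δ / s) y := by
      have h1 := (((hasDerivAt_id y).const_mul (√δ)).add hd1).log hpos.ne'
      refine h1.congr_deriv ?_
      symm
      change √δ / s = (√δ * 1 + δ * y / s) / (√δ * y + s)
      have h3 := Real.sq_sqrt hδ.le
      field_simp
      linear_combination y * h3
    have hd3 := ((((hasDerivAt_id y).mul hd1).div_const 2).add (hd2.const_mul (B / (2 * √δ)))).sub
      (((hasDerivAt_pow 2 y).const_mul (t / u)).div_const 2) |>.div_const (2 * a)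
    refine hd3.congr_deriv ?_
    unfold len
    simp only [id]
    rw [← hB, ← hs]
    congr 1
    have e : s = (s + y * (δ * y / s)) / 2 + B / (2 * √δ) * (√δ / s) := by
      have : B = s ^ 2 - δ * y ^ 2 := by linarith
      rw [this]; field_simp; ring
    push_cast
    rw [one_mul, ← e]
    ring
  have hcont : Continuous (len δ t u a M) := by unfold len; fun_prop
  rw [intervalIntegral.integral_eq_sub_of_hasDerivAt (fun y _ => hder y)
    (hcont.intervalIntegrable _ _)]
  have hr : 0 < √(a * M) := Real.sqrt_pos.2 (by positivity)
  have hr2 := Real.sq_sqrt (show 0 ≤ a * M by positivity)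
  have hBs : √B = 2 * √(a * M) := by
    rw [Real.sqrt_eq_iff_mul_self_eq hB0.le (by positivity)]; nlinarith
  rw [hB, len_end hδ ht hu htu ha hM, ← hB]
  have z : (0:ℝ) ^ 2 = 0 := by norm_num
  rw [z, mul_zero, mul_zero, zero_add, zero_add, hBs]
  have hlog : Real.log (√δ * (u * √(a * M)) + t * √(a * M)) - Real.log (2 * √(a * M)) =
      Real.log ((t + u * √δ) / 2) := by
    rw [← Real.log_div (by positivity) (by positivity)]
    congr 1; field_simp; ring
  rw [← hlog, hB]
  generalize Real.log (√δ * (u * √(a * M)) + t * √(a * M)) = l1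
  generalize Real.log (2 * √(a * M)) = l2
  have : u * √(a * M) * (t * √(a * M)) / 2 = t / u * (u * √(a * M)) ^ 2 / 2 := by
    field_simp
  rw [this]; field_simp; ring

/-- Riemann sum -/
lemma len_sum (hδ : 0 < δ) (ht : 0 < t) (hu : 0 < u) (htu : t ^ 2 = δ * u ^ 2 + 4) (ha : 0 < a) (hM : 0 < M) :
    |∑ y ∈ Finset.range ⌈u * √(a * M)⌉₊, len δ t u a M y - M * Real.log ((t + u * √δ) / 2) / √δ|
      ≤ √(a * M) / a := by
  set Y0 := u * √(a * M) with hY0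
  have hY0p : 0 ≤ Y0 := by positivity
  have hanti := len_antitone hδ ht hu htu ha hM
  have hend : len δ t u a M Y0 = 0 := by
    unfold len; rw [hY0, len_end hδ ht hu htu ha hM]; field_simp; ring
  set lp : ℝ → ℝ := fun y => max (len δ t u a M y) 0 with hlp
  have hlpa : AntitoneOn lp (Set.Ici 0) := fun y hy y' hy' h => max_le_max (hanti hy hy' h) le_rfl
  have hcont : Continuous (len δ t u a M) := by unfold len; fun_prop
  have hlpc : Continuous lp := hcont.max continuous_const
  set Y := ⌈Y0⌉₊ with hY
  have hYle : Y0 ≤ Y := Nat.le_ceil _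
  have hIntg : ∫ y in (0:ℝ)..Y, lp y = M * Real.log ((t + u * √δ) / 2) / √δ := by
    rw [← len_integral hδ ht hu htu ha hM, ← hY0,
      ← intervalIntegral.integral_add_adjacent_intervals (b := Y0) (hlpc.intervalIntegrable _ _)
        (hlpc.intervalIntegrable _ _)]
    have h1 : ∫ y in (0:ℝ)..Y0, lp y = ∫ y in (0:ℝ)..Y0, len δ t u a M y := by
      apply intervalIntegral.integral_congr
      intro y hy
      rw [Set.uIcc_of_le hY0p] at hy
      simp only [hlp]
      apply max_eq_left
      rw [← hend]; exact hanti hy.1 hY0p hy.2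
    have h2 : ∫ y in Y0..Y, lp y = ∫ y in Y0..Y, (0:ℝ) := by
      apply intervalIntegral.integral_congr
      intro y hy
      rw [Set.uIcc_of_le hYle] at hy
      simp only [hlp]
      apply max_eq_right
      rw [← hend]; exact hanti hY0p (hY0p.trans hy.1) hy.1
    rw [h1, h2]; simp
  have hs : ∑ y ∈ Finset.range Y, len δ t u a M y = ∑ y ∈ Finset.range Y, lp y := by
    apply Finset.sum_congr rfl
    intro y hy
    rw [Finset.mem_range, hY, Nat.lt_ceil] at hy
    simp only [hlp]
    symm; apply max_eq_left
    rw [← hend]; exact hanti (Set.mem_Ici.2 (Nat.cast_nonneg y)) hY0p hy.le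
  have hA : AntitoneOn lp (Set.Icc 0 (0 + (Y:ℝ))) := hlpa.mono (fun y hy => hy.1)
  have u1 := hA.integral_le_sum
  have u2 := hA.sum_le_integral
  simp only [zero_add] at u1 u2
  rw [hIntg] at u1 u2
  have e1 := Finset.sum_range_succ' (fun i : ℕ => lp (i:ℝ)) Y
  have e2 := Finset.sum_range_succ (fun i : ℕ => lp (i:ℝ)) Y
  have hl0 : lp 0 = √(a * M) / a := by
    have : len δ t u a M 0 = √(a * M) / a := by
      unfold len
      have hBs : √(δ * 0 ^ 2 + 4 * a * M) = 2 * √(a * M) := by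
        rw [Real.sqrt_eq_iff_mul_self_eq (by positivity) (by positivity)]
        nlinarith [Real.sq_sqrt (show 0 ≤ a * M by positivity)]
      rw [hBs]; field_simp; ring
    simp only [hlp, this]
    exact max_eq_left (by positivity)
  have hlY : 0 ≤ lp Y := le_max_right _ _
  have hl00 : 0 ≤ lp 0 := le_max_right _ _
  simp only [Nat.cast_zero] at e1
  rw [hs, ← hl0, abs_le]
  constructor <;> linarith

end

lemma int_period_shift (h : ℤ → ℝ) (P : ℕ) (hP : ∀ x, h (x + P) = h x) (k : ℤ) :
    ∑ i ∈ Finset.range P, h (k + i) = ∑ i ∈ Finset.range P, h i := by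
  have step : ∀ k : ℤ, ∑ i ∈ Finset.range P, h (k + 1 + i) = ∑ i ∈ Finset.range P, h (k + i) := by
    intro k
    have e1 := Finset.sum_range_succ' (fun i : ℕ => h (k + i)) P
    have e2 := Finset.sum_range_succ (fun i : ℕ => h (k + i)) P
    rw [hP k] at e2
    simp only [Nat.cast_zero, add_zero] at e1
    have e3 : ∑ i ∈ Finset.range P, h (k + 1 + i) = ∑ i ∈ Finset.range P, h (k + ((i + 1 : ℕ):ℤ)) := by
      apply Finset.sum_congr rfl; intro i _; congr 1; push_cast; ring
    rw [e3]; linarith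
  induction k using Int.induction_on with
  | zero => simp
  | succ k ih => rw [step, ih]
  | pred k ih => rw [← ih, ← step]; simp

lemma int_count (h : ℤ → ℝ) (P : ℕ) (hP0 : 0 < P) (hP : ∀ x, h (x + P) = h x) (h1 : ∀ x, |h x| ≤ 1)
    (α β : ℝ) (hαβ : α ≤ β) :
    |∑ x ∈ Finset.Ioc ⌊α⌋ ⌊β⌋, h x - (∑ i ∈ Finset.range P, h i) / P * (β - α)| ≤ 2 * P + 1 := by
  have hfl : ⌊α⌋ ≤ ⌊β⌋ := Int.floor_le_floor hαβ
  obtain ⟨n, hn⟩ := Int.eq_ofNat_of_zero_le (sub_nonneg.2 hfl)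
  have hsum : ∑ x ∈ Finset.Ioc ⌊α⌋ ⌊β⌋, h x = ∑ i ∈ Finset.range n, h (⌊α⌋ + 1 + i) := by
    symm
    apply Finset.sum_bij (fun (i : ℕ) _ => ⌊α⌋ + 1 + (i:ℤ))
    · intro i hi; rw [Finset.mem_range] at hi; rw [Finset.mem_Ioc]; omega
    · intro i _ j _ hij; omega
    · intro x hx
      rw [Finset.mem_Ioc] at hx
      exact ⟨(x - ⌊α⌋ - 1).toNat, by rw [Finset.mem_range]; omega, by omega⟩
    · intro i _; rfl
  have hb := periodic_sum_bound (fun i : ℕ => h (⌊α⌋ + 1 + i)) P hP0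
    (fun i => by rw [← hP (⌊α⌋ + 1 + i)]; congr 1; push_cast; ring) 1 (fun i => h1 _) n
  have hav : avg P (fun i : ℕ => h (⌊α⌋ + 1 + i)) = (∑ i ∈ Finset.range P, h i) / P := by
    unfold avg; rw [int_period_shift h P hP]
  rw [hav, Finset.sum_sub_distrib] at hb
  simp only [Finset.sum_const, Finset.card_range, nsmul_eq_mul] at hb
  rw [hsum]
  set A := (∑ i ∈ Finset.range P, h i) / P with hA
  have hA1 : |A| ≤ 1 := by
    rw [hA, abs_div, Nat.abs_cast]
    apply div_le_one_of_le₀ _ (by positivity)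
    calc _ ≤ ∑ i ∈ Finset.range P, |h (i:ℤ)| := Finset.abs_sum_le_sum_abs _ _
      _ ≤ ∑ i ∈ Finset.range P, (1:ℝ) := Finset.sum_le_sum (fun i _ => h1 (i:ℤ))
      _ = P := by simp
  have hn' : (n:ℝ) = ⌊β⌋ - ⌊α⌋ := by
    have : ((⌊β⌋ - ⌊α⌋ : ℤ) : ℝ) = ((n : ℤ) : ℝ) := by rw [hn]
    push_cast at this; linarith
  have hdiff : |(n:ℝ) - (β - α)| ≤ 1 := by
    have := Int.floor_le α; have := Int.lt_floor_add_one α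
    have := Int.floor_le β; have := Int.lt_floor_add_one β
    rw [abs_le]; constructor <;> linarith
  have e : ∑ i ∈ Finset.range n, h (⌊α⌋ + 1 + i) - A * (β - α) =
      (∑ i ∈ Finset.range n, h (⌊α⌋ + 1 + i) - n * A) + A * (n - (β - α)) := by ring
  rw [e]
  refine (abs_add_le _ _).trans ?_
  rw [abs_mul]
  have := mul_le_mul hA1 hdiff (abs_nonneg _) zero_le_one
  linarith

end VA
end

section
namespace VA

noncomputable def alphaB (b t u a y : ℝ) : ℝ := (t / u * y - b * y) / (2 * a)
noncomputable def betaB (δ b a M y : ℝ) : ℝ := (√(δ * y ^ 2 + 4 * a * M) - b * y) / (2 * a)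

noncomputable def Ncount (ind : ℤ → ℤ → ℝ) (δ b t u a M : ℝ) : ℝ :=
  ∑ y ∈ Finset.range ⌈u * √(a * M)⌉₊, ∑ x ∈ Finset.Ioc ⌊alphaB b t u a y⌋ ⌊betaB δ b a M y⌋, ind x y

lemma Ncount_bound (ind : ℤ → ℤ → ℝ) (P : ℕ) (hP0 : 0 < P) (hPx : ∀ x y, ind (x + P) y = ind x y)
    (hPy : ∀ x y, ind x (y + P) = ind x y) (h1 : ∀ x y, |ind x y| ≤ 1)
    {δ b t u a M : ℝ} (hδ : 0 < δ) (ht : 0 < t) (hu : 0 < u) (htu : t ^ 2 = δ * u ^ 2 + 4)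
    (ha : 0 < a) (hM : 1 ≤ M) :
    |Ncount ind δ b t u a M - (∑ y ∈ Finset.range P, ∑ x ∈ Finset.range P, ind x y) / P ^ 2 *
      (M * Real.log ((t + u * √δ) / 2) / √δ)| ≤
      ((u * √a + 1) * (2 * P + 1) + (2 * P + 1) * (√a / a)) * √M := by
  have hM0 : 0 < M := by linarith
  have hPr : (0:ℝ) < P := by exact_mod_cast hP0
  have hMs : 1 ≤ √M := by rw [← Real.sqrt_one]; exact Real.sqrt_le_sqrt hM
  have haM : √(a * M) = √a * √M := Real.sqrt_mul ha.le _
  set Y := ⌈u * √(a * M)⌉₊ with hY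
  have hYle : (Y:ℝ) ≤ (u * √a + 1) * √M := by
    have := (Nat.ceil_lt_add_one (show 0 ≤ u * √(a * M) by positivity)).le
    rw [← hY, haM] at this
    nlinarith
  have hanti := len_antitone hδ ht hu htu ha hM0
  have hend : len δ t u a M (u * √(a * M)) = 0 := by
    unfold len; rw [len_end hδ ht hu htu ha hM0]; field_simp; ring
  have hlen0 : ∀ y ∈ Finset.range Y, 0 ≤ len δ t u a M y := by
    intro y hy
    rw [Finset.mem_range, hY, Nat.lt_ceil] at hy
    rw [← hend]; exact hanti (Set.mem_Ici.2 (Nat.cast_nonneg y)) (Set.mem_Ici.2 (by positivity)) hy.le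
  set Wy : ℕ → ℝ := fun y => (∑ x ∈ Finset.range P, ind x y) / P with hWy
  have hWper : ∀ y, Wy (y + P) = Wy y := by
    intro y; simp only [hWy]; congr 1; apply Finset.sum_congr rfl; intro x _
    push_cast; exact hPy _ _
  have hW1 : ∀ y, |Wy y| ≤ 1 := by
    intro y
    simp only [hWy]
    rw [abs_div, Nat.abs_cast]
    apply div_le_one_of_le₀ _ (by positivity)
    calc _ ≤ ∑ i ∈ Finset.range P, |ind (i:ℤ) y| := Finset.abs_sum_le_sum_abs _ _
      _ ≤ ∑ i ∈ Finset.range P, (1:ℝ) := Finset.sum_le_sum (fun i _ => h1 (i:ℤ) y)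
      _ = P := by simp
  set A := avg P Wy with hA
  have hAe : (∑ y ∈ Finset.range P, ∑ x ∈ Finset.range P, ind x y) / P ^ 2 = A := by
    rw [hA, avg]; simp only [hWy]; rw [← Finset.sum_div]; field_simp
  have hA1 : |A| ≤ 1 := by
    rw [hA, avg, abs_div, Nat.abs_cast]
    apply div_le_one_of_le₀ _ (by positivity)
    calc _ ≤ ∑ i ∈ Finset.range P, |Wy i| := Finset.abs_sum_le_sum_abs _ _
      _ ≤ ∑ i ∈ Finset.range P, (1:ℝ) := Finset.sum_le_sum (fun i _ => hW1 i)
      _ = P := by simp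
  rw [hAe]
  -- step 1
  have s1 : |Ncount ind δ b t u a M - ∑ y ∈ Finset.range Y, Wy y * len δ t u a M y| ≤ Y * (2 * P + 1) := by
    unfold Ncount
    rw [← hY, ← Finset.sum_sub_distrib]
    calc _ ≤ ∑ y ∈ Finset.range Y, |∑ x ∈ Finset.Ioc ⌊alphaB b t u a y⌋ ⌊betaB δ b a M y⌋, ind x y -
          Wy y * len δ t u a M y| := Finset.abs_sum_le_sum_abs _ _
      _ ≤ ∑ y ∈ Finset.range Y, (2 * P + 1 : ℝ) := by
        apply Finset.sum_le_sum
        intro y hy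
        have hl := hlen0 y hy
        have e : betaB δ b a M y - alphaB b t u a y = len δ t u a M y := by
          unfold alphaB betaB len; ring
        have := int_count (fun x => ind x y) P hP0 (fun x => hPx x y) (fun x => h1 x y)
          (alphaB b t u a y) (betaB δ b a M y) (by linarith)
        rw [e] at this
        exact this
      _ = _ := by simp; ring
  -- step 2
  have hl00 : len δ t u a M 0 = √a / a * √M := by
    unfold len
    have hBs : √(δ * 0 ^ 2 + 4 * a * M) = 2 * √(a * M) := by
      rw [Real.sqrt_eq_iff_mul_self_eq (by positivity) (by positivity)]
      nlinarith [Real.sq_sqrt (show 0 ≤ a * M by positivity)]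
    rw [hBs, haM]; field_simp; ring
  have s2 : |∑ y ∈ Finset.range Y, Wy y * len δ t u a M y - A * ∑ y ∈ Finset.range Y, len δ t u a M y|
      ≤ 2 * P * (√a / a * √M) := by
    have h := abel_antitone (fun i : ℕ => max (len δ t u a M i) 0) (fun i => Wy i - A) 0 Y (2 * 1 * P)
      (fun i _ => max_le_max (hanti (Set.mem_Ici.2 (Nat.cast_nonneg i))
        (Set.mem_Ici.2 (Nat.cast_nonneg (i + 1))) (by push_cast; linarith)) le_rfl)
      (fun i _ => le_max_right _ _)
      (fun m => by
        rw [← Finset.range_eq_Ico]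
        exact periodic_sum_bound Wy P hP0 hWper 1 hW1 m)
    rw [← Finset.range_eq_Ico] at h
    have e0 : max (len δ t u a M ((0:ℕ):ℝ)) 0 = √a / a * √M := by
      rw [Nat.cast_zero, hl00]; exact max_eq_left (by positivity)
    simp only [e0] at h
    have e : ∑ y ∈ Finset.range Y, max (len δ t u a M y) 0 * (Wy y - A) =
        ∑ y ∈ Finset.range Y, Wy y * len δ t u a M y - A * ∑ y ∈ Finset.range Y, len δ t u a M y := by
      rw [Finset.mul_sum, ← Finset.sum_sub_distrib]
      apply Finset.sum_congr rfl
      intro y hy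
      rw [max_eq_left (hlen0 y hy)]; ring
    rw [e] at h
    linarith
  -- step 3
  have s3 := len_sum hδ ht hu htu ha hM0
  rw [← hY] at s3
  have s3' : |A * ∑ y ∈ Finset.range Y, len δ t u a M y - A * (M * Real.log ((t + u * √δ) / 2) / √δ)|
      ≤ √a / a * √M := by
    rw [← mul_sub, abs_mul]
    calc _ ≤ 1 * _ := mul_le_mul hA1 s3 (abs_nonneg _) zero_le_one
      _ = _ := by rw [haM]; ring
  have hfin : (Y:ℝ) * (2 * P + 1) ≤ (u * √a + 1) * √M * (2 * P + 1) :=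
    mul_le_mul_of_nonneg_right hYle (by positivity)
  rw [abs_le] at s1 s2 s3' ⊢
  constructor <;> nlinarith

lemma Ncount_tendsto (ind : ℤ → ℤ → ℝ) (P : ℕ) (hP0 : 0 < P) (hPx : ∀ x y, ind (x + P) y = ind x y)
    (hPy : ∀ x y, ind x (y + P) = ind x y) (h1 : ∀ x y, |ind x y| ≤ 1)
    {δ b t u a : ℝ} (hδ : 0 < δ) (ht : 0 < t) (hu : 0 < u) (htu : t ^ 2 = δ * u ^ 2 + 4)
    (ha : 0 < a) :
    Tendsto (fun M : ℕ => Ncount ind δ b t u a M / M) atTop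
      (nhds ((∑ y ∈ Finset.range P, ∑ x ∈ Finset.range P, ind x y) / P ^ 2 *
      (Real.log ((t + u * √δ) / 2) / √δ))) := by
  rw [tendsto_iff_norm_sub_tendsto_zero]
  set C := ((u * √a + 1) * (2 * P + 1) + (2 * P + 1) * (√a / a)) with hC
  have hlim : Tendsto (fun M : ℕ => C * (√(M:ℝ))⁻¹) atTop (nhds 0) := by
    rw [← mul_zero C]
    apply Tendsto.const_mul
    exact (tendsto_inv_atTop_zero.comp Real.tendsto_sqrt_atTop).comp tendsto_natCast_atTop_atTop
  refine squeeze_zero' (Eventually.of_forall (fun _ => norm_nonneg _)) ?_ hlim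
  filter_upwards [eventually_ge_atTop 1] with M hM
  have hMr : (1:ℝ) ≤ M := by exact_mod_cast hM
  have hM0 : (0:ℝ) < M := by linarith
  have h := Ncount_bound (b := b) ind P hP0 hPx hPy h1 hδ ht hu htu ha hMr
  rw [← hC] at h
  rw [Real.norm_eq_abs]
  have e : Ncount ind δ b t u a M / M - (∑ y ∈ Finset.range P, ∑ x ∈ Finset.range P, ind x y) / P ^ 2 *
      (Real.log ((t + u * √δ) / 2) / √δ) = (Ncount ind δ b t u a M -
      (∑ y ∈ Finset.range P, ∑ x ∈ Finset.range P, ind x y) / P ^ 2 *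
      (M * Real.log ((t + u * √δ) / 2) / √δ)) / M := by
    field_simp
  rw [e, abs_div, abs_of_pos hM0, div_le_iff₀ hM0]
  have e2 : C * (√(M:ℝ))⁻¹ * M = C * √M := by
    have h3 := Real.sq_sqrt hM0.le
    have h4 : 0 < √(M:ℝ) := Real.sqrt_pos.2 hM0
    field_simp
    rw [h3]
  rw [e2]; exact h

end VA
end

section
namespace VA

lemma mem_region {d : ℤ} (h0 : 0 < d) (hns : ¬ IsSquare d) {a b c : ℤ} (ha : 0 < a)
    (hd : formDisc (a, b, c) = d) (M : ℕ) (x : ℤ) (n : ℕ) :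
    (n < ⌈(ud d : ℝ) * √((a:ℝ) * M)⌉₊ ∧ x ∈ Finset.Ioc ⌊alphaB b (td d) (ud d) a n⌋ ⌊betaB d b a M n⌋) ↔
      (cone d (a, b, c) (x, n) ∧ formVal (a, b, c) x n ≤ M) := by
  obtain ⟨ht0, hu0, htu⟩ := td_ud_spec h0 hns
  have ht : (0:ℝ) < (td d : ℝ) := by exact_mod_cast ht0
  have hu : (0:ℝ) < (ud d : ℝ) := by exact_mod_cast hu0
  have htu' : (td d : ℝ) ^ 2 - d * (ud d : ℝ) ^ 2 = 4 := by exact_mod_cast htu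
  have hdr : (0:ℝ) < d := by exact_mod_cast h0
  have har : (0:ℝ) < a := by exact_mod_cast ha
  have hn : (0:ℝ) ≤ n := Nat.cast_nonneg n
  have hX := formVal_X a b c x n
  rw [hd] at hX
  have hXr : 4 * (a:ℝ) * (formVal (a, b, c) x n : ℝ) = (2 * a * x + b * n) ^ 2 - d * (n:ℝ) ^ 2 := by
    exact_mod_cast hX
  have hcone : cone d (a, b, c) (x, n) ↔ (td d : ℝ) * n < ud d * (2 * a * x + b * n) := by
    unfold cone
    simp only
    constructor
    · rintro ⟨-, h⟩; exact_mod_cast h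
    · intro h; exact ⟨by positivity, by exact_mod_cast h⟩
  have hM : formVal (a, b, c) x n ≤ M ↔ (formVal (a, b, c) x n : ℝ) ≤ M := by
    constructor
    · intro h; exact_mod_cast h
    · intro h; exact_mod_cast h
  rw [hcone, hM, Finset.mem_Ioc, Int.floor_lt, Int.le_floor, Nat.lt_ceil]
  generalize (formVal (a, b, c) x n : ℝ) = F at *
  generalize (td d : ℝ) = t at *
  generalize (ud d : ℝ) = u at *
  unfold alphaB betaB
  rw [div_lt_iff₀ (by positivity), le_div_iff₀ (by positivity)]
  set X : ℝ := 2 * a * x + b * n with hXX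
  have hB : (0:ℝ) ≤ d * (n:ℝ) ^ 2 + 4 * a * M := by positivity
  have c1 : t / u * n - b * n < x * (2 * a) ↔ t * n < u * X := by
    have : t / u * n - b * n < x * (2 * a) ↔ t / u * n < X := by
      rw [hXX]; constructor <;> intro h <;> linarith
    rw [this, div_mul_eq_mul_div, div_lt_iff₀ hu, mul_comm X]
  rw [c1]
  constructor
  · rintro ⟨h1, h2, h3⟩
    refine ⟨h2, ?_⟩
    have hX0 : 0 < X := by
      have : 0 < u * X := lt_of_le_of_lt (by positivity) h2
      exact pos_of_mul_pos_right this hu.le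
    have h4 : X ≤ √(d * (n:ℝ) ^ 2 + 4 * a * M) := by rw [hXX]; linarith
    have h5 : X ^ 2 ≤ d * (n:ℝ) ^ 2 + 4 * a * M := (Real.le_sqrt hX0.le hB).1 h4
    have : 4 * a * F ≤ 4 * a * M := by linarith
    exact le_of_mul_le_mul_left this (by positivity)
  · rintro ⟨h2, h3⟩
    have hX0 : 0 < X := by
      have : 0 < u * X := lt_of_le_of_lt (by positivity) h2
      exact pos_of_mul_pos_right this hu.le
    have h5 : X ^ 2 ≤ d * (n:ℝ) ^ 2 + 4 * a * M := by nlinarith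
    refine ⟨?_, h2, ?_⟩
    · have h6 : (t * n) ^ 2 < (u * X) ^ 2 := by
        apply pow_lt_pow_left₀ h2 (by positivity) two_ne_zero
      have h7 : (u * X) ^ 2 ≤ u ^ 2 * (d * (n:ℝ) ^ 2 + 4 * a * M) := by
        rw [mul_pow]; exact mul_le_mul_of_nonneg_left h5 (by positivity)
      have h8 : (n:ℝ) ^ 2 < (u * √(a * M)) ^ 2 := by
        rw [mul_pow, Real.sq_sqrt (by positivity)]
        nlinarith
      exact lt_of_pow_lt_pow_left₀ 2 (by positivity) h8
    · have h4 : X ≤ √(d * (n:ℝ) ^ 2 + 4 * a * M) := (Real.le_sqrt hX0.le hB).2 h5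
      rw [hXX] at h4; linarith

lemma cone_pos {d : ℤ} (h0 : 0 < d) (hns : ¬ IsSquare d) {a b c : ℤ} (ha : 0 < a)
    (hd : formDisc (a, b, c) = d) (v : ℤ × ℤ) (hv : cone d (a, b, c) v) :
    0 < formVal (a, b, c) v.1 v.2 := by
  obtain ⟨x, y⟩ := v
  obtain ⟨hy, hc⟩ := hv
  obtain ⟨ht0, hu0, htu⟩ := td_ud_spec h0 hns
  have ht : (0:ℤ) < (td d : ℤ) := by exact_mod_cast ht0
  have hu : (0:ℤ) < (ud d : ℤ) := by exact_mod_cast hu0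
  have hX := formVal_X a b c x y
  rw [hd] at hX
  simp only at *
  generalize (td d : ℤ) = t at *
  generalize (ud d : ℤ) = u at *
  set X := 2 * a * x + b * y
  have h6 : (t * y) ^ 2 < (u * X) ^ 2 := pow_lt_pow_left₀ hc (by positivity) two_ne_zero
  have h8 : 0 < u ^ 2 * (X ^ 2 - d * y ^ 2) := by nlinarith [sq_nonneg y]
  have h9 : 0 < X ^ 2 - d * y ^ 2 := pos_of_mul_pos_right h8 (by positivity)
  rw [← hX] at h9
  exact pos_of_mul_pos_right h9 (by positivity)

open Classical in
/-- indicator of coprime values -/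
noncomputable def indC (d : ℤ) (f : ℤ × ℤ × ℤ) (x y : ℤ) : ℝ :=
  if Nat.Coprime (formVal f x y).natAbs (2 * d.natAbs) then 1 else 0

open Classical in
lemma Ncount_eq {d : ℤ} (h0 : 0 < d) (hns : ¬ IsSquare d) {a b c : ℤ} (ha : 0 < a)
    (hd : formDisc (a, b, c) = d) (M : ℕ) :
    Ncount (indC d (a, b, c)) d b (td d) (ud d) a M =
      ∑ m ∈ (Finset.Ioc 0 M).filter (fun m => Nat.Coprime m (2 * d.natAbs)),
        (Nat.card (Kset d (a, b, c) m) : ℝ) := by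
  set S : Finset (Σ _ : ℕ, ℤ) := (Finset.range ⌈(ud d : ℝ) * √((a:ℝ) * M)⌉₊).sigma
    (fun n => Finset.Ioc ⌊alphaB b (td d) (ud d) a n⌋ ⌊betaB d b a M n⌋) with hS
  have hmem : ∀ n x, (⟨n, x⟩ : Σ _ : ℕ, ℤ) ∈ S ↔ (cone d (a, b, c) (x, n) ∧ formVal (a, b, c) x n ≤ M) := by
    intro n x
    rw [hS, Finset.mem_sigma, Finset.mem_range]
    exact mem_region h0 hns ha hd M x n
  set val : (Σ _ : ℕ, ℤ) → ℕ := fun p => (formVal (a, b, c) p.2 p.1).natAbs with hval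
  have e1 : Ncount (indC d (a, b, c)) d b (td d) (ud d) a M =
      ((S.filter (fun p => Nat.Coprime (val p) (2 * d.natAbs))).card : ℝ) := by
    unfold Ncount indC
    rw [Finset.sum_sigma', ← hS, Finset.sum_boole]
  rw [e1]
  have hmaps : ∀ p ∈ S.filter (fun p => Nat.Coprime (val p) (2 * d.natAbs)),
      val p ∈ (Finset.Ioc 0 M).filter (fun m => Nat.Coprime m (2 * d.natAbs)) := by
    rintro ⟨n, x⟩ hp
    rw [Finset.mem_filter, hmem] at hp
    obtain ⟨⟨h1, h2⟩, h3⟩ := hp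
    have hpos := cone_pos h0 hns ha hd _ h1
    simp only at hpos
    rw [Finset.mem_filter, Finset.mem_Ioc]
    refine ⟨⟨?_, ?_⟩, h3⟩ <;> simp only [hval] <;> omega
  rw [Finset.card_eq_sum_card_fiberwise hmaps]
  push_cast
  apply Finset.sum_congr rfl
  intro m hm
  rw [Finset.mem_filter, Finset.mem_Ioc] at hm
  norm_cast
  rw [Finset.filter_filter]
  have hb : ∃ φ : ((S.filter (fun p => Nat.Coprime (val p) (2 * d.natAbs) ∧ val p = m) : Finset _) : Set (Σ _ : ℕ, ℤ)) →
      Kset d (a, b, c) m, Function.Bijective φ := by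
    refine ⟨fun p => ⟨(p.1.2, (p.1.1 : ℤ)), ?_⟩, ?_, ?_⟩
    · obtain ⟨⟨n, x⟩, hp⟩ := p
      rw [Finset.mem_coe, Finset.mem_filter, hmem] at hp
      obtain ⟨⟨h1, h2⟩, h3, h4⟩ := hp
      have hpos := cone_pos h0 hns ha hd _ h1
      refine ⟨h1, ?_⟩
      simp only [hval] at h4 hpos ⊢
      omega
    · rintro ⟨⟨n, x⟩, hp⟩ ⟨⟨n', x'⟩, hp'⟩ h
      simp only [Subtype.mk.injEq, Prod.mk.injEq] at h
      obtain ⟨h1, h2⟩ := h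
      have : n = n' := by exact_mod_cast h2
      subst h1 this; rfl
    · rintro ⟨⟨x, y⟩, h1, h2⟩
      have hy : 0 ≤ y := h1.1
      lift y to ℕ using hy
      refine ⟨⟨⟨y, x⟩, ?_⟩, rfl⟩
      simp only at h2
      rw [Finset.mem_coe, Finset.mem_filter, hmem]
      have hv : val ⟨y, x⟩ = m := by simp only [hval]; omega
      refine ⟨⟨h1, by omega⟩, by rw [hv]; exact hm.2, hv⟩
  obtain ⟨φ, hφ⟩ := hb
  rw [← Nat.card_congr (Equiv.ofBijective φ hφ)]
  simp

lemma conv_zero (d : ℤ) (hd : d ≠ 0) (m : ℕ) (hm : ¬ Nat.Coprime m (2 * d.natAbs)) :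
    (chiA d * copA (2 * d.natAbs)) m = 0 := by
  rw [← rho_conv d hd, ArithmeticFunction.mul_apply]
  apply Finset.sum_eq_zero
  rintro ⟨x, y⟩ hxy
  rw [Nat.mem_divisorsAntidiagonal] at hxy
  simp only [rhoA, sqA, ArithmeticFunction.coe_mk] at *
  by_cases hx : Nat.Coprime x (2 * d.natAbs)
  · by_cases hy : Nat.Coprime y (2 * d.natAbs)
    · exfalso; apply hm; rw [← hxy.1]; exact Nat.Coprime.mul_left hx hy
    · simp [hy]
  · simp [hx]

lemma total_count {d : ℤ} (h0 : 0 < d) (hns : ¬ IsSquare d) (hd4 : d % 4 = 0 ∨ d % 4 = 1)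
    {rep : Cl d → ℤ × ℤ × ℤ} (hrep : GoodRep d rep) (M : ℕ) (s : Finset (Cl d)) :
    (∑ c ∈ s, Ncount (indC d (rep c)) d (rep c).2.1 (td d) (ud d) (rep c).1 M ≤
      ∑ m ∈ Finset.Ioc 0 M, (chiA d * copA (2 * d.natAbs)) m) ∧
    ((∀ c, c ∈ s) → ∑ c ∈ s, Ncount (indC d (rep c)) d (rep c).2.1 (td d) (ud d) (rep c).1 M =
      ∑ m ∈ Finset.Ioc 0 M, (chiA d * copA (2 * d.natAbs)) m) := by
  classical
  have e : ∑ c ∈ s, Ncount (indC d (rep c)) d (rep c).2.1 (td d) (ud d) (rep c).1 M =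
      ∑ m ∈ (Finset.Ioc 0 M).filter (fun m => Nat.Coprime m (2 * d.natAbs)),
        ∑ c ∈ s, (Nat.card (Kset d (rep c) m) : ℝ) := by
    rw [Finset.sum_comm]
    apply Finset.sum_congr rfl
    intro c _
    exact Ncount_eq h0 hns (hrep.pos c) (hrep.disc c) M
  have e2 : ∑ m ∈ Finset.Ioc 0 M, (chiA d * copA (2 * d.natAbs)) m =
      ∑ m ∈ (Finset.Ioc 0 M).filter (fun m => Nat.Coprime m (2 * d.natAbs)),
        (chiA d * copA (2 * d.natAbs)) m := by
    rw [Finset.sum_filter]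
    apply Finset.sum_congr rfl
    intro m _
    split_ifs with h
    · rfl
    · exact conv_zero d h0.ne' m h
  have key : ∀ m ∈ (Finset.Ioc 0 M).filter (fun m => Nat.Coprime m (2 * d.natAbs)),
      ∃ A : ℕ, (A:ℝ) = (chiA d * copA (2 * d.natAbs)) m ∧
      (∑ c ∈ s, Nat.card (Kset d (rep c) m) ≤ A) ∧
      ((∀ c, c ∈ s) → ∑ c ∈ s, Nat.card (Kset d (rep c) m) = A) := by
    intro m hm
    rw [Finset.mem_filter, Finset.mem_Ioc] at hm
    obtain ⟨hfin, hcard⟩ := count_identity h0 hns hd4 hrep hm.1.1 hm.2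
    refine ⟨_, hcard, ?_⟩
    have hK : ∀ c, Finite (Kset d (rep c) m) := fun c =>
      Finite.of_injective (fun v => (⟨c, v⟩ : Σ c : Cl d, Kset d (rep c) m))
        (fun v v1 h => by simpa using h)
    have hs : ∑ c ∈ s, Nat.card (Kset d (rep c) m) = Nat.card (Σ c : s, Kset d (rep c.1) m) := by
      rw [Nat.card_sigma, ← Finset.sum_coe_sort]
    have hinj : Function.Injective (fun p : (Σ c : s, Kset d (rep c.1) m) =>
        (⟨p.1.1, p.2⟩ : Σ c : Cl d, Kset d (rep c) m)) := by
      rintro ⟨⟨c, hc⟩, v⟩ ⟨⟨c', hc'⟩, v'⟩ h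
      simp only [Sigma.mk.injEq] at h
      obtain ⟨h1, h2⟩ := h
      subst h1
      rw [heq_eq_eq] at h2
      subst h2; rfl
    constructor
    · rw [hs]; exact Nat.card_le_card_of_injective _ hinj
    · intro hall
      rw [hs]
      apply Nat.card_congr (Equiv.ofBijective _ ⟨hinj, ?_⟩)
      rintro ⟨c, v⟩
      exact ⟨⟨⟨c, hall c⟩, v⟩, rfl⟩
  rw [e, e2]
  constructor
  · apply Finset.sum_le_sum
    intro m hm
    obtain ⟨A, h1, h2, -⟩ := key m hm
    rw [← h1]; exact_mod_cast h2
  · intro hall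
    apply Finset.sum_congr rfl
    intro m hm
    obtain ⟨A, h1, -, h2⟩ := key m hm
    rw [← h1]; exact_mod_cast h2 hall

end VA
end

section
namespace VA

lemma cop_congr {P : ℕ} {A B : ℤ} (h : ∀ p : ℕ, p.Prime → p ∣ P → ((p:ℤ) ∣ A ↔ (p:ℤ) ∣ B)) :
    Nat.Coprime A.natAbs P ↔ Nat.Coprime B.natAbs P := by
  rw [← not_iff_not, Nat.Prime.not_coprime_iff_dvd, Nat.Prime.not_coprime_iff_dvd]
  constructor
  · rintro ⟨p, hp, h1, h2⟩
    exact ⟨p, hp, Int.natCast_dvd.1 ((h p hp h2).1 (Int.natCast_dvd.2 h1)), h2⟩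
  · rintro ⟨p, hp, h1, h2⟩
    exact ⟨p, hp, Int.natCast_dvd.1 ((h p hp h2).2 (Int.natCast_dvd.2 h1)), h2⟩

open Classical in
lemma cnt_shift (P : ℕ) (hP : 0 < P) (k : ℤ) :
    ∑ x ∈ Finset.range P, (if Nat.Coprime ((x:ℤ) + k).natAbs P then (1:ℝ) else 0) = Nat.totient P := by
  have hP' : (0:ℤ) < P := by exact_mod_cast hP
  obtain ⟨k', hk'⟩ : ∃ k' : ℕ, (k':ℤ) = k % P := ⟨(k % P).toNat, Int.toNat_of_nonneg (Int.emod_nonneg _ hP'.ne')⟩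
  have h1 : ∀ x : ℕ, Nat.Coprime ((x:ℤ) + k).natAbs P ↔ Nat.Coprime (k' + x) P := by
    intro x
    have : (k' + x) = ((x:ℤ) + k').natAbs := by omega
    rw [this]
    apply cop_congr
    intro p _ hpP
    have hp : (p:ℤ) ∣ k - k' := by
      have : (P:ℤ) ∣ k - k' := by rw [hk']; exact Int.dvd_self_sub_emod
      exact dvd_trans (by exact_mod_cast hpP) this
    have e : (x:ℤ) + k = (x + k') + (k - k') := by ring
    rw [e]; exact dvd_add_left hp
  simp only [h1]
  rw [sum_range_periodic_shift (fun n => if Nat.Coprime n P then (1:ℝ) else 0) P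
    (fun n => by simp [Nat.coprime_add_self_left])]
  rw [Finset.sum_boole, Nat.totient]
  congr 2
  ext x; simp [Nat.coprime_comm]

open Classical in
lemma cnt_shift2 (P Q : ℕ) (hP : 0 < P) (k : ℤ) :
    ∑ x ∈ Finset.range (P * Q), (if Nat.Coprime ((x:ℤ) + k).natAbs P then (1:ℝ) else 0) = Q * Nat.totient P := by
  rw [sum_range_mul_period, cnt_shift P hP]
  intro n
  have : Nat.Coprime (((n + P : ℕ):ℤ) + k).natAbs P ↔ Nat.Coprime ((n:ℤ) + k).natAbs P := by
    apply cop_congr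
    intro p _ hpP
    have e : ((n + P : ℕ):ℤ) + k = (n + k) + P := by push_cast; ring
    rw [e]; exact dvd_add_left (by exact_mod_cast hpP)
  simp only [this]

/-- the 2-adic factor -/
noncomputable def c2 (d : ℤ) : ℝ :=
  if d % 4 = 0 then 1 else if d % 8 = 1 then 2 else if d % 8 = 5 then 2 / 3 else 0

lemma indC_periodic (d : ℤ) (f : ℤ × ℤ × ℤ) (x y : ℤ) :
    indC d f (x + (2 * d.natAbs : ℕ)) y = indC d f x y ∧
    indC d f x (y + (2 * d.natAbs : ℕ)) = indC d f x y := by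
  unfold indC formVal
  constructor
  · congr 1
    rw [eq_iff_iff]
    apply cop_congr
    intro p _ hp
    obtain ⟨q, hq⟩ := hp
    rw [hq]; push_cast
    have e : f.1 * (x + p * q) ^ 2 + f.2.1 * (x + p * q) * y + f.2.2 * y ^ 2 =
      (f.1 * x ^ 2 + f.2.1 * x * y + f.2.2 * y ^ 2) + p * (f.1 * (2 * x * q + p * q ^ 2) + f.2.1 * q * y) := by ring
    rw [e]; exact dvd_add_left (dvd_mul_right _ _)
  · congr 1
    rw [eq_iff_iff]
    apply cop_congr
    intro p _ hp
    obtain ⟨q, hq⟩ := hp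
    rw [hq]; push_cast
    have e : f.1 * x ^ 2 + f.2.1 * x * (y + p * q) + f.2.2 * (y + p * q) ^ 2 =
      (f.1 * x ^ 2 + f.2.1 * x * y + f.2.2 * y ^ 2) + p * (f.2.2 * (2 * y * q + p * q ^ 2) + f.2.1 * q * x) := by ring
    rw [e]; exact dvd_add_left (dvd_mul_right _ _)

lemma odd_prime_iff {p a b c d k x y : ℤ} (hp : Prime p) (h2 : ¬ p ∣ 2) (ha : ¬ p ∣ a)
    (hd : b ^ 2 - 4 * a * c = d) (hpd : p ∣ d) (hk : p ∣ 2 * a * k - b) :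
    p ∣ formVal (a, b, c) x y ↔ p ∣ x + k * y := by
  unfold formVal
  simp only
  have e : 4 * a * (a * x ^ 2 + b * x * y + c * y ^ 2) = (2 * a * x + b * y) ^ 2 - d * y ^ 2 := by
    rw [← hd]; ring
  have e2 : 2 * a * (x + k * y) = (2 * a * x + b * y) + (2 * a * k - b) * y := by ring
  have h4a : p ∣ 4 * a * (a * x ^ 2 + b * x * y + c * y ^ 2) ↔ p ∣ a * x ^ 2 + b * x * y + c * y ^ 2 := by
    constructor
    · intro h
      rcases hp.dvd_or_dvd h with h | h
      · exfalso
        rcases hp.dvd_or_dvd h with h | h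
        · have : p ∣ 2 * 2 := by norm_num; exact h
          rcases hp.dvd_or_dvd this with h | h <;> exact h2 h
        · exact ha h
      · exact h
    · intro h; exact dvd_mul_of_dvd_right h _
  have h2a : p ∣ 2 * a * (x + k * y) ↔ p ∣ x + k * y := by
    constructor
    · intro h
      rcases hp.dvd_or_dvd h with h | h
      · exfalso
        rcases hp.dvd_or_dvd h with h | h
        · exact h2 h
        · exact ha h
      · exact h
    · intro h; exact dvd_mul_of_dvd_right h _
  rw [← h4a, ← h2a, e, e2, dvd_sub_left (dvd_mul_of_dvd_left hpd _), dvd_add_left (dvd_mul_of_dvd_left hk _)]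
  exact hp.dvd_pow_iff_dvd two_ne_zero

lemma W_four {d : ℤ} (h0 : 0 < d) (hd4 : d % 4 = 0) {a b c : ℤ} (hd : b ^ 2 - 4 * a * c = d)
    (hcop : IsCoprime a (2 * d)) (y : ℕ) :
    ∑ x ∈ Finset.range (2 * d.natAbs), indC d (a, b, c) x y = Nat.totient (2 * d.natAbs) := by
  obtain ⟨r, s, hrs⟩ := hcop
  have hb : b % 2 = 0 := by
    rcases Int.emod_two_eq_zero_or_one b with h | h
    · exact h
    · exfalso
      obtain ⟨k, hk⟩ : ∃ k, b = 2 * k + 1 := ⟨b / 2, by omega⟩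
      subst hk; ring_nf at hd; omega
  obtain ⟨b', hb'⟩ : ∃ k, b = 2 * k := ⟨b / 2, by omega⟩
  obtain ⟨d', hd'⟩ : ∃ k, d = 4 * k := ⟨d / 4, by omega⟩
  rw [← cnt_shift (2 * d.natAbs) (by omega) ((r * b' + d') * y)]
  apply Finset.sum_congr rfl
  intro x _
  unfold indC
  congr 1
  rw [eq_iff_iff]
  apply cop_congr
  intro p hp hpd
  have hpi : Prime (p:ℤ) := Nat.prime_iff_prime_int.1 hp
  have hap : ¬ (p:ℤ) ∣ a := by
    intro h
    have h3 : (p:ℤ) ∣ 2 * d := by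
      have : ((2 * d.natAbs : ℕ):ℤ) = 2 * d := by push_cast; rw [abs_of_pos h0]
      rw [← this]; exact_mod_cast hpd
    have : (p:ℤ) ∣ 1 := by rw [← hrs]; exact dvd_add (dvd_mul_of_dvd_right h _) (dvd_mul_of_dvd_right h3 _)
    exact hpi.not_unit (isUnit_of_dvd_one this)
  by_cases hp2 : p = 2
  · subst hp2
    push_cast
    have ha2 : a % 2 = 1 := by push_cast at hap; omega
    have hr2 : r % 2 = 1 := by
      rcases Int.emod_two_eq_zero_or_one r with h | h
      · exfalso
        obtain ⟨r', hr'⟩ : ∃ k, r = 2 * k := ⟨r / 2, by omega⟩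
        rw [hr'] at hrs
        have : 2 * (r' * a + s * d) = 1 := by linarith
        omega
      · exact h
    have hdd : d' = b' ^ 2 - a * c := by
      rw [hb', hd'] at hd; linarith
    have hae : ¬ Even a := by rw [Int.not_even_iff]; exact ha2
    have hre : ¬ Even r := by rw [Int.not_even_iff]; exact hr2
    have hbe : Even b := by rw [Int.even_iff]; exact hb
    rw [← even_iff_two_dvd, ← even_iff_two_dvd, hdd]
    unfold formVal
    simp only [Int.even_add, Int.even_sub, Int.even_mul, Int.even_pow, hae, hre, hbe]
    tauto
  · have hpd' : (p:ℤ) ∣ d := by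
      have h1 : p ∣ d.natAbs := by
        rcases (Nat.Prime.dvd_mul hp).1 hpd with h | h
        · exact absurd ((Nat.prime_dvd_prime_iff_eq hp Nat.prime_two).1 h) hp2
        · exact h
      exact Int.natCast_dvd.2 h1
    have hp2' : ¬ (p:ℤ) ∣ 2 := by
      intro h
      exact hp2 ((Nat.prime_dvd_prime_iff_eq hp Nat.prime_two).1 (by exact_mod_cast h))
    have hpd4 : (p:ℤ) ∣ d' := by
      rw [hd'] at hpd'
      rcases hpi.dvd_or_dvd hpd' with h | h
      · exfalso
        have : (p:ℤ) ∣ 2 * 2 := by norm_num; exact h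
        rcases hpi.dvd_or_dvd this with h | h <;> exact hp2' h
      · exact h
    refine odd_prime_iff hpi hp2' hap hd hpd' ?_
    have : 2 * a * (r * b' + d') - b = - (2 * s * b) * d + 2 * a * d' := by
      have : r * a = 1 - s * (2 * d) := by linarith
      calc 2 * a * (r * b' + d') - b = 2 * (r * a) * b' - b + 2 * a * d' := by ring
        _ = _ := by rw [this, hb']; ring
    rw [this]
    exact dvd_add (dvd_mul_of_dvd_right hpd' _) (dvd_mul_of_dvd_right hpd4 _)

lemma W_odd {d : ℤ} (h0 : 0 < d) (hd4 : d % 4 = 1) {a b c : ℤ} (hd : b ^ 2 - 4 * a * c = d)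
    (hcop : IsCoprime a (2 * d)) (y : ℕ) :
    ∑ x ∈ Finset.range (2 * d.natAbs), indC d (a, b, c) x y =
      if y % 2 = 0 then (Nat.totient (2 * d.natAbs) : ℝ) else
        if d % 8 = 1 then 0 else 2 * (Nat.totient (2 * d.natAbs) : ℝ) := by
  obtain ⟨r, s, hrs⟩ := hcop
  have hb : b % 2 = 1 := by
    rcases Int.emod_two_eq_zero_or_one b with h | h
    · exfalso
      obtain ⟨k, hk⟩ : ∃ k, b = 2 * k := ⟨b / 2, by omega⟩
      subst hk; ring_nf at hd; omega
    · exact h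
  obtain ⟨b', hb'⟩ : ∃ k, b = 2 * k + 1 := ⟨b / 2, by omega⟩
  obtain ⟨d', hd'⟩ : ∃ k, d = 4 * k + 1 := ⟨d / 4, by omega⟩
  have ha2 : a % 2 = 1 := by
    rcases Int.emod_two_eq_zero_or_one a with h | h
    · exfalso
      obtain ⟨r', hr'⟩ : ∃ k, a = 2 * k := ⟨a / 2, by omega⟩
      rw [hr'] at hrs
      have : 2 * (r * r' + s * d) = 1 := by linarith
      omega
    · exact h
  have hr2 : r % 2 = 1 := by
    rcases Int.emod_two_eq_zero_or_one r with h | h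
    · exfalso
      obtain ⟨r', hr'⟩ : ∃ k, r = 2 * k := ⟨r / 2, by omega⟩
      rw [hr'] at hrs
      have : 2 * (r' * a + s * d) = 1 := by linarith
      omega
    · exact h
  -- inverse of 2 mod d is (d+1)/2 = 2 d' + 1
  set k : ℤ := r * (2 * d' + 1) * b + d with hk
  have hkey : ∀ p : ℕ, p.Prime → (p:ℤ) ∣ d → ∀ x : ℤ, (p:ℤ) ∣ formVal (a, b, c) x y ↔ (p:ℤ) ∣ x + k * y := by
    intro p hp hpd x
    have hpi : Prime (p:ℤ) := Nat.prime_iff_prime_int.1 hp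
    have hap : ¬ (p:ℤ) ∣ a := by
      intro h
      have : (p:ℤ) ∣ 1 := by
        rw [← hrs]; exact dvd_add (dvd_mul_of_dvd_right h _) (dvd_mul_of_dvd_right (dvd_mul_of_dvd_right hpd _) _)
      exact hpi.not_unit (isUnit_of_dvd_one this)
    have hp2' : ¬ (p:ℤ) ∣ 2 := by
      intro h
      have h2 : p = 2 := (Nat.prime_dvd_prime_iff_eq hp Nat.prime_two).1 (by exact_mod_cast h)
      subst h2; push_cast at hpd; omega
    refine odd_prime_iff hpi hp2' hap hd hpd ?_
    have : 2 * a * k - b = d * ((1 - s * (2 * d)) * b - 2 * s * b + 2 * a) := by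
      have h1 : r * a = 1 - s * (2 * d) := by linarith
      have h2 : 2 * (2 * d' + 1) = d + 1 := by linarith
      calc 2 * a * k - b = (r * a) * (2 * (2 * d' + 1)) * b - b + 2 * a * d := by rw [hk]; ring
        _ = _ := by rw [h1, h2]; ring
    rw [this]; exact dvd_mul_of_dvd_left hpd _
  have hae : ¬ Even a := by rw [Int.not_even_iff]; exact ha2
  have hre : ¬ Even r := by rw [Int.not_even_iff]; exact hr2
  have hbe : ¬ Even b := by rw [Int.not_even_iff]; exact hb
  have hde : ¬ Even d := by rw [Int.not_even_iff]; omega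
  have hke : Even k := by
    rw [hk]
    simp only [Int.even_add, Int.even_mul, hae, hre, hbe, hde]
    simp
  have hdN : ((d.natAbs : ℕ) : ℤ) = d := by rw [Int.natCast_natAbs, abs_of_pos h0]
  have hce : Even c ↔ d % 8 = 1 := by
    have h1 : b' ^ 2 + b' - a * c = d' := by rw [hb', hd'] at hd; linarith
    have h2 : Even c ↔ Even d' := by
      rw [← h1]; simp only [Int.even_add, Int.even_sub, Int.even_mul, Int.even_pow, hae]; simp
    rw [h2, Int.even_iff]; omega
  have hfe : ∀ x : ℤ, Even (formVal (a, b, c) x y) ↔ (if Even (y:ℤ) then Even x else Even c) := by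
    intro x
    unfold formVal
    simp only [Int.even_add, Int.even_mul, Int.even_pow, hae, hbe]
    split_ifs with h <;> simp [h]
  have hprime : ∀ p : ℕ, p.Prime → p ∣ 2 * d.natAbs → p = 2 ∨ (p:ℤ) ∣ d := by
    intro p hp h
    rcases (Nat.Prime.dvd_mul hp).1 h with h | h
    · left; exact (Nat.prime_dvd_prime_iff_eq hp Nat.prime_two).1 h
    · right; exact Int.natCast_dvd.2 h
  have hye : Even (y:ℤ) ↔ y % 2 = 0 := by rw [Int.even_coe_nat, Nat.even_iff]
  by_cases hy : y % 2 = 0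
  · rw [if_pos hy, ← cnt_shift (2 * d.natAbs) (by omega) (k * y)]
    apply Finset.sum_congr rfl
    intro x _
    unfold indC
    congr 1
    rw [eq_iff_iff]
    apply cop_congr
    intro p hp hpd
    rcases hprime p hp hpd with rfl | h
    · push_cast
      rw [← even_iff_two_dvd, ← even_iff_two_dvd, hfe, if_pos (hye.2 hy)]
      simp [Int.even_add, Int.even_mul, hke]
    · exact hkey p hp h x
  · rw [if_neg hy]
    split_ifs with h8
    · apply Finset.sum_eq_zero
      intro x _
      unfold indC
      rw [if_neg]
      have h1 : Even (formVal (a, b, c) x y) := by rw [hfe, if_neg (fun h => hy (hye.1 h))]; exact hce.2 h8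
      rw [Nat.Prime.not_coprime_iff_dvd]
      refine ⟨2, Nat.prime_two, ?_, Nat.dvd_mul_right _ _⟩
      have h3 : ((2:ℕ):ℤ) ∣ formVal (a, b, c) x y := by exact_mod_cast even_iff_two_dvd.1 h1
      exact Int.natCast_dvd.1 h3
    · have h1 : ∀ x : ℤ, ¬ Even (formVal (a, b, c) x y) := by
        intro x; rw [hfe, if_neg (fun h => hy (hye.1 h)), hce]; exact h8
      have hφ : Nat.totient (2 * d.natAbs) = Nat.totient d.natAbs := by
        rw [Nat.totient_mul]
        · simp
        · rw [Nat.coprime_two_left, Int.natAbs_odd]; exact Int.not_even_iff_odd.1 hde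
      rw [hφ]
      have := cnt_shift2 d.natAbs 2 (by omega) (k * y)
      rw [mul_comm d.natAbs 2] at this
      push_cast at this
      rw [← this]
      apply Finset.sum_congr rfl
      intro x _
      unfold indC
      congr 1
      rw [eq_iff_iff]
      have : Nat.Coprime (formVal (a, b, c) x y).natAbs (2 * d.natAbs) ↔
          Nat.Coprime (formVal (a, b, c) x y).natAbs d.natAbs := by
        rw [Nat.coprime_mul_iff_right]
        have : Nat.Coprime (formVal (a, b, c) x y).natAbs 2 := by
          rw [Nat.coprime_two_right, Int.natAbs_odd]; exact Int.not_even_iff_odd.1 (h1 x)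
        tauto
      rw [this]
      apply cop_congr
      intro p hp hpd
      exact hkey p hp (Int.natCast_dvd.2 hpd) x

lemma W_total {d : ℤ} (h0 : 0 < d) (hd4 : d % 4 = 0 ∨ d % 4 = 1) {f : ℤ × ℤ × ℤ} (hd : formDisc f = d)
    (hcop : IsCoprime f.1 (2 * d)) :
    (∑ y ∈ Finset.range (2 * d.natAbs), ∑ x ∈ Finset.range (2 * d.natAbs), indC d f x y) * c2 d =
      Nat.totient (2 * d.natAbs) * (2 * d.natAbs) := by
  obtain ⟨a, b, c⟩ := f
  unfold formDisc at hd
  simp only at hd hcop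
  rcases hd4 with h | h
  · have : c2 d = 1 := by unfold c2; rw [if_pos h]
    rw [this, Finset.sum_congr rfl (fun y _ => W_four h0 h hd hcop y)]
    simp; ring
  · rw [Finset.sum_congr rfl (fun y _ => W_odd h0 h hd hcop y)]
    have hs : ∀ A B : ℝ, ∑ y ∈ Finset.range (2 * d.natAbs), (if y % 2 = 0 then A else B) = d.natAbs * (A + B) := by
      intro A B
      rw [sum_range_mul_period]
      · simp [Finset.sum_range_succ]
      · intro n; simp
    rw [hs]
    have : d % 8 = 1 ∨ d % 8 = 5 := by omega
    rcases this with h8 | h8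
    · have hc : c2 d = 2 := by unfold c2; rw [if_neg (by omega), if_pos h8]
      rw [hc, if_pos h8]; ring
    · have hc : c2 d = 2 / 3 := by unfold c2; rw [if_neg (by omega), if_neg (by omega), if_pos h8]
      rw [hc, if_neg (by omega)]; ring

lemma classNumber_formula {d : ℤ} (h0 : 0 < d) (hns : ¬ IsSquare d) (hd4 : d % 4 = 0 ∨ d % 4 = 1) :
    (classNumber d : ℝ) * Real.log (eps d) / √(d:ℝ) = c2 d * Lodd d := by
  obtain ⟨rep, hrep⟩ := exists_goodRep h0 hns
  have hdr : (0:ℝ) < d := by exact_mod_cast h0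
  obtain ⟨ht0, hu0, htu⟩ := td_ud_spec h0 hns
  have ht2 := td_gt_two h0 hns
  have ht : (0:ℝ) < (td d : ℝ) := by exact_mod_cast ht0
  have ht2' : (2:ℝ) < (td d : ℝ) := by exact_mod_cast ht2
  have hu : (0:ℝ) < (ud d : ℝ) := by exact_mod_cast hu0
  have htu' : (td d : ℝ) ^ 2 = d * (ud d : ℝ) ^ 2 + 4 := by
    have : (td d : ℝ) ^ 2 - d * (ud d : ℝ) ^ 2 = 4 := by exact_mod_cast htu
    linarith
  set P := 2 * d.natAbs with hP
  have hP0 : 0 < P := by omega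
  have hPr : (0:ℝ) < P := by exact_mod_cast hP0
  have hPd : (P:ℝ) = 2 * d.natAbs := by rw [hP]; push_cast; ring
  have hφ : (0:ℝ) < Nat.totient P := by exact_mod_cast Nat.totient_pos.2 hP0
  have hc2 : 0 < c2 d := by
    unfold c2
    split_ifs <;> norm_num
    omega
  have hlog : 0 < Real.log (eps d) := by
    apply Real.log_pos
    unfold eps
    have : 0 < (ud d : ℝ) * √(d:ℝ) := by positivity
    linarith
  set E := Real.log (eps d) / √(d:ℝ) with hE
  have hE0 : 0 < E := by positivity
  have hlim : ∀ c : Cl d, Tendsto (fun M : ℕ => Ncount (indC d (rep c)) d (rep c).2.1 (td d) (ud d) (rep c).1 M / M) atTop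
      (nhds ((Nat.totient P / P : ℝ) / c2 d * E)) := by
    intro c
    have := Ncount_tendsto (indC d (rep c)) P hP0 (fun x y => (indC_periodic d (rep c) x y).1)
      (fun x y => (indC_periodic d (rep c) x y).2) (fun x y => by unfold indC; split_ifs <;> norm_num)
      (b := (rep c).2.1) hdr ht hu htu' (a := (rep c).1) (by exact_mod_cast hrep.pos c)
    have hW := W_total h0 hd4 (hrep.disc c) (hrep.cop c)
    rw [← hP, ← hPd] at hW
    have e : (∑ y ∈ Finset.range P, ∑ x ∈ Finset.range P, indC d (rep c) x y) / (P:ℝ) ^ 2 = (Nat.totient P / P : ℝ) / c2 d := by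
      rw [div_div, div_eq_div_iff (by positivity) (by positivity)]
      linear_combination (P:ℝ) * hW
    rw [e] at this
    exact this
  have hsum : ∀ s : Finset (Cl d), Tendsto (fun M : ℕ => (∑ c ∈ s, Ncount (indC d (rep c)) d (rep c).2.1 (td d) (ud d) (rep c).1 M) / M) atTop
      (nhds (s.card * ((Nat.totient P / P : ℝ) / c2 d * E))) := by
    intro s
    have := tendsto_finset_sum s (fun c _ => hlim c)
    simp only [Finset.sum_const, nsmul_eq_mul] at this
    refine this.congr (fun M => ?_)
    rw [Finset.sum_div]
  have hcl := class_sum_tendsto h0 hns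
  rw [← hP] at hcl
  have hle : ∀ s : Finset (Cl d), (s.card : ℝ) * ((Nat.totient P / P : ℝ) / c2 d * E) ≤ (Nat.totient P / P : ℝ) * Lodd d := by
    intro s
    refine le_of_tendsto_of_tendsto' (hsum s) hcl (fun M => ?_)
    exact div_le_div_of_nonneg_right (total_count h0 hns hd4 hrep M s).1 (Nat.cast_nonneg _)
  have hfin : Finite (Cl d) := by
    by_contra hinf
    rw [not_finite_iff_infinite] at hinf
    set K := (Nat.totient P / P : ℝ) / c2 d * E
    have hK : 0 < K := by positivity
    obtain ⟨n, hn⟩ := exists_nat_gt ((Nat.totient P / P : ℝ) * Lodd d / K)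
    obtain ⟨s, hs⟩ := Infinite.exists_subset_card_eq (Cl d) n
    have := hle s
    rw [hs] at this
    rw [div_lt_iff₀ hK] at hn
    linarith
  have := Fintype.ofFinite (Cl d)
  have heq : ((Finset.univ : Finset (Cl d)).card : ℝ) * ((Nat.totient P / P : ℝ) / c2 d * E) = (Nat.totient P / P : ℝ) * Lodd d := by
    refine tendsto_nhds_unique (hsum Finset.univ) (hcl.congr (fun M => ?_))
    rw [(total_count h0 hns hd4 hrep M Finset.univ).2 (fun c => Finset.mem_univ c)]
  have hcard : (classNumber d : ℝ) = ((Finset.univ : Finset (Cl d)).card : ℝ) := by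
    unfold classNumber
    rw [Finset.card_univ, ← Nat.card_eq_fintype_card]
  rw [hcard, mul_div_assoc, ← hE]
  have hq : (0:ℝ) < Nat.totient P / P := by positivity
  apply mul_left_cancel₀ hq.ne'
  field_simp at heq ⊢
  linarith

end VA
end

section
namespace VA

/-- truncated 2-adic factor -/
noncomputable def gam : ℕ → ℤ → ℝ
  | 0, _ => 0
  | K + 1, x => c2 x + if (4:ℤ) ∣ x then gam K (x / 4) / 2 else 0

lemma gam_eq (K : ℕ) : ∀ x : ℤ, gam K x = ∑ i ∈ Finset.range K,
    if (4:ℤ) ^ i ∣ x then c2 (x / 4 ^ i) / 2 ^ i else 0 := by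
  induction K with
  | zero => intro x; simp [gam]
  | succ K ih =>
    intro x
    rw [Finset.sum_range_succ']
    simp only [pow_zero, one_dvd, if_true, Int.ediv_one, div_one]
    rw [gam, add_comm]
    congr 1
    split_ifs with h
    · obtain ⟨y, rfl⟩ := h
      rw [Int.mul_ediv_cancel_left _ (by norm_num), ih, Finset.sum_div]
      apply Finset.sum_congr rfl
      intro i _
      have h1 : (4:ℤ) ^ (i + 1) ∣ 4 * y ↔ (4:ℤ) ^ i ∣ y := by
        rw [pow_succ', mul_dvd_mul_iff_left (by norm_num)]
      have h2 : (4 * y) / (4:ℤ) ^ (i + 1) = y / 4 ^ i := by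
        rw [pow_succ', Int.mul_ediv_mul_of_pos _ _ (by norm_num)]
      simp only [h1, h2]
      split_ifs
      · rw [pow_succ]; field_simp
      · simp
    · symm
      apply Finset.sum_eq_zero
      intro i _
      rw [if_neg]
      intro h1
      exact h (dvd_trans (dvd_pow_self _ (by omega)) h1)

lemma c2_nonneg (x : ℤ) : 0 ≤ c2 x := by unfold c2; split_ifs <;> norm_num

lemma c2_le (x : ℤ) : c2 x ≤ 2 := by unfold c2; split_ifs <;> norm_num

lemma gam_nonneg (K : ℕ) (x : ℤ) : 0 ≤ gam K x := by
  rw [gam_eq]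
  apply Finset.sum_nonneg
  intro i _
  split_ifs
  · have := c2_nonneg (x / 4 ^ i); positivity
  · exact le_rfl

lemma gam_sub_le {J K : ℕ} (h : J ≤ K) (x : ℤ) : |gam K x - gam J x| ≤ 4 * (1 / 2) ^ J := by
  rw [gam_eq, gam_eq, ← Finset.sum_Ico_eq_sub _ h]
  refine (Finset.abs_sum_le_sum_abs _ _).trans ?_
  have : ∀ i ∈ Finset.Ico J K, |if (4:ℤ) ^ i ∣ x then c2 (x / 4 ^ i) / 2 ^ i else 0| ≤ 2 * (1/2:ℝ) ^ i := by
    intro i _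
    have h1 := c2_nonneg (x / 4 ^ i)
    have h2 := c2_le (x / 4 ^ i)
    split_ifs
    · rw [abs_of_nonneg (by positivity), one_div, inv_pow, ← div_eq_mul_inv]
      gcongr
    · simp
  refine (Finset.sum_le_sum this).trans ?_
  rw [← Finset.mul_sum, geom_sum_Ico (by norm_num) h]
  have h1 : (0:ℝ) ≤ (1/2) ^ K := by positivity
  have : ((1/2:ℝ) ^ K - (1/2) ^ J) / (1/2 - 1) = 2 * ((1/2) ^ J - (1/2) ^ K) := by ring
  rw [this]; linarith

lemma gam_le (K : ℕ) (x : ℤ) : gam K x ≤ 4 := by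
  have := gam_sub_le (Nat.zero_le K) x
  simp only [gam, sub_zero, pow_zero, mul_one] at this
  exact (le_abs_self _).trans this

/-- the discriminant -/
def Dz (n : ℕ) : ℤ := (n:ℤ) ^ 2 - 4

open Classical in
/-- the odd part of the amplitude -/
noncomputable def Oval (n : ℕ) : ℝ :=
  ∑ v ∈ Finset.range n, if Odd v ∧ (v:ℤ) ^ 2 ∣ Dz n then Lodd (Dz n / v ^ 2) / v else 0

lemma Dz_pos {n : ℕ} (hn : 3 ≤ n) : 0 < Dz n := by
  unfold Dz; have : (3:ℤ) ≤ n := by exact_mod_cast hn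
  nlinarith

lemma Dz_lt {n : ℕ} : Dz n < (n:ℤ) ^ 2 := by unfold Dz; linarith

lemma Dz_not_square {n : ℕ} (hn : 3 ≤ n) : ¬ IsSquare (Dz n) := by
  rintro ⟨r, hr⟩
  wlog h : 0 ≤ r generalizing r
  · exact this (-r) (by rw [hr]; ring) (by omega)
  unfold Dz at hr
  have hn' : (3:ℤ) ≤ n := by exact_mod_cast hn
  have h1 : r < n := by nlinarith
  have h2 : r ≤ n - 1 := by omega
  nlinarith

lemma Dz_div_props {n : ℕ} (hn : 3 ≤ n) {d u : ℤ} (h : d * u ^ 2 = Dz n) : 0 < d ∧ ¬ IsSquare d := by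
  have h1 := Dz_pos hn
  constructor
  · rw [← h] at h1
    exact pos_of_mul_pos_left h1 (sq_nonneg u)
  · rintro ⟨r, hr⟩
    apply Dz_not_square hn
    exact ⟨r * u, by rw [← h, hr]; ring⟩

lemma Lodd_four_pow (i : ℕ) (d : ℤ) : Lodd (4 ^ i * d) = Lodd d := by
  have : Lpart (4 ^ i * d) = Lpart d := by
    funext N
    unfold Lpart
    apply Finset.sum_congr rfl
    intro q _
    have : chi (4 ^ i * d) q = chi d q := by
      by_cases hq : Odd q
      · have e : (4:ℤ) ^ i * d = (2 ^ i) ^ 2 * d := by rw [← pow_mul, mul_comm i 2, pow_mul]; norm_num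
        rw [e]
        apply chi_sq_mul
        rw [Int.natAbs_pow]
        exact Nat.Coprime.pow_left _ (Nat.coprime_two_left.2 hq)
      · simp [chi, hq]
    rw [this]
  unfold Lodd
  rw [this]

lemma odd_sq_mod8 {v : ℕ} (hv : Odd v) : ((v:ℤ) ^ 2) % 8 = 1 := by
  have h1 := Nat.odd_iff.1 hv
  have h2 : (v:ℤ) % 8 = 1 ∨ (v:ℤ) % 8 = 3 ∨ (v:ℤ) % 8 = 5 ∨ (v:ℤ) % 8 = 7 := by omega
  rcases h2 with h | h | h | h <;> simp [pow_two, Int.mul_emod, h]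

lemma c2_sq_mul {v : ℕ} (hv : Odd v) (d : ℤ) : c2 ((v:ℤ) ^ 2 * d) = c2 d := by
  have h8 : ((v:ℤ) ^ 2 * d) % 8 = d % 8 := by
    rw [Int.mul_emod, odd_sq_mod8 hv]; simp
  have h4 : ((v:ℤ) ^ 2 * d) % 4 = d % 4 := by omega
  unfold c2
  rw [h8, h4]

lemma c2_zero {d : ℤ} (h : ¬ (d % 4 = 0 ∨ d % 4 = 1)) : c2 d = 0 := by
  unfold c2
  rw [if_neg (by omega), if_neg (by omega), if_neg (by omega)]

open Classical in
lemma ampA_eq {n K : ℕ} (hn : 3 ≤ n) (hK : n ≤ K) : ampA n = gam K (Dz n) * Oval n := by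
  have hD : ((n ^ 2 - 4 : ℕ) : ℤ) = Dz n := by
    have : 4 ≤ n ^ 2 := by nlinarith
    unfold Dz; push_cast [Nat.cast_sub this]; ring
  set D : ℕ := n ^ 2 - 4 with hDdef
  have hDpos : 0 < D := by have := Dz_pos hn; omega
  have hDlt : D < n ^ 2 := by have := @Dz_lt n; rw [← hD] at this; exact_mod_cast this
  have s1 : ampA n = ∑ p ∈ (Finset.range (n ^ 2) ×ˢ Finset.range (n ^ 2)).filter
      (fun p => 0 < p.1 ∧ 0 < p.2 ∧ p.1 * p.2 ^ 2 = D), c2 (p.1 : ℤ) * Lodd (p.1 : ℤ) / p.2 := by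
    unfold ampA
    rw [Finset.sum_filter, Finset.sum_filter]
    apply Finset.sum_congr rfl
    rintro ⟨d, u⟩ _
    simp only
    by_cases h4 : d % 4 = 0 ∨ d % 4 = 1
    · by_cases h : 0 < d ∧ 0 < u ∧ d * u ^ 2 = D
      · rw [if_pos ⟨h.1, h.2.1, h4, h.2.2⟩, if_pos h]
        have hp : (d:ℤ) * (u:ℤ) ^ 2 = Dz n := by rw [← hD, ← h.2.2]; push_cast; ring
        obtain ⟨h1, h2⟩ := Dz_div_props hn hp
        rw [← classNumber_formula h1 h2 (by omega)]
        have : (((d:ℕ):ℤ):ℝ) = (d:ℝ) := by push_cast; rfl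
        rw [this, div_div, mul_comm (u:ℝ)]
      · rw [if_neg h, if_neg (by tauto)]
    · rw [if_neg (by tauto)]
      have : c2 (d:ℤ) = 0 := c2_zero (by omega)
      rw [this]; simp
  rw [s1, gam_eq, Oval, Finset.sum_mul_sum, ← Finset.sum_product']
  have s2 : ∀ p ∈ Finset.range K ×ˢ Finset.range n,
      ((if (4:ℤ) ^ p.1 ∣ Dz n then c2 (Dz n / 4 ^ p.1) / 2 ^ p.1 else 0) *
        if Odd p.2 ∧ (p.2:ℤ) ^ 2 ∣ Dz n then Lodd (Dz n / p.2 ^ 2) / p.2 else 0) =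
      if (Odd p.2 ∧ 4 ^ p.1 * p.2 ^ 2 ∣ D) then
        c2 ((D / (4 ^ p.1 * p.2 ^ 2) : ℕ) : ℤ) * Lodd ((D / (4 ^ p.1 * p.2 ^ 2) : ℕ) : ℤ) / ((2 ^ p.1 * p.2 : ℕ):ℝ) else 0 := by
    rintro ⟨i, v⟩ _
    simp only
    by_cases hv : Odd v
    · have hcop : Nat.Coprime (4 ^ i) (v ^ 2) := by
        apply Nat.Coprime.pow
        have : (4:ℕ) = 2 ^ 2 := by norm_num
        rw [this]
        exact Nat.Coprime.pow_left _ (Nat.coprime_two_left.2 hv)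
      have e1 : (4:ℤ) ^ i ∣ Dz n ↔ 4 ^ i ∣ D := by rw [← hD]; exact_mod_cast Int.natCast_dvd_natCast
      have e2 : (v:ℤ) ^ 2 ∣ Dz n ↔ v ^ 2 ∣ D := by rw [← hD]; exact_mod_cast Int.natCast_dvd_natCast
      have e3 : 4 ^ i * v ^ 2 ∣ D ↔ 4 ^ i ∣ D ∧ v ^ 2 ∣ D :=
        ⟨fun h => ⟨dvd_of_mul_right_dvd h, dvd_of_mul_left_dvd h⟩, fun h => Nat.Coprime.mul_dvd_of_dvd_of_dvd hcop h.1 h.2⟩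
      by_cases h : 4 ^ i * v ^ 2 ∣ D
      · have h' := e3.1 h
        rw [if_pos (e1.2 h'.1), if_pos ⟨hv, e2.2 h'.2⟩, if_pos ⟨hv, h⟩]
        obtain ⟨d, hd⟩ := h
        have hv0 : 0 < v := hv.pos
        rw [hd, Nat.mul_div_cancel_left _ (by positivity), ← hD, hd]
        have f1 : ((4 ^ i * v ^ 2 * d : ℕ):ℤ) / 4 ^ i = (v:ℤ) ^ 2 * d := by
          push_cast; rw [mul_assoc, Int.mul_ediv_cancel_left _ (by positivity)]
        have f2 : ((4 ^ i * v ^ 2 * d : ℕ):ℤ) / (v:ℤ) ^ 2 = 4 ^ i * d := by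
          push_cast
          rw [mul_comm ((4:ℤ) ^ i), mul_assoc, Int.mul_ediv_cancel_left _ (by positivity)]
        rw [f1, f2, c2_sq_mul hv, Lodd_four_pow]
        push_cast
        have : (v:ℝ) ≠ 0 := by positivity
        field_simp
      · have hr : ¬ (Odd v ∧ 4 ^ i * v ^ 2 ∣ D) := fun h2 => h h2.2
        rw [if_neg hr]
        by_cases h1 : 4 ^ i ∣ D
        · have hr2 : ¬ (Odd v ∧ (v:ℤ) ^ 2 ∣ Dz n) := fun h2 => h (e3.2 ⟨h1, e2.1 h2.2⟩)
          rw [if_neg hr2, mul_zero]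
        · have hr2 : ¬ ((4:ℤ) ^ i ∣ Dz n) := fun h2 => h1 (e1.1 h2)
          rw [if_neg hr2, zero_mul]
    · simp [hv]
  rw [Finset.sum_congr rfl s2, ← Finset.sum_filter]
  refine Finset.sum_nbij' (fun p => (p.2.factorization 2, p.2 / 2 ^ p.2.factorization 2))
    (fun p => (D / (4 ^ p.1 * p.2 ^ 2), 2 ^ p.1 * p.2)) ?_ ?_ ?_ ?_ ?_
  · rintro ⟨d, u⟩ h
    simp only [Finset.mem_filter, Finset.mem_product, Finset.mem_range] at h ⊢
    obtain ⟨-, hd, hu, h⟩ := h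
    have hu2 : 2 ^ u.factorization 2 * (u / 2 ^ u.factorization 2) = u := Nat.ordProj_mul_ordCompl_eq_self u 2
    have hodd : Odd (u / 2 ^ u.factorization 2) := by
      rw [← Nat.not_even_iff_odd, even_iff_two_dvd]
      exact Nat.not_dvd_ordCompl Nat.prime_two hu.ne'
    have hun : u < n := by
      have : u ^ 2 < n ^ 2 := by nlinarith
      exact lt_of_pow_lt_pow_left₀ 2 (by omega) this
    refine ⟨⟨?_, ?_⟩, hodd, ?_⟩
    · have := Nat.factorization_lt 2 hu.ne'
      omega
    · exact lt_of_le_of_lt (Nat.div_le_self _ _) hun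
    · have : 4 ^ u.factorization 2 * (u / 2 ^ u.factorization 2) ^ 2 = u ^ 2 := by
        conv_rhs => rw [← hu2]
        rw [mul_pow, ← pow_mul, mul_comm _ 2, pow_mul]; norm_num
      rw [this, ← h]; exact Dvd.intro_left _ rfl
  · rintro ⟨i, v⟩ h
    simp only [Finset.mem_filter, Finset.mem_product, Finset.mem_range] at h ⊢
    obtain ⟨-, hv, d, hd⟩ := h
    have hv0 : 0 < v := hv.pos
    rw [hd, Nat.mul_div_cancel_left _ (by positivity)]
    have hd0 : 0 < d := by
      rcases Nat.eq_zero_or_pos d with h | h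
      · subst h; omega
      · exact h
    have e : (2 ^ i * v) ^ 2 = 4 ^ i * v ^ 2 := by
      rw [mul_pow, ← pow_mul, mul_comm _ 2, pow_mul]; norm_num
    have hu0 : 0 < 2 ^ i * v := by positivity
    have e2 : D = d * (2 ^ i * v) ^ 2 := by rw [e, hd]; ring
    generalize 2 ^ i * v = u at *
    refine ⟨⟨?_, ?_⟩, hd0, hu0, ?_⟩
    · have : d ≤ d * u ^ 2 := Nat.le_mul_of_pos_right _ (by positivity)
      omega
    · have h1 : u ≤ u ^ 2 := Nat.le_self_pow two_ne_zero u
      have : u ^ 2 ≤ d * u ^ 2 := Nat.le_mul_of_pos_left _ hd0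
      omega
    · rw [← hd, e2]
  · rintro ⟨d, u⟩ h
    simp only [Finset.mem_filter, Finset.mem_product, Finset.mem_range] at h ⊢
    obtain ⟨-, hd, hu, h⟩ := h
    have hu2 : 2 ^ u.factorization 2 * (u / 2 ^ u.factorization 2) = u := Nat.ordProj_mul_ordCompl_eq_self u 2
    have : 4 ^ u.factorization 2 * (u / 2 ^ u.factorization 2) ^ 2 = u ^ 2 := by
      conv_rhs => rw [← hu2]
      rw [mul_pow, ← pow_mul, mul_comm _ 2, pow_mul]; norm_num
    rw [this, hu2, ← h, Nat.mul_div_cancel _ (by positivity)]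
  · rintro ⟨i, v⟩ h
    simp only [Finset.mem_filter, Finset.mem_product, Finset.mem_range] at h ⊢
    obtain ⟨-, hv, -⟩ := h
    have hv0 : v ≠ 0 := hv.pos.ne'
    have : (2 ^ i * v).factorization 2 = i := by
      rw [Nat.factorization_mul (by positivity) hv0, Nat.Prime.factorization_pow Nat.prime_two]
      have : v.factorization 2 = 0 := Nat.factorization_eq_zero_of_not_dvd (by
        rw [← even_iff_two_dvd, Nat.not_even_iff_odd]; exact hv)
      simp [this]
    rw [this, Nat.mul_div_cancel_left _ (by positivity)]
  · rintro ⟨d, u⟩ h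
    simp only [Finset.mem_filter, Finset.mem_product, Finset.mem_range] at h ⊢
    obtain ⟨-, hd, hu, h⟩ := h
    have hu2 : 2 ^ u.factorization 2 * (u / 2 ^ u.factorization 2) = u := Nat.ordProj_mul_ordCompl_eq_self u 2
    have : 4 ^ u.factorization 2 * (u / 2 ^ u.factorization 2) ^ 2 = u ^ 2 := by
      conv_rhs => rw [← hu2]
      rw [mul_pow, ← pow_mul, mul_comm _ 2, pow_mul]; norm_num
    rw [this, hu2, ← h, Nat.mul_div_cancel _ (by positivity)]

end VA
end

section
namespace VA

/-- average over a residue system -/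
noncomputable def av (P : ℕ) (F : ℤ → ℝ) : ℝ := (∑ x ∈ Finset.range P, F (x:ℤ)) / P

/-- periodicity -/
def Per (P : ℕ) (F : ℤ → ℝ) : Prop := ∀ x y : ℤ, x ≡ y [ZMOD P] → F x = F y

lemma Per.nat {P : ℕ} {F : ℤ → ℝ} (h : Per P F) (n : ℕ) : F ((n + P : ℕ):ℤ) = F (n:ℤ) := by
  apply h
  push_cast
  exact (Int.modEq_iff_dvd.2 ⟨-1, by ring⟩)

lemma Per.mul_right {P : ℕ} {F : ℤ → ℝ} (h : Per P F) (k : ℕ) : Per (P * k) F := by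
  intro x y hxy
  apply h
  apply hxy.of_dvd
  push_cast
  exact dvd_mul_right _ _

lemma Per.mul_left {P : ℕ} {F : ℤ → ℝ} (h : Per P F) (k : ℕ) : Per (k * P) F := by
  rw [mul_comm]; exact h.mul_right k

lemma Per.of_dvd {P Q : ℕ} {F : ℤ → ℝ} (h : Per P F) (hd : P ∣ Q) : Per Q F := by
  obtain ⟨k, rfl⟩ := hd
  exact h.mul_right k

lemma Per.const (P : ℕ) (c : ℝ) : Per P (fun _ => c) := fun _ _ _ => rfl

lemma Per.add {P : ℕ} {F G : ℤ → ℝ} (h : Per P F) (h' : Per P G) : Per P (fun x => F x + G x) := by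
  intro x y hxy; simp only [h x y hxy, h' x y hxy]

lemma Per.mul {P : ℕ} {F G : ℤ → ℝ} (h : Per P F) (h' : Per P G) : Per P (fun x => F x * G x) := by
  intro x y hxy; simp only [h x y hxy, h' x y hxy]

lemma Per.comp {P : ℕ} {F : ℤ → ℝ} (h : Per P F) (φ : ℝ → ℝ) : Per P (fun x => φ (F x)) := by
  intro x y hxy; simp only [h x y hxy]

lemma Per.ite_dvd (d : ℕ) {P : ℕ} (G : ℤ → ℝ) (h : Per P G) :
    Per (d * P) (fun x => if (d:ℤ) ∣ x then G (x / d) else 0) := by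
  intro x y hxy
  rcases Nat.eq_zero_or_pos d with rfl | hd
  · have : x = y := by
      have := hxy
      simp [Int.ModEq] at this; exact this
    rw [this]
  have h1 : x ≡ y [ZMOD d] := hxy.of_dvd (by push_cast; exact dvd_mul_right _ _)
  have h2 : (d:ℤ) ∣ x ↔ (d:ℤ) ∣ y := h1.dvd_iff
  simp only [h2]
  split_ifs with h3
  · apply h
    obtain ⟨b, rfl⟩ := h3
    obtain ⟨a, rfl⟩ := h2.2 (dvd_mul_right _ _)
    have hd' : (d:ℤ) ≠ 0 := by exact_mod_cast hd.ne'
    rw [Int.mul_ediv_cancel_left _ hd', Int.mul_ediv_cancel_left _ hd']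
    push_cast at hxy
    exact Int.ModEq.mul_left_cancel' hd' hxy
  · rfl

lemma av_congr {P : ℕ} {F G : ℤ → ℝ} (h : ∀ x : ℤ, F x = G x) : av P F = av P G := by
  have : F = G := funext h
  rw [this]

lemma av_add (P : ℕ) (F G : ℤ → ℝ) : av P (fun x => F x + G x) = av P F + av P G := by
  unfold av; rw [Finset.sum_add_distrib, add_div]

lemma av_const_mul (P : ℕ) (c : ℝ) (F : ℤ → ℝ) : av P (fun x => c * F x) = c * av P F := by
  unfold av; rw [← Finset.mul_sum, mul_div_assoc]

lemma av_const {P : ℕ} (hP : 0 < P) (c : ℝ) : av P (fun _ => c) = c := by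
  unfold av; have : (P:ℝ) ≠ 0 := by positivity
  simp; field_simp

lemma av_sum {ι : Type*} (s : Finset ι) (P : ℕ) (F : ι → ℤ → ℝ) :
    av P (fun x => ∑ i ∈ s, F i x) = ∑ i ∈ s, av P (F i) := by
  unfold av; rw [Finset.sum_comm, Finset.sum_div]

lemma av_mul_period {P : ℕ} {F : ℤ → ℝ} (h : Per P F) (k : ℕ) (hk : k ≠ 0) : av (P * k) F = av P F := by
  have := avg_mul_period (fun n => F (n:ℤ)) P (fun n => by simpa using h.nat n) k hk
  simpa [avg, av] using this

lemma av_dvd {P Q : ℕ} {F : ℤ → ℝ} (h : Per P F) (hd : P ∣ Q) (hQ : Q ≠ 0) : av Q F = av P F := by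
  obtain ⟨k, rfl⟩ := hd
  exact av_mul_period h k (by rintro rfl; simp at hQ)

lemma av_abs_le {P : ℕ} (hP : 0 < P) {F : ℤ → ℝ} {C : ℝ} (h : ∀ x, |F x| ≤ C) : |av P F| ≤ C := by
  unfold av
  rw [abs_div, Nat.abs_cast, div_le_iff₀ (by positivity)]
  refine (Finset.abs_sum_le_sum_abs _ _).trans ?_
  refine (Finset.sum_le_sum (fun (x:ℕ) _ => h (x:ℤ))).trans ?_
  simp [mul_comm]

lemma av_sub_le {P : ℕ} (hP : 0 < P) {F G : ℤ → ℝ} {C : ℝ} (h : ∀ x, |F x - G x| ≤ C) : |av P F - av P G| ≤ C := by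
  have : av P F - av P G = av P (fun x => F x - G x) := by
    unfold av; rw [Finset.sum_sub_distrib, sub_div]
  rw [this]; exact av_abs_le hP h

lemma av_nonneg {P : ℕ} {F : ℤ → ℝ} (h : ∀ x, 0 ≤ F x) : 0 ≤ av P F := by
  unfold av; exact div_nonneg (Finset.sum_nonneg fun x _ => h x) (by positivity)

/-- CRT product -/
lemma av_crt {P Q : ℕ} (hPQ : Nat.Coprime P Q) (hP : 0 < P) (hQ : 0 < Q) {F G : ℤ → ℝ} (hF : Per P F) (hG : Per Q G) :
    av (P * Q) (fun x => F x * G x) = av P F * av Q G := by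
  unfold av
  rw [div_mul_div_comm, Finset.sum_mul_sum, ← Finset.sum_product', Nat.cast_mul]
  congr 1
  apply Finset.sum_bij' (fun x _ => (x % P, x % Q)) (fun p _ => (Nat.chineseRemainder hPQ p.1 p.2 : ℕ))
  · intro x _
    simp [Nat.mod_lt, hP, hQ]
  · intro p _
    rw [Finset.mem_range]
    exact Nat.chineseRemainder_lt_mul hPQ _ _ hP.ne' hQ.ne'
  · intro x hx
    have := Nat.chineseRemainder_modEq_unique hPQ (a := x % P) (b := x % Q) (z := x) (Nat.mod_modEq _ _).symm (Nat.mod_modEq _ _).symm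
    have h2 := Nat.chineseRemainder_lt_mul hPQ (x % P) (x % Q) hP.ne' hQ.ne'
    exact (Nat.ModEq.eq_of_lt_of_lt this (Finset.mem_range.1 hx) h2).symm
  · intro p hp
    simp only [Finset.mem_product, Finset.mem_range] at hp
    have h1 := (Nat.chineseRemainder hPQ p.1 p.2).2
    ext
    · exact Nat.mod_eq_of_modEq h1.1 hp.1
    · exact Nat.mod_eq_of_modEq h1.2 hp.2
  · intro x _
    simp only
    congr 1
    · apply hF; push_cast; exact (Int.mod_modEq _ _).symm
    · apply hG; push_cast; exact (Int.mod_modEq _ _).symm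

/-- permutation invariance -/
lemma av_perm {P : ℕ} (hP : 0 < P) {F : ℤ → ℝ} (hF : Per P F) (T : ℤ → ℤ)
    (hT : ∀ x y : ℤ, T x ≡ T y [ZMOD P] → x ≡ y [ZMOD P]) :
    av P (fun x => F (T x)) = av P F := by
  have hP' : (0:ℤ) < P := by exact_mod_cast hP
  unfold av
  congr 1
  have key : ∀ x : ℕ, F (T x) = F (((T x % P).toNat : ℕ) : ℤ) := by
    intro x
    rw [Int.toNat_of_nonneg (Int.emod_nonneg _ hP'.ne')]
    exact hF _ _ (Int.mod_modEq _ _).symm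
  have hmaps : ∀ x ∈ Finset.range P, (T x % P).toNat ∈ Finset.range P := by
    intro x _
    rw [Finset.mem_range]
    have := Int.emod_lt_of_pos (T x) hP'
    have := Int.emod_nonneg (T x) hP'.ne'
    omega
  have hinj : Set.InjOn (fun x : ℕ => (T x % P).toNat) (Finset.range P) := by
    intro x hx y hy hxy
    simp only [Finset.coe_range, Set.mem_Iio] at hx hy
    simp only at hxy
    have a1 := Int.emod_nonneg (T x) hP'.ne'
    have a2 := Int.emod_nonneg (T y) hP'.ne'
    have h1 : T x % P = T y % P := by omega
    have h2 := hT _ _ h1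
    have h3 : x ≡ y [MOD P] := by exact_mod_cast (Int.natCast_modEq_iff).1 h2
    exact Nat.ModEq.eq_of_lt_of_lt h3 hx hy
  have himg : (Finset.range P).image (fun x : ℕ => (T x % P).toNat) = Finset.range P := by
    apply Finset.eq_of_subset_of_card_le
    · intro y hy
      obtain ⟨x, hx, rfl⟩ := Finset.mem_image.1 hy
      exact hmaps x hx
    · rw [Finset.card_image_of_injOn hinj]
  rw [Finset.sum_congr rfl (fun x _ => key x)]
  conv_rhs => rw [← himg]
  rw [Finset.sum_image hinj]

/-- dilation -/
lemma av_dil {d B : ℕ} (hd : 0 < d) (G : ℤ → ℝ) :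
    av (d * B) (fun x => if (d:ℤ) ∣ x then G (x / d) else 0) = av B G / d := by
  unfold av
  rw [← Finset.sum_filter, div_div, Nat.cast_mul, mul_comm (B:ℝ)]
  congr 1
  symm
  apply Finset.sum_bij (fun x _ => d * x)
  · intro x hx
    rw [Finset.mem_range] at hx
    rw [Finset.mem_filter, Finset.mem_range]
    exact ⟨Nat.mul_lt_mul_of_pos_left hx hd, by push_cast; exact dvd_mul_right _ _⟩
  · intro x _ y _ h
    exact Nat.eq_of_mul_eq_mul_left hd h
  · intro y hy
    rw [Finset.mem_filter, Finset.mem_range] at hy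
    obtain ⟨k, hk⟩ := Int.natCast_dvd_natCast.1 hy.2
    refine ⟨k, ?_, hk.symm⟩
    rw [Finset.mem_range]
    rw [hk] at hy
    exact Nat.lt_of_mul_lt_mul_left hy.1
  · intro x _
    push_cast
    rw [Int.mul_ediv_cancel_left]
    exact_mod_cast hd.ne'

lemma av_ind {d B : ℕ} (hd : 0 < d) (hB : 0 < B) :
    av (d * B) (fun x => if (d:ℤ) ∣ x then 1 else 0) = 1 / d := by
  rw [av_dil hd (fun _ => 1), av_const hB]

end VA
end

section
namespace VA

/-- the Dirichlet coefficients of the odd part -/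
noncomputable def lam (D : ℤ) (m : ℕ) : ℝ :=
  ∑ u ∈ m.divisors, if Odd m ∧ (u:ℤ) ^ 2 ∣ D then (chi (D / (u:ℤ) ^ 2) (m / u) : ℝ) else 0

lemma lam_one (D : ℤ) : lam D 1 = 1 := by simp [lam, chi_one]

lemma lam_even {m : ℕ} (h : ¬ Odd m) (D : ℤ) : lam D m = 0 := by simp [lam, h]

lemma lam_abs_le (D : ℤ) (m : ℕ) : |lam D m| ≤ m.divisors.card := by
  unfold lam
  refine (Finset.abs_sum_le_sum_abs _ _).trans ?_
  have : ∀ u ∈ m.divisors, |if Odd m ∧ (u:ℤ) ^ 2 ∣ D then (chi (D / (u:ℤ) ^ 2) (m / u) : ℝ) else 0| ≤ 1 := by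
    intro u _
    split_ifs
    · exact chi_abs_le_real _ _
    · simp
  refine (Finset.sum_le_sum this).trans ?_
  simp

lemma lam_abs_le' (D : ℤ) (m : ℕ) : |lam D m| ≤ m :=
  (lam_abs_le D m).trans (by exact_mod_cast Nat.card_divisors_le_self m)

lemma lam_congr {m : ℕ} {D E : ℤ} (h : D ≡ E [ZMOD ((m ^ 2 : ℕ):ℤ)]) : lam D m = lam E m := by
  unfold lam
  apply Finset.sum_congr rfl
  intro u hu
  obtain ⟨k, rfl⟩ := Nat.dvd_of_mem_divisors hu
  have hm0 := (Nat.mem_divisors.1 hu).2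
  have hu0 : u ≠ 0 := by rintro rfl; simp at hm0
  have h1 : (u:ℤ) ^ 2 ∣ D ↔ (u:ℤ) ^ 2 ∣ E := by
    have : D ≡ E [ZMOD (u:ℤ) ^ 2] := h.of_dvd (by push_cast; exact ⟨k ^ 2, by ring⟩)
    exact this.dvd_iff
  simp only [h1]
  split_ifs with h2
  · congr 1
    apply chi_congr
    obtain ⟨e, rfl⟩ := h2.2
    obtain ⟨d, rfl⟩ := h1.2 (dvd_mul_right _ _)
    have hu' : (u:ℤ) ^ 2 ≠ 0 := by positivity
    rw [Int.mul_ediv_cancel_left _ hu', Int.mul_ediv_cancel_left _ hu', Nat.mul_div_cancel_left _ (Nat.pos_of_ne_zero hu0)]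
    have e1 : (((u * k) ^ 2 : ℕ):ℤ) = (u:ℤ) ^ 2 * (k:ℤ) ^ 2 := by push_cast; ring
    rw [e1] at h
    exact (Int.ModEq.mul_left_cancel' hu' h).of_dvd (dvd_pow_self _ (by norm_num))
  · rfl

lemma coprime_sum_divisors {a b : ℕ} (h : Nat.Coprime a b) (f : ℕ → ℝ) :
    ∑ u ∈ (a * b).divisors, f u = ∑ u ∈ a.divisors, ∑ w ∈ b.divisors, f (u * w) := by
  rw [← Finset.sum_product', Nat.divisors_mul, Finset.mul_def, Finset.sum_image h.mul_injOn_divisors]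

lemma lam_mul {a b : ℕ} (h : Nat.Coprime a b) (D : ℤ) : lam D (a * b) = lam D a * lam D b := by
  unfold lam
  rw [coprime_sum_divisors h, Finset.sum_mul_sum]
  apply Finset.sum_congr rfl
  intro u hu
  apply Finset.sum_congr rfl
  intro w hw
  obtain ⟨k, hk⟩ := Nat.dvd_of_mem_divisors hu
  obtain ⟨l, hl⟩ := Nat.dvd_of_mem_divisors hw
  have ha0 := (Nat.mem_divisors.1 hu).2
  have hb0 := (Nat.mem_divisors.1 hw).2
  have hu0 : u ≠ 0 := by rintro rfl; simp at hk; exact ha0 hk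
  have hw0 : w ≠ 0 := by rintro rfl; simp at hl; exact hb0 hl
  have huw : Nat.Coprime u w := Nat.Coprime.of_dvd (Dvd.intro _ hk.symm) (Dvd.intro _ hl.symm) h
  have hul : Nat.Coprime u l := Nat.Coprime.of_dvd (Dvd.intro _ hk.symm) (Dvd.intro_left _ hl.symm) h
  have hwk : Nat.Coprime w k := Nat.Coprime.of_dvd (Dvd.intro _ hl.symm) (Dvd.intro_left _ hk.symm) h.symm
  have e1 : a / u = k := by rw [hk, Nat.mul_div_cancel_left _ (Nat.pos_of_ne_zero hu0)]
  have e2 : b / w = l := by rw [hl, Nat.mul_div_cancel_left _ (Nat.pos_of_ne_zero hw0)]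
  have e3 : a * b / (u * w) = k * l := by
    rw [hk, hl, show u * k * (w * l) = u * w * (k * l) by ring, Nat.mul_div_cancel_left _ (by positivity)]
  rw [e1, e2, e3]
  simp only [Nat.odd_mul]
  have hcop : IsCoprime ((u:ℤ) ^ 2) ((w:ℤ) ^ 2) := IsCoprime.pow (Nat.isCoprime_iff_coprime.2 huw)
  have hd : (((u * w : ℕ):ℤ)) ^ 2 ∣ D ↔ (u:ℤ) ^ 2 ∣ D ∧ (w:ℤ) ^ 2 ∣ D := by
    push_cast; rw [mul_pow]
    exact ⟨fun h => ⟨dvd_of_mul_right_dvd h, dvd_of_mul_left_dvd h⟩, fun h => hcop.mul_dvd h.1 h.2⟩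
  by_cases hc : (Odd a ∧ Odd b) ∧ (((u * w : ℕ):ℤ)) ^ 2 ∣ D
  · have hc2 := hd.1 hc.2
    rw [if_pos hc, if_pos ⟨hc.1.1, hc2.1⟩, if_pos ⟨hc.1.2, hc2.2⟩]
    obtain ⟨x, hx⟩ := hc.2
    have g1 : D / (((u * w : ℕ):ℤ)) ^ 2 = x := by
      rw [hx, Int.mul_ediv_cancel_left _ (by positivity)]
    have g2 : D / (u:ℤ) ^ 2 = (w:ℤ) ^ 2 * x := by
      rw [hx]; push_cast
      rw [show ((u:ℤ) * w) ^ 2 * x = (u:ℤ) ^ 2 * ((w:ℤ) ^ 2 * x) by ring, Int.mul_ediv_cancel_left _ (by positivity)]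
    have g3 : D / (w:ℤ) ^ 2 = (u:ℤ) ^ 2 * x := by
      rw [hx]; push_cast
      rw [show ((u:ℤ) * w) ^ 2 * x = (w:ℤ) ^ 2 * ((u:ℤ) ^ 2 * x) by ring, Int.mul_ediv_cancel_left _ (by positivity)]
    rw [g1, g2, g3, chi_sq_mul (by simpa using hwk), chi_sq_mul (by simpa using hul), chi_mul]
    push_cast; rfl
  · rw [if_neg hc]
    rw [hd] at hc
    by_cases h1 : Odd a ∧ (u:ℤ) ^ 2 ∣ D
    · by_cases h2 : Odd b ∧ (w:ℤ) ^ 2 ∣ D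
      · exact absurd ⟨⟨h1.1, h2.1⟩, h1.2, h2.2⟩ hc
      · rw [if_neg h2, mul_zero]
    · rw [if_neg h1, zero_mul]

lemma lam_prime_pow {p : ℕ} (hp : p.Prime) (h2 : p ≠ 2) (D : ℤ) (a : ℕ) :
    lam D (p ^ a) = ∑ j ∈ Finset.range (a + 1),
      if (p:ℤ) ^ (2 * j) ∣ D then (chi (D / (p:ℤ) ^ (2 * j)) p : ℝ) ^ (a - j) else 0 := by
  have hodd : Odd (p ^ a) := (hp.odd_of_ne_two h2).pow
  unfold lam
  rw [Nat.sum_divisors_prime_pow hp]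
  apply Finset.sum_congr rfl
  intro j hj
  rw [Finset.mem_range] at hj
  have e : (((p ^ j : ℕ):ℤ)) ^ 2 = (p:ℤ) ^ (2 * j) := by push_cast; rw [← pow_mul, mul_comm]
  rw [e, Nat.pow_div (by omega) hp.pos]
  simp only [hodd, true_and]
  have : ∀ (x : ℤ) (k : ℕ), chi x (p ^ k) = chi x p ^ k := by
    intro x k
    induction k with
    | zero => simp [chi_one]
    | succ k ih => rw [pow_succ, chi_mul, ih, pow_succ]
  rw [this]
  push_cast; rfl

/-- conv multiplicativity -/
noncomputable def cv (h : ℕ → ℕ → ℝ) (N : ℕ) : ℝ := ∑ u ∈ N.divisors, h u (N / u)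

lemma cv_mul (h : ℕ → ℕ → ℝ)
    (hh : ∀ a b c d : ℕ, Nat.Coprime (a * b) (c * d) → h (a * c) (b * d) = h a b * h c d)
    {M N : ℕ} (hMN : Nat.Coprime M N) : cv h (M * N) = cv h M * cv h N := by
  unfold cv
  rw [coprime_sum_divisors hMN, Finset.sum_mul_sum]
  apply Finset.sum_congr rfl
  intro u hu
  apply Finset.sum_congr rfl
  intro w hw
  have h1 := Nat.dvd_of_mem_divisors hu
  have h2 := Nat.dvd_of_mem_divisors hw
  rw [← hh _ _ _ _ (by rw [Nat.mul_div_cancel' h1, Nat.mul_div_cancel' h2]; exact hMN), Nat.div_mul_div_comm h1 h2]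

lemma hyper_sum (Z : ℕ) (f : ℕ → ℕ → ℝ) :
    ∑ m ∈ Finset.Icc 1 Z, ∑ u ∈ m.divisors, f u (m / u) =
      ∑ u ∈ Finset.Icc 1 Z, ∑ q ∈ Finset.Icc 1 (Z / u), f u q := by
  rw [Finset.sum_sigma', Finset.sum_sigma']
  apply Finset.sum_nbij' (fun x => ⟨x.2, x.1 / x.2⟩) (fun x => ⟨x.1 * x.2, x.1⟩)
  · rintro ⟨m, u⟩ h
    simp only [Finset.mem_sigma, Finset.mem_Icc, Nat.mem_divisors] at h ⊢
    obtain ⟨⟨h1, h2⟩, ⟨k, rfl⟩, h0⟩ := h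
    have hu : 0 < u := Nat.pos_of_ne_zero (by rintro rfl; simp at h0)
    have hk : 0 < k := Nat.pos_of_ne_zero (by rintro rfl; simp at h0)
    rw [Nat.mul_div_cancel_left _ hu]
    refine ⟨⟨hu, ?_⟩, hk, ?_⟩
    · nlinarith
    · rw [Nat.le_div_iff_mul_le hu]; rw [mul_comm]; exact h2
  · rintro ⟨u, q⟩ h
    simp only [Finset.mem_sigma, Finset.mem_Icc, Nat.mem_divisors] at h ⊢
    obtain ⟨⟨h1, h2⟩, h3, h4⟩ := h
    rw [Nat.le_div_iff_mul_le (by omega)] at h4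
    refine ⟨⟨Nat.mul_pos h1 h3, by rw [mul_comm]; exact h4⟩, dvd_mul_right _ _, ?_⟩
    positivity
  · rintro ⟨m, u⟩ h
    simp only [Finset.mem_sigma, Finset.mem_Icc, Nat.mem_divisors] at h ⊢
    rw [Nat.mul_div_cancel' h.2.1]
  · rintro ⟨u, q⟩ h
    simp only [Finset.mem_sigma, Finset.mem_Icc] at h ⊢
    rw [Nat.mul_div_cancel_left _ (by omega)]
  · rintro ⟨m, u⟩ h
    rfl

/-- truncated odd part -/
noncomputable def OZ (Z : ℕ) (D : ℤ) : ℝ := ∑ m ∈ Finset.Icc 1 Z, lam D m / m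

lemma Lpart_Icc (d : ℤ) (N : ℕ) : Lpart d (N + 1) = ∑ q ∈ Finset.Icc 1 N, (chi d q : ℝ) / q := by
  unfold Lpart
  rw [Finset.sum_range_eq_add_Ico _ (by omega)]
  simp [chi_zero]
  rfl

lemma OZ_eq (Z : ℕ) (D : ℤ) : OZ Z D = ∑ v ∈ Finset.Icc 1 Z,
    if Odd v ∧ (v:ℤ) ^ 2 ∣ D then Lpart (D / (v:ℤ) ^ 2) (Z / v + 1) / v else 0 := by
  obtain ⟨f, hf⟩ : ∃ f : ℕ → ℕ → ℝ, f = fun u q : ℕ => if Odd u ∧ (u:ℤ) ^ 2 ∣ D then (chi (D / (u:ℤ) ^ 2) q : ℝ) / q / u else 0 := ⟨_, rfl⟩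
  have h1 : OZ Z D = ∑ m ∈ Finset.Icc 1 Z, ∑ u ∈ m.divisors, f u (m / u) := by
    unfold OZ lam
    apply Finset.sum_congr rfl
    intro m hm
    rw [Finset.sum_div]
    apply Finset.sum_congr rfl
    intro u hu
    obtain ⟨k, rfl⟩ := Nat.dvd_of_mem_divisors hu
    have h0 := (Nat.mem_divisors.1 hu).2
    have hu0 : 0 < u := Nat.pos_of_ne_zero (by rintro rfl; simp at h0)
    simp only [hf, Nat.mul_div_cancel_left _ hu0, Nat.odd_mul]
    by_cases hk : Odd k
    · simp only [hk, and_true]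
      split_ifs
      · push_cast; rw [div_div, mul_comm]
      · simp
    · simp [hk, chi]
  rw [h1, hyper_sum]
  apply Finset.sum_congr rfl
  intro v _
  simp only [hf]
  split_ifs
  · rw [Lpart_Icc, Finset.sum_div]
  · simp

end VA
end

section
namespace VA

lemma modEq_cancel {c P x y : ℤ} (hc : IsCoprime P c) (h : c * x ≡ c * y [ZMOD P]) : x ≡ y [ZMOD P] := by
  rw [Int.modEq_iff_dvd] at h ⊢
  rw [← mul_sub] at h
  exact hc.dvd_of_dvd_mul_left h

lemma sum_range_zmod (p : ℕ) [NeZero p] (f : ZMod p → ℤ) :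
    ∑ x ∈ Finset.range p, f ((x:ℕ) : ZMod p) = ∑ a : ZMod p, f a := by
  apply Finset.sum_bij' (fun x _ => ((x:ℕ) : ZMod p)) (fun a _ => a.val)
  · intro x _; exact Finset.mem_univ _
  · intro a _; rw [Finset.mem_range]; exact ZMod.val_lt a
  · intro x hx; rw [Finset.mem_range] at hx; exact ZMod.val_cast_of_lt hx
  · intro a _; exact ZMod.natCast_zmod_val a
  · intro x _; rfl

lemma chi_quad {p : ℕ} [Fact p.Prime] (h2 : p ≠ 2) (x : ℤ) : chi x p = quadraticChar (ZMod p) (x : ZMod p) := by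
  have hp := Fact.out (p := p.Prime)
  unfold chi
  rw [if_pos (hp.odd_of_ne_two h2), ← jacobiSym.legendreSym.to_jacobiSym, legendreSym]

lemma Per_chi (p : ℕ) : Per p (fun x => (chi x p : ℝ)) := by
  intro x y h
  simp only [chi_congr h]

lemma av_chi {p : ℕ} (hp : p.Prime) (h2 : p ≠ 2) : av p (fun x => (chi x p : ℝ)) = 0 := by
  have := Fact.mk hp
  unfold av
  have h := sum_range_zmod p (fun a => quadraticChar (ZMod p) a)
  rw [quadraticChar_sum_zero (by rw [ZMod.ringChar_zmod_n]; exact h2)] at h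
  have : ∑ x ∈ Finset.range p, (chi (x:ℤ) p : ℝ) = ((∑ x ∈ Finset.range p, quadraticChar (ZMod p) ((x:ℕ) : ZMod p) : ℤ) : ℝ) := by
    push_cast
    apply Finset.sum_congr rfl
    intro x _
    rw [chi_quad h2]; simp
  rw [this, h]; simp

lemma chi_neg_one_sq {p : ℕ} (hp : p.Prime) (h2 : p ≠ 2) : chi (-1) p * chi (-1) p = 1 := by
  rw [← chi_mul_left]
  have h : Nat.Coprime (1:ℤ).natAbs p := by simp
  have := chi_sq_mul (d := 1) (u := 1) h
  unfold chi
  simp [hp.odd_of_ne_two h2]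

lemma Per_Dq {P : ℕ} {F : ℤ → ℝ} (h : Per P F) : Per P (fun n => F (n ^ 2 - 4)) := by
  intro x y hxy
  exact h _ _ ((hxy.pow 2).sub rfl)

lemma av_chi_Dq {p : ℕ} (hp : p.Prime) (h2 : p ≠ 2) : av p (fun n => (chi (n ^ 2 - 4) p : ℝ)) = -1 / p := by
  have := Fact.mk hp
  have hodd := hp.odd_of_ne_two h2
  rw [← av_perm hp.pos (Per_Dq (Per_chi p)) (fun x => 4 * x - 2)]
  swap
  · intro x y hxy
    have h1 : 4 * x ≡ 4 * y [ZMOD p] := by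
      have := hxy.add_right 2
      simpa using this
    have hc : IsCoprime (p:ℤ) 4 := by
      have : Nat.Coprime p 4 := (Nat.Coprime.pow_right 2 (Nat.coprime_two_right.2 hodd))
      exact_mod_cast Nat.isCoprime_iff_coprime.2 this
    exact modEq_cancel hc h1
  have e : ∀ x : ℤ, (chi ((4 * x - 2) ^ 2 - 4) p : ℝ) = ((chi (-1) p * (quadraticChar (ZMod p) (x : ZMod p) * quadraticChar (ZMod p) (1 - (x : ZMod p))) : ℤ) : ℝ) := by
    intro x
    congr 1
    have : (4 * x - 2) ^ 2 - 4 = 4 ^ 2 * (-1 * (x * (1 - x))) := by ring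
    rw [this, chi_sq_mul, chi_mul_left, chi_mul_left, chi_quad h2 x, chi_quad h2 (1 - x)]
    · push_cast; rfl
    · exact Nat.Coprime.pow_left 2 (Nat.coprime_two_left.2 hodd)
  rw [av_congr e]
  unfold av
  congr 1
  have h := sum_range_zmod p (fun a => quadraticChar (ZMod p) a * quadraticChar (ZMod p) (1 - a))
  have hJ := jacobiSum_nontrivial_inv (χ := quadraticChar (ZMod p)) (quadraticChar_ne_one (by rw [ZMod.ringChar_zmod_n]; exact h2))
  rw [(quadraticChar_isQuadratic (ZMod p)).inv, jacobiSum] at hJ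
  rw [hJ] at h
  have e2 : quadraticChar (ZMod p) (-1) = chi (-1) p := by rw [chi_quad h2]; simp
  rw [e2] at h
  have : ∑ x ∈ Finset.range p, chi (-1) p * (quadraticChar (ZMod p) ((x:ℤ) : ZMod p) * quadraticChar (ZMod p) (1 - ((x:ℤ) : ZMod p))) = -1 := by
    rw [← Finset.mul_sum]
    have h3 := chi_neg_one_sq hp h2
    simp only [Int.cast_natCast]
    rw [h]; linarith
  have h9 := congrArg (fun z : ℤ => (z:ℝ)) this
  simp only [Int.cast_sum] at h9
  refine h9.trans ?_
  simp

lemma chi_sq_real {p : ℕ} (hp : p.Prime) (h2 : p ≠ 2) (x : ℤ) : (chi x p : ℝ) ^ 2 = 1 - if (p:ℤ) ∣ x then 1 else 0 := by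
  have := Fact.mk hp
  rw [chi_quad h2]
  split_ifs with h
  · rw [(ZMod.intCast_zmod_eq_zero_iff_dvd x p).2 h]; simp
  · have h0 : (x : ZMod p) ≠ 0 := fun h' => h ((ZMod.intCast_zmod_eq_zero_iff_dvd x p).1 h')
    have := quadraticChar_sq_one h0
    rw [sub_zero]
    exact_mod_cast this

lemma chi_of_dvd {p : ℕ} (hp : p.Prime) {x : ℤ} (h : (p:ℤ) ∣ x) : chi x p = 0 := by
  apply chi_eq_zero_of_not_coprime
  rw [Nat.coprime_comm, hp.coprime_iff_not_dvd, not_not]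
  exact Int.natCast_dvd.1 h

end VA
end

section
namespace VA

/-- mean of products of two coefficients -/
noncomputable def Mm (a b : ℕ) : ℝ := av ((a * b) ^ 2) (fun n => lam (n ^ 2 - 4) a * lam (n ^ 2 - 4) b)

lemma Per_lam (m : ℕ) : Per (m ^ 2) (fun x => lam x m) := by
  intro x y h
  exact lam_congr h

lemma Per_lam2 (a b : ℕ) : Per ((a * b) ^ 2) (fun n => lam (n ^ 2 - 4) a * lam (n ^ 2 - 4) b) := by
  apply Per.mul
  · exact Per_Dq ((Per_lam a).of_dvd ⟨b ^ 2, by ring⟩)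
  · exact Per_Dq ((Per_lam b).of_dvd ⟨a ^ 2, by ring⟩)

lemma Mm_eq {a b Q : ℕ} (h : (a * b) ^ 2 ∣ Q) (hQ : Q ≠ 0) :
    av Q (fun n => lam (n ^ 2 - 4) a * lam (n ^ 2 - 4) b) = Mm a b :=
  av_dvd (Per_lam2 a b) h hQ

lemma Mm_mul (a b c d : ℕ) (h : Nat.Coprime (a * b) (c * d)) : Mm (a * c) (b * d) = Mm a b * Mm c d := by
  rcases Nat.eq_zero_or_pos (a * b) with h0 | h0
  · have e : ∀ x y, x * y = 0 → Mm x y = 0 := by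
      intro x y hxy; unfold Mm av; simp [hxy]
    rw [e a b h0, e (a * c) (b * d), zero_mul]
    rw [show a * c * (b * d) = a * b * (c * d) by ring, h0, zero_mul]
  rcases Nat.eq_zero_or_pos (c * d) with h1 | h1
  · have e : ∀ x y, x * y = 0 → Mm x y = 0 := by
      intro x y hxy; unfold Mm av; simp [hxy]
    rw [e c d h1, e (a * c) (b * d), mul_zero]
    rw [show a * c * (b * d) = a * b * (c * d) by ring, h1, mul_zero]
  have hac : Nat.Coprime a c := Nat.Coprime.of_dvd (dvd_mul_right _ _) (dvd_mul_right _ _) h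
  have hbd : Nat.Coprime b d := Nat.Coprime.of_dvd (dvd_mul_left _ _) (dvd_mul_left _ _) h
  unfold Mm
  rw [← av_crt (Nat.Coprime.pow 2 2 h) (by positivity) (by positivity) (Per_lam2 a b) (Per_lam2 c d)]
  rw [show (a * c * (b * d)) ^ 2 = (a * b) ^ 2 * (c * d) ^ 2 by ring]
  apply av_congr
  intro x
  rw [lam_mul hac, lam_mul hbd]; ring

lemma Mm_one : Mm 1 1 = 1 := by
  unfold Mm
  simp only [lam_one]
  rw [av_const (by norm_num)]; norm_num

lemma Mm_comm (a b : ℕ) : Mm a b = Mm b a := by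
  unfold Mm
  rw [mul_comm a b]
  exact av_congr fun x => mul_comm _ _

lemma Mm_even {a b : ℕ} (h : ¬ (Odd a ∧ Odd b)) : Mm a b = 0 := by
  unfold Mm
  have : ∀ x : ℤ, lam (x ^ 2 - 4) a * lam (x ^ 2 - 4) b = 0 := by
    intro x
    by_cases ha : Odd a
    · rw [lam_even (by tauto : ¬ Odd b), mul_zero]
    · rw [lam_even ha, zero_mul]
  rw [av_congr this]; simp [av]

lemma Mm_abs_le (a b : ℕ) : |Mm a b| ≤ a.divisors.card * b.divisors.card := by
  rcases Nat.eq_zero_or_pos ((a * b) ^ 2) with h0 | h0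
  · unfold Mm av; simp [h0]; positivity
  · apply av_abs_le h0
    intro x
    rw [abs_mul]
    exact mul_le_mul (lam_abs_le _ _) (lam_abs_le _ _) (abs_nonneg _) (by positivity)

lemma not_both_dvd {p : ℕ} (hp : p.Prime) (h2 : p ≠ 2) {x : ℤ} : ¬ ((p:ℤ) ∣ (x - 2) ∧ (p:ℤ) ∣ (x + 2)) := by
  rintro ⟨h1, h3⟩
  have : (p:ℤ) ∣ 4 := by have := dvd_sub h3 h1; ring_nf at this; exact this
  have h4 : p ∣ 2 ^ 2 := by exact_mod_cast this
  exact h2 ((Nat.prime_dvd_prime_iff_eq hp Nat.prime_two).1 (hp.dvd_of_dvd_pow h4))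

/-- splitting divisibility of x^2-4 -/
lemma dvd_Dq {p : ℕ} (hp : p.Prime) (h2 : p ≠ 2) (k : ℕ) (x : ℤ) :
    (p:ℤ) ^ k ∣ x ^ 2 - 4 ↔ (p:ℤ) ^ k ∣ x - 2 ∨ (p:ℤ) ^ k ∣ x + 2 := by
  have e : x ^ 2 - 4 = (x - 2) * (x + 2) := by ring
  have hpi : Prime (p:ℤ) := Nat.prime_iff_prime_int.1 hp
  rw [e]
  constructor
  · intro h
    by_cases h1 : (p:ℤ) ∣ x - 2
    · left
      have h3 : ¬ (p:ℤ) ∣ x + 2 := fun h3 => not_both_dvd hp h2 ⟨h1, h3⟩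
      have : IsCoprime ((p:ℤ) ^ k) (x + 2) := IsCoprime.pow_left ((hpi.coprime_iff_not_dvd).2 h3)
      exact this.dvd_of_dvd_mul_right h
    · right
      have : IsCoprime ((p:ℤ) ^ k) (x - 2) := IsCoprime.pow_left ((hpi.coprime_iff_not_dvd).2 h1)
      exact this.dvd_of_dvd_mul_left h
  · rintro (h | h)
    · exact dvd_mul_of_dvd_left h _
    · exact dvd_mul_of_dvd_right h _

/-- averages over p^k | x^2-4 -/
lemma av_dvd_Dq {p : ℕ} (hp : p.Prime) (h2 : p ≠ 2) {k B : ℕ} (hk : k ≠ 0) (hB : 0 < B) (F : ℤ → ℝ) (hF : Per (p ^ k * B) F) :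
    av (p ^ k * B) (fun x => if (p:ℤ) ^ k ∣ x ^ 2 - 4 then F x else 0) =
      (av B (fun y => F (2 + p ^ k * y)) + av B (fun y => F (-2 + p ^ k * y))) / p ^ k := by
  have hpk : 0 < p ^ k := pow_pos hp.pos k
  have e : ∀ x : ℤ, (if (p:ℤ) ^ k ∣ x ^ 2 - 4 then F x else 0) =
      (if (p:ℤ) ^ k ∣ x - 2 then F x else 0) + (if (p:ℤ) ^ k ∣ x + 2 then F x else 0) := by
    intro x
    have h := dvd_Dq hp h2 k x
    have h3 : ¬ ((p:ℤ) ^ k ∣ x - 2 ∧ (p:ℤ) ^ k ∣ x + 2) := fun h3 =>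
      not_both_dvd hp h2 ⟨(dvd_pow_self _ hk).trans h3.1, (dvd_pow_self _ hk).trans h3.2⟩
    by_cases h1 : (p:ℤ) ^ k ∣ x - 2
    · have h4 : ¬ (p:ℤ) ^ k ∣ x + 2 := fun h4 => h3 ⟨h1, h4⟩
      rw [if_pos h1, if_neg h4, if_pos (h.2 (Or.inl h1)), add_zero]
    · by_cases h4 : (p:ℤ) ^ k ∣ x + 2
      · rw [if_neg h1, if_pos h4, if_pos (h.2 (Or.inr h4)), zero_add]
      · rw [if_neg h1, if_neg h4, if_neg (by tauto), add_zero]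
  rw [av_congr e, av_add, add_div]
  have key : ∀ c : ℤ, av (p ^ k * B) (fun x => if (p:ℤ) ^ k ∣ x - c then F x else 0) = av B (fun y => F (c + p ^ k * y)) / p ^ k := by
    intro c
    have hd := av_dil hpk (B := B) (fun y => F (c + p ^ k * y))
    push_cast at hd
    rw [← hd]
    have hG : Per (p ^ k * B) (fun x => if (p:ℤ) ^ k ∣ x - c then F x else 0) := by
      intro x y hxy
      have h1 : x - c ≡ y - c [ZMOD (p:ℤ) ^ k] := (hxy.of_dvd (by push_cast; exact dvd_mul_right _ _)).sub rfl
      simp only [h1.dvd_iff, hF x y hxy]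
    rw [← av_perm (by positivity) hG (fun x => c + x)]
    · apply av_congr
      intro x
      have : c + x - c = x := by ring
      rw [this]
      split_ifs with h
      · rw [Int.mul_ediv_cancel' h]
      · rfl
    · intro x y hxy
      exact Int.ModEq.add_left_cancel' c hxy
  rw [key 2]
  have := key (-2)
  simp only [sub_neg_eq_add] at this
  rw [this]

lemma lam_prime {p : ℕ} (hp : p.Prime) (h2 : p ≠ 2) (D : ℤ) :
    lam D p = chi D p + if (p:ℤ) ^ 2 ∣ D then 1 else 0 := by
  have := lam_prime_pow hp h2 D 1
  rw [pow_one] at this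
  rw [this, Finset.sum_range_succ, Finset.sum_range_one]
  simp

lemma Mm_prime {p : ℕ} (hp : p.Prime) (h2 : p ≠ 2) : Mm p 1 = -1 / p + 2 / p ^ 2 := by
  have hp0 : (p:ℝ) ≠ 0 := by exact_mod_cast hp.ne_zero
  unfold Mm
  have e : ∀ n : ℤ, lam (n ^ 2 - 4) p * lam (n ^ 2 - 4) 1 = chi (n ^ 2 - 4) p + if (p:ℤ) ^ 2 ∣ (n ^ 2 - 4) then 1 else 0 := by
    intro n; rw [lam_one, mul_one, lam_prime hp h2]
  rw [av_congr e, av_add, mul_one]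
  congr 1
  · rw [av_dvd (Per_Dq (Per_chi p)) (dvd_pow_self p (by norm_num)) (by positivity [hp.pos] ), av_chi_Dq hp h2]
  · have := av_dvd_Dq hp h2 (k := 2) (B := 1) (by norm_num) (by norm_num) (fun _ => 1) (Per.const _ _)
    rw [mul_one] at this
    rw [this, av_const (by norm_num)]
    norm_num

/-- the Euler terms -/
noncomputable def hM (a b : ℕ) : ℝ := Mm a b / (a * b)

lemma hM_mul (a b c d : ℕ) (h : Nat.Coprime (a * b) (c * d)) : hM (a * c) (b * d) = hM a b * hM c d := by
  unfold hM; rw [Mm_mul a b c d h, div_mul_div_comm]; push_cast; ring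

lemma ahM_mul (a b c d : ℕ) (h : Nat.Coprime (a * b) (c * d)) : |hM (a * c) (b * d)| = |hM a b| * |hM c d| := by
  rw [hM_mul a b c d h, abs_mul]

/-- absolute Euler terms -/
noncomputable def aF : ℕ → ℝ := cv (fun a b => |hM a b|)

lemma aF_nonneg (n : ℕ) : 0 ≤ aF n := by
  unfold aF cv; exact Finset.sum_nonneg fun _ _ => abs_nonneg _

lemma aF_one : aF 1 = 1 := by simp [aF, cv, hM, Mm_one]

lemma aF_mul {m n : ℕ} (h : Nat.Coprime m n) : aF (m * n) = aF m * aF n := cv_mul _ ahM_mul h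

lemma aF_pow {p : ℕ} (hp : p.Prime) (e : ℕ) : aF (p ^ e) ≤ ((e:ℝ) + 1) ^ 3 / p ^ e := by
  unfold aF cv
  rw [Nat.sum_divisors_prime_pow hp]
  have hp0 : (0:ℝ) < p := by exact_mod_cast hp.pos
  have : ∀ j ∈ Finset.range (e + 1), |hM (p ^ j) (p ^ e / p ^ j)| ≤ ((e:ℝ) + 1) ^ 2 / p ^ e := by
    intro j hj
    rw [Finset.mem_range] at hj
    rw [Nat.pow_div (by omega) hp.pos]
    unfold hM
    have e1 : ((p ^ j : ℕ):ℝ) * ((p ^ (e - j) : ℕ):ℝ) = (p:ℝ) ^ e := by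
      push_cast; rw [← pow_add]; congr 1; omega
    rw [e1, abs_div, abs_of_pos (pow_pos hp0 e)]
    gcongr
    refine (Mm_abs_le _ _).trans ?_
    rw [Nat.divisors_prime_pow hp, Nat.divisors_prime_pow hp, Finset.card_map, Finset.card_map, Finset.card_range, Finset.card_range, pow_two]
    have h1 : (((j + 1 : ℕ)):ℝ) ≤ e + 1 := by exact_mod_cast hj
    have h2 : (((e - j + 1 : ℕ)):ℝ) ≤ e + 1 := by
      have : e - j + 1 ≤ e + 1 := by omega
      exact_mod_cast this
    gcongr
  refine (Finset.sum_le_sum this).trans ?_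
  rw [Finset.sum_const, Finset.card_range, nsmul_eq_mul]
  apply le_of_eq
  push_cast; ring

lemma aF_prime {p : ℕ} (hp : p.Prime) : aF p ≤ 2 / (p:ℝ) ^ 2 := by
  have hp0 : (0:ℝ) < p := by exact_mod_cast hp.pos
  have e : aF p = 2 * (|Mm p 1| / p) := by
    unfold aF cv
    rw [hp.sum_divisors, Nat.div_self hp.pos, Nat.div_one]
    unfold hM
    beta_reduce
    rw [Mm_comm 1 p]
    simp only [Nat.cast_one, mul_one, one_mul, abs_div, Nat.abs_cast]
    ring
  rw [e]
  have : |Mm p 1| ≤ 1 / p := by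
    by_cases h2 : p = 2
    · rw [Mm_even (by rw [h2]; simp)]; simp
    · rw [Mm_prime hp h2]
      have h3 : (3:ℝ) ≤ p := by
        have := hp.two_le
        have : 3 ≤ p := by omega
        exact_mod_cast this
      have : -1 / (p:ℝ) + 2 / p ^ 2 = -((p - 2) / p ^ 2) := by field_simp; ring
      rw [this, abs_neg, abs_of_nonneg (div_nonneg (by linarith) (by positivity)), div_le_div_iff₀ (by positivity) (by positivity)]
      nlinarith
  calc 2 * (|Mm p 1| / p) ≤ 2 * (1 / p / p) := by gcongr
    _ = 2 / (p:ℝ) ^ 2 := by field_simp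

end VA
end

section
namespace VA

lemma summ_cube : Summable (fun e : ℕ => ((e:ℝ) + 3) ^ 3 * (1 / 2) ^ e) := by
  have h : ∀ k : ℕ, Summable (fun e : ℕ => (e:ℝ) ^ k * (1 / 2 : ℝ) ^ e) := fun k =>
    summable_pow_mul_geometric_of_norm_lt_one k (by norm_num)
  have := (((h 3).add ((h 2).mul_left 9)).add ((h 1).mul_left 27)).add ((h 0).mul_left 27)
  refine this.congr ?_
  intro e; ring

/-- the tail constant -/
noncomputable def CE : ℝ := 2 + ∑' e : ℕ, ((e:ℝ) + 3) ^ 3 * (1 / 2) ^ e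

lemma CE_nonneg : 0 ≤ CE := by
  unfold CE
  have : 0 ≤ ∑' e : ℕ, ((e:ℝ) + 3) ^ 3 * (1 / 2) ^ e := tsum_nonneg fun e => by positivity
  linarith

lemma aF_pow_add {p : ℕ} (hp : p.Prime) (e : ℕ) :
    aF (p ^ (e + 2)) ≤ (1 / (p:ℝ) ^ 2) * (((e:ℝ) + 3) ^ 3 * (1 / 2) ^ e) := by
  have hp0 : (0:ℝ) < p := by exact_mod_cast hp.pos
  have hp2 : (2:ℝ) ≤ p := by exact_mod_cast hp.two_le
  refine (aF_pow hp (e + 2)).trans ?_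
  have e1 : (((e + 2 : ℕ):ℝ) + 1) ^ 3 / (p:ℝ) ^ (e + 2) = (1 / (p:ℝ) ^ 2) * (((e:ℝ) + 3) ^ 3 * (1 / p) ^ e) := by
    push_cast
    rw [one_div_pow, pow_add]
    field_simp
    ring
  rw [e1]
  gcongr

lemma aF_summ {p : ℕ} (hp : p.Prime) : Summable (fun e => aF (p ^ e)) := by
  rw [← summable_nat_add_iff 2]
  exact Summable.of_nonneg_of_le (fun e => aF_nonneg _) (aF_pow_add hp) (summ_cube.mul_left _)

lemma aF_tsum {p : ℕ} (hp : p.Prime) : ∑' e, aF (p ^ e) ≤ 1 + CE / (p:ℝ) ^ 2 := by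
  obtain ⟨f, hf⟩ : ∃ f : ℕ → ℝ, f = fun e => aF (p ^ e) := ⟨_, rfl⟩
  have f0 : f 0 = 1 := by rw [hf]; simp [aF_one]
  have f1 : f 1 ≤ 2 / (p:ℝ) ^ 2 := by rw [hf]; simpa using aF_prime hp
  obtain ⟨g, hg⟩ : ∃ g : ℕ → ℝ, g = fun e : ℕ => ((e:ℝ) + 3) ^ 3 * (1 / 2) ^ e := ⟨_, rfl⟩
  have f2 : ∀ e, f (e + 2) ≤ (1 / (p:ℝ) ^ 2) * g e := by rw [hf, hg]; exact aF_pow_add hp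
  have hs : Summable f := by rw [hf]; exact aF_summ hp
  have hgs : Summable g := by rw [hg]; exact summ_cube
  have hC : CE = 2 + ∑' e, g e := by rw [hg]; rfl
  rw [← hf, hC]
  clear hf hg hC
  have e0 := hs.sum_add_tsum_nat_add 2
  rw [Finset.sum_range_succ, Finset.sum_range_one, f0] at e0
  have h1 : ∑' e, f (e + 2) ≤ ∑' e : ℕ, (1 / (p:ℝ) ^ 2) * g e :=
    Summable.tsum_le_tsum f2 ((summable_nat_add_iff 2).2 hs) (hgs.mul_left _)
  rw [tsum_mul_left] at h1
  rw [← e0, add_div, div_eq_mul_one_div (∑' e, g e), mul_comm (∑' e, g e)]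
  linarith

lemma aF_zero : aF 0 = 0 := by simp [aF, cv]

lemma aF_summable : Summable aF := by
  have hsq : Summable (fun n : ℕ => CE / (n:ℝ) ^ 2) := by
    have : Summable (fun n : ℕ => 1 / (n:ℝ) ^ 2) := Real.summable_one_div_nat_pow.2 (by norm_num)
    refine (this.mul_left CE).congr ?_
    intro n; ring
  apply summable_of_sum_range_le (c := Real.exp (∑' n : ℕ, CE / (n:ℝ) ^ 2)) aF_nonneg
  intro N
  obtain ⟨h1, h2⟩ := EulerProduct.summable_and_hasSum_smoothNumbers_prod_primesBelow_tsum (f := aF) aF_one aF_mul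
    (fun hp => by simpa [abs_of_nonneg (aF_nonneg _)] using aF_summ hp) N
  have h3 : ∑ n ∈ Finset.range N, aF n ≤ ∑' m : N.smoothNumbers, aF m := by
    have hs : Summable (fun m : N.smoothNumbers => aF m) := h2.summable
    have e : ∑ n ∈ Finset.range N, aF n = ∑ n ∈ (Finset.range N).filter (fun n => n ∈ N.smoothNumbers), aF n := by
      symm
      apply Finset.sum_filter_of_ne
      intro x hx hne
      apply Nat.mem_smoothNumbers_of_lt
      · apply Nat.pos_of_ne_zero
        rintro rfl
        exact hne aF_zero
      · exact Finset.mem_range.1 hx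
    rw [e]
    rw [← Finset.sum_subtype_of_mem (p := fun n => n ∈ N.smoothNumbers)]
    · exact hs.sum_le_tsum _ (fun m _ => aF_nonneg _)
    · intro x hx; exact (Finset.mem_filter.1 hx).2
  refine h3.trans ?_
  rw [h2.tsum_eq]
  calc ∏ p ∈ N.primesBelow, ∑' n, aF (p ^ n) ≤ ∏ p ∈ N.primesBelow, Real.exp (CE / (p:ℝ) ^ 2) := by
        apply Finset.prod_le_prod
        · intro p _; exact tsum_nonneg fun e => aF_nonneg _
        · intro p hp
          refine (aF_tsum (Nat.prime_of_mem_primesBelow hp)).trans ?_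
          have := Real.add_one_le_exp (CE / (p:ℝ) ^ 2)
          linarith
    _ = Real.exp (∑ p ∈ N.primesBelow, CE / (p:ℝ) ^ 2) := (Real.exp_sum _ _).symm
    _ ≤ _ := by
        apply Real.exp_le_exp.2
        apply hsq.sum_le_tsum
        intro i _
        have := CE_nonneg
        positivity

/-- summability over pairs -/
lemma hM_summable : Summable (fun x : ℕ × ℕ => |hM x.1 x.2|) := by
  apply summable_of_sum_le (c := ∑' n, aF n) (fun _ => abs_nonneg _)
  intro s
  classical
  have h0 : ∀ x ∈ s, x.1 * x.2 = 0 → |hM x.1 x.2| = 0 := by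
    intro x _ h
    have : ((x.1:ℝ) * x.2) = 0 := by exact_mod_cast h
    simp [hM, this]
  have e : ∑ x ∈ s, |hM x.1 x.2| = ∑ x ∈ s.filter (fun x => x.1 * x.2 ≠ 0), |hM x.1 x.2| := by
    symm
    apply Finset.sum_filter_of_ne
    intro x hx hne h
    exact hne (h0 x hx h)
  rw [e]
  set s' := s.filter (fun x => x.1 * x.2 ≠ 0) with hs'
  have e2 : ∑ x ∈ s', |hM x.1 x.2| ≤ ∑ n ∈ s'.image (fun x => x.1 * x.2), aF n := by
    rw [← Finset.sum_fiberwise_of_maps_to (g := fun x : ℕ × ℕ => x.1 * x.2) (t := s'.image (fun x => x.1 * x.2))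
      (fun x hx => Finset.mem_image_of_mem _ hx)]
    apply Finset.sum_le_sum
    intro n hn
    unfold aF cv
    have hn0 : n ≠ 0 := by
      obtain ⟨x, hx, rfl⟩ := Finset.mem_image.1 hn
      exact (Finset.mem_filter.1 hx).2
    have hinj : Set.InjOn (fun x : ℕ × ℕ => x.1) (s'.filter (fun x : ℕ × ℕ => x.1 * x.2 = n) : Finset (ℕ × ℕ)) := by
      rintro ⟨a, b⟩ hx ⟨c, d⟩ hy hxy
      simp only at hxy
      have h1 := (Finset.mem_filter.1 hx).2
      have h2 := (Finset.mem_filter.1 hy).2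
      simp only at h1 h2
      subst hxy
      have : 0 < a := Nat.pos_of_ne_zero (by rintro rfl; simp at h1; exact hn0 h1.symm)
      rw [← h2] at h1
      rw [Nat.eq_of_mul_eq_mul_left this h1]
    have e3 := Finset.sum_image (f := fun u => |hM u (n / u)|) hinj
    have e4 : ∑ x ∈ s'.filter (fun x : ℕ × ℕ => x.1 * x.2 = n), |hM x.1 x.2| = ∑ x ∈ s'.filter (fun x : ℕ × ℕ => x.1 * x.2 = n), |hM x.1 (n / x.1)| := by
      apply Finset.sum_congr rfl
      rintro ⟨a, b⟩ hx
      have h1 := (Finset.mem_filter.1 hx).2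
      simp only at h1 ⊢
      have : 0 < a := Nat.pos_of_ne_zero (by rintro rfl; simp at h1; exact hn0 h1.symm)
      rw [← h1, Nat.mul_div_cancel_left _ this]
    rw [e4, ← e3]
    apply Finset.sum_le_sum_of_subset_of_nonneg
    · intro u hu
      obtain ⟨x, hx, rfl⟩ := Finset.mem_image.1 hu
      have := (Finset.mem_filter.1 hx).2
      exact Nat.mem_divisors.2 ⟨⟨x.2, this.symm⟩, hn0⟩
    · intros; exact abs_nonneg _
  refine e2.trans ?_
  exact aF_summable.sum_le_tsum _ (fun n _ => aF_nonneg n)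

end VA
end

section
namespace VA

/-- the odd constant -/
noncomputable def KO : ℝ := ∑' x : ℕ × ℕ, hM x.1 x.2

lemma hM_summable' : Summable (fun x : ℕ × ℕ => hM x.1 x.2) := hM_summable.of_abs

lemma hM_zero_left (b : ℕ) : hM 0 b = 0 := by simp [hM]
lemma hM_zero_right (a : ℕ) : hM a 0 = 0 := by simp [hM]

lemma box_tendsto {G : ℕ × ℕ → ℝ} (h : Summable G) :
    Tendsto (fun Z : ℕ => ∑ a ∈ Finset.range (Z + 1), ∑ b ∈ Finset.range (Z + 1), G (a, b)) atTop (nhds (∑' x, G x)) := by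
  have h1 : Tendsto (fun Z : ℕ => Finset.range (Z + 1) ×ˢ Finset.range (Z + 1)) atTop atTop := by
    apply tendsto_atTop_finset_of_monotone
    · intro a b hab
      apply Finset.product_subset_product <;> exact Finset.range_mono (by omega)
    · rintro ⟨a, b⟩
      refine ⟨a + b, ?_⟩
      simp only [Finset.mem_product, Finset.mem_range]; omega
  have := h.hasSum.comp h1
  refine this.congr ?_
  intro Z
  simp only [Function.comp]
  rw [Finset.sum_product]

lemma range_succ_Icc (Z : ℕ) (f : ℕ → ℝ) (h0 : f 0 = 0) : ∑ a ∈ Finset.range (Z + 1), f a = ∑ a ∈ Finset.Icc 1 Z, f a := by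
  rw [Finset.sum_range_eq_add_Ico _ (by omega), h0, zero_add]
  rfl

lemma KO_box : Tendsto (fun Z : ℕ => ∑ a ∈ Finset.Icc 1 Z, ∑ b ∈ Finset.Icc 1 Z, hM a b) atTop (nhds KO) := by
  refine (box_tendsto hM_summable').congr ?_
  intro Z
  rw [range_succ_Icc]
  · apply Finset.sum_congr rfl
    intro a _
    rw [range_succ_Icc]
    exact hM_zero_right a
  · simp [hM_zero_left]

lemma hyp_tendsto : Tendsto (fun Z : ℕ => ∑ N ∈ Finset.range (Z + 1), cv hM N) atTop (nhds KO) := by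
  have h1 : Tendsto (fun Z : ℕ => (Finset.range (Z + 1) ×ˢ Finset.range (Z + 1)).filter (fun x => x.1 * x.2 ≤ Z)) atTop atTop := by
    apply tendsto_atTop_finset_of_monotone
    · intro a b hab x hx
      simp only [Finset.mem_filter, Finset.mem_product, Finset.mem_range] at hx ⊢
      omega
    · rintro ⟨a, b⟩
      refine ⟨a + b + a * b, ?_⟩
      simp only [Finset.mem_filter, Finset.mem_product, Finset.mem_range]
      have := Nat.zero_le (a * b)
      omega
  have := hM_summable'.hasSum.comp h1
  refine this.congr ?_
  intro Z
  simp only [Function.comp]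
  rw [range_succ_Icc _ _ (by simp [cv])]
  unfold cv
  rw [hyper_sum, Finset.sum_filter, Finset.sum_product, range_succ_Icc]
  · apply Finset.sum_congr rfl
    intro u hu
    rw [Finset.mem_Icc] at hu
    rw [range_succ_Icc]
    · rw [← Finset.sum_filter]
      apply Finset.sum_congr
      · ext q
        simp only [Finset.mem_filter, Finset.mem_Icc]
        rw [Nat.le_div_iff_mul_le (by omega), mul_comm q u]
        constructor
        · rintro ⟨⟨h2, h3⟩, h4⟩; exact ⟨h2, h4⟩
        · rintro ⟨h2, h4⟩
          refine ⟨⟨h2, ?_⟩, h4⟩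
          nlinarith
      · intros; rfl
    · simp [hM_zero_right]
  · simp [hM_zero_left]

lemma cv_abs_le (N : ℕ) : ‖cv hM N‖ ≤ aF N := by
  unfold cv aF
  exact Finset.abs_sum_le_sum_abs _ _

lemma cv_summable : Summable (fun N => ‖cv hM N‖) :=
  Summable.of_nonneg_of_le (fun _ => norm_nonneg _) cv_abs_le aF_summable

lemma cv_tsum : ∑' N, cv hM N = KO := by
  have h1 := (cv_summable.of_norm.hasSum.tendsto_sum_nat).comp (tendsto_add_atTop_nat 1)
  exact tendsto_nhds_unique h1 hyp_tendsto

/-- local factor -/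
noncomputable def loc (p : ℕ) : ℝ := ∑' x : ℕ × ℕ, hM (p ^ x.1) (p ^ x.2)

lemma loc_summable {p : ℕ} (hp : p.Prime) : Summable (fun x : ℕ × ℕ => hM (p ^ x.1) (p ^ x.2)) := by
  have hinj : Function.Injective (fun x : ℕ × ℕ => (p ^ x.1, p ^ x.2)) := by
    rintro ⟨a, b⟩ ⟨c, d⟩ h
    simp only [Prod.mk.injEq] at h
    rw [Nat.pow_right_injective hp.two_le h.1, Nat.pow_right_injective hp.two_le h.2]
  have := hM_summable'.comp_injective hinj
  simpa only [Function.comp_def] using this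

lemma antidiag_tsum (G : ℕ × ℕ → ℝ) (hs : Summable G) :
    ∑' x, G x = ∑' e, ∑ c ∈ Finset.HasAntidiagonal.antidiagonal e, G c := by
  rw [← Finset.HasAntidiagonal.sigmaAntidiagonalEquivProd.tsum_eq G]
  have hs' := (Finset.HasAntidiagonal.sigmaAntidiagonalEquivProd.summable_iff).2 hs
  refine (Summable.tsum_sigma' (fun n => (hasSum_fintype _).summable) hs').trans ?_
  congr 1
  funext e
  rw [tsum_fintype]
  exact Finset.sum_coe_sort (Finset.HasAntidiagonal.antidiagonal e) G

lemma cv_loc {p : ℕ} (hp : p.Prime) : ∑' e, cv hM (p ^ e) = loc p := by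
  have hs := loc_summable hp
  unfold loc
  rw [antidiag_tsum _ hs]
  congr 1
  funext e
  rw [Finset.Nat.sum_antidiagonal_eq_sum_range_succ (fun a b => hM (p ^ a) (p ^ b))]
  unfold cv
  rw [Nat.sum_divisors_prime_pow hp]
  apply Finset.sum_congr rfl
  intro j hj
  rw [Finset.mem_range] at hj
  rw [Nat.pow_div (by omega) hp.pos]

lemma KO_hasProd : HasProd (fun p : Nat.Primes => loc p) KO := by
  have h := EulerProduct.eulerProduct_hasProd (f := cv hM) (by simp [cv, hM, Mm_one]) (fun h => cv_mul _ hM_mul h) cv_summable (by simp [cv])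
  rw [cv_tsum] at h
  have e : (fun p : Nat.Primes => ∑' e, cv hM ((p:ℕ) ^ e)) = fun p : Nat.Primes => loc p := by
    funext p
    exact cv_loc p.2
  rw [e] at h
  exact h

lemma loc_two : loc 2 = 1 := by
  unfold loc
  rw [tsum_eq_single (0, 0)]
  · simp [hM, Mm_one]
  · rintro ⟨a, b⟩ hab
    unfold hM
    rw [Mm_even, zero_div]
    intro h
    apply hab
    have h1 : a = 0 := by
      by_contra ha
      have := h.1
      simp only at this
      rw [← Nat.not_even_iff_odd] at this
      exact this (even_two.pow_of_ne_zero ha)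
    have h2 : b = 0 := by
      by_contra hb
      have := h.2
      simp only at this
      rw [← Nat.not_even_iff_odd] at this
      exact this (even_two.pow_of_ne_zero hb)
    rw [h1, h2]

lemma loc_box {p : ℕ} (hp : p.Prime) : Tendsto (fun K : ℕ => av (p ^ (4 * K + 4)) (fun n => (∑ a ∈ Finset.range (K + 1), lam (n ^ 2 - 4) (p ^ a) / p ^ a) ^ 2)) atTop (nhds (loc p)) := by
  refine (box_tendsto (loc_summable hp)).congr ?_
  intro K
  have e : ∀ n : ℤ, (∑ a ∈ Finset.range (K + 1), lam (n ^ 2 - 4) (p ^ a) / p ^ a) ^ 2 =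
      ∑ a ∈ Finset.range (K + 1), ∑ b ∈ Finset.range (K + 1), (1 / ((p:ℝ) ^ a * p ^ b)) * (lam (n ^ 2 - 4) (p ^ a) * lam (n ^ 2 - 4) (p ^ b)) := by
    intro n
    rw [pow_two, Finset.sum_mul_sum]
    apply Finset.sum_congr rfl; intro a _
    apply Finset.sum_congr rfl; intro b _
    rw [div_mul_div_comm]; ring
  rw [av_congr e, av_sum]
  apply Finset.sum_congr rfl; intro a ha
  rw [av_sum]
  apply Finset.sum_congr rfl; intro b hb
  rw [Finset.mem_range] at ha hb
  rw [av_const_mul, Mm_eq]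
  · unfold hM; push_cast; ring
  · rw [← pow_add, ← pow_mul]
    exact pow_dvd_pow _ (by omega)
  · exact (pow_pos hp.pos _).ne'

end VA
end

section
namespace VA

noncomputable def Sp (p K : ℕ) (x : ℤ) : ℝ := ∑ a ∈ Finset.range (K + 1), lam x (p ^ a) / (p:ℝ) ^ a

noncomputable def tauA (p K : ℕ) : ℝ := ∑ a ∈ Finset.range (K + 1), (1 / (p:ℝ)) ^ a
noncomputable def tauB (p K : ℕ) : ℝ := ∑ a ∈ Finset.range (K + 1), (-(1 / (p:ℝ))) ^ a
noncomputable def tal (p K : ℕ) : ℝ := (tauA p K - tauB p K) / 2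
noncomputable def tbe (p K : ℕ) : ℝ := (tauA p K + tauB p K) / 2 - 1

lemma chi_cases (x : ℤ) (p : ℕ) : (chi x p : ℝ) = 0 ∨ (chi x p : ℝ) = 1 ∨ (chi x p : ℝ) = -1 := by
  have h := chi_abs_le x p
  rw [abs_le] at h
  obtain ⟨h1, h2⟩ := h
  generalize chi x p = c at *
  interval_cases c <;> simp

lemma lam_step {p : ℕ} (hp : p.Prime) (h2 : p ≠ 2) (x : ℤ) (a : ℕ) :
    lam x (p ^ (a + 1)) = (chi x p : ℝ) ^ (a + 1) + if (p:ℤ) ^ 2 ∣ x then lam (x / (p:ℤ) ^ 2) (p ^ a) else 0 := by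
  have hp0 : (p:ℤ) ≠ 0 := by exact_mod_cast hp.ne_zero
  rw [lam_prime_pow hp h2, Finset.sum_range_succ']
  have e0 : (if (p:ℤ) ^ (2 * 0) ∣ x then (chi (x / (p:ℤ) ^ (2 * 0)) p : ℝ) ^ (a + 1 - 0) else 0) = (chi x p : ℝ) ^ (a + 1) := by simp
  rw [e0, add_comm]
  congr 1
  split_ifs with h
  · obtain ⟨y, rfl⟩ := h
    rw [Int.mul_ediv_cancel_left _ (by positivity), lam_prime_pow hp h2]
    apply Finset.sum_congr rfl
    intro j _
    have e1 : (p:ℤ) ^ (2 * (j + 1)) = (p:ℤ) ^ 2 * (p:ℤ) ^ (2 * j) := by ring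
    have e2 : a + 1 - (j + 1) = a - j := by omega
    rw [e1, e2, Int.mul_ediv_mul_of_pos _ _ (by positivity)]
    simp only [mul_dvd_mul_iff_left (pow_ne_zero 2 hp0)]
  · apply Finset.sum_eq_zero
    intro j _
    rw [if_neg]
    intro h'
    exact h ((pow_dvd_pow _ (by omega)).trans h')

lemma tau_eq (p K : ℕ) (x : ℤ) : ∑ a ∈ Finset.range (K + 1), ((chi x p : ℝ) / p) ^ a = 1 + tal p K * chi x p + tbe p K * (chi x p : ℝ) ^ 2 := by
  unfold tal tbe tauA tauB
  rcases chi_cases x p with h | h | h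
  · rw [h, Finset.sum_range_succ']
    simp
  · rw [h]; ring
  · rw [h]; 
    have : ((-1:ℝ) / p) = -(1 / p) := by ring
    rw [this]
    ring

lemma Sp_step {p : ℕ} (hp : p.Prime) (h2 : p ≠ 2) (K : ℕ) (x : ℤ) :
    Sp p (K + 1) x = (1 + tal p (K + 1) * chi x p + tbe p (K + 1) * (chi x p : ℝ) ^ 2) + if (p:ℤ) ^ 2 ∣ x then Sp p K (x / (p:ℤ) ^ 2) / p else 0 := by
  have hp0 : (p:ℝ) ≠ 0 := by exact_mod_cast hp.ne_zero
  rw [← tau_eq]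
  unfold Sp
  rw [Finset.sum_range_succ', Finset.sum_range_succ' _ (K + 1)]
  simp only [lam_step hp h2]
  simp only [pow_zero, lam_one, add_div, Finset.sum_add_distrib, div_pow]
  have : ∑ a ∈ Finset.range (K + 1), (if (p:ℤ) ^ 2 ∣ x then lam (x / (p:ℤ) ^ 2) (p ^ a) else 0) / (p:ℝ) ^ (a + 1) = if (p:ℤ) ^ 2 ∣ x then (∑ a ∈ Finset.range (K + 1), lam (x / (p:ℤ) ^ 2) (p ^ a) / (p:ℝ) ^ a) / p else 0 := by
    split_ifs
    · rw [Finset.sum_div]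
      apply Finset.sum_congr rfl
      intro a _
      rw [pow_succ (p:ℝ) a, div_div]
    · simp
  rw [this]
  ring

lemma Sp_zero (p : ℕ) (x : ℤ) : Sp p 0 x = 1 := by simp [Sp, lam_one]

lemma Per_Sp (p K : ℕ) : Per (p ^ (2 * K)) (Sp p K) := by
  intro x y h
  unfold Sp
  apply Finset.sum_congr rfl
  intro a ha
  rw [Finset.mem_range] at ha
  rw [lam_congr]
  refine h.of_dvd ?_
  rw [Int.natCast_dvd_natCast, ← pow_mul]
  exact pow_dvd_pow _ (by omega)

lemma Sp_sq_step {p : ℕ} (hp : p.Prime) (h2 : p ≠ 2) (K : ℕ) (x : ℤ) :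
    Sp p (K + 1) x ^ 2 = (1 + (2 * tal p (K + 1) + 2 * tal p (K + 1) * tbe p (K + 1)) * chi x p + (tal p (K + 1) ^ 2 + 2 * tbe p (K + 1) + tbe p (K + 1) ^ 2) * (chi x p : ℝ) ^ 2) + if (p:ℤ) ^ 2 ∣ x then (2 / (p:ℝ) * Sp p K (x / (p:ℤ) ^ 2) + 1 / (p:ℝ) ^ 2 * Sp p K (x / (p:ℤ) ^ 2) ^ 2) else 0 := by
  rw [Sp_step hp h2]
  split_ifs with h
  · have : chi x p = 0 := chi_of_dvd hp ((dvd_pow_self _ two_ne_zero).trans h)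
    rw [this]
    push_cast
    ring
  · rcases chi_cases x p with h | h | h <;> rw [h] <;> ring

lemma av_form {p : ℕ} (hp : p.Prime) (h2 : p ≠ 2) (c1 c2 : ℝ) (j : ℕ) (G : ℤ → ℝ) :
    av (p ^ 2 * p ^ (j + 1)) (fun x => (1 + c1 * (chi x p : ℝ) + c2 * (chi x p : ℝ) ^ 2) + if (p:ℤ) ^ 2 ∣ x then G (x / (p:ℤ) ^ 2) else 0)
      = 1 + c2 * (1 - 1 / p) + av (p ^ (j + 1)) G / p ^ 2 := by
  have hpp := hp.pos
  have hP : 0 < p ^ 2 * p ^ (j + 1) := by positivity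
  have hd : p ∣ p ^ 2 * p ^ (j + 1) := (dvd_pow_self _ two_ne_zero).mul_right _
  simp only [chi_sq_real hp h2]
  rw [av_add, av_add, av_add, av_const hP, av_const_mul, av_const_mul, av_dvd (Per_chi p) hd hP.ne', av_chi hp h2]
  have e1 := av_dil (d := p ^ 2) (B := p ^ (j + 1)) (by positivity) G
  push_cast at e1
  rw [e1]
  have e2 : av (p ^ 2 * p ^ (j + 1)) (fun x => (1 - if (p:ℤ) ∣ x then 1 else 0 : ℝ)) = 1 - 1 / p := by
    have e3 := av_ind (d := p) (B := p * p ^ (j + 1)) hpp (by positivity)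
    have e4 : p * (p * p ^ (j + 1)) = p ^ 2 * p ^ (j + 1) := by ring
    rw [e4] at e3
    have e5 : ∀ x : ℤ, (1 - if (p:ℤ) ∣ x then 1 else 0 : ℝ) = 1 + (-1) * (if (p:ℤ) ∣ x then 1 else 0 : ℝ) := by intro x; ring
    rw [av_congr e5, av_add, av_const hP, av_const_mul, e3]
    ring
  rw [e2]
  ring

lemma av_quadperm {p : ℕ} (hp : p.Prime) (h2 : p ≠ 2) (j : ℕ) {G : ℤ → ℝ} (hG : Per (p ^ j) G) (e : ℤ) (he : e = 4 ∨ e = -4) :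
    av (p ^ j) (fun y => G (y * ((p:ℤ) ^ 2 * y + e))) = av (p ^ j) G := by
  apply av_perm (pow_pos hp.pos _) hG (fun y => y * ((p:ℤ) ^ 2 * y + e))
  intro x y hxy
  have hc : IsCoprime (((p ^ j : ℕ)):ℤ) ((p:ℤ) ^ 2 * (x + y) + e) := by
    push_cast
    apply IsCoprime.pow_left
    rw [(Nat.prime_iff_prime_int.1 hp).coprime_iff_not_dvd]
    intro hd
    have h4 : (p:ℤ) ∣ e := by
      have := dvd_sub hd (show (p:ℤ) ∣ (p:ℤ) ^ 2 * (x + y) from (dvd_pow_self _ two_ne_zero).mul_right _)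
      rwa [add_sub_cancel_left] at this
    have h5 : (p:ℤ) ∣ 4 := by
      rcases he with rfl | rfl
      · exact h4
      · exact (dvd_neg.1 h4)
    have h6 : p ∣ 2 ^ 2 := by exact_mod_cast h5
    exact h2 ((Nat.prime_dvd_prime_iff_eq hp Nat.prime_two).1 (hp.dvd_of_dvd_pow h6))
  apply modEq_cancel hc
  rw [Int.modEq_iff_dvd] at hxy ⊢
  convert hxy using 1
  ring

lemma av_formD {p : ℕ} (hp : p.Prime) (h2 : p ≠ 2) (c1 c2 : ℝ) (j : ℕ) {G : ℤ → ℝ} (hG : Per (p ^ (j + 1)) G) :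
    av (p ^ 2 * p ^ (j + 1)) (fun n => (1 + c1 * (chi (n ^ 2 - 4) p : ℝ) + c2 * (chi (n ^ 2 - 4) p : ℝ) ^ 2) + if (p:ℤ) ^ 2 ∣ n ^ 2 - 4 then G ((n ^ 2 - 4) / (p:ℤ) ^ 2) else 0)
      = 1 - c1 / p + c2 * (1 - 2 / p) + 2 * av (p ^ (j + 1)) G / p ^ 2 := by
  have hpp := hp.pos
  have hp0 : (p:ℤ) ≠ 0 := by exact_mod_cast hp.ne_zero
  have hP : 0 < p ^ 2 * p ^ (j + 1) := by positivity
  have hd : p ∣ p ^ 2 * p ^ (j + 1) := (dvd_pow_self _ two_ne_zero).mul_right _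
  simp only [chi_sq_real hp h2]
  rw [av_add, av_add, av_add, av_const hP, av_const_mul, av_const_mul, av_dvd (Per_Dq (Per_chi p)) hd hP.ne', av_chi_Dq hp h2]
  have e1 : av (p ^ 2 * p ^ (j + 1)) (fun n => if (p:ℤ) ^ 2 ∣ n ^ 2 - 4 then G ((n ^ 2 - 4) / (p:ℤ) ^ 2) else 0) = 2 * av (p ^ (j + 1)) G / p ^ 2 := by
    have hper : Per (p ^ 2 * p ^ (j + 1)) (fun n => if (p:ℤ) ^ 2 ∣ n ^ 2 - 4 then G ((n ^ 2 - 4) / (p:ℤ) ^ 2) else 0) := by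
      have := Per_Dq (Per.ite_dvd (p ^ 2) G hG)
      push_cast at this
      exact this
    have e0 : ∀ x : ℤ, (if (p:ℤ) ^ 2 ∣ x ^ 2 - 4 then G ((x ^ 2 - 4) / (p:ℤ) ^ 2) else 0) = if (p:ℤ) ^ 2 ∣ x ^ 2 - 4 then (if (p:ℤ) ^ 2 ∣ x ^ 2 - 4 then G ((x ^ 2 - 4) / (p:ℤ) ^ 2) else 0) else 0 := by
      intro x; split_ifs <;> rfl
    rw [av_congr e0, av_dvd_Dq hp h2 two_ne_zero (by positivity) (fun x => if (p:ℤ) ^ 2 ∣ x ^ 2 - 4 then G ((x ^ 2 - 4) / (p:ℤ) ^ 2) else 0) hper]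
    have f1 : ∀ y : ℤ, (fun x : ℤ => if (p:ℤ) ^ 2 ∣ x ^ 2 - 4 then G ((x ^ 2 - 4) / (p:ℤ) ^ 2) else 0) (2 + (p:ℤ) ^ 2 * y) = G (y * ((p:ℤ) ^ 2 * y + 4)) := by
      intro y
      have : (2 + (p:ℤ) ^ 2 * y) ^ 2 - 4 = (p:ℤ) ^ 2 * (y * ((p:ℤ) ^ 2 * y + 4)) := by ring
      simp only
      rw [this, if_pos (dvd_mul_right _ _), Int.mul_ediv_cancel_left _ (pow_ne_zero 2 hp0)]
    have f2 : ∀ y : ℤ, (fun x : ℤ => if (p:ℤ) ^ 2 ∣ x ^ 2 - 4 then G ((x ^ 2 - 4) / (p:ℤ) ^ 2) else 0) (-2 + (p:ℤ) ^ 2 * y) = G (y * ((p:ℤ) ^ 2 * y + (-4))) := by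
      intro y
      have : (-2 + (p:ℤ) ^ 2 * y) ^ 2 - 4 = (p:ℤ) ^ 2 * (y * ((p:ℤ) ^ 2 * y + (-4))) := by ring
      simp only
      rw [this, if_pos (dvd_mul_right _ _), Int.mul_ediv_cancel_left _ (pow_ne_zero 2 hp0)]
    rw [av_congr f1, av_congr f2, av_quadperm hp h2 _ hG 4 (Or.inl rfl), av_quadperm hp h2 _ hG (-4) (Or.inr rfl)]
    ring
  rw [e1]
  have e2 : av (p ^ 2 * p ^ (j + 1)) (fun x => (1 - if (p:ℤ) ∣ x ^ 2 - 4 then 1 else 0 : ℝ)) = 1 - 2 / p := by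
    have e3 := av_dvd_Dq hp h2 (k := 1) (B := p * p ^ (j + 1)) one_ne_zero (by positivity) (fun _ => 1) (Per.const _ _)
    have e4 : p ^ 1 * (p * p ^ (j + 1)) = p ^ 2 * p ^ (j + 1) := by ring
    rw [e4, av_const (by positivity)] at e3
    simp only [pow_one] at e3
    have e5 : ∀ x : ℤ, (1 - if (p:ℤ) ∣ x ^ 2 - 4 then 1 else 0 : ℝ) = 1 + (-1) * (if (p:ℤ) ∣ x ^ 2 - 4 then 1 else 0 : ℝ) := by intro x; ring
    rw [av_congr e5, av_add, av_const hP, av_const_mul, e3]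
    ring
  rw [e2]
  ring

noncomputable def hS (p K : ℕ) : ℝ := av (p ^ (2 * K + 1)) (Sp p K)
noncomputable def HS (p K : ℕ) : ℝ := av (p ^ (2 * K + 1)) (fun x => Sp p K x ^ 2)

lemma hS_step {p : ℕ} (hp : p.Prime) (h2 : p ≠ 2) (K : ℕ) :
    hS p (K + 1) = 1 + tbe p (K + 1) * (1 - 1 / p) + hS p K / (p:ℝ) ^ 3 := by
  have hp0 : (p:ℝ) ≠ 0 := by exact_mod_cast hp.ne_zero
  unfold hS
  have e : p ^ (2 * (K + 1) + 1) = p ^ 2 * p ^ (2 * K + 1) := by ring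
  rw [e, av_congr (Sp_step hp h2 K), av_form hp h2 _ _ (2 * K) (fun y => Sp p K y / p)]
  have : av (p ^ (2 * K + 1)) (fun y => Sp p K y / p) = 1 / p * av (p ^ (2 * K + 1)) (Sp p K) := by
    rw [← av_const_mul]; apply av_congr; intro x; ring
  rw [this]
  field_simp

lemma avG {p : ℕ} (K : ℕ) : av (p ^ (2 * K + 1)) (fun y => 2 / (p:ℝ) * Sp p K y + 1 / (p:ℝ) ^ 2 * Sp p K y ^ 2) = 2 / p * hS p K + 1 / (p:ℝ) ^ 2 * HS p K := by
  unfold hS HS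
  rw [av_add, av_const_mul, av_const_mul]

lemma HS_step {p : ℕ} (hp : p.Prime) (h2 : p ≠ 2) (K : ℕ) :
    HS p (K + 1) = 1 + (tal p (K + 1) ^ 2 + 2 * tbe p (K + 1) + tbe p (K + 1) ^ 2) * (1 - 1 / p) + 2 / (p:ℝ) ^ 3 * hS p K + HS p K / (p:ℝ) ^ 4 := by
  have hp0 : (p:ℝ) ≠ 0 := by exact_mod_cast hp.ne_zero
  have e : p ^ (2 * (K + 1) + 1) = p ^ 2 * p ^ (2 * K + 1) := by ring
  have := av_form hp h2 (2 * tal p (K + 1) + 2 * tal p (K + 1) * tbe p (K + 1)) (tal p (K + 1) ^ 2 + 2 * tbe p (K + 1) + tbe p (K + 1) ^ 2) (2 * K) (fun y => 2 / (p:ℝ) * Sp p K y + 1 / (p:ℝ) ^ 2 * Sp p K y ^ 2)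
  rw [avG] at this
  have h := av_congr (P := p ^ 2 * p ^ (2 * K + 1)) (Sp_sq_step hp h2 K)
  unfold HS at *
  rw [e, h, this]
  field_simp
  ring

lemma loc_step {p : ℕ} (hp : p.Prime) (h2 : p ≠ 2) (K : ℕ) :
    av (p ^ (4 * (K + 1) + 4)) (fun n => Sp p (K + 1) (n ^ 2 - 4) ^ 2) = 1 - (2 * tal p (K + 1) + 2 * tal p (K + 1) * tbe p (K + 1)) / p + (tal p (K + 1) ^ 2 + 2 * tbe p (K + 1) + tbe p (K + 1) ^ 2) * (1 - 2 / p) + 4 / (p:ℝ) ^ 3 * hS p K + 2 * HS p K / (p:ℝ) ^ 4 := by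
  have hp0 : (p:ℝ) ≠ 0 := by exact_mod_cast hp.ne_zero
  have hpp := hp.pos
  have e : p ^ (2 * (K + 1) + 1) = p ^ 2 * p ^ (2 * K + 1) := by ring
  have hper : Per (p ^ (2 * K + 1)) (Sp p K) := (Per_Sp p K).of_dvd (pow_dvd_pow _ (by omega))
  have hG : Per (p ^ (2 * K + 1)) (fun y => 2 / (p:ℝ) * Sp p K y + 1 / (p:ℝ) ^ 2 * Sp p K y ^ 2) := by
    intro x y hxy; simp only [hper x y hxy]
  have := av_formD hp h2 (2 * tal p (K + 1) + 2 * tal p (K + 1) * tbe p (K + 1)) (tal p (K + 1) ^ 2 + 2 * tbe p (K + 1) + tbe p (K + 1) ^ 2) (2 * K) hG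
  rw [avG] at this
  have hper2 : Per (p ^ 2 * p ^ (2 * K + 1)) (fun n => Sp p (K + 1) (n ^ 2 - 4) ^ 2) := by
    have h3 : Per (p ^ 2 * p ^ (2 * K + 1)) (Sp p (K + 1)) := (Per_Sp p (K + 1)).of_dvd (by rw [← e]; exact pow_dvd_pow _ (by omega))
    exact (Per_Dq h3).comp (fun t => t ^ 2)
  rw [av_dvd hper2 (by rw [← e]; exact pow_dvd_pow _ (by omega)) (by positivity)]
  have h := av_congr (P := p ^ 2 * p ^ (2 * K + 1)) (fun n : ℤ => Sp_sq_step hp h2 K (n ^ 2 - 4))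
  rw [h, this]
  field_simp
  ring

lemma rec_tendsto {u x : ℕ → ℝ} {r a : ℝ} (hr0 : 0 ≤ r) (hr1 : r < 1) (hu : Tendsto u atTop (nhds a))
    (hx : ∀ K, x (K + 1) = u K + r * x K) : Tendsto x atTop (nhds (a / (1 - r))) := by
  have h1r : 0 < 1 - r := by linarith
  rw [Metric.tendsto_atTop] at hu ⊢
  intro ε hε
  obtain ⟨N, hN⟩ := hu (ε / 2 * (1 - r)) (by positivity)
  have hind : ∀ j, |x (N + j) - a / (1 - r)| ≤ r ^ j * |x N - a / (1 - r)| + ε / 2 := by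
    intro j
    induction j with
    | zero => simp; linarith
    | succ j ih =>
      have h1 := hN (N + j) (by omega)
      rw [Real.dist_eq] at h1
      have e : x (N + (j + 1)) - a / (1 - r) = (u (N + j) - a) + r * (x (N + j) - a / (1 - r)) := by
        rw [← add_assoc, hx]; field_simp; ring
      rw [e]
      calc _ ≤ |u (N + j) - a| + |r * (x (N + j) - a / (1 - r))| := abs_add_le _ _
        _ ≤ ε / 2 * (1 - r) + r * (r ^ j * |x N - a / (1 - r)| + ε / 2) := by
          rw [abs_mul, abs_of_nonneg hr0]; gcongr
        _ = _ := by ring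
  have ht : Tendsto (fun j => r ^ j * |x N - a / (1 - r)|) atTop (nhds (0 * |x N - a / (1 - r)|)) := (tendsto_pow_atTop_nhds_zero_of_lt_one hr0 hr1).mul_const _
  rw [zero_mul, Metric.tendsto_atTop] at ht
  obtain ⟨J, hJ⟩ := ht (ε / 2) (by positivity)
  refine ⟨N + J, fun n hn => ?_⟩
  obtain ⟨j, rfl⟩ : ∃ j, n = N + j := ⟨n - N, by omega⟩
  have h1 := hind j
  have h2 := hJ j (by omega)
  rw [Real.dist_eq, sub_zero, abs_of_nonneg (by positivity)] at h2
  rw [Real.dist_eq]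
  linarith

lemma tauA_tendsto {p : ℕ} (hp : p.Prime) : Tendsto (tauA p) atTop (nhds ((p:ℝ) / (p - 1))) := by
  have hp2 : (2:ℝ) ≤ p := by exact_mod_cast hp.two_le
  have h := (hasSum_geometric_of_abs_lt_one (r := 1 / (p:ℝ)) (by rw [abs_of_nonneg (by positivity), div_lt_one (by linarith)]; linarith)).tendsto_sum_nat
  have e : (1 - 1 / (p:ℝ))⁻¹ = p / (p - 1) := by
    have : (p:ℝ) - 1 ≠ 0 := by linarith
    field_simp
  rw [e] at h
  exact h.comp (tendsto_add_atTop_nat 1)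

lemma tauB_tendsto {p : ℕ} (hp : p.Prime) : Tendsto (tauB p) atTop (nhds ((p:ℝ) / (p + 1))) := by
  have hp2 : (2:ℝ) ≤ p := by exact_mod_cast hp.two_le
  have h := (hasSum_geometric_of_abs_lt_one (r := -(1 / (p:ℝ))) (by rw [abs_neg, abs_of_nonneg (by positivity), div_lt_one (by linarith)]; linarith)).tendsto_sum_nat
  have e : (1 - -(1 / (p:ℝ)))⁻¹ = p / (p + 1) := by
    have : (p:ℝ) + 1 ≠ 0 := by linarith
    rw [sub_neg_eq_add]
    field_simp
  rw [e] at h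
  exact h.comp (tendsto_add_atTop_nat 1)

theorem loc_eq {p : ℕ} (hp : p.Prime) (h2 : p ≠ 2) :
    loc p = 1 + ((p:ℝ) ^ 4 - 2 * (p:ℝ) ^ 3 + 1) / ((p:ℝ) ^ 2 - 1) ^ 3 := by
  have hp2 : (2:ℝ) ≤ p := by exact_mod_cast hp.two_le
  have hA := tauA_tendsto hp
  have hB := tauB_tendsto hp
  have hal : Tendsto (tal p) atTop (nhds (((p:ℝ) / (p - 1) - p / (p + 1)) / 2)) := (hA.sub hB).div_const 2
  have hbe : Tendsto (tbe p) atTop (nhds (((p:ℝ) / (p - 1) + p / (p + 1)) / 2 - 1)) := ((hA.add hB).div_const 2).sub_const 1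
  have hal' := hal.comp (tendsto_add_atTop_nat 1)
  have hbe' := hbe.comp (tendsto_add_atTop_nat 1)
  simp only [Function.comp_def] at hal' hbe'
  set α := (((p:ℝ) / (p - 1) - p / (p + 1)) / 2) with hα
  set β := (((p:ℝ) / (p - 1) + p / (p + 1)) / 2 - 1) with hβ
  have hp3 : (1:ℝ) / p ^ 3 < 1 := by
    rw [div_lt_one (by positivity)]; exact one_lt_pow₀ (by linarith) (by norm_num)
  have hp4 : (1:ℝ) / p ^ 4 < 1 := by
    rw [div_lt_one (by positivity)]; exact one_lt_pow₀ (by linarith) (by norm_num)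
  have hh := rec_tendsto (x := hS p) (r := 1 / (p:ℝ) ^ 3) (by positivity) hp3 ((hbe'.mul_const (1 - 1 / (p:ℝ))).const_add 1)
    (fun K => by rw [hS_step hp h2]; ring)
  set h := (1 + β * (1 - 1 / (p:ℝ))) / (1 - 1 / (p:ℝ) ^ 3) with hhd
  have hc2 := ((hal'.pow 2).add (hbe'.const_mul 2)).add (hbe'.pow 2)
  have hc1 := (hal'.const_mul 2).add ((hal'.const_mul 2).mul hbe')
  have hH := rec_tendsto (x := HS p) (r := 1 / (p:ℝ) ^ 4) (by positivity) hp4 (((hc2.mul_const (1 - 1 / (p:ℝ))).const_add 1).add (hh.const_mul (2 / (p:ℝ) ^ 3)))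
    (fun K => by rw [HS_step hp h2]; ring)
  set H := (1 + (α ^ 2 + 2 * β + β ^ 2) * (1 - 1 / (p:ℝ)) + 2 / (p:ℝ) ^ 3 * h) / (1 - 1 / (p:ℝ) ^ 4) with hHd
  have hl := (((((hc1.div_const (p:ℝ)).const_sub 1).add (hc2.mul_const (1 - 2 / (p:ℝ)))).add (hh.const_mul (4 / (p:ℝ) ^ 3)))).add ((hH.const_mul 2).div_const ((p:ℝ) ^ 4))
  have hl2 := (loc_box hp).comp (tendsto_add_atTop_nat 1)
  have hl3 := hl.congr (fun K => (loc_step hp h2 K).symm)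
  have := tendsto_nhds_unique hl2 hl3
  rw [this]
  have k1 : (p:ℝ) - 1 ≠ 0 := by linarith
  have k2 : (p:ℝ) + 1 ≠ 0 := by linarith
  have k3 : (p:ℝ) ^ 2 - 1 ≠ 0 := by have : (p:ℝ) ^ 2 - 1 = (p - 1) * (p + 1) := by ring
                                    rw [this]; exact mul_ne_zero k1 k2
  have k0 : (p:ℝ) ≠ 0 := by linarith
  have k5 : (p:ℝ) ^ 2 + p + 1 ≠ 0 := by positivity
  have k6 : (p:ℝ) ^ 2 + 1 ≠ 0 := by positivity
  have a1 : α = p / (p ^ 2 - 1) := by rw [hα]; field_simp; ring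
  have b1 : β = 1 / (p ^ 2 - 1) := by rw [hβ]; field_simp; ring
  have h1 : h = p ^ 2 / (p ^ 2 - 1) := by
    have k4 : (1 - 1 / (p:ℝ) ^ 3) = (p - 1) * (p ^ 2 + p + 1) / p ^ 3 := by field_simp; ring
    rw [hhd, b1, k4]; field_simp; ring
  have H1 : H = (1 + (α ^ 2 + 2 * β + β ^ 2) * (1 - 1 / (p:ℝ)) + 2 / (p:ℝ) ^ 3 * h) * p ^ 4 / ((p ^ 2 - 1) * (p ^ 2 + 1)) := by
    have k4 : (1 - 1 / (p:ℝ) ^ 4) = (p ^ 2 - 1) * (p ^ 2 + 1) / p ^ 4 := by field_simp; ring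
    rw [hHd, k4]; field_simp
  rw [H1, h1, a1, b1]
  field_simp
  ring

end VA
end

section
namespace VA

lemma av_split2 (P : ℕ) (F : ℤ → ℝ) : av (2 * P) F = (av P (fun x => F (2 * x)) + av P (fun x => F (2 * x + 1))) / 2 := by
  have : ∀ P : ℕ, ∑ x ∈ Finset.range (2 * P), F (x:ℤ) = ∑ x ∈ Finset.range P, F (2 * (x:ℤ)) + ∑ x ∈ Finset.range P, F (2 * (x:ℤ) + 1) := by
    intro P
    induction P with
    | zero => simp
    | succ P ih =>
      rw [show 2 * (P + 1) = 2 * P + 1 + 1 by ring, Finset.sum_range_succ, Finset.sum_range_succ, Finset.sum_range_succ, Finset.sum_range_succ, ih]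
      push_cast
      ring
  unfold av
  rw [this]
  push_cast
  rw [← add_div, div_div, mul_comm]

lemma Per_c2 : Per 8 c2 := by
  intro x y h
  have h8 : x % 8 = y % 8 := h
  have h4 : x % 4 = y % 4 := by omega
  unfold c2
  rw [h8, h4]

lemma Per_gam (J : ℕ) : Per (2 ^ (2 * J + 1)) (gam J) := by
  induction J with
  | zero => intro x y _; rfl
  | succ J ih =>
    have h1 : Per (2 ^ (2 * (J + 1) + 1)) c2 := Per_c2.of_dvd ⟨2 ^ (2 * J), by ring⟩
    have h2 := Per.ite_dvd 4 (fun x => gam J x / 2) (ih.comp (fun t => t / 2))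
    have e : 4 * 2 ^ (2 * J + 1) = 2 ^ (2 * (J + 1) + 1) := by ring
    rw [e] at h2
    exact h1.add h2

lemma av_c2 : av 8 c2 = 7 / 12 := by
  simp [av, Finset.sum_range_succ, c2]; norm_num

lemma av_c2_sq : av 8 (fun x => c2 x ^ 2) = 29 / 36 := by
  simp [av, Finset.sum_range_succ, c2]; norm_num

noncomputable def g1 (K : ℕ) : ℝ := av (2 ^ (2 * K + 3)) (gam K)
noncomputable def g2 (K : ℕ) : ℝ := av (2 ^ (2 * K + 3)) (fun x => gam K x ^ 2)

lemma g1_step (K : ℕ) : g1 (K + 1) = 7 / 12 + 1 / 8 * g1 K := by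
  unfold g1
  have e : 2 ^ (2 * (K + 1) + 3) = 4 * 2 ^ (2 * K + 3) := by ring
  have h : ∀ x, gam (K + 1) x = c2 x + if ((4:ℕ):ℤ) ∣ x then (fun y => 1 / 2 * gam K y) (x / (4:ℕ)) else 0 := by
    intro x; simp only [gam]; push_cast; split_ifs <;> ring
  rw [av_congr h, av_add, e, av_dil (by norm_num) (fun y => 1 / 2 * gam K y), av_const_mul, av_dvd Per_c2 ⟨2 ^ (2 * K + 2), by ring⟩ (by positivity), av_c2]
  push_cast
  ring

lemma g2_step (K : ℕ) : g2 (K + 1) = (29 / 36 + 1 / 4 * g1 K) + 1 / 16 * g2 K := by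
  unfold g1 g2
  have e : 2 ^ (2 * (K + 1) + 3) = 4 * 2 ^ (2 * K + 3) := by ring
  have h : ∀ x, gam (K + 1) x ^ 2 = c2 x ^ 2 + if ((4:ℕ):ℤ) ∣ x then (fun y => gam K y + 1 / 4 * gam K y ^ 2) (x / (4:ℕ)) else 0 := by
    intro x; simp only [gam]; push_cast; split_ifs with h
    · have : c2 x = 1 := by unfold c2; rw [if_pos (Int.emod_eq_zero_of_dvd h)]
      rw [this]; ring
    · ring
  rw [av_congr h, av_add, e, av_dil (by norm_num) (fun y => gam K y + 1 / 4 * gam K y ^ 2), av_add, av_const_mul, av_dvd (Per_c2.comp (fun t => t ^ 2)) ⟨2 ^ (2 * K + 2), by ring⟩ (by positivity), av_c2_sq]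
  push_cast
  ring

lemma g1_tendsto : Tendsto g1 atTop (nhds (2 / 3)) := by
  have := rec_tendsto (x := g1) (r := 1 / 8) (by norm_num) (by norm_num) tendsto_const_nhds g1_step
  norm_num at this
  exact this

lemma g2_tendsto : Tendsto g2 atTop (nhds (28 / 27)) := by
  have := rec_tendsto (x := g2) (r := 1 / 16) (by norm_num) (by norm_num) ((g1_tendsto.const_mul (1 / 4)).const_add (29 / 36)) g2_step
  norm_num at this
  exact this

lemma modEq_two_pow {k : ℕ} {x y c : ℤ} (hc : Odd c) (h : ((2 ^ k : ℕ):ℤ) ∣ c * (y - x)) : x ≡ y [ZMOD (2 ^ k : ℕ)] := by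
  rw [Int.modEq_iff_dvd]
  apply IsCoprime.dvd_of_dvd_mul_left _ h
  push_cast
  apply IsCoprime.pow_left
  rw [Int.prime_two.coprime_iff_not_dvd]
  rw [← Int.not_even_iff_odd, even_iff_two_dvd] at hc
  exact hc

lemma av_beta (J : ℕ) : av (2 ^ (2 * J + 7)) (fun n => gam (J + 3) (n ^ 2 - 4) ^ 2) =
    2 / 9 + 1 / 4 + 1 / 8 * (9 / 4 + 49 / 16 + 7 / 16 * g1 J + 1 / 64 * g2 J) := by
  have hQ : 0 < 2 ^ (2 * J + 4) := by positivity
  have e1 : 2 ^ (2 * J + 7) = 2 * (2 * (2 * 2 ^ (2 * J + 4))) := by ring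
  have e2 : 2 ^ (2 * J + 4) = 2 * 2 ^ (2 * J + 3) := by ring
  -- values
  have v1 : ∀ m : ℤ, gam (J + 3) ((2 * m + 1) ^ 2 - 4) ^ 2 = 4 / 9 := by
    intro m
    have h8 : ((2 * m + 1) ^ 2 - 4) % 8 = 5 := by
      have : (2 * m + 1) ^ 2 - 4 = 4 * (m * (m + 1)) - 3 := by ring
      have h2 := Int.even_mul_succ_self m
      rw [this]; obtain ⟨r, hr⟩ := h2; rw [hr]; omega
    simp only [gam, c2]
    rw [if_neg (by omega), if_neg (by omega), if_pos h8, if_neg (by omega)]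
    norm_num
  have v2 : ∀ m : ℤ, gam (J + 3) ((2 * m) ^ 2 - 4) = 1 + gam (J + 2) (m ^ 2 - 1) / 2 := by
    intro m
    have e : (2 * m) ^ 2 - 4 = 4 * (m ^ 2 - 1) := by ring
    rw [e, gam, if_pos (dvd_mul_right _ _), Int.mul_ediv_cancel_left _ (by norm_num)]
    unfold c2; rw [if_pos (by omega)]
  have v3 : ∀ i : ℤ, gam (J + 3) ((2 * (2 * i)) ^ 2 - 4) ^ 2 = 1 := by
    intro i
    rw [v2]
    have e : (2 * i) ^ 2 - 1 = 4 * (i ^ 2) - 1 := by ring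
    rw [e]
    simp only [gam, c2]
    rw [if_neg (by omega), if_neg (by omega), if_neg (by omega), if_neg (by omega)]
    norm_num
  have v4 : ∀ j : ℤ, gam (J + 3) ((2 * (2 * j + 1)) ^ 2 - 4) = 3 / 2 + gam (J + 1) (j * (j + 1)) / 4 := by
    intro j
    rw [v2]
    have e : (2 * j + 1) ^ 2 - 1 = 4 * (j * (j + 1)) := by ring
    rw [e, gam, if_pos (dvd_mul_right _ _), Int.mul_ediv_cancel_left _ (by norm_num)]
    unfold c2; rw [if_pos (by omega)]; ring
  set Psi : ℤ → ℝ := fun z => (3 / 2 + gam (J + 1) (2 * z) / 4) ^ 2 with hPsi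
  have hPer : Per (2 ^ (2 * J + 4)) Psi := by
    intro x y hxy
    simp only [hPsi]
    rw [(Per_gam (J + 1)).of_dvd (Q := 2 ^ (2 * J + 4)) (pow_dvd_pow _ (by omega)) (2 * x) (2 * y) (hxy.mul_left _)]
  have v5 : ∀ i : ℤ, gam (J + 3) ((2 * (2 * (2 * i) + 1)) ^ 2 - 4) ^ 2 = Psi (i * (2 * i + 1)) := by
    intro i
    rw [v4]; simp only [hPsi]
    rw [show 2 * i * (2 * i + 1) = 2 * (i * (2 * i + 1)) by ring]
  have v6 : ∀ i : ℤ, gam (J + 3) ((2 * (2 * (2 * i + 1) + 1)) ^ 2 - 4) ^ 2 = Psi ((i + 1) * (2 * i + 1)) := by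
    intro i
    rw [v4]; simp only [hPsi]
    rw [show (2 * i + 1) * (2 * i + 1 + 1) = 2 * ((i + 1) * (2 * i + 1)) by ring]
  have p5 : av (2 ^ (2 * J + 4)) (fun i => Psi (i * (2 * i + 1))) = av (2 ^ (2 * J + 4)) Psi := by
    apply av_perm hQ hPer (fun i => i * (2 * i + 1))
    intro x y h
    apply modEq_two_pow (c := 2 * (x + y) + 1) ⟨x + y, rfl⟩
    rw [Int.modEq_iff_dvd] at h
    convert h using 1; ring
  have p6 : av (2 ^ (2 * J + 4)) (fun i => Psi ((i + 1) * (2 * i + 1))) = av (2 ^ (2 * J + 4)) Psi := by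
    apply av_perm hQ hPer (fun i => (i + 1) * (2 * i + 1))
    intro x y h
    apply modEq_two_pow (c := 2 * (x + y) + 3) ⟨x + y + 1, by ring⟩
    rw [Int.modEq_iff_dvd] at h
    convert h using 1; ring
  have w1 : ∀ t : ℤ, Psi (2 * t + 1) = 9 / 4 := by
    intro t
    simp only [hPsi, gam, c2]
    rw [if_neg (by omega), if_neg (by omega), if_neg (by omega), if_neg (by omega)]
    norm_num
  have w2 : ∀ t : ℤ, Psi (2 * t) = 49 / 16 + (7 / 16 * gam J t + 1 / 64 * gam J t ^ 2) := by
    intro t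
    simp only [hPsi]
    rw [show 2 * (2 * t) = 4 * t by ring, gam, if_pos (dvd_mul_right _ _), Int.mul_ediv_cancel_left _ (by norm_num)]
    unfold c2; rw [if_pos (by omega)]; ring
  have hPsiav : av (2 ^ (2 * J + 4)) Psi = (49 / 16 + (7 / 16 * g1 J + 1 / 64 * g2 J) + 9 / 4) / 2 := by
    rw [e2, av_split2, av_congr w1, av_congr w2, av_add, av_add, av_const (by positivity), av_const (by positivity), av_const_mul, av_const_mul]
    rfl
  rw [e1, av_split2, av_congr v1, av_split2, av_congr v3, av_const (by positivity), av_split2, av_congr v5, av_congr v6, p5, p6, hPsiav, av_const (by positivity)]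
  ring

lemma beta_tendsto : Tendsto (fun K => av (2 ^ (2 * K + 1)) (fun n => gam K (n ^ 2 - 4) ^ 2)) atTop (nhds (1015 / 864)) := by
  rw [← tendsto_add_atTop_iff_nat 3]
  have h := (((((g1_tendsto.const_mul (7 / 16)).const_add (9 / 4 + 49 / 16)).add (g2_tendsto.const_mul (1 / 64))).const_mul (1 / 8)).const_add (2 / 9 + 1 / 4))
  norm_num at h
  refine h.congr ?_
  intro J
  have := av_beta J
  rw [show 2 * (J + 3) + 1 = 2 * J + 7 by ring, this]
  ring

lemma kappa_eq : kappa = 1015 / 864 * KO := by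
  unfold kappa
  congr 1
  let i : {p : ℕ // p.Prime ∧ p ≠ 2} → Nat.Primes := fun p => ⟨p.1, p.2.1⟩
  have hi : Function.Injective i := by
    intro a b h
    exact Subtype.ext (congrArg (fun q : Nat.Primes => (q:ℕ)) h)
  have h : HasProd ((fun p : Nat.Primes => loc p) ∘ i) KO := by
    rw [hi.hasProd_iff]
    · exact KO_hasProd
    · intro x hx
      by_cases h2 : (x:ℕ) = 2
      · simp only [h2]; exact loc_two
      · exact absurd ⟨⟨x.1, x.2, h2⟩, rfl⟩ hx
  rw [← h.tprod_eq]
  apply tprod_congr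
  intro p
  exact (loc_eq p.2.1 p.2.2).symm

end VA
end

section
namespace VA

lemma exists_pow_bound (ε : ℝ) (hε : 0 < ε) : ∃ C : ℝ, 1 ≤ C ∧ ∀ p e : ℕ, 2 ≤ p → ((e:ℝ) + 1) ≤ C * ((p:ℝ) ^ e) ^ ε := by
  refine ⟨max 1 (1 + 1 / (ε * Real.log 2)), le_max_left _ _, ?_⟩
  intro p e hp
  have hl2 : 0 < Real.log 2 := Real.log_pos (by norm_num)
  have hp2 : (2:ℝ) ≤ p := by exact_mod_cast hp
  have h1 : 1 + (e:ℝ) * (ε * Real.log 2) ≤ ((p:ℝ) ^ e) ^ ε := by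
    rw [← Real.rpow_natCast, ← Real.rpow_mul (by positivity), Real.rpow_def_of_pos (by positivity)]
    have h3 := Real.add_one_le_exp (Real.log p * (e * ε))
    have h4 : Real.log 2 * (e * ε) ≤ Real.log p * (e * ε) := by
      apply mul_le_mul_of_nonneg_right _ (by positivity)
      exact Real.log_le_log (by norm_num) hp2
    nlinarith
  have h2 : (e:ℝ) + 1 ≤ (1 + 1 / (ε * Real.log 2)) * (1 + (e:ℝ) * (ε * Real.log 2)) := by
    have : 0 < ε * Real.log 2 := by positivity
    have h5 : (1 + 1 / (ε * Real.log 2)) * (1 + (e:ℝ) * (ε * Real.log 2)) = 1 + e + 1 / (ε * Real.log 2) + e * (ε * Real.log 2) := by field_simp; ring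
    rw [h5]
    have : 0 ≤ 1 / (ε * Real.log 2) + e * (ε * Real.log 2) := by positivity
    linarith
  refine h2.trans ?_
  gcongr
  exact le_max_right _ _

/-- divisor bound -/
lemma divisor_bound (ε : ℝ) (hε : 0 < ε) : ∃ C : ℝ, 1 ≤ C ∧ ∀ n : ℕ, (n.divisors.card : ℝ) ≤ C * (n:ℝ) ^ ε := by
  obtain ⟨C, hC1, hC⟩ := exists_pow_bound ε hε
  obtain ⟨B, hB⟩ := exists_nat_gt ((2:ℝ) ^ (1 / ε))
  have hC0 : 0 < C := by linarith
  refine ⟨C ^ B, one_le_pow₀ hC1, ?_⟩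
  intro n
  rcases Nat.eq_zero_or_pos n with rfl | hn
  · simp; positivity
  rw [Nat.card_divisors hn.ne']
  have e1 : (n:ℝ) ^ ε = ∏ p ∈ n.primeFactors, ((p:ℝ) ^ (n.factorization p)) ^ ε := by
    rw [Real.finsetProd_rpow _ _ (fun i _ => by positivity)]
    congr 1
    have := Nat.prod_factorization_pow_eq_self hn.ne'
    conv_lhs => rw [← this]
    rw [Finsupp.prod]
    push_cast
    rfl
  rw [e1]
  push_cast
  have e2 : ∀ p ∈ n.primeFactors, ((n.factorization p : ℝ) + 1) ≤ (if p < B then C else 1) * ((p:ℝ) ^ (n.factorization p)) ^ ε := by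
    intro p hp
    have hp' := Nat.prime_of_mem_primeFactors hp
    split_ifs with h
    · exact hC p _ hp'.two_le
    · push Not at h
      rw [one_mul]
      have hpB : (2:ℝ) ^ (1 / ε) ≤ p := hB.le.trans (by exact_mod_cast h)
      have h2 : (2:ℝ) ≤ (p:ℝ) ^ ε := by
        have := Real.rpow_le_rpow (by positivity) hpB hε.le
        rw [← Real.rpow_mul (by norm_num), one_div_mul_cancel hε.ne', Real.rpow_one] at this
        exact this
      rw [← Real.rpow_natCast, ← Real.rpow_mul (by positivity), mul_comm, Real.rpow_mul (by positivity), Real.rpow_natCast]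
      have h3 := one_add_mul_le_pow (a := (1:ℝ)) (by norm_num) (n.factorization p)
      calc ((n.factorization p : ℝ) + 1) ≤ (1 + 1) ^ (n.factorization p) := by linarith
        _ ≤ _ := by
          apply pow_le_pow_left₀ (by norm_num); linarith
  refine (Finset.prod_le_prod (fun p _ => by positivity) e2).trans ?_
  rw [Finset.prod_mul_distrib]
  apply mul_le_mul_of_nonneg_right _ (Finset.prod_nonneg fun p _ => by positivity)
  rw [Finset.prod_ite, Finset.prod_const, Finset.prod_const_one, mul_one]
  apply pow_le_pow_right₀ hC1
  calc _ ≤ (Finset.range B).card := by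
        apply Finset.card_le_card
        intro p hp
        rw [Finset.mem_filter] at hp
        exact Finset.mem_range.2 hp.2
    _ = B := Finset.card_range B

/-- doubling -/
lemma doubling {n m : ℤ} (hn : 3 ≤ n) (hnm : n < m) (h : IsSquare ((n ^ 2 - 4) * (m ^ 2 - 4))) : 2 * n < m := by
  by_contra hle
  push Not at hle
  obtain ⟨y, hy⟩ := h
  wlog hy0 : 0 ≤ y generalizing y
  · exact this (-y) (by rw [hy]; ring) (by omega)
  -- parity
  have hpar : Even (n * m - y) := by
    have h1 : Even ((n * m) ^ 2 - y ^ 2) := ⟨2 * (n ^ 2 + m ^ 2) - 8, by linear_combination hy⟩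
    rw [Int.even_sub, Int.even_pow' two_ne_zero, Int.even_pow' two_ne_zero] at h1
    rwa [Int.even_sub]
  obtain ⟨t, ht⟩ := hpar
  have hf : t ^ 2 - n * m * t + n ^ 2 + m ^ 2 - 4 = 0 := by
    have h2 : y = n * m - 2 * t := by linarith
    rw [h2] at hy
    linarith [hy, show (n * m - 2 * t) * (n * m - 2 * t) = (n*m)^2 - 4 * (n * m * t) + 4 * t ^ 2 by ring, show (n ^ 2 - 4) * (m ^ 2 - 4) = (n * m) ^ 2 - 4 * n ^ 2 - 4 * m ^ 2 + 16 by ring]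
  have ht2 : 2 * t ≤ n * m := by linarith
  have hnm9 : 12 ≤ n * m := by nlinarith
  -- t ≥ 3
  have ht3 : 3 ≤ t := by
    by_contra hlt
    push Not at hlt
    have h5 : (t - 2) * (t + 2 - n * m) = - (n - m) ^ 2 := by linear_combination hf
    have h6 : 0 < (n - m) ^ 2 := by
      have : n - m ≠ 0 := by omega
      positivity
    have h7 : 0 ≤ (t - 2) * (t + 2 - n * m) := mul_nonneg_of_nonpos_of_nonpos (by omega) (by linarith)
    linarith
  have h8 : (t - 3) * (t + 3 - n * m) = -(n ^ 2 + m ^ 2 + 5 - 3 * (n * m)) := by linear_combination hf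
  have h9 : (t - 3) * (t + 3 - n * m) ≤ 0 := mul_nonpos_of_nonneg_of_nonpos (by omega) (by linarith)
  nlinarith [mul_nonneg (show 0 ≤ m - n by omega) (show 0 ≤ 2 * n - m by omega)]

lemma isSquare_of_mul_sq {a b : ℤ} (ha : a ≠ 0) (h : IsSquare (a ^ 2 * b)) : IsSquare b := by
  obtain ⟨y, hy⟩ := h
  have h1 : a ^ 2 ∣ y ^ 2 := ⟨b, by linear_combination -hy⟩
  rw [Int.pow_dvd_pow_iff two_ne_zero] at h1
  obtain ⟨z, rfl⟩ := h1
  refine ⟨z, ?_⟩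
  have h2 : a ^ 2 ≠ 0 := pow_ne_zero 2 ha
  apply mul_left_cancel₀ h2
  linear_combination hy

lemma class_count {n N : ℕ} (hn : 3 ≤ n) (S : Finset ℕ) (hS : ∀ m ∈ S, 3 ≤ m ∧ m < N) (hsq : ∀ m ∈ S, IsSquare (Dz n * Dz m)) :
    S.card ≤ Nat.log 2 N + 1 := by
  have hinj : Set.InjOn (Nat.log 2) (S : Set ℕ) := by
    have key : ∀ a b : ℕ, a ∈ S → b ∈ S → a < b → Nat.log 2 a ≠ Nat.log 2 b := by
      intro a b ha hb hab he
      have h1 : IsSquare (Dz a * Dz b) := by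
        apply isSquare_of_mul_sq (Dz_pos hn).ne'
        have := (hsq a ha).mul (hsq b hb)
        have e : Dz n ^ 2 * (Dz a * Dz b) = Dz n * Dz a * (Dz n * Dz b) := by ring
        rw [e]; exact this
      have h2 := doubling (by exact_mod_cast (hS a ha).1) (by exact_mod_cast hab) h1
      have h3 : 2 * a < b := by exact_mod_cast h2
      have h4 := Nat.lt_pow_succ_log_self (b := 2) (by norm_num) b
      have h5 := Nat.pow_log_le_self 2 (x := a) (by have := (hS a ha).1; omega)
      rw [← he, pow_succ] at h4
      omega
    intro a ha b hb he
    rcases lt_trichotomy a b with h | h | h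
    · exact absurd he (key a b ha hb h)
    · exact h
    · exact absurd he.symm (key b a hb ha h)
  rw [← Finset.card_image_of_injOn hinj]
  calc _ ≤ (Finset.range (Nat.log 2 N + 1)).card := by
        apply Finset.card_le_card
        intro l hl
        rw [Finset.mem_image] at hl
        obtain ⟨m, hm, rfl⟩ := hl
        rw [Finset.mem_range]
        have := Nat.log_mono_right (b := 2) (hS m hm).2.le
        omega
    _ = _ := Finset.card_range _

end VA
end

section
namespace VA

open Classical in
lemma large_sieve (S : Finset ℕ) (d : ℕ → ℤ) (Dm : ℝ) (Δ : ℕ) (M0 M1 : ℕ) (hM0 : 0 < M0) (b : ℕ → ℝ)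
    (hd : ∀ n ∈ S, 0 < d n ∧ (d n : ℝ) ≤ Dm)
    (hΔ : ∀ n ∈ S, (S.filter (fun m => IsSquare (d n * d m))).card ≤ Δ) :
    ∑ n ∈ S, (∑ m ∈ Finset.Ico M0 M1, b m * (chi (d n) m / m : ℝ)) ^ 2 ≤
      (∑ m ∈ Finset.Ico M0 M1, b m ^ 2 / m) * (Δ * (∑ m ∈ Finset.Ico M0 M1, (1:ℝ) / m) + S.card * (16 * Dm ^ 2 / M0)) := by
  set I := Finset.Ico M0 M1 with hI
  set c : ℕ → ℝ := fun n => ∑ m ∈ I, b m * (chi (d n) m / m : ℝ) with hc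
  set K : ℝ := Δ * (∑ m ∈ I, (1:ℝ) / m) + S.card * (16 * Dm ^ 2 / M0) with hK
  have hIpos : ∀ m ∈ I, (0:ℝ) < m := by
    intro m hm
    rw [hI, Finset.mem_Ico] at hm
    exact_mod_cast lt_of_lt_of_le hM0 hm.1
  have hH : 0 ≤ ∑ m ∈ I, (1:ℝ) / m := Finset.sum_nonneg fun m _ => by positivity
  have hK0 : 0 ≤ K := by positivity
  have hB0 : 0 ≤ ∑ m ∈ I, b m ^ 2 / m := Finset.sum_nonneg fun m _ => by positivity
  -- kernel
  set ker : ℕ → ℕ → ℝ := fun n n' => ∑ m ∈ I, (chi (d n * d n') m / m : ℝ) with hker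
  have hkersymm : ∀ n n', ker n n' = ker n' n := by
    intro n n'; simp only [hker, mul_comm (d n)]
  have hkerb : ∀ n ∈ S, ∑ n' ∈ S, |ker n n'| ≤ K := by
    intro n hn
    have h1 : ∀ n' ∈ S, |ker n n'| ≤ (if IsSquare (d n * d n') then ∑ m ∈ I, (1:ℝ) / m else 0) + 16 * Dm ^ 2 / M0 := by
      intro n' hn'
      split_ifs with h
      · have : |ker n n'| ≤ ∑ m ∈ I, (1:ℝ) / m := by
          refine (Finset.abs_sum_le_sum_abs _ _).trans (Finset.sum_le_sum ?_)
          intro m hm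
          rw [abs_div, Nat.abs_cast]
          have := chi_abs_le_real (d n * d n') m
          gcongr
        have h2 : 0 ≤ 16 * Dm ^ 2 / (M0:ℝ) := by positivity
        linarith
      · rw [zero_add]
        have h0 : 0 < d n * d n' := mul_pos (hd n hn).1 (hd n' hn').1
        have h3 := chi_sum_div_Ico_le h0 h M0 M1 hM0
        refine h3.trans ?_
        gcongr
        have h4 := (hd n hn).2
        have h5 := (hd n' hn').2
        have h6 : (0:ℝ) < d n := by exact_mod_cast (hd n hn).1
        have h7 : (0:ℝ) < d n' := by exact_mod_cast (hd n' hn').1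
        push_cast
        nlinarith
    refine (Finset.sum_le_sum h1).trans ?_
    rw [Finset.sum_add_distrib, ← Finset.sum_filter, Finset.sum_const, Finset.sum_const, nsmul_eq_mul, nsmul_eq_mul]
    have h2 : ((S.filter (fun m => IsSquare (d n * d m))).card : ℝ) ≤ Δ := by exact_mod_cast hΔ n hn
    rw [hK]
    gcongr
  -- Schur
  have hschur : ∑ m ∈ I, (1 / (m:ℝ)) * (∑ n ∈ S, c n * chi (d n) m) ^ 2 ≤ K * ∑ n ∈ S, c n ^ 2 := by
    have e1 : ∑ m ∈ I, (1 / (m:ℝ)) * (∑ n ∈ S, c n * chi (d n) m) ^ 2 = ∑ n ∈ S, ∑ n' ∈ S, c n * c n' * ker n n' := by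
      have : ∀ m ∈ I, (1 / (m:ℝ)) * (∑ n ∈ S, c n * chi (d n) m) ^ 2 = ∑ n ∈ S, ∑ n' ∈ S, c n * c n' * (chi (d n * d n') m / m : ℝ) := by
        intro m _
        rw [pow_two, Finset.sum_mul_sum, Finset.mul_sum]
        apply Finset.sum_congr rfl; intro n _
        rw [Finset.mul_sum]
        apply Finset.sum_congr rfl; intro n' _
        rw [chi_mul_left]; push_cast; ring
      rw [Finset.sum_congr rfl this, Finset.sum_comm]
      apply Finset.sum_congr rfl; intro n _
      rw [Finset.sum_comm]
      apply Finset.sum_congr rfl; intro n' _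
      exact (Finset.mul_sum _ _ _).symm
    rw [e1]
    have h2 : ∀ n ∈ S, ∀ n' ∈ S, c n * c n' * ker n n' ≤ c n ^ 2 / 2 * |ker n n'| + c n' ^ 2 / 2 * |ker n n'| := by
      intro n _ n' _
      have h3 : c n * c n' * ker n n' ≤ |c n * c n'| * |ker n n'| := by
        rw [← abs_mul]; exact le_abs_self _
      have h4 : |c n * c n'| ≤ c n ^ 2 / 2 + c n' ^ 2 / 2 := by
        rw [abs_le]; constructor <;> nlinarith [sq_nonneg (c n - c n'), sq_nonneg (c n + c n')]
      nlinarith [abs_nonneg (ker n n')]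
    calc _ ≤ ∑ n ∈ S, ∑ n' ∈ S, (c n ^ 2 / 2 * |ker n n'| + c n' ^ 2 / 2 * |ker n n'|) :=
          Finset.sum_le_sum fun n hn => Finset.sum_le_sum fun n' hn' => h2 n hn n' hn'
      _ = ∑ n ∈ S, c n ^ 2 / 2 * ∑ n' ∈ S, |ker n n'| + ∑ n' ∈ S, c n' ^ 2 / 2 * ∑ n ∈ S, |ker n' n| := by
          simp only [Finset.sum_add_distrib]
          congr 1
          · apply Finset.sum_congr rfl; intro n _; rw [Finset.mul_sum]
          · rw [Finset.sum_comm]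
            apply Finset.sum_congr rfl; intro n _; rw [Finset.mul_sum]
            apply Finset.sum_congr rfl; intro n' _; rw [hkersymm]
      _ ≤ ∑ n ∈ S, c n ^ 2 / 2 * K + ∑ n ∈ S, c n ^ 2 / 2 * K := by
          apply add_le_add
          · exact Finset.sum_le_sum fun n hn => mul_le_mul_of_nonneg_left (hkerb n hn) (by positivity)
          · exact Finset.sum_le_sum fun n hn => mul_le_mul_of_nonneg_left (hkerb n hn) (by positivity)
      _ = _ := by rw [← Finset.sum_mul, ← Finset.sum_div]; ring
  -- duality
  set A := ∑ n ∈ S, c n ^ 2 with hA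
  have hA0 : 0 ≤ A := Finset.sum_nonneg fun n _ => sq_nonneg _
  have e2 : A = ∑ m ∈ I, (b m / Real.sqrt m) * ((1 / Real.sqrt m) * ∑ n ∈ S, c n * chi (d n) m) := by
    have : ∀ n ∈ S, c n ^ 2 = ∑ m ∈ I, c n * (b m * (chi (d n) m / m : ℝ)) := by
      intro n _; rw [← Finset.mul_sum, pow_two]
    rw [hA, Finset.sum_congr rfl this, Finset.sum_comm]
    apply Finset.sum_congr rfl; intro m hm
    rw [Finset.mul_sum, Finset.mul_sum]
    apply Finset.sum_congr rfl; intro n _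
    have h1 : (m:ℝ) = Real.sqrt m * Real.sqrt m := (Real.mul_self_sqrt (Nat.cast_nonneg m)).symm
    conv_lhs => rw [h1]
    field_simp
  have hCS := Finset.sum_mul_sq_le_sq_mul_sq I (fun m => b m / Real.sqrt m) (fun m => (1 / Real.sqrt m) * ∑ n ∈ S, c n * chi (d n) m)
  rw [← e2] at hCS
  have e3 : ∑ m ∈ I, (b m / Real.sqrt m) ^ 2 = ∑ m ∈ I, b m ^ 2 / m := by
    apply Finset.sum_congr rfl; intro m _; rw [div_pow, Real.sq_sqrt (Nat.cast_nonneg m)]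
  have e4 : ∑ m ∈ I, ((1 / Real.sqrt m) * ∑ n ∈ S, c n * chi (d n) m) ^ 2 = ∑ m ∈ I, (1 / (m:ℝ)) * (∑ n ∈ S, c n * chi (d n) m) ^ 2 := by
    apply Finset.sum_congr rfl; intro m _; rw [mul_pow, div_pow, Real.sq_sqrt (Nat.cast_nonneg m), one_pow]
  rw [e3, e4] at hCS
  have h5 : A ^ 2 ≤ (∑ m ∈ I, b m ^ 2 / m) * K * A := by
    refine hCS.trans ?_
    rw [mul_assoc]
    exact mul_le_mul_of_nonneg_left hschur hB0
  rcases hA0.eq_or_lt with h | h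
  · rw [← h]; positivity
  · have : A * A ≤ (∑ m ∈ I, b m ^ 2 / m) * K * A := by rw [← pow_two]; exact h5
    exact le_of_mul_le_mul_right this h

end VA
end

section
namespace VA

/-- coefficient of the k-th power expansion -/
noncomputable def pb (k A B m : ℕ) : ℝ :=
  (((Fintype.piFinset (fun _ : Fin k => Finset.Ico A B)).filter (fun f => ∏ i, f i = m)).card : ℝ)

lemma pb_nonneg (k A B m : ℕ) : 0 ≤ pb k A B m := by unfold pb; positivity

lemma pb_le (k A B m : ℕ) (hA : 0 < A) : pb k A B m ≤ (m.divisors.card : ℝ) ^ k := by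
  unfold pb
  have h : ((Fintype.piFinset (fun _ : Fin k => Finset.Ico A B)).filter (fun f => ∏ i, f i = m)) ⊆
      Fintype.piFinset (fun _ : Fin k => m.divisors) := by
    intro f hf
    rw [Finset.mem_filter, Fintype.mem_piFinset] at hf
    rw [Fintype.mem_piFinset]
    intro i
    rw [Nat.mem_divisors]
    refine ⟨hf.2 ▸ Finset.dvd_prod_of_mem f (Finset.mem_univ i), ?_⟩
    rw [← hf.2]
    apply Finset.prod_ne_zero_iff.mpr
    intro j _
    have := Finset.mem_Ico.mp (hf.1 j)
    omega
  have h2 := Finset.card_le_card h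
  rw [Fintype.card_piFinset_const] at h2
  exact_mod_cast h2

lemma pow_expand (k A B : ℕ) (χ : ℕ → ℝ) (h1 : χ 1 = 1) (hm : ∀ a b, χ (a * b) = χ a * χ b) :
    (∑ q ∈ Finset.Ico A B, χ q / q) ^ k = ∑ m ∈ Finset.Ico (A ^ k) (B ^ k + 1), pb k A B m * (χ m / m) := by
  have e1 : (∑ q ∈ Finset.Ico A B, χ q / q) ^ k = ∏ i : Fin k, ∑ q ∈ Finset.Ico A B, χ q / q := by
    rw [Finset.prod_const, Finset.card_univ, Fintype.card_fin]
  rw [e1, Finset.prod_univ_sum]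
  have hprod : ∀ f : Fin k → ℕ, ∏ i, χ (f i) / (f i : ℝ) = χ (∏ i, f i) / ((∏ i, f i : ℕ) : ℝ) := by
    intro f
    rw [Finset.prod_div_distrib, Nat.cast_prod]
    congr 1
    let F : ℕ →* ℝ := { toFun := χ, map_one' := h1, map_mul' := hm }
    exact (map_prod F f Finset.univ).symm
  rw [Finset.sum_congr rfl (fun f _ => hprod f)]
  have hmaps : ∀ f ∈ Fintype.piFinset (fun _ : Fin k => Finset.Ico A B), ∏ i, f i ∈ Finset.Ico (A ^ k) (B ^ k + 1) := by
    intro f hf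
    rw [Fintype.mem_piFinset] at hf
    rw [Finset.mem_Ico]
    have h1 : A ^ k = ∏ i : Fin k, A := by simp
    have h2 : B ^ k = ∏ i : Fin k, B := by simp
    refine ⟨?_, Nat.lt_succ_of_le ?_⟩
    · rw [h1]; exact Finset.prod_le_prod' fun i _ => (Finset.mem_Ico.mp (hf i)).1
    · rw [h2]; exact Finset.prod_le_prod' fun i _ => (Finset.mem_Ico.mp (hf i)).2.le
  rw [← Finset.sum_fiberwise_of_maps_to hmaps]
  apply Finset.sum_congr rfl
  intro m _
  rw [Finset.sum_congr rfl (g := fun _ => χ m / (m:ℝ))]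
  · rw [Finset.sum_const, nsmul_eq_mul, pb]
  · intro f hf
    rw [(Finset.mem_filter.mp hf).2]

lemma harm_le (A B : ℕ) (hA : 0 < A) (hB : 0 < B): ∑ q ∈ Finset.Ico A B, (1:ℝ) / q ≤ 1 + Real.log B := by
  have h := harmonic_le_one_add_log B
  refine le_trans ?_ h
  rw [harmonic_eq_sum_Icc]
  push_cast
  simp only [one_div]
  apply Finset.sum_le_sum_of_subset_of_nonneg
  · intro x hx; simp only [Finset.mem_Ico, Finset.mem_Icc] at *; omega
  · intros; positivity

open Classical in
/-- high moment bound for short character sums -/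
lemma moment_bound (S : Finset ℕ) (d : ℕ → ℤ) (Dm : ℝ) (Δ : ℕ) (k A B : ℕ) (hA : 0 < A) (hB : 0 < B)
    (hd : ∀ n ∈ S, 0 < d n ∧ (d n : ℝ) ≤ Dm)
    (hΔ : ∀ n ∈ S, (S.filter (fun m => IsSquare (d n * d m))).card ≤ Δ) (M : ℝ) (hM0 : 0 ≤ M)
    (hM : ∀ m ∈ Finset.Ico (A ^ k) (B ^ k + 1), (m.divisors.card : ℝ) ≤ M) :
    ∑ n ∈ S, (∑ q ∈ Finset.Ico A B, (chi (d n) q / q : ℝ)) ^ (2 * k) ≤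
      (M ^ k * (1 + Real.log B) ^ k) * (Δ * (1 + Real.log (B ^ k + 1)) + S.card * (16 * Dm ^ 2 / (A:ℝ) ^ k)) := by
  have hls := large_sieve S d Dm Δ (A ^ k) (B ^ k + 1) (by positivity) (pb k A B) hd hΔ
  have e1 : ∀ n ∈ S, (∑ q ∈ Finset.Ico A B, (chi (d n) q / q : ℝ)) ^ (2 * k) =
      (∑ m ∈ Finset.Ico (A ^ k) (B ^ k + 1), pb k A B m * (chi (d n) m / m : ℝ)) ^ 2 := by
    intro n _
    rw [mul_comm, pow_mul, pow_expand k A B (fun q => (chi (d n) q : ℝ))]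
    · simp [chi_one]
    · intro a b; simp [chi_mul]
  rw [Finset.sum_congr rfl e1]
  refine hls.trans ?_
  have hlogB : 0 ≤ Real.log B := Real.log_natCast_nonneg B
  have hlogB2 : 0 ≤ Real.log ((B:ℝ) ^ k + 1) := by
    have := Real.log_natCast_nonneg (B ^ k + 1)
    push_cast at this; exact this
  have h2 : ∑ m ∈ Finset.Ico (A ^ k) (B ^ k + 1), pb k A B m ^ 2 / (m:ℝ) ≤ M ^ k * (1 + Real.log B) ^ k := by
    have e2 := pow_expand k A B (fun _ => 1) rfl (by simp)
    calc _ ≤ ∑ m ∈ Finset.Ico (A ^ k) (B ^ k + 1), M ^ k * (pb k A B m * (1 / (m:ℝ))) := by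
          apply Finset.sum_le_sum; intro m hm
          have h3 : pb k A B m ≤ M ^ k := (pb_le k A B m hA).trans (pow_le_pow_left₀ (by positivity) (hM m hm) k)
          have h4 := pb_nonneg k A B m
          rw [pow_two, mul_div_assoc, div_eq_mul_one_div]
          exact mul_le_mul_of_nonneg_right h3 (by positivity)
      _ = M ^ k * (∑ q ∈ Finset.Ico A B, (1:ℝ) / q) ^ k := by rw [← Finset.mul_sum, ← e2]
      _ ≤ _ := by
          have := harm_le A B hA hB
          gcongr
  have h3 := harm_le (A ^ k) (B ^ k + 1) (by positivity) (by positivity)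
  push_cast at h3 ⊢
  gcongr

end VA
end

section
namespace VA

lemma log_le_of (δ : ℝ) (hδ : 0 < δ) (hδ1 : δ ≤ 1) (c : ℝ) (hc : 0 ≤ c) :
    ∃ C : ℝ, 0 < C ∧ ∀ Y : ℝ, 1 ≤ Y → c + c * Real.log Y ≤ C * Y ^ δ := by
  refine ⟨c + c / δ + 1, by positivity, fun Y hY => ?_⟩
  have h1 := Real.log_le_rpow_div (x := Y) (by linarith) hδ
  have h2 : 1 ≤ Y ^ δ := Real.one_le_rpow hY hδ.le
  have h3 : c * Real.log Y ≤ c / δ * Y ^ δ := by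
    have := mul_le_mul_of_nonneg_left h1 hc
    calc _ ≤ _ := this
      _ = _ := by ring
  nlinarith

lemma young (P θ : ℝ) (k : ℕ) (hk : 1 ≤ k) (hθ : 0 < θ) : P ^ 2 ≤ θ + P ^ (2 * k) / θ ^ (k - 1) := by
  by_cases h : P ^ 2 ≤ θ
  · have : 0 ≤ P ^ (2 * k) / θ ^ (k - 1) := by
      rw [pow_mul]; positivity
    linarith
  · push Not at h
    have h1 : θ ^ (k-1) ≤ (P ^ 2) ^ (k - 1) := pow_le_pow_left₀ hθ.le h.le _
    have h2 : P ^ 2 ≤ P ^ (2 * k) / θ ^ (k - 1) := by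
      rw [le_div_iff₀ (by positivity), pow_mul]
      obtain ⟨j, rfl⟩ : ∃ j, k = j + 1 := ⟨k - 1, by omega⟩
      rw [Nat.add_sub_cancel] at *
      rw [pow_succ (P ^ 2) j, mul_comm]
      gcongr
    linarith

lemma log_pow_bound (Y N : ℕ) (hY : 1 ≤ Y) (hN : N ≤ Y ^ 33) : Nat.log 2 N + 1 ≤ 67 * Y := by
  obtain ⟨j, hj⟩ : ∃ j, j = 33 := ⟨_, rfl⟩
  rw [← hj] at hN
  have h1 : Y < 2 ^ (Nat.log 2 Y + 1) := Nat.lt_pow_succ_log_self (by norm_num) Y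
  have h2 : Y ^ j < 2 ^ (j * (Nat.log 2 Y + 1)) := by
    rw [mul_comm, pow_mul]; exact Nat.pow_lt_pow_left h1 (by omega)
  have h3 : Nat.log 2 N < j * (Nat.log 2 Y + 1) := by
    apply Nat.log_lt_of_lt_pow'
    · rw [hj]; omega
    · exact lt_of_le_of_lt hN h2
  have h4 : Nat.log 2 Y ≤ Y := Nat.log_le_self 2 Y
  rw [hj] at h3
  omega

open Classical in
lemma tail_v : ∃ C : ℝ, 0 < C ∧ ∀ Y N v : ℕ, 1 ≤ Y → Y ^ 32 ≤ N → N ≤ Y ^ 33 → 1 ≤ v → v ≤ Y →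
    ∑ n ∈ (Finset.Ico 3 N).filter (fun n => (v:ℤ) ^ 2 ∣ Dz n),
      (∑ q ∈ Finset.Ico (Y ^ 2 / v + 1) (N ^ 3), (chi (Dz n / (v:ℤ) ^ 2) q / q : ℝ)) ^ 2 ≤
      C * N * (Y:ℝ) ^ (-(1/8) : ℝ) := by
  obtain ⟨k, hk⟩ : ∃ k : ℕ, k = 165 := ⟨_, rfl⟩
  have hkR : (k:ℝ) = 165 := by rw [hk]; norm_num
  obtain ⟨C0, hC0, hdiv⟩ := divisor_bound (1 / (16335 * 165)) (by norm_num)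
  obtain ⟨c1, hc1, hl1⟩ := log_le_of (1/165) (by norm_num) (by norm_num) 99 (by norm_num)
  obtain ⟨c2, hc2, hl2⟩ := log_le_of 1 (by norm_num) (by norm_num) 16335 (by norm_num)
  have hC0p : 0 < C0 := by linarith
  refine ⟨1 + C0 ^ k * c1 ^ k * (67 * c2 + 16), by positivity, ?_⟩
  intro Y N v hY hN1 hN2 hv1 hv2
  have hYR : (1:ℝ) ≤ Y := by exact_mod_cast hY
  have hY0 : (0:ℝ) < Y := by linarith
  have hN0 : 0 < N := lt_of_lt_of_le (by positivity) hN1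
  have hNR : (0:ℝ) < N := by exact_mod_cast hN0
  have hN2R : (N:ℝ) ≤ (Y:ℝ) ^ 33 := by exact_mod_cast hN2
  have hN1R : (Y:ℝ) ^ 32 ≤ (N:ℝ) := by exact_mod_cast hN1
  have hlogN : Real.log N ≤ 33 * Real.log Y := by
    have := Real.log_le_log hNR hN2R
    rw [Real.log_pow] at this; exact_mod_cast this
  set S := (Finset.Ico 3 N).filter (fun n => (v:ℤ) ^ 2 ∣ Dz n) with hS
  set A := Y ^ 2 / v + 1 with hA
  have hvpos : (0:ℤ) < (v:ℤ) ^ 2 := by positivity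
  have hAY : Y ≤ A := by
    have : Y ≤ Y ^ 2 / v := by
      rw [Nat.le_div_iff_mul_le (by omega)]; nlinarith
    omega
  have hScard : (S.card : ℝ) ≤ N := by
    have : S.card ≤ N := by
      refine (Finset.card_filter_le _ _).trans ?_
      rw [Nat.card_Ico]; omega
    exact_mod_cast this
  have hmul : ∀ n ∈ S, Dz n / (v:ℤ) ^ 2 * (v:ℤ) ^ 2 = Dz n := by
    intro n hn
    exact Int.ediv_mul_cancel (Finset.mem_filter.mp hn).2
  have hSn : ∀ n ∈ S, 3 ≤ n ∧ n < N := by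
    intro n hn
    exact Finset.mem_Ico.mp (Finset.mem_filter.mp hn).1
  have hd : ∀ n ∈ S, 0 < Dz n / (v:ℤ) ^ 2 ∧ ((Dz n / (v:ℤ) ^ 2 : ℤ) : ℝ) ≤ (N:ℝ) ^ 2 := by
    intro n hn
    have h := hSn n hn
    refine ⟨(Dz_div_props (n := n) h.1 (hmul n hn)).1, ?_⟩
    have h1 : Dz n / (v:ℤ) ^ 2 ≤ (N:ℤ) ^ 2 := by
      refine (Int.ediv_le_self _ (Dz_pos h.1).le).trans ?_
      unfold Dz
      have : (n:ℤ) < N := by exact_mod_cast h.2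
      nlinarith
    exact_mod_cast h1
  have hΔ : ∀ n ∈ S, (S.filter (fun m => IsSquare (Dz n / (v:ℤ) ^ 2 * (Dz m / (v:ℤ) ^ 2)))).card ≤ Nat.log 2 N + 1 := by
    intro n hn
    apply class_count (hSn n hn).1
    · intro m hm
      exact hSn m (Finset.mem_filter.mp hm).1
    · intro m hm
      rw [Finset.mem_filter] at hm
      rw [← hmul n hn, ← hmul m hm.1]
      obtain ⟨r, hr⟩ := hm.2
      refine ⟨r * v ^ 2, ?_⟩
      calc _ = (Dz n / (v:ℤ) ^ 2 * (Dz m / (v:ℤ) ^ 2)) * (v ^ 2 * v ^ 2) := by ring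
        _ = _ := by rw [hr]; ring
  have hM : ∀ m ∈ Finset.Ico (A ^ k) ((N ^ 3) ^ k + 1), (m.divisors.card : ℝ) ≤ C0 * (Y:ℝ) ^ (1/165 : ℝ) := by
    intro m hm
    refine (hdiv m).trans ?_
    apply mul_le_mul_of_nonneg_left _ hC0p.le
    have h1 : (m:ℝ) ≤ (Y:ℝ) ^ (16335:ℝ) := by
      have h2 : m ≤ (N ^ 3) ^ k := by have := (Finset.mem_Ico.mp hm).2; omega
      have h3 : (N ^ 3) ^ k ≤ ((Y ^ 33) ^ 3) ^ k := by gcongr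
      have h4 : (m:ℝ) ≤ (((Y ^ 33) ^ 3) ^ k : ℕ) := by exact_mod_cast h2.trans h3
      refine h4.trans (le_of_eq ?_)
      push_cast
      rw [← pow_mul, ← pow_mul, ← Real.rpow_natCast]
      congr 1
      push_cast; rw [hkR]; norm_num
    calc (m:ℝ) ^ (1 / (16335 * 165) : ℝ) ≤ ((Y:ℝ) ^ (16335:ℝ)) ^ (1 / (16335 * 165) : ℝ) :=
          Real.rpow_le_rpow (by positivity) h1 (by norm_num)
      _ = _ := by rw [← Real.rpow_mul hY0.le]; norm_num
  have hmom := moment_bound S (fun n => Dz n / (v:ℤ) ^ 2) ((N:ℝ) ^ 2) (Nat.log 2 N + 1) k A (N ^ 3) (by omega) (by positivity) hd hΔ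
    (C0 * (Y:ℝ) ^ (1/165 : ℝ)) (by positivity) hM
  have hYk : ((Y:ℝ) ^ (1/165 : ℝ)) ^ k = Y := by
    rw [← Real.rpow_natCast, ← Real.rpow_mul hY0.le, hkR]; norm_num
  have hbound : ∑ n ∈ S, (∑ q ∈ Finset.Ico A (N ^ 3), (chi (Dz n / (v:ℤ) ^ 2) q / q : ℝ)) ^ (2 * k) ≤
      C0 ^ k * c1 ^ k * (67 * c2 + 16) * (Y:ℝ) ^ 4 := by
    refine hmom.trans ?_
    have b1 : (1 + Real.log ((N ^ 3 : ℕ) : ℝ)) ≤ c1 * (Y:ℝ) ^ (1/165 : ℝ) := by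
      refine le_trans ?_ (hl1 Y hYR)
      push_cast; rw [Real.log_pow]; push_cast; linarith
    have b1' : 0 ≤ (1 + Real.log ((N ^ 3 : ℕ) : ℝ)) := by
      have := Real.log_natCast_nonneg (N ^ 3); linarith
    have b2 : (1 + Real.log (((N ^ 3 : ℕ) : ℝ) ^ k + 1)) ≤ c2 * (Y:ℝ) := by
      have h := hl2 Y hYR
      rw [Real.rpow_one] at h
      refine le_trans ?_ h
      have h1 : ((N ^ 3 : ℕ) : ℝ) ^ k + 1 ≤ 2 * ((N ^ 3 : ℕ) : ℝ) ^ k := by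
        have : (1:ℝ) ≤ ((N ^ 3 : ℕ) : ℝ) ^ k := by
          have : 1 ≤ (N ^ 3) ^ k := Nat.one_le_pow _ _ (by positivity)
          exact_mod_cast this
        linarith
      have h2 := Real.log_le_log (by positivity) h1
      have h3 : Real.log (2 * ((N ^ 3 : ℕ) : ℝ) ^ k) = Real.log 2 + 495 * Real.log N := by
        rw [Real.log_mul (by norm_num) (by positivity), Real.log_pow]; push_cast
        rw [Real.log_pow, hkR]; push_cast; ring
      have h4 : Real.log 2 ≤ 1 := by have := Real.log_two_lt_d9; linarith
      rw [h3] at h2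
      linarith
    have b2' : 0 ≤ (1 + Real.log (((N ^ 3 : ℕ) : ℝ) ^ k + 1)) := by
      have := Real.log_natCast_nonneg ((N ^ 3) ^ k + 1)
      push_cast at this ⊢; linarith
    have b3 : ((Nat.log 2 N + 1 : ℕ) : ℝ) ≤ 67 * Y := by exact_mod_cast log_pow_bound Y N hY hN2
    have b4 : (S.card : ℝ) * (16 * ((N:ℝ) ^ 2) ^ 2 / (A:ℝ) ^ k) ≤ 16 := by
      have h1 : (N:ℝ) ^ 5 ≤ (A:ℝ) ^ k := by
        have : N ^ 5 ≤ A ^ k := by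
          calc N ^ 5 ≤ (Y ^ 33) ^ 5 := by gcongr
            _ = Y ^ k := by rw [← pow_mul, hk]
            _ ≤ A ^ k := by gcongr
        exact_mod_cast this
      have hApos : (0:ℝ) < (A:ℝ) ^ k := lt_of_lt_of_le (by positivity) h1
      calc (S.card : ℝ) * (16 * ((N:ℝ) ^ 2) ^ 2 / (A:ℝ) ^ k) ≤ N * (16 * ((N:ℝ) ^ 2) ^ 2 / (A:ℝ) ^ k) := by gcongr
        _ = 16 * ((N:ℝ) ^ 5 / (A:ℝ) ^ k) := by ring
        _ ≤ 16 * 1 := by gcongr; rw [div_le_one hApos]; exact h1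
        _ = 16 := by ring
    calc _ ≤ ((C0 * (Y:ℝ) ^ (1/165 : ℝ)) ^ k * (c1 * (Y:ℝ) ^ (1/165 : ℝ)) ^ k) * ((67 * Y) * (c2 * Y) + 16) := by
          gcongr
      _ = C0 ^ k * c1 ^ k * (Y:ℝ) ^ 2 * (67 * c2 * (Y:ℝ) ^ 2 + 16) := by
          rw [mul_pow, mul_pow, hYk]; ring
      _ ≤ C0 ^ k * c1 ^ k * (Y:ℝ) ^ 2 * ((67 * c2 + 16) * (Y:ℝ) ^ 2) := by
          have : (1:ℝ) ≤ (Y:ℝ) ^ 2 := one_le_pow₀ hYR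
          gcongr
          nlinarith
      _ = _ := by ring
  set θ := (Y:ℝ) ^ (-(1/8) : ℝ) with hθ
  have hθ0 : 0 < θ := by positivity
  have hθk : θ ^ (k - 1) = (Y:ℝ) ^ (-(164/8) : ℝ) := by
    rw [hθ, ← Real.rpow_natCast, ← Real.rpow_mul hY0.le, hk]; norm_num
  have hfin : (Y:ℝ) ^ 4 / θ ^ (k - 1) ≤ N * θ := by
    rw [hθk, ← Real.rpow_natCast, ← Real.rpow_sub hY0]
    calc _ ≤ (Y:ℝ) ^ ((32:ℕ) + (-(1/8)) : ℝ) := by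
          apply Real.rpow_le_rpow_of_exponent_le hYR; norm_num
      _ = (Y:ℝ) ^ 32 * θ := by rw [Real.rpow_add hY0, Real.rpow_natCast]
      _ ≤ _ := by gcongr
  calc _ ≤ ∑ n ∈ S, (θ + (∑ q ∈ Finset.Ico A (N ^ 3), (chi (Dz n / (v:ℤ) ^ 2) q / q : ℝ)) ^ (2 * k) / θ ^ (k - 1)) :=
        Finset.sum_le_sum fun n _ => young _ _ _ (by omega) hθ0
    _ = S.card * θ + (∑ n ∈ S, (∑ q ∈ Finset.Ico A (N ^ 3), (chi (Dz n / (v:ℤ) ^ 2) q / q : ℝ)) ^ (2 * k)) / θ ^ (k - 1) := by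
        rw [Finset.sum_add_distrib, Finset.sum_const, nsmul_eq_mul, Finset.sum_div]
    _ ≤ N * θ + (C0 ^ k * c1 ^ k * (67 * c2 + 16) * (Y:ℝ) ^ 4) / θ ^ (k - 1) := by gcongr
    _ = N * θ + (C0 ^ k * c1 ^ k * (67 * c2 + 16)) * ((Y:ℝ) ^ 4 / θ ^ (k - 1)) := by ring
    _ ≤ N * θ + (C0 ^ k * c1 ^ k * (67 * c2 + 16)) * (N * θ) := by gcongr
    _ = _ := by ring

end VA
end

section
namespace VA

lemma Lpart_abs_le (d : ℤ) (M B : ℕ) (hMB : M ≤ B) (hB : 0 < B) : |Lpart d M| ≤ 1 + Real.log B := by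
  unfold Lpart
  have h1 : ∑ q ∈ Finset.range M, (chi d q / q : ℝ) = ∑ q ∈ Finset.Ico 1 M, (chi d q / q : ℝ) := by
    rw [Finset.range_eq_Ico]
    rcases Nat.eq_zero_or_pos M with h | h
    · subst h; simp
    · rw [Finset.sum_eq_sum_Ico_succ_bot h]; simp
  rw [h1]
  refine (Finset.abs_sum_le_sum_abs _ _).trans ?_
  refine le_trans ?_ (harm_le 1 B (by norm_num) hB)
  refine le_trans (Finset.sum_le_sum (g := fun q : ℕ => (1:ℝ) / q) ?_) ?_
  · intro q _
    rw [abs_div, Nat.abs_cast]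
    have := chi_abs_le_real d q
    gcongr
  · apply Finset.sum_le_sum_of_subset_of_nonneg
    · exact Finset.Ico_subset_Ico le_rfl hMB
    · intros; positivity

lemma sq_dvd_lt {n v : ℕ} (hn : 3 ≤ n) (h : (v:ℤ) ^ 2 ∣ Dz n) : v < n := by
  by_contra hh
  push Not at hh
  have h1 := Int.le_of_dvd (Dz_pos hn) h
  unfold Dz at h1
  have : (n:ℤ) ≤ v := by exact_mod_cast hh
  nlinarith

open Classical in
lemma Oval_Icc {n N : ℕ} (hn : 3 ≤ n) (hN : n ≤ N) :
    Oval n = ∑ v ∈ Finset.Icc 1 N, if Odd v ∧ (v:ℤ) ^ 2 ∣ Dz n then Lodd (Dz n / (v:ℤ) ^ 2) / v else 0 := by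
  unfold Oval
  rw [← Finset.sum_filter, ← Finset.sum_filter]
  apply Finset.sum_congr _ (fun _ _ => rfl)
  ext v
  simp only [Finset.mem_filter, Finset.mem_range, Finset.mem_Icc]
  constructor
  · rintro ⟨h1, h2, h3⟩
    refine ⟨⟨h2.pos, by omega⟩, h2, h3⟩
  · rintro ⟨h1, h2, h3⟩
    exact ⟨sq_dvd_lt hn h3, h2, h3⟩

open Classical in
lemma OZ_Icc {n N Z : ℕ} (hN : Z ≤ N) :
    OZ Z (Dz n) = ∑ v ∈ Finset.Icc 1 N, if Odd v ∧ (v:ℤ) ^ 2 ∣ Dz n then Lpart (Dz n / (v:ℤ) ^ 2) (Z / v + 1) / v else 0 := by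
  rw [OZ_eq]
  apply Finset.sum_subset
  · exact Finset.Icc_subset_Icc le_rfl hN
  · intro v hv hv2
    simp only [Finset.mem_Icc] at hv hv2
    have : Z / v = 0 := Nat.div_eq_of_lt (by omega)
    rw [this]
    have h0 : ∀ d, Lpart d (0 + 1) = 0 := by intro d; simp [Lpart]
    rw [h0]; simp

open Classical in
lemma tail_bound : ∃ C : ℝ, 0 < C ∧ ∀ Y N : ℕ, 1 ≤ Y → Y ^ 32 ≤ N → N ≤ Y ^ 33 →
    ∑ n ∈ Finset.Ico 3 N, (Oval n - OZ (Y ^ 2) (Dz n)) ^ 2 ≤ C * N * (Y:ℝ) ^ (-(1/10) : ℝ) := by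
  obtain ⟨C1, hC1, htail⟩ := tail_v
  obtain ⟨C0, hC0, hdiv⟩ := divisor_bound (1 / 264) (by norm_num)
  obtain ⟨c1, hc1, hl1⟩ := log_le_of (1/80) (by norm_num) (by norm_num) 2 (by norm_num)
  obtain ⟨c2, hc2, hl2⟩ := log_le_of (1/4) (by norm_num) (by norm_num) 132 (by norm_num)
  have hC0p : 0 < C0 := by linarith
  refine ⟨2 * (c1 * c1 * C1) + 2 * (C0 * c2) ^ 2, by positivity, ?_⟩
  intro Y N hY hN1 hN2
  have hYR : (1:ℝ) ≤ Y := by exact_mod_cast hY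
  have hY0 : (0:ℝ) < Y := by linarith
  have hYN : Y ≤ N := le_trans (Nat.le_self_pow (by norm_num) Y) hN1
  have hY2N : Y ^ 2 ≤ N := le_trans (Nat.pow_le_pow_right hY (by norm_num)) hN1
  have hN0 : 0 < N := by omega
  have hNR : (1:ℝ) ≤ N := by exact_mod_cast hN0
  have hN2R : (N:ℝ) ≤ (Y:ℝ) ^ 33 := by exact_mod_cast hN2
  have hlogN : Real.log N ≤ 33 * Real.log Y := by
    have := Real.log_le_log (by linarith) hN2R
    rw [Real.log_pow] at this; exact_mod_cast this
  set cnd : ℕ → ℕ → Prop := fun n v => Odd v ∧ (v:ℤ) ^ 2 ∣ Dz n with hcnd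
  set P : ℕ → ℕ → ℝ := fun n v => ∑ q ∈ Finset.Ico (Y ^ 2 / v + 1) (N ^ 3), (chi (Dz n / (v:ℤ) ^ 2) q / q : ℝ) with hP
  set x : ℕ → ℝ := fun n => ∑ v ∈ Finset.Icc 1 Y, if cnd n v then P n v / v else 0 with hx
  set R : ℕ → ℕ → ℝ := fun n v => if v ≤ Y then Lodd (Dz n / (v:ℤ) ^ 2) - Lpart (Dz n / (v:ℤ) ^ 2) (N ^ 3)
    else Lodd (Dz n / (v:ℤ) ^ 2) - Lpart (Dz n / (v:ℤ) ^ 2) (Y ^ 2 / v + 1) with hR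
  set y : ℕ → ℝ := fun n => ∑ v ∈ Finset.Icc 1 N, if cnd n v then R n v / v else 0 with hy
  have hxy : ∀ n ∈ Finset.Ico 3 N, Oval n - OZ (Y ^ 2) (Dz n) = x n + y n := by
    intro n hn
    rw [Finset.mem_Ico] at hn
    rw [Oval_Icc hn.1 hn.2.le, OZ_Icc hY2N, ← Finset.sum_sub_distrib]
    have e1 : x n = ∑ v ∈ Finset.Icc 1 N, if v ≤ Y then (if cnd n v then P n v / v else 0) else 0 := by
      rw [← Finset.sum_filter]
      apply Finset.sum_congr _ (fun _ _ => rfl)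
      ext v; simp only [Finset.mem_filter, Finset.mem_Icc]; omega
    rw [e1, hy, ← Finset.sum_add_distrib]
    apply Finset.sum_congr rfl
    intro v hv
    rw [Finset.mem_Icc] at hv
    by_cases hc : cnd n v
    · have hc' : Odd v ∧ (v:ℤ) ^ 2 ∣ Dz n := hc
      simp only [if_pos hc, if_pos hc']
      by_cases hvY : v ≤ Y
      · simp only [hR, if_pos hvY]
        have hle : Y ^ 2 / v + 1 ≤ N ^ 3 := by
          have h1 : Y ^ 2 / v ≤ Y ^ 2 := Nat.div_le_self _ _
          have h2 : 3 ≤ N := by omega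
          have h3 : N + 1 ≤ N ^ 3 := by
            calc N + 1 ≤ N * 3 := by omega
              _ ≤ N * N := Nat.mul_le_mul_left _ h2
              _ ≤ N ^ 3 := by rw [pow_succ, pow_two]; exact Nat.le_mul_of_pos_right _ (by omega)
          omega
        have h4 := Finset.sum_Ico_eq_sub (fun q : ℕ => (chi (Dz n / (v:ℤ) ^ 2) q / q : ℝ)) hle
        have h5 : P n v = Lpart (Dz n / (v:ℤ) ^ 2) (N ^ 3) - Lpart (Dz n / (v:ℤ) ^ 2) (Y ^ 2 / v + 1) := h4
        rw [h5]; ring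
      · simp only [hR, if_neg hvY]; ring
    · have hc' : ¬ (Odd v ∧ (v:ℤ) ^ 2 ∣ Dz n) := hc
      simp only [if_neg hc, if_neg hc']
      simp
  -- bound y
  have hyb : ∀ n ∈ Finset.Ico 3 N, (y n) ^ 2 ≤ (C0 * c2) ^ 2 * (Y:ℝ) ^ (-(1/10) : ℝ) := by
    intro n hn
    rw [Finset.mem_Ico] at hn
    have hE : ∀ v ∈ Finset.Icc 1 N, cnd n v → |R n v / v| ≤ c2 * (Y:ℝ) ^ (1/4 : ℝ) / Y := by
      intro v hv hc
      rw [Finset.mem_Icc] at hv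
      have hmul : Dz n / (v:ℤ) ^ 2 * (v:ℤ) ^ 2 = Dz n := Int.ediv_mul_cancel hc.2
      obtain ⟨hd0, hdsq⟩ := Dz_div_props hn.1 hmul
      have hv1 : (1:ℝ) ≤ v := by exact_mod_cast hv.1
      have hdN : ((Dz n / (v:ℤ) ^ 2 : ℤ) : ℝ) ≤ (N:ℝ) ^ 2 := by
        have h1 : Dz n / (v:ℤ) ^ 2 ≤ (N:ℤ) ^ 2 := by
          refine (Int.ediv_le_self _ (Dz_pos hn.1).le).trans ?_
          unfold Dz
          have : (n:ℤ) < N := by exact_mod_cast hn.2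
          nlinarith
        exact_mod_cast h1
      have hEb : 49 + 132 * Real.log Y ≤ c2 * (Y:ℝ) ^ (1/4 : ℝ) := by
        have := hl2 Y hYR; linarith
      have hlogY : 0 ≤ Real.log Y := Real.log_nonneg hYR
      rw [abs_div, Nat.abs_cast]
      by_cases hvY : v ≤ Y
      · simp only [hR, if_pos hvY]
        have h1 := Lodd_sub_Lpart hd0 hdsq (N ^ 3) (by positivity)
        have h2 : |Lodd (Dz n / (v:ℤ) ^ 2) - Lpart (Dz n / (v:ℤ) ^ 2) (N ^ 3)| ≤ 16 / Y := by
          refine h1.trans ?_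
          push_cast
          have hNY : (Y:ℝ) ≤ N := by exact_mod_cast hYN
          rw [div_le_div_iff₀ (by positivity) hY0]
          have : (16:ℝ) * ((Dz n / (v:ℤ) ^ 2 : ℤ) : ℝ) * Y ≤ 16 * (N:ℝ) ^ 2 * N := by
            gcongr
          calc _ ≤ _ := this
            _ = _ := by ring
        calc _ ≤ |Lodd (Dz n / (v:ℤ) ^ 2) - Lpart (Dz n / (v:ℤ) ^ 2) (N ^ 3)| / 1 := by gcongr
          _ ≤ 16 / Y := by rw [div_one]; exact h2
          _ ≤ _ := by gcongr; linarith
      · simp only [hR, if_neg hvY]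
        push Not at hvY
        have h1 := Lodd_sub_Lpart hd0 hdsq (16 * N ^ 2) (by positivity)
        have h1' : |Lodd (Dz n / (v:ℤ) ^ 2) - Lpart (Dz n / (v:ℤ) ^ 2) (16 * N ^ 2)| ≤ 1 := by
          refine h1.trans ?_
          push_cast
          rw [div_le_one (by positivity)]
          linarith
        have h2 := Lpart_abs_le (Dz n / (v:ℤ) ^ 2) (16 * N ^ 2) (16 * N ^ 2) le_rfl (by positivity)
        have h3 := Lpart_abs_le (Dz n / (v:ℤ) ^ 2) (Y ^ 2 / v + 1) (16 * N ^ 2) (by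
          have h1 : Y ^ 2 / v ≤ Y ^ 2 := Nat.div_le_self _ _
          nlinarith) (by positivity)
        have h4 : Real.log ((16 * N ^ 2 : ℕ) : ℝ) ≤ 15 + 66 * Real.log Y := by
          push_cast
          rw [Real.log_mul (by norm_num) (by positivity), Real.log_pow]
          have := Real.log_le_sub_one_of_pos (show (0:ℝ) < 16 by norm_num)
          push_cast; linarith
        have h5 : |Lodd (Dz n / (v:ℤ) ^ 2) - Lpart (Dz n / (v:ℤ) ^ 2) (Y ^ 2 / v + 1)| ≤ 49 + 132 * Real.log Y := by
          rw [abs_le] at *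
          constructor <;> linarith [h1'.1, h1'.2, h2.1, h2.2, h3.1, h3.2]
        have hvYR : (Y:ℝ) ≤ v := by exact_mod_cast hvY.le
        calc _ ≤ (49 + 132 * Real.log Y) / Y := by gcongr
          _ ≤ _ := by gcongr
    have hyabs : |y n| ≤ (C0 * (Y:ℝ) ^ (1/4 : ℝ)) * (c2 * (Y:ℝ) ^ (1/4 : ℝ) / Y) := by
      have h1 : |y n| ≤ ∑ v ∈ (Finset.Icc 1 N).filter (cnd n), (c2 * (Y:ℝ) ^ (1/4 : ℝ) / Y) := by
        simp only [hy]
        rw [← Finset.sum_filter]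
        refine (Finset.abs_sum_le_sum_abs _ _).trans (Finset.sum_le_sum ?_)
        intro v hv
        rw [Finset.mem_filter] at hv
        exact hE v hv.1 hv.2
      rw [Finset.sum_const, nsmul_eq_mul] at h1
      refine h1.trans ?_
      apply mul_le_mul_of_nonneg_right _ (by positivity)
      have h2 : ((Finset.Icc 1 N).filter (cnd n)).card ≤ (Dz n).natAbs.divisors.card := by
        apply Finset.card_le_card
        intro v hv
        rw [Finset.mem_filter] at hv
        rw [Nat.mem_divisors]
        refine ⟨?_, ?_⟩
        · have : (v:ℤ) ∣ Dz n := (dvd_pow_self _ (by norm_num)).trans hv.2.2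
          exact Int.natCast_dvd.mp this
        · have := Dz_pos hn.1; omega
      have h3 : (((Finset.Icc 1 N).filter (cnd n)).card : ℝ) ≤ (Dz n).natAbs.divisors.card := by exact_mod_cast h2
      refine h3.trans ((hdiv _).trans ?_)
      apply mul_le_mul_of_nonneg_left _ hC0p.le
      have h4 : (((Dz n).natAbs : ℕ) : ℝ) ≤ (Y:ℝ) ^ (66:ℝ) := by
        have h5 : (((Dz n).natAbs : ℕ) : ℤ) ≤ (N:ℤ) ^ 2 := by
          rw [Int.natAbs_of_nonneg (Dz_pos hn.1).le]
          unfold Dz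
          have : (n:ℤ) < N := by exact_mod_cast hn.2
          nlinarith
        have h6 : (((Dz n).natAbs : ℕ) : ℝ) ≤ (N:ℝ) ^ 2 := by exact_mod_cast h5
        refine h6.trans ?_
        calc (N:ℝ) ^ 2 ≤ ((Y:ℝ) ^ 33) ^ 2 := by gcongr
          _ = (Y:ℝ) ^ (66:ℝ) := by rw [← pow_mul, ← Real.rpow_natCast]; norm_num
      calc (((Dz n).natAbs : ℕ) : ℝ) ^ (1 / 264 : ℝ) ≤ ((Y:ℝ) ^ (66:ℝ)) ^ (1 / 264 : ℝ) :=
            Real.rpow_le_rpow (by positivity) h4 (by norm_num)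
        _ = _ := by rw [← Real.rpow_mul hY0.le]; norm_num
    have h8 : (C0 * (Y:ℝ) ^ (1/4 : ℝ)) * (c2 * (Y:ℝ) ^ (1/4 : ℝ) / Y) = C0 * c2 * (Y:ℝ) ^ (-(1/2) : ℝ) := by
      have : (Y:ℝ) ^ (-(1/2) : ℝ) = (Y:ℝ) ^ (1/4 : ℝ) * (Y:ℝ) ^ (1/4 : ℝ) / Y := by
        rw [← Real.rpow_add hY0]
        nth_rewrite 3 [← Real.rpow_one (Y:ℝ)]
        rw [← Real.rpow_sub hY0]; norm_num
      rw [this]; ring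
    rw [h8] at hyabs
    calc (y n) ^ 2 = |y n| ^ 2 := (sq_abs _).symm
      _ ≤ (C0 * c2 * (Y:ℝ) ^ (-(1/2) : ℝ)) ^ 2 := by gcongr
      _ = (C0 * c2) ^ 2 * (Y:ℝ) ^ (-1 : ℝ) := by
          rw [mul_pow, ← Real.rpow_natCast ((Y:ℝ) ^ (-(1/2) : ℝ)), ← Real.rpow_mul hY0.le]; norm_num
      _ ≤ _ := by
          gcongr
          norm_num
  -- bound x
  have hH : ∑ v ∈ Finset.Icc 1 Y, (1:ℝ) / v ≤ c1 * (Y:ℝ) ^ (1/80 : ℝ) := by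
    have h1 := harm_le 1 (Y + 1) (by norm_num) (by omega)
    have h2 : Finset.Ico 1 (Y + 1) = Finset.Icc 1 Y := by ext; simp only [Finset.mem_Ico, Finset.mem_Icc]; omega
    rw [h2] at h1
    refine h1.trans (le_trans ?_ (hl1 Y hYR))
    have h3 : ((Y + 1 : ℕ) : ℝ) ≤ 2 * Y := by push_cast; linarith
    have h4 := Real.log_le_log (by positivity) h3
    rw [Real.log_mul (by norm_num) (by positivity)] at h4
    have h5 : Real.log 2 ≤ 1 := by have := Real.log_two_lt_d9; linarith
    have hlogY : 0 ≤ Real.log Y := Real.log_nonneg hYR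
    linarith
  have hH0 : 0 ≤ ∑ v ∈ Finset.Icc 1 Y, (1:ℝ) / v := Finset.sum_nonneg fun _ _ => by positivity
  have hxb : ∀ n, (x n) ^ 2 ≤ (∑ v ∈ Finset.Icc 1 Y, (1:ℝ) / v) * ∑ v ∈ Finset.Icc 1 Y, (1 / (v:ℝ)) * (if cnd n v then P n v ^ 2 else 0) := by
    intro n
    have h1 := Finset.sum_mul_sq_le_sq_mul_sq (Finset.Icc 1 Y) (fun v : ℕ => 1 / Real.sqrt v)
      (fun v : ℕ => if cnd n v then P n v / Real.sqrt v else 0)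
    have e1 : ∑ v ∈ Finset.Icc 1 Y, (1 / Real.sqrt (v:ℝ)) * (if cnd n v then P n v / Real.sqrt v else 0) = x n := by
      apply Finset.sum_congr rfl; intro v _
      split_ifs
      · rw [div_mul_div_comm, one_mul, Real.mul_self_sqrt (Nat.cast_nonneg v)]
      · ring
    have e2 : ∑ v ∈ Finset.Icc 1 Y, (1 / Real.sqrt (v:ℝ)) ^ 2 = ∑ v ∈ Finset.Icc 1 Y, (1:ℝ) / v := by
      apply Finset.sum_congr rfl; intro v _
      rw [div_pow, Real.sq_sqrt (Nat.cast_nonneg v), one_pow]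
    have e3 : ∑ v ∈ Finset.Icc 1 Y, (if cnd n v then P n v / Real.sqrt v else 0) ^ 2 = ∑ v ∈ Finset.Icc 1 Y, (1 / (v:ℝ)) * (if cnd n v then P n v ^ 2 else 0) := by
      apply Finset.sum_congr rfl; intro v _
      split_ifs
      · rw [div_pow, Real.sq_sqrt (Nat.cast_nonneg v)]; ring
      · ring
    rw [e1, e2, e3] at h1
    exact h1
  have hxsum : ∑ n ∈ Finset.Ico 3 N, (x n) ^ 2 ≤ c1 * c1 * C1 * N * (Y:ℝ) ^ (-(1/10) : ℝ) := by
    have h1 : ∑ n ∈ Finset.Ico 3 N, ∑ v ∈ Finset.Icc 1 Y, (1 / (v:ℝ)) * (if cnd n v then P n v ^ 2 else 0) ≤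
        (∑ v ∈ Finset.Icc 1 Y, (1:ℝ) / v) * (C1 * N * (Y:ℝ) ^ (-(1/8) : ℝ)) := by
      rw [Finset.sum_comm, Finset.sum_mul]
      apply Finset.sum_le_sum
      intro v hv
      rw [Finset.mem_Icc] at hv
      rw [← Finset.mul_sum]
      apply mul_le_mul_of_nonneg_left _ (by positivity)
      refine le_trans ?_ (htail Y N v hY hN1 hN2 hv.1 hv.2)
      rw [Finset.sum_filter]
      apply Finset.sum_le_sum
      intro n _
      by_cases hc : cnd n v
      · rw [if_pos hc, if_pos hc.2]
      · rw [if_neg hc]; split_ifs <;> positivity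
    calc _ ≤ ∑ n ∈ Finset.Ico 3 N, (∑ v ∈ Finset.Icc 1 Y, (1:ℝ) / v) * ∑ v ∈ Finset.Icc 1 Y, (1 / (v:ℝ)) * (if cnd n v then P n v ^ 2 else 0) :=
          Finset.sum_le_sum fun n _ => hxb n
      _ = (∑ v ∈ Finset.Icc 1 Y, (1:ℝ) / v) * ∑ n ∈ Finset.Ico 3 N, ∑ v ∈ Finset.Icc 1 Y, (1 / (v:ℝ)) * (if cnd n v then P n v ^ 2 else 0) := by
          rw [Finset.mul_sum]
      _ ≤ (∑ v ∈ Finset.Icc 1 Y, (1:ℝ) / v) * ((∑ v ∈ Finset.Icc 1 Y, (1:ℝ) / v) * (C1 * N * (Y:ℝ) ^ (-(1/8) : ℝ))) := by gcongr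
      _ ≤ (c1 * (Y:ℝ) ^ (1/80 : ℝ)) * ((c1 * (Y:ℝ) ^ (1/80 : ℝ)) * (C1 * N * (Y:ℝ) ^ (-(1/8) : ℝ))) := by gcongr
      _ = c1 * c1 * C1 * N * ((Y:ℝ) ^ (1/80 : ℝ) * (Y:ℝ) ^ (1/80 : ℝ) * (Y:ℝ) ^ (-(1/8) : ℝ)) := by ring
      _ = _ := by
          rw [← Real.rpow_add hY0, ← Real.rpow_add hY0]; norm_num
  have hysum : ∑ n ∈ Finset.Ico 3 N, (y n) ^ 2 ≤ N * ((C0 * c2) ^ 2 * (Y:ℝ) ^ (-(1/10) : ℝ)) := by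
    refine (Finset.sum_le_sum hyb).trans ?_
    rw [Finset.sum_const, nsmul_eq_mul]
    gcongr
    rw [Nat.card_Ico]; omega
  calc _ ≤ ∑ n ∈ Finset.Ico 3 N, (2 * (x n) ^ 2 + 2 * (y n) ^ 2) := by
        apply Finset.sum_le_sum; intro n hn
        rw [hxy n hn]
        nlinarith [sq_nonneg (x n - y n)]
    _ = 2 * ∑ n ∈ Finset.Ico 3 N, (x n) ^ 2 + 2 * ∑ n ∈ Finset.Ico 3 N, (y n) ^ 2 := by
        rw [Finset.sum_add_distrib, Finset.mul_sum, Finset.mul_sum]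
    _ ≤ 2 * (c1 * c1 * C1 * N * (Y:ℝ) ^ (-(1/10) : ℝ)) + 2 * (N * ((C0 * c2) ^ 2 * (Y:ℝ) ^ (-(1/10) : ℝ))) := by gcongr
    _ = _ := by ring

end VA
end

section
namespace VA

/-- half the length of the class of trace n -/
noncomputable def aa (n : ℕ) : ℝ := Real.log (((n : ℝ) + Real.sqrt ((n : ℝ) ^ 2 - 4)) / 2)

lemma log_Nnorm (n : ℕ) : Real.log (Nnorm n) = 2 * aa n := by
  unfold Nnorm aa; rw [Real.log_pow]; norm_num

lemma EE_ge {n : ℕ} (hn : 2 ≤ n) : (n:ℝ) - 1 ≤ ((n : ℝ) + Real.sqrt ((n : ℝ) ^ 2 - 4)) / 2 := by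
  have h : (2:ℝ) ≤ n := by exact_mod_cast hn
  have : (n:ℝ) - 2 ≤ Real.sqrt ((n : ℝ) ^ 2 - 4) := by
    apply Real.le_sqrt_of_sq_le; nlinarith
  linarith

lemma exp_aa {n : ℕ} (hn : 2 ≤ n) : Real.exp (aa n) = ((n : ℝ) + Real.sqrt ((n : ℝ) ^ 2 - 4)) / 2 := by
  unfold aa
  apply Real.exp_log
  have h : (2:ℝ) ≤ n := by exact_mod_cast hn
  have := EE_ge hn
  linarith

lemma exp_aa_ge {n : ℕ} (hn : 2 ≤ n) : (n:ℝ) - 1 ≤ Real.exp (aa n) := by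
  rw [exp_aa hn]; exact EE_ge hn

lemma exp_aa_le {n : ℕ} (hn : 2 ≤ n) : Real.exp (aa n) ≤ n := by
  rw [exp_aa hn]
  have h : (2:ℝ) ≤ n := by exact_mod_cast hn
  have : Real.sqrt ((n : ℝ) ^ 2 - 4) ≤ n := by
    apply Real.sqrt_le_iff.mpr; constructor <;> nlinarith
  linarith

lemma two_cosh_aa {n : ℕ} (hn : 2 ≤ n) : 2 * Real.cosh (aa n) = n := by
  rw [Real.cosh_eq, Real.exp_neg, exp_aa hn]
  have h : (2:ℝ) ≤ n := by exact_mod_cast hn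
  have h1 : Real.sqrt ((n : ℝ) ^ 2 - 4) ^ 2 = (n:ℝ) ^ 2 - 4 := Real.sq_sqrt (by nlinarith)
  have h2 : (0:ℝ) < (n : ℝ) + Real.sqrt ((n : ℝ) ^ 2 - 4) := by positivity
  field_simp
  nlinarith

lemma aa_two : aa 2 = 0 := by
  unfold aa; norm_num

lemma aa_gap {n : ℕ} (hn : 2 ≤ n) : 1 / (2 * ((n:ℝ) + 1)) ≤ aa (n + 1) - aa n := by
  have h : (2:ℝ) ≤ n := by exact_mod_cast hn
  have h1 := exp_aa hn
  have h2 := exp_aa (show 2 ≤ n + 1 by omega)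
  have h3 := exp_aa_le (show 2 ≤ n + 1 by omega)
  have h4 : Real.sqrt ((n : ℝ) ^ 2 - 4) ≤ Real.sqrt (((n + 1 : ℕ) : ℝ) ^ 2 - 4) := by
    apply Real.sqrt_le_sqrt; push_cast; nlinarith
  have h5 : Real.exp (aa n) + 1 / 2 ≤ Real.exp (aa (n+1)) := by
    rw [h1, h2]; push_cast at *; linarith
  have h6 := Real.add_one_le_exp (-(aa (n+1) - aa n))
  rw [neg_sub, Real.exp_sub] at h6
  have h7 : Real.exp (aa n) / Real.exp (aa (n+1)) ≤ 1 - 1 / (2 * ((n:ℝ) + 1)) := by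
    rw [div_le_iff₀ (Real.exp_pos _)]
    push_cast at h3
    have h8 : 1 / (2 * ((n:ℝ) + 1)) * Real.exp (aa (n+1)) ≤ 1 / 2 := by
      rw [one_div, inv_mul_le_iff₀ (by positivity)]; linarith
    linarith
  linarith

lemma aa_mono : MonotoneOn aa (Set.Ici 2) := by
  have : Monotone (fun k : ℕ => aa (k + 2)) := by
    apply monotone_nat_of_le_succ
    intro k
    have := aa_gap (show 2 ≤ k + 2 by omega)
    have h2 : 0 ≤ 1 / (2 * (((k + 2 : ℕ):ℝ) + 1)) := by positivity
    have e : k + 1 + 2 = k + 2 + 1 := by omega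
    rw [e]; linarith
  intro n hn m hm hnm
  simp only [Set.mem_Ici] at hn hm
  have h := this (show n - 2 ≤ m - 2 by omega)
  simp only at h
  rwa [Nat.sub_add_cancel hn, Nat.sub_add_cancel hm] at h

lemma aa_nonneg {n : ℕ} (hn : 2 ≤ n) : 0 ≤ aa n := by
  rw [← aa_two]; exact aa_mono (by simp) hn hn

lemma aa_sep {n m N : ℕ} (hn : 2 ≤ n) (hnm : n < m) (hm : m ≤ N) : 1 / (2 * (N:ℝ)) ≤ aa m - aa n := by
  have h1 := aa_gap hn
  have h2 := aa_mono (show n + 1 ∈ Set.Ici 2 by simp only [Set.mem_Ici]; omega) (show m ∈ Set.Ici 2 by simp only [Set.mem_Ici]; omega) (show n + 1 ≤ m by omega)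
  have h3 : 1 / (2 * (N:ℝ)) ≤ 1 / (2 * ((n:ℝ) + 1)) := by
    have : (n:ℝ) + 1 ≤ N := by exact_mod_cast (show n + 1 ≤ N by omega)
    gcongr
  linarith

lemma aa_three {n : ℕ} (hn : 3 ≤ n) : 1 / 2 ≤ aa n := by
  have h1 := exp_aa_ge (show 2 ≤ n by omega)
  have h2 : (3:ℝ) ≤ n := by exact_mod_cast hn
  have h3 : Real.log 2 ≤ aa n := by
    rw [Real.log_le_iff_le_exp (by norm_num)]; linarith
  have := Real.log_two_gt_d9
  linarith

lemma aa_le_log {n : ℕ} (hn : 2 ≤ n) : aa n ≤ Real.log n := by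
  have h : (2:ℝ) ≤ n := by exact_mod_cast hn
  rw [Real.le_log_iff_exp_le (by linarith)]
  exact exp_aa_le hn

/-- admissible weights -/
structure Wt (q : ℝ → ℝ) (Q Λ : ℝ) : Prop where
  nonneg : ∀ x, 0 ≤ q x
  le : ∀ x, q x ≤ Q
  lip : ∀ x y, |q x - q y| ≤ Λ * |x - y|
  supp : ∀ x, 1 < x → q x = 0

lemma Wt.Lnonneg {q : ℝ → ℝ} {Q Λ : ℝ} (h : Wt q Q Λ) : 0 ≤ Λ := by
  have := h.lip 0 1
  simp at this
  exact le_trans (abs_nonneg _) this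

lemma Wt.Qnonneg {q : ℝ → ℝ} {Q Λ : ℝ} (h : Wt q Q Λ) : 0 ≤ Q := (h.nonneg 0).trans (h.le 0)

lemma Wt.cont {q : ℝ → ℝ} {Q Λ : ℝ} (h : Wt q Q Λ) : Continuous q := by
  have : LipschitzWith ⟨Λ, h.Lnonneg⟩ q := LipschitzWith.of_dist_le_mul fun x y => by
    rw [Real.dist_eq, Real.dist_eq]; exact h.lip x y
  exact this.continuous

/-- the range cutoff -/
structure Cut (R : ℝ) (N : ℕ) : Prop where
  R1 : 1 ≤ R
  three : 3 ≤ N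
  ge : Real.exp R ≤ (N:ℝ) - 1
  le : (N:ℝ) ≤ 4 * Real.exp R

lemma Cut.aa_ge {R : ℝ} {N : ℕ} (h : Cut R N) {n : ℕ} (hn : N ≤ n) : R ≤ aa n := by
  have h1 := exp_aa_ge (show 2 ≤ n by have := h.three; omega)
  have h2 : (N:ℝ) ≤ n := by exact_mod_cast hn
  have h3 := h.ge
  rw [← Real.exp_le_exp]; linarith

lemma Cut.aa_le {R : ℝ} {N : ℕ} (h : Cut R N) : aa N ≤ 3 * R := by
  have h1 := exp_aa_le (show 2 ≤ N by have := h.three; omega)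
  have h2 := h.le
  have h3 := h.R1
  have h4 : (4:ℝ) ≤ Real.exp 2 := by
    have h5 := Real.add_one_le_exp (1:ℝ)
    have : Real.exp 2 = Real.exp 1 * Real.exp 1 := by rw [← Real.exp_add]; norm_num
    rw [this]; nlinarith
  rw [← Real.exp_le_exp]
  calc _ ≤ 4 * Real.exp R := by linarith
    _ ≤ Real.exp 2 * Real.exp R := by gcongr
    _ = Real.exp (2 + R) := by rw [Real.exp_add]
    _ ≤ _ := by rw [Real.exp_le_exp]; linarith

lemma sinh_int {n : ℕ} (hn : 2 ≤ n) : ∫ s in (aa n)..(aa (n+1)), 2 * Real.sinh s = 1 := by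
  have h : ∀ s ∈ Set.uIcc (aa n) (aa (n+1)), HasDerivAt (fun s => 2 * Real.cosh s) (2 * Real.sinh s) s :=
    fun s _ => (Real.hasDerivAt_cosh s).const_mul 2
  rw [intervalIntegral.integral_eq_sub_of_hasDerivAt h (by apply Continuous.intervalIntegrable; fun_prop)]
  rw [two_cosh_aa hn, two_cosh_aa (by omega)]; push_cast; ring

lemma W_compare {q : ℝ → ℝ} {Q Λ : ℝ} (hq : Wt q Q Λ) {R : ℝ} {N : ℕ} (hc : Cut R N) :
    |∑ n ∈ Finset.Ico 3 N, q (aa n / R) - ∫ s in Set.Ioi (0:ℝ), q (s / R) * Real.exp s| ≤ 3 * Λ + 2 * Q := by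
  have hR : 0 < R := by linarith [hc.R1]
  have h3 := hc.three
  have hqc := hq.cont
  have hcont : Continuous fun s => q (s / R) := hqc.comp (continuous_id.div_const R)
  have hQ := hq.Qnonneg
  have hL := hq.Lnonneg
  set F : ℝ → ℝ := fun s => q (s / R) * (2 * Real.sinh s) with hF
  have hFc : Continuous F := hcont.mul (by fun_prop)
  -- reduce integral
  have e1 : ∫ s in Set.Ioi (0:ℝ), q (s / R) * Real.exp s = ∫ s in (0:ℝ)..(aa N), q (s / R) * Real.exp s := by
    rw [intervalIntegral.integral_of_le (aa_nonneg (by omega))]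
    apply setIntegral_eq_of_subset_of_forall_diff_eq_zero measurableSet_Ioi
    · exact Set.Ioc_subset_Ioi_self
    · intro s hs
      simp only [Set.mem_diff, Set.mem_Ioi, Set.mem_Ioc, not_and, not_le] at hs
      have h1 := hs.2 hs.1
      have h2 := hc.aa_ge le_rfl
      rw [hq.supp, zero_mul]
      rw [lt_div_iff₀ hR]; linarith
  have hEc : Continuous fun s : ℝ => q (s / R) * Real.exp (-s) := hcont.mul (by fun_prop)
  have e2 : ∫ s in (0:ℝ)..(aa N), q (s / R) * Real.exp s = (∫ s in (0:ℝ)..(aa N), F s) + ∫ s in (0:ℝ)..(aa N), q (s / R) * Real.exp (-s) := by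
    rw [← intervalIntegral.integral_add (hFc.intervalIntegrable _ _) (hEc.intervalIntegrable _ _)]
    congr 1; ext s
    simp only [hF, Real.sinh_eq]; ring
  have b1 : |∫ s in (0:ℝ)..(aa N), q (s / R) * Real.exp (-s)| ≤ Q := by
    have hN0 := aa_nonneg (show 2 ≤ N by omega)
    have i1 : ∫ s in (0:ℝ)..(aa N), Real.exp (-s) ≤ 1 := by
      rw [intervalIntegral.integral_comp_neg (fun s => Real.exp s)]
      rw [integral_exp]
      simp; positivity
    rw [abs_of_nonneg (intervalIntegral.integral_nonneg hN0 fun s _ => mul_nonneg (hq.nonneg _) (Real.exp_pos _).le)]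
    calc _ ≤ ∫ s in (0:ℝ)..(aa N), Q * Real.exp (-s) := by
          apply intervalIntegral.integral_mono_on hN0 (hEc.intervalIntegrable _ _) (Continuous.intervalIntegrable (by fun_prop) _ _)
          intro s _
          exact mul_le_mul_of_nonneg_right (hq.le _) (Real.exp_pos _).le
      _ = Q * ∫ s in (0:ℝ)..(aa N), Real.exp (-s) := intervalIntegral.integral_const_mul _ _
      _ ≤ Q * 1 := by gcongr
      _ = Q := mul_one Q
  have e3 : ∫ s in (0:ℝ)..(aa N), F s = ∑ n ∈ Finset.Ico 2 N, ∫ s in (aa n)..(aa (n+1)), F s := by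
    rw [intervalIntegral.sum_integral_adjacent_intervals_Ico (by omega) (fun k _ => hFc.intervalIntegrable _ _), aa_two]
  have hle : ∀ n, 2 ≤ n → aa n ≤ aa (n+1) := fun n hn => aa_mono (show n ∈ Set.Ici 2 from hn) (show n + 1 ∈ Set.Ici 2 by simp only [Set.mem_Ici]; omega) (by omega)
  have b2 : ∀ n, 2 ≤ n → |q (aa n / R) - ∫ s in (aa n)..(aa (n+1)), F s| ≤ Λ / R * (aa (n+1) - aa n) := by
    intro n hn
    have hnn := hle n hn
    have e4 : q (aa n / R) - ∫ s in (aa n)..(aa (n+1)), F s = ∫ s in (aa n)..(aa (n+1)), (q (aa n / R) - q (s / R)) * (2 * Real.sinh s) := by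
      have : q (aa n / R) = ∫ s in (aa n)..(aa (n+1)), q (aa n / R) * (2 * Real.sinh s) := by
        rw [intervalIntegral.integral_const_mul, sinh_int hn, mul_one]
      conv_lhs => rw [this]
      rw [← intervalIntegral.integral_sub (Continuous.intervalIntegrable (by fun_prop) _ _) (hFc.intervalIntegrable _ _)]
      congr 1; ext s; simp only [hF]; ring
    rw [e4]
    refine (intervalIntegral.abs_integral_le_integral_abs hnn).trans ?_
    have h0 := aa_nonneg hn
    calc _ ≤ ∫ s in (aa n)..(aa (n+1)), (Λ / R * (aa (n+1) - aa n)) * (2 * Real.sinh s) := by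
          apply intervalIntegral.integral_mono_on hnn
          · apply Continuous.intervalIntegrable
            exact ((continuous_const.sub hcont).mul (by fun_prop)).abs
          · apply Continuous.intervalIntegrable; fun_prop
          · intro s hs
            have hs0 : 0 ≤ Real.sinh s := Real.sinh_nonneg_iff.mpr (by linarith [hs.1])
            rw [abs_mul, abs_of_nonneg (show 0 ≤ 2 * Real.sinh s by positivity)]
            apply mul_le_mul_of_nonneg_right _ (by positivity)
            refine (hq.lip _ _).trans ?_
            have : |aa n / R - s / R| ≤ (aa (n+1) - aa n) / R := by
              rw [← sub_div, abs_div, abs_of_pos hR]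
              gcongr
              rw [abs_le]; constructor <;> linarith [hs.1, hs.2]
            calc _ ≤ Λ * ((aa (n+1) - aa n) / R) := by gcongr
              _ = _ := by ring
      _ = _ := by rw [intervalIntegral.integral_const_mul, sinh_int hn, mul_one]
  have b3 : |∑ n ∈ Finset.Ico 2 N, (q (aa n / R) - ∫ s in (aa n)..(aa (n+1)), F s)| ≤ 3 * Λ := by
    refine (Finset.abs_sum_le_sum_abs _ _).trans ?_
    calc _ ≤ ∑ n ∈ Finset.Ico 2 N, Λ / R * (aa (n+1) - aa n) := Finset.sum_le_sum fun n hn => b2 n (Finset.mem_Ico.mp hn).1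
      _ = Λ / R * (aa N - aa 2) := by rw [← Finset.mul_sum, Finset.sum_Ico_sub _ (by omega)]
      _ ≤ Λ / R * (3 * R) := by
          have := hc.aa_le
          rw [aa_two, sub_zero]
          gcongr
      _ = 3 * Λ := by field_simp
  rw [e1, e2, e3]
  rw [Finset.sum_sub_distrib, Finset.sum_eq_sum_Ico_succ_bot (show 2 < N by omega)] at b3
  have b4 := hq.nonneg (aa 2 / R)
  have b5 := hq.le (aa 2 / R)
  rw [abs_le] at *
  constructor <;> linarith [b1.1, b1.2, b3.1, b3.2]

end VA
end

section
namespace VA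

lemma per_weight {q : ℝ → ℝ} {Q Λ : ℝ} (hq : Wt q Q Λ) {R : ℝ} {N : ℕ} (hc : Cut R N)
    {P : ℕ} (hP : 0 < P) {F : ℤ → ℝ} (hF : Per P F) {C : ℝ} (hC : ∀ x, |F x| ≤ C) :
    |∑ n ∈ Finset.Ico 3 N, q (aa n / R) * F n - av P F * ∑ n ∈ Finset.Ico 3 N, q (aa n / R)| ≤
      2 * C * P * (2 * Q + 3 * Λ) := by
  have hR : 0 < R := by linarith [hc.R1]
  have h3 := hc.three
  have hQ := hq.Qnonneg
  have hL := hq.Lnonneg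
  set G : ℕ → ℝ := fun n => if 2 < n then q (aa n / R) else 0 with hG
  have hsum : ∀ H : ℕ → ℝ, ∑ n ∈ Finset.range N, G n * H n = ∑ n ∈ Finset.Ico 3 N, q (aa n / R) * H n := by
    intro H
    rw [Finset.range_eq_Ico, ← Finset.sum_Ico_consecutive _ (Nat.zero_le 3) h3]
    have h0 : ∑ n ∈ Finset.Ico 0 3, G n * H n = 0 := by
      apply Finset.sum_eq_zero; intro n hn
      rw [Finset.mem_Ico] at hn
      simp only [hG]; rw [if_neg (by omega), zero_mul]
    rw [h0, zero_add]
    apply Finset.sum_congr rfl; intro n hn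
    rw [Finset.mem_Ico] at hn
    simp only [hG]; rw [if_pos (by omega)]
  have hC0 : 0 ≤ C := (abs_nonneg _).trans (hC 0)
  have hvar : |G N| + ∑ i ∈ Finset.range N, |G i - G (i + 1)| ≤ 2 * Q + 3 * Λ := by
    have h1 : |G N| ≤ Q := by
      simp only [hG]; rw [if_pos (by omega), abs_of_nonneg (hq.nonneg _)]; exact hq.le _
    have h2 : ∑ i ∈ Finset.range N, |G i - G (i + 1)| ≤ Q + 3 * Λ := by
      rw [Finset.range_eq_Ico, ← Finset.sum_Ico_consecutive _ (Nat.zero_le 3) h3]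
      apply add_le_add
      · rw [← Finset.range_eq_Ico, Finset.sum_range_succ, Finset.sum_range_succ, Finset.sum_range_succ]
        simp only [hG]
        norm_num
        rw [abs_of_nonneg (hq.nonneg _)]; exact hq.le _
      · calc _ ≤ ∑ n ∈ Finset.Ico 3 N, Λ / R * (aa (n+1) - aa n) := by
              apply Finset.sum_le_sum; intro n hn
              rw [Finset.mem_Ico] at hn
              simp only [hG]; rw [if_pos (by omega), if_pos (by omega)]
              refine (hq.lip _ _).trans ?_
              have hmono := aa_mono (show n ∈ Set.Ici 2 by simp only [Set.mem_Ici]; omega) (show n + 1 ∈ Set.Ici 2 by simp only [Set.mem_Ici]; omega) (show n ≤ n + 1 by omega)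
              rw [← sub_div, abs_div, abs_of_pos hR, abs_sub_comm, abs_of_nonneg (by linarith)]
              apply le_of_eq; ring
          _ = Λ / R * (aa N - aa 3) := by rw [← Finset.mul_sum, Finset.sum_Ico_sub _ (by omega)]
          _ ≤ Λ / R * (3 * R) := by
              have := hc.aa_le
              have h4 := aa_nonneg (show 2 ≤ 3 by norm_num)
              gcongr; linarith
          _ = 3 * Λ := by field_simp
    linarith
  have hper := periodic_sum_bound (fun n : ℕ => F (n:ℤ)) P hP (fun n => hF.nat n) C (fun n => hC n)
  have hab := abel_variation G (fun n : ℕ => F (n:ℤ) - avg P (fun n : ℕ => F (n:ℤ))) N (2 * C * P) (fun m _ => hper m)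
  have e : ∑ i ∈ Finset.range N, G i * (F (i:ℤ) - avg P (fun n : ℕ => F (n:ℤ))) =
      ∑ n ∈ Finset.Ico 3 N, q (aa n / R) * F n - av P F * ∑ n ∈ Finset.Ico 3 N, q (aa n / R) := by
    rw [hsum (fun i => F (i:ℤ) - avg P (fun n : ℕ => F (n:ℤ)))]
    rw [Finset.mul_sum, ← Finset.sum_sub_distrib]
    apply Finset.sum_congr rfl; intro n _
    have : avg P (fun n : ℕ => F (n:ℤ)) = av P F := rfl
    rw [this]; ring
  rw [e] at hab
  refine hab.trans ?_
  gcongr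

/-- the 2-adic average -/
noncomputable def Bj (J : ℕ) : ℝ := av (2 ^ (2 * J + 1)) (fun n => gam J (n ^ 2 - 4) ^ 2)

/-- the box sum -/
noncomputable def boxS (Z : ℕ) : ℝ := ∑ a ∈ Finset.Icc 1 Z, ∑ b ∈ Finset.Icc 1 Z, hM a b

lemma pair_sum {q : ℝ → ℝ} {Q Λ : ℝ} (hq : Wt q Q Λ) {R : ℝ} {N : ℕ} (hc : Cut R N) (J Z : ℕ) {a b : ℕ}
    (ha : a ∈ Finset.Icc 1 Z) (hb : b ∈ Finset.Icc 1 Z) :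
    |∑ n ∈ Finset.Ico 3 N, q (aa n / R) * (gam J (Dz n) ^ 2 * (lam (Dz n) a * lam (Dz n) b)) / (a * b) -
      Bj J * hM a b * ∑ n ∈ Finset.Ico 3 N, q (aa n / R)| ≤ 2 * 16 * (2 ^ (2 * J + 1) * Z ^ 4) * (2 * Q + 3 * Λ) := by
  rw [Finset.mem_Icc] at ha hb
  have hQ := hq.Qnonneg
  have hL := hq.Lnonneg
  have ha0 : (0:ℝ) < a := by exact_mod_cast ha.1
  have hb0 : (0:ℝ) < b := by exact_mod_cast hb.1
  by_cases hodd : Odd a ∧ Odd b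
  · have hcop : Nat.Coprime (2 ^ (2 * J + 1)) ((a * b) ^ 2) := by
      apply Nat.Coprime.pow
      rw [Nat.coprime_two_left]
      exact hodd.1.mul hodd.2
    have hP1 : 0 < 2 ^ (2 * J + 1) := by positivity
    have hP2 : 0 < (a * b) ^ 2 := by
      have := Nat.mul_pos ha.1 hb.1
      positivity
    have p1 : Per (2 ^ (2 * J + 1)) (fun n => gam J (n ^ 2 - 4) ^ 2) := Per_Dq ((Per_gam J).comp (fun t => t ^ 2))
    have p2 := Per_lam2 a b
    have h1 := per_weight hq hc (P := 2 ^ (2 * J + 1) * (a * b) ^ 2) (Nat.mul_pos hP1 hP2)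
      ((p1.mul_right ((a * b) ^ 2)).mul (p2.mul_left (2 ^ (2 * J + 1)))) (C := 16 * (a * b)) (by
        intro x
        rw [abs_mul, abs_mul]
        have g1 := gam_nonneg J (x ^ 2 - 4)
        have g2 := gam_le J (x ^ 2 - 4)
        have g3 := lam_abs_le' (x ^ 2 - 4) a
        have g4 := lam_abs_le' (x ^ 2 - 4) b
        rw [abs_of_nonneg (by positivity)]
        have g5 : gam J (x ^ 2 - 4) ^ 2 ≤ 16 := by nlinarith
        gcongr)
    rw [av_crt hcop hP1 hP2 p1 p2] at h1
    have e1 : ∑ n ∈ Finset.Ico 3 N, q (aa n / R) * (gam J (Dz n) ^ 2 * (lam (Dz n) a * lam (Dz n) b)) / (a * b) -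
      Bj J * hM a b * ∑ n ∈ Finset.Ico 3 N, q (aa n / R) =
      (∑ n ∈ Finset.Ico 3 N, q (aa n / R) * (gam J ((n:ℤ) ^ 2 - 4) ^ 2 * (lam ((n:ℤ) ^ 2 - 4) a * lam ((n:ℤ) ^ 2 - 4) b)) -
        av (2 ^ (2 * J + 1)) (fun n => gam J (n ^ 2 - 4) ^ 2) * av ((a * b) ^ 2) (fun n => lam (n ^ 2 - 4) a * lam (n ^ 2 - 4) b) * ∑ n ∈ Finset.Ico 3 N, q (aa n / R)) / (a * b) := by
      rw [sub_div, ← Finset.sum_div]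
      congr 1
      unfold Bj hM Mm
      field_simp
    have hab0 : (0:ℝ) < a * b := mul_pos ha0 hb0
    rw [e1, abs_div, abs_of_pos hab0, div_le_iff₀ hab0]
    refine h1.trans ?_
    have haZ : (a:ℝ) ≤ Z := by exact_mod_cast ha.2
    have hbZ : (b:ℝ) ≤ Z := by exact_mod_cast hb.2
    have h5 : ((a:ℝ) * b) ^ 2 ≤ (Z:ℝ) ^ 4 := by
      calc ((a:ℝ) * b) ^ 2 ≤ ((Z:ℝ) * Z) ^ 2 := by gcongr
        _ = _ := by ring
    push_cast
    calc _ = 2 * 16 * (2 ^ (2 * J + 1) * ((a:ℝ) * b) ^ 2) * (2 * Q + 3 * Λ) * (a * b) := by ring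
      _ ≤ _ := by gcongr
  · have e0 : ∑ n ∈ Finset.Ico 3 N, q (aa n / R) * (gam J (Dz n) ^ 2 * (lam (Dz n) a * lam (Dz n) b)) / (a * b) = 0 := by
      apply Finset.sum_eq_zero; intro n _
      have : lam (Dz n) a * lam (Dz n) b = 0 := by
        by_cases h : Odd a
        · rw [lam_even (m := b) (fun hb => hodd ⟨h, hb⟩), mul_zero]
        · rw [lam_even h, zero_mul]
      rw [this]; ring
    rw [e0, hM, Mm_even hodd]
    simp
    positivity

lemma main_sum {q : ℝ → ℝ} {Q Λ : ℝ} (hq : Wt q Q Λ) {R : ℝ} {N : ℕ} (hc : Cut R N) (J Z : ℕ) :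
    |∑ n ∈ Finset.Ico 3 N, q (aa n / R) * (gam J (Dz n) * OZ Z (Dz n)) ^ 2 -
      Bj J * boxS Z * ∑ n ∈ Finset.Ico 3 N, q (aa n / R)| ≤
      (Z:ℝ) ^ 2 * (2 * 16 * (2 ^ (2 * J + 1) * Z ^ 4) * (2 * Q + 3 * Λ)) := by
  obtain ⟨X, hX⟩ : ∃ X, X = ∑ n ∈ Finset.Ico 3 N, q (aa n / R) := ⟨_, rfl⟩
  rw [← hX]
  have e1 : ∑ n ∈ Finset.Ico 3 N, q (aa n / R) * (gam J (Dz n) * OZ Z (Dz n)) ^ 2 =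
      ∑ a ∈ Finset.Icc 1 Z, ∑ b ∈ Finset.Icc 1 Z, ∑ n ∈ Finset.Ico 3 N, q (aa n / R) * (gam J (Dz n) ^ 2 * (lam (Dz n) a * lam (Dz n) b)) / (a * b) := by
    have : ∀ n ∈ Finset.Ico 3 N, q (aa n / R) * (gam J (Dz n) * OZ Z (Dz n)) ^ 2 =
        ∑ a ∈ Finset.Icc 1 Z, ∑ b ∈ Finset.Icc 1 Z, q (aa n / R) * (gam J (Dz n) ^ 2 * (lam (Dz n) a * lam (Dz n) b)) / (a * b) := by
      intro n _
      have : q (aa n / R) * (gam J (Dz n) * OZ Z (Dz n)) ^ 2 = (q (aa n / R) * gam J (Dz n) ^ 2) * (OZ Z (Dz n) * OZ Z (Dz n)) := by ring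
      rw [this]; unfold OZ
      rw [Finset.sum_mul_sum, Finset.mul_sum]
      apply Finset.sum_congr rfl; intro a _
      rw [Finset.mul_sum]
      apply Finset.sum_congr rfl; intro b _
      ring
    rw [Finset.sum_congr rfl this, Finset.sum_comm]
    apply Finset.sum_congr rfl; intro a _
    rw [Finset.sum_comm]
  have e2 : Bj J * boxS Z * X = ∑ a ∈ Finset.Icc 1 Z, ∑ b ∈ Finset.Icc 1 Z, Bj J * hM a b * X := by
    unfold boxS
    rw [Finset.mul_sum, Finset.sum_mul]
    apply Finset.sum_congr rfl; intro a _
    rw [Finset.mul_sum, Finset.sum_mul]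
  rw [e1, e2, ← Finset.sum_sub_distrib]
  calc _ ≤ ∑ a ∈ Finset.Icc 1 Z, ∑ b ∈ Finset.Icc 1 Z, 2 * 16 * (2 ^ (2 * J + 1) * (Z:ℝ) ^ 4) * (2 * Q + 3 * Λ) := by
        refine (Finset.abs_sum_le_sum_abs _ _).trans (Finset.sum_le_sum fun a ha => ?_)
        rw [← Finset.sum_sub_distrib]
        refine (Finset.abs_sum_le_sum_abs _ _).trans (Finset.sum_le_sum fun b hb => ?_)
        rw [hX]
        exact pair_sum hq hc J Z ha hb
    _ = _ := by
        rw [Finset.sum_const, Finset.sum_const, Nat.card_Icc, nsmul_eq_mul, nsmul_eq_mul]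
        simp; ring

end VA
end

section
namespace VA

/-- cutoff -/
noncomputable def NR (R : ℝ) : ℕ := ⌊Real.exp R⌋₊ + 2

/-- root of the cutoff -/
noncomputable def YR (R : ℝ) : ℕ := ⌊((NR R : ℕ) : ℝ) ^ (1/32 : ℝ)⌋₊

lemma NR_gt (R : ℝ) : Real.exp R ≤ (NR R : ℝ) - 1 := by
  unfold NR; push_cast
  have := Nat.lt_floor_add_one (Real.exp R); linarith

lemma NR_cut {R : ℝ} (hR : 1 ≤ R) : Cut R (NR R) := by
  have h1 : 1 ≤ Real.exp R := Real.one_le_exp (by linarith)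
  refine ⟨hR, ?_, NR_gt R, ?_⟩
  · unfold NR
    have : 1 ≤ ⌊Real.exp R⌋₊ := by rw [Nat.one_le_floor_iff]; exact h1
    omega
  · unfold NR; push_cast
    have := Nat.floor_le (Real.exp_pos R).le
    linarith

lemma NR_tendsto : Tendsto NR atTop atTop := by
  have h : Tendsto (fun R => ((NR R : ℕ):ℝ)) atTop atTop := by
    apply tendsto_atTop_mono _ Real.tendsto_exp_atTop
    intro R; have := NR_gt R; linarith
  exact tendsto_natCast_atTop_iff.mp h

lemma YR_tendsto : Tendsto YR atTop atTop := by
  unfold YR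
  apply tendsto_nat_floor_atTop.comp
  exact (tendsto_rpow_atTop (by norm_num)).comp (tendsto_natCast_atTop_atTop.comp NR_tendsto)

lemma YR_pow_le (R : ℝ) : (YR R) ^ 32 ≤ NR R := by
  have h1 : (YR R : ℝ) ≤ ((NR R : ℕ) : ℝ) ^ (1/32 : ℝ) := Nat.floor_le (by positivity)
  have h2 : (YR R : ℝ) ^ 32 ≤ (((NR R : ℕ) : ℝ) ^ (1/32 : ℝ)) ^ 32 := by gcongr
  rw [← Real.rpow_natCast (((NR R : ℕ) : ℝ) ^ (1/32 : ℝ)), ← Real.rpow_mul (by positivity)] at h2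
  norm_num at h2
  exact_mod_cast h2

lemma YR_pow_ge {R : ℝ} (h : 2 ^ 32 ≤ YR R) : NR R ≤ (YR R) ^ 33 := by
  have h1 : ((NR R : ℕ) : ℝ) ^ (1/32 : ℝ) < YR R + 1 := Nat.lt_floor_add_one _
  have h2 : (((NR R : ℕ) : ℝ) ^ (1/32 : ℝ)) ^ 32 ≤ ((YR R : ℝ) + 1) ^ 32 := by gcongr
  rw [← Real.rpow_natCast (((NR R : ℕ) : ℝ) ^ (1/32 : ℝ)), ← Real.rpow_mul (by positivity)] at h2
  norm_num at h2
  have h3 : (2:ℝ) ^ 32 ≤ YR R := by exact_mod_cast h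
  have h4 : ((YR R : ℝ) + 1) ^ 32 ≤ (YR R : ℝ) ^ 33 := by
    calc ((YR R : ℝ) + 1) ^ 32 ≤ (2 * (YR R : ℝ)) ^ 32 := by
          gcongr; linarith
      _ = 2 ^ 32 * (YR R : ℝ) ^ 32 := by rw [mul_pow]
      _ ≤ (YR R : ℝ) * (YR R : ℝ) ^ 32 := by gcongr
      _ = _ := by ring
  exact_mod_cast h2.trans h4

/-- the weight integral -/
noncomputable def II (q : ℝ → ℝ) (R : ℝ) : ℝ := ∫ s in Set.Ioi (0:ℝ), q (s / R) * Real.exp s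

/-- error size -/
noncomputable def del (q : ℝ → ℝ) (R : ℝ) : ℝ := (NR R : ℝ) * (YR R : ℝ) ^ (-(1/10) : ℝ) / II q R

lemma del_tendsto {q : ℝ → ℝ} {c : ℝ} (hc : 0 < c) (hlow : ∀ R, 1 ≤ R → c * Real.exp (999/1000 * R) ≤ II q R) :
    Tendsto (del q) atTop (nhds 0) := by
  have hlim : Tendsto (fun R : ℝ => 4 / c * Real.exp (-(1/1000 * R))) atTop (nhds 0) := by
    have : Tendsto (fun R : ℝ => Real.exp (-(1/1000 * R))) atTop (nhds 0) :=
      Real.tendsto_exp_neg_atTop_nhds_zero.comp (tendsto_id.const_mul_atTop (by norm_num))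
    simpa using this.const_mul (4 / c)
  apply squeeze_zero' _ _ hlim
  · filter_upwards [eventually_ge_atTop 1] with R hR
    unfold del
    have := hlow R hR
    have h2 : 0 < II q R := lt_of_lt_of_le (by positivity) this
    positivity
  · filter_upwards [eventually_ge_atTop 1, YR_tendsto.eventually_ge_atTop (2 ^ 32)] with R hR hY
    have h1 := hlow R hR
    have h0 : 0 < c * Real.exp (999/1000 * R) := by positivity
    have h2 : 0 < II q R := lt_of_lt_of_le h0 h1
    have h3 := YR_pow_ge hY
    have hcut := NR_cut hR
    have hN0 : (0:ℝ) < NR R := by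
      have := hcut.three
      exact_mod_cast (show 0 < NR R by omega)
    have hY0 : (0:ℝ) < YR R := by
      have : 0 < YR R := lt_of_lt_of_le (by norm_num) hY
      exact_mod_cast this
    have h4 : (YR R : ℝ) ^ (-(1/10) : ℝ) ≤ (NR R : ℝ) ^ (-(1/330) : ℝ) := by
      have h5 : (NR R : ℝ) ^ (1/33 : ℝ) ≤ YR R := by
        have h6 : (NR R : ℝ) ≤ (YR R : ℝ) ^ (33:ℝ) := by
          have : (NR R : ℝ) ≤ (YR R : ℝ) ^ 33 := by exact_mod_cast h3
          rw [← Real.rpow_natCast] at this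
          exact_mod_cast this
        calc (NR R : ℝ) ^ (1/33 : ℝ) ≤ ((YR R : ℝ) ^ (33:ℝ)) ^ (1/33 : ℝ) := Real.rpow_le_rpow hN0.le h6 (by norm_num)
          _ = _ := by rw [← Real.rpow_mul hY0.le]; norm_num
      calc (YR R : ℝ) ^ (-(1/10) : ℝ) ≤ ((NR R : ℝ) ^ (1/33 : ℝ)) ^ (-(1/10) : ℝ) :=
            Real.rpow_le_rpow_of_nonpos (by positivity) h5 (by norm_num)
        _ = _ := by rw [← Real.rpow_mul hN0.le]; norm_num
    have h7 : (NR R : ℝ) * (YR R : ℝ) ^ (-(1/10) : ℝ) ≤ 4 * Real.exp (998/1000 * R) := by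
      calc _ ≤ (NR R : ℝ) * (NR R : ℝ) ^ (-(1/330) : ℝ) := by gcongr
        _ = (NR R : ℝ) ^ (329/330 : ℝ) := by
            nth_rewrite 1 [← Real.rpow_one (NR R : ℝ)]
            rw [← Real.rpow_add hN0]; norm_num
        _ ≤ (4 * Real.exp R) ^ (329/330 : ℝ) := Real.rpow_le_rpow hN0.le hcut.le (by norm_num)
        _ = 4 ^ (329/330 : ℝ) * Real.exp (R * (329/330)) := by
            rw [Real.mul_rpow (by norm_num) (Real.exp_pos _).le, ← Real.exp_mul]
        _ ≤ 4 ^ (1 : ℝ) * Real.exp (998/1000 * R) := by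
            have : Real.exp (R * (329/330)) ≤ Real.exp (998/1000 * R) := by
              rw [Real.exp_le_exp]; nlinarith
            have h8 : (4:ℝ) ^ (329/330 : ℝ) ≤ 4 ^ (1:ℝ) := Real.rpow_le_rpow_of_exponent_le (by norm_num) (by norm_num)
            gcongr
        _ = _ := by rw [Real.rpow_one]
    unfold del
    rw [div_le_iff₀ h2]
    calc _ ≤ 4 * Real.exp (998/1000 * R) := h7
      _ = 4 / c * Real.exp (-(1/1000 * R)) * (c * Real.exp (999/1000 * R)) := by
          have : Real.exp (998/1000 * R) = Real.exp (-(1/1000 * R)) * Real.exp (999/1000 * R) := by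
            rw [← Real.exp_add]; congr 1; ring
          rw [this]; field_simp
      _ ≤ _ := by gcongr

end VA
end

section
namespace VA

lemma OZ_abs (Z : ℕ) (D : ℤ) : |OZ Z D| ≤ Z := by
  unfold OZ
  refine (Finset.abs_sum_le_sum_abs _ _).trans ?_
  calc _ ≤ ∑ m ∈ Finset.Icc 1 Z, (1:ℝ) := by
        apply Finset.sum_le_sum; intro m hm
        rw [Finset.mem_Icc] at hm
        have h0 : (0:ℝ) < m := by exact_mod_cast (show 0 < m by omega)
        rw [abs_div, abs_of_pos h0, div_le_one h0]
        exact lam_abs_le' D m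
    _ = _ := by simp

/-- truncation depth -/
def JY (Y : ℕ) : ℕ := 3 * (Nat.log 2 Y + 1)

lemma JY_ge {Y : ℕ} : Y ^ 3 ≤ 2 ^ JY Y := by
  unfold JY
  rw [mul_comm, pow_mul]
  exact Nat.pow_le_pow_left (Nat.lt_pow_succ_log_self (by norm_num) Y).le 3

lemma JY_le {Y : ℕ} (hY : 1 ≤ Y) : 2 ^ JY Y ≤ 8 * Y ^ 3 := by
  unfold JY
  rw [mul_comm, pow_mul]
  have h := Nat.pow_log_le_self 2 (show Y ≠ 0 by omega)
  calc (2 ^ (Nat.log 2 Y + 1)) ^ 3 ≤ (2 * Y) ^ 3 := by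
        apply Nat.pow_le_pow_left; rw [pow_succ]; omega
    _ = _ := by ring

lemma JY_tendsto : Tendsto JY atTop atTop := by
  apply tendsto_atTop_mono (f := fun Y => Nat.log 2 Y)
  · intro Y; unfold JY; omega
  · exact tendsto_atTop_atTop.mpr (fun b => ⟨2 ^ b, fun a ha => Nat.le_log_of_pow_le (by norm_num) ha⟩)

lemma diff_bound {n J : ℕ} (hn : 3 ≤ n) (Z : ℕ) :
    (ampA n - gam J (Dz n) * OZ Z (Dz n)) ^ 2 ≤
      32 * (Oval n - OZ Z (Dz n)) ^ 2 + 32 * ((1/2) ^ J * Z) ^ 2 := by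
  rw [ampA_eq hn (show n ≤ n + J by omega)]
  obtain ⟨x, hx⟩ : ∃ x, x = gam (n + J) (Dz n) := ⟨_, rfl⟩
  obtain ⟨y, hy⟩ : ∃ y, y = gam J (Dz n) := ⟨_, rfl⟩
  have h1 : 0 ≤ x := hx ▸ gam_nonneg _ _
  have h2 : x ≤ 4 := hx ▸ gam_le _ _
  have h3 : |x - y| ≤ 4 * (1/2) ^ J := by rw [hx, hy]; exact gam_sub_le (by omega) _
  have h4 := OZ_abs Z (Dz n)
  rw [← hx, ← hy]
  obtain ⟨o, ho⟩ : ∃ o, o = OZ Z (Dz n) := ⟨_, rfl⟩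
  rw [← ho] at h4 ⊢
  have e : x * Oval n - y * o = x * (Oval n - o) + (x - y) * o := by ring
  rw [e]
  have h5 : (x * (Oval n - o)) ^ 2 ≤ 16 * (Oval n - o) ^ 2 := by
    rw [mul_pow]; gcongr; nlinarith
  have h6 : ((x - y) * o) ^ 2 ≤ 16 * ((1/2) ^ J * Z) ^ 2 := by
    have : |(x - y) * o| ≤ 4 * (1/2) ^ J * Z := by rw [abs_mul]; gcongr
    calc _ = |(x - y) * o| ^ 2 := (sq_abs _).symm
      _ ≤ (4 * (1/2) ^ J * Z) ^ 2 := by gcongr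
      _ = _ := by ring
  nlinarith [sq_nonneg (x * (Oval n - o) - (x - y) * o)]

lemma main_diff {q : ℝ → ℝ} {Q Λ : ℝ} (hq : Wt q Q Λ) : ∃ C : ℝ, 0 < C ∧ ∀ R, 1 ≤ R → 2 ^ 32 ≤ YR R →
    ∑ n ∈ Finset.Ico 3 (NR R), q (aa n / R) * (ampA n - gam (JY (YR R)) (Dz n) * OZ (YR R ^ 2) (Dz n)) ^ 2 ≤
      C * ((NR R : ℝ) * (YR R : ℝ) ^ (-(1/10) : ℝ)) := by
  obtain ⟨C, hC, ht⟩ := tail_bound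
  refine ⟨(Q + 1) * (32 * (C + 1)), by have := hq.Qnonneg; positivity, ?_⟩
  intro R hR hY
  have hQ := hq.Qnonneg
  have h1 := ht (YR R) (NR R) (le_trans (by norm_num) hY) (YR_pow_le R) (YR_pow_ge hY)
  obtain ⟨Y, hYe⟩ : ∃ Y, Y = YR R := ⟨_, rfl⟩
  obtain ⟨N, hNe⟩ : ∃ N, N = NR R := ⟨_, rfl⟩
  rw [← hYe, ← hNe] at h1 ⊢
  rw [← hYe] at hY
  have hY1 : (1:ℝ) ≤ Y := by exact_mod_cast (le_trans (by norm_num) hY : 1 ≤ Y)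
  have hJ : ((1/2:ℝ) ^ JY Y * ((Y ^ 2 : ℕ) : ℝ)) ^ 2 ≤ (Y:ℝ) ^ (-(1/10) : ℝ) := by
    have h2 : (Y:ℝ) ^ 3 ≤ 2 ^ JY Y := by exact_mod_cast (JY_ge (Y := Y))
    have h3 : (1/2:ℝ) ^ JY Y * ((Y ^ 2 : ℕ) : ℝ) ≤ (Y:ℝ)⁻¹ := by
      push_cast
      rw [one_div, inv_pow]
      calc ((2:ℝ) ^ JY Y)⁻¹ * (Y:ℝ) ^ 2 ≤ ((Y:ℝ) ^ 3)⁻¹ * (Y:ℝ) ^ 2 := by gcongr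
        _ = _ := by field_simp
    calc _ ≤ ((Y:ℝ)⁻¹) ^ 2 := by gcongr
      _ ≤ (Y:ℝ)⁻¹ := by
          have : (Y:ℝ)⁻¹ ≤ 1 := inv_le_one_of_one_le₀ hY1
          have h0 : 0 ≤ (Y:ℝ)⁻¹ := by positivity
          nlinarith
      _ = (Y:ℝ) ^ (-1 : ℝ) := by rw [Real.rpow_neg_one]
      _ ≤ _ := Real.rpow_le_rpow_of_exponent_le hY1 (by norm_num)
  obtain ⟨η, hη⟩ : ∃ η, η = (Y:ℝ) ^ (-(1/10) : ℝ) := ⟨_, rfl⟩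
  rw [← hη] at h1 hJ ⊢
  have hη0 : 0 ≤ η := by rw [hη]; positivity
  calc _ ≤ ∑ n ∈ Finset.Ico 3 N, (Q + 1) * (32 * (Oval n - OZ (Y^2) (Dz n)) ^ 2 + 32 * η) := by
        apply Finset.sum_le_sum; intro n hn
        rw [Finset.mem_Ico] at hn
        have := diff_bound (J := JY Y) hn.1 (Y ^ 2)
        have hql := hq.le (aa n / R)
        apply mul_le_mul (by linarith) (by linarith) (sq_nonneg _) (by linarith)
    _ = (Q + 1) * (32 * ∑ n ∈ Finset.Ico 3 N, (Oval n - OZ (Y^2) (Dz n)) ^ 2 + 32 * (((N - 3 : ℕ) : ℝ) * η)) := by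
        rw [← Finset.mul_sum, Finset.sum_add_distrib, ← Finset.mul_sum]
        simp; left; ring
    _ ≤ (Q + 1) * (32 * (C * N * η) + 32 * ((N : ℝ) * η)) := by
        gcongr; omega
    _ = _ := by ring

lemma main_err {q : ℝ → ℝ} {Q Λ : ℝ} (hq : Wt q Q Λ) : ∃ C : ℝ, 0 < C ∧ ∀ R, 1 ≤ R → 2 ^ 32 ≤ YR R →
    |∑ n ∈ Finset.Ico 3 (NR R), q (aa n / R) * (gam (JY (YR R)) (Dz n) * OZ (YR R ^ 2) (Dz n)) ^ 2 -
      Bj (JY (YR R)) * boxS (YR R ^ 2) * ∑ n ∈ Finset.Ico 3 (NR R), q (aa n / R)| ≤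
      C * ((NR R : ℝ) * (YR R : ℝ) ^ (-(1/10) : ℝ)) := by
  have hQ := hq.Qnonneg
  have hL := hq.Lnonneg
  refine ⟨4096 * (2 * Q + 3 * Λ) + 1, by positivity, ?_⟩
  intro R hR hY
  refine (main_sum hq (NR_cut hR) (JY (YR R)) (YR R ^ 2)).trans ?_
  have hN := YR_pow_le R
  obtain ⟨Y, hYe⟩ : ∃ Y, Y = YR R := ⟨_, rfl⟩
  obtain ⟨N, hNe⟩ : ∃ N, N = NR R := ⟨_, rfl⟩
  rw [← hYe, ← hNe] at hN ⊢
  rw [← hYe] at hY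
  have hY1n : 1 ≤ Y := le_trans (by norm_num) hY
  have hY1 : (1:ℝ) ≤ Y := by exact_mod_cast hY1n
  have h2 : (2:ℝ) ^ JY Y ≤ 8 * (Y:ℝ) ^ 3 := by exact_mod_cast (JY_le hY1n)
  have h3 : (2:ℝ) ^ (2 * JY Y + 1) ≤ 128 * (Y:ℝ) ^ 6 := by
    calc (2:ℝ) ^ (2 * JY Y + 1) = 2 * (2 ^ JY Y) ^ 2 := by rw [pow_succ, mul_comm 2 (JY Y), pow_mul]; ring
      _ ≤ 2 * (8 * (Y:ℝ) ^ 3) ^ 2 := by gcongr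
      _ = _ := by ring
  have h4 : (Y:ℝ) ^ 18 ≤ (N:ℝ) * (Y:ℝ) ^ (-(1/10) : ℝ) := by
    have h5 : (Y:ℝ)^32 ≤ N := by exact_mod_cast hN
    calc (Y:ℝ) ^ 18 ≤ (Y:ℝ)^31 := pow_le_pow_right₀ hY1 (by norm_num)
      _ = (Y:ℝ)^32 * (Y:ℝ)⁻¹ := by field_simp
      _ ≤ (N:ℝ) * (Y:ℝ) ^ (-(1/10) : ℝ) := by
          gcongr
          rw [← Real.rpow_neg_one]
          exact Real.rpow_le_rpow_of_exponent_le hY1 (by norm_num)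
  push_cast
  calc ((Y:ℝ) ^ 2) ^ 2 * (2 * 16 * (2 ^ (2 * JY Y + 1) * ((Y:ℝ) ^ 2) ^ 4) * (2 * Q + 3 * Λ)) ≤
      ((Y:ℝ) ^ 2) ^ 2 * (2 * 16 * (128 * (Y:ℝ) ^ 6 * ((Y:ℝ) ^ 2) ^ 4) * (2 * Q + 3 * Λ)) := by gcongr
    _ = 4096 * (2 * Q + 3 * Λ) * (Y:ℝ) ^ 18 := by ring
    _ ≤ (4096 * (2 * Q + 3 * Λ) + 1) * (Y:ℝ) ^ 18 := by gcongr; linarith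
    _ ≤ _ := by gcongr

lemma Bj_tendsto : Tendsto Bj atTop (nhds (1015/864)) := beta_tendsto

lemma boxS_tendsto : Tendsto boxS atTop (nhds KO) := KO_box

lemma main_limit {q : ℝ → ℝ} {Q Λ c : ℝ} (hq : Wt q Q Λ) (hc : 0 < c)
    (hlow : ∀ R, 1 ≤ R → c * Real.exp (999/1000 * R) ≤ II q R) :
    Tendsto (fun R => (∑ n ∈ Finset.Ico 3 (NR R), q (aa n / R) * ampA n ^ 2) / II q R) atTop (nhds kappa) := by
  have hQ := hq.Qnonneg
  have hL := hq.Lnonneg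
  obtain ⟨C1, hC1, hd⟩ := main_diff hq
  obtain ⟨C2, hC2, he⟩ := main_err hq
  have hdel := del_tendsto hc hlow
  have hev : ∀ᶠ R in atTop, 1 ≤ R ∧ 2 ^ 32 ≤ YR R :=
    (eventually_ge_atTop 1).and (YR_tendsto.eventually_ge_atTop (2 ^ 32))
  have hIpos : ∀ R, 1 ≤ R → 0 < II q R := fun R hR => lt_of_lt_of_le (by positivity) (hlow R hR)
  have hIinf : Tendsto (II q) atTop atTop := by
    have h1 : Tendsto (fun R : ℝ => c * Real.exp (999/1000 * R)) atTop atTop :=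
      (Real.tendsto_exp_atTop.comp (tendsto_id.const_mul_atTop (by norm_num))).const_mul_atTop hc
    apply tendsto_atTop_mono' _ _ h1
    filter_upwards [eventually_ge_atTop 1] with R hR using hlow R hR
  obtain ⟨W, hW⟩ : ∃ W : ℝ → ℝ, W = fun R => ∑ n ∈ Finset.Ico 3 (NR R), q (aa n / R) := ⟨_, rfl⟩
  have hWI : Tendsto (fun R => W R / II q R) atTop (nhds 1) := by
    have h0 : Tendsto (fun R => W R / II q R - 1) atTop (nhds 0) := by
      apply squeeze_zero_norm' (a := fun R => (3 * Λ + 2 * Q) / II q R)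
      · filter_upwards [eventually_ge_atTop 1] with R hR
        have hp := hIpos R hR
        have := W_compare hq (NR_cut hR)
        rw [Real.norm_eq_abs, div_sub_one hp.ne', abs_div, abs_of_pos hp]
        have h2 : |W R - II q R| ≤ 3 * Λ + 2 * Q := by rw [hW]; exact this
        gcongr
      · exact hIinf.const_div_atTop _
    simpa using h0.add_const 1
  obtain ⟨M, hM⟩ : ∃ M : ℝ → ℝ, M = fun R => ∑ n ∈ Finset.Ico 3 (NR R), q (aa n / R) * (gam (JY (YR R)) (Dz n) * OZ (YR R ^ 2) (Dz n)) ^ 2 := ⟨_, rfl⟩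
  have hMI : Tendsto (fun R => M R / II q R) atTop (nhds kappa) := by
    have hB : Tendsto (fun R => Bj (JY (YR R)) * boxS (YR R ^ 2) * (W R / II q R)) atTop (nhds kappa) := by
      have h1 := Bj_tendsto.comp (JY_tendsto.comp YR_tendsto)
      have h2 : Tendsto (fun R => YR R ^ 2) atTop atTop := (tendsto_pow_atTop (by norm_num)).comp YR_tendsto
      have h3 := boxS_tendsto.comp h2
      have := (h1.mul h3).mul hWI
      rw [mul_one, ← kappa_eq] at this
      exact this
    have h0 : Tendsto (fun R => M R / II q R - Bj (JY (YR R)) * boxS (YR R ^ 2) * (W R / II q R)) atTop (nhds 0) := by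
      apply squeeze_zero_norm' (a := fun R => C2 * del q R)
      · filter_upwards [hev] with R hR
        have hp := hIpos R hR.1
        have := he R hR.1 hR.2
        have e : M R / II q R - Bj (JY (YR R)) * boxS (YR R ^ 2) * (W R / II q R) =
            (M R - Bj (JY (YR R)) * boxS (YR R ^ 2) * W R) / II q R := by ring
        rw [Real.norm_eq_abs, e, abs_div, abs_of_pos hp]
        unfold del
        rw [← mul_div_assoc]
        apply div_le_div_of_nonneg_right _ hp.le
        rw [hM, hW]; exact this
      · simpa using hdel.const_mul C2
    simpa using h0.add hB
  have hs : Tendsto (fun R => Real.sqrt (del q R)) atTop (nhds 0) := by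
    simpa using hdel.sqrt
  have h0 : Tendsto (fun R => (∑ n ∈ Finset.Ico 3 (NR R), q (aa n / R) * ampA n ^ 2) / II q R - M R / II q R) atTop (nhds 0) := by
    apply squeeze_zero_norm' (a := fun R => C1 * del q R + C1 * Real.sqrt (del q R) + Real.sqrt (del q R) * (M R / II q R))
    · filter_upwards [hev] with R hR
      have hp := hIpos R hR.1
      have hY0 : 0 < YR R := lt_of_lt_of_le (by norm_num) hR.2
      have hN0 : 0 < NR R := by have := (NR_cut hR.1).three; omega
      have hdpos : 0 < del q R := by
        unfold del
        have h1 : (0:ℝ) < YR R := by exact_mod_cast hY0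
        have h2 : (0:ℝ) < NR R := by exact_mod_cast hN0
        positivity
      obtain ⟨t, ht⟩ : ∃ t, t = Real.sqrt (del q R) := ⟨_, rfl⟩
      have ht0 : 0 < t := by rw [ht]; exact Real.sqrt_pos.mpr hdpos
      have htt : t * t = del q R := by rw [ht]; exact Real.mul_self_sqrt hdpos.le
      rw [← ht]
      have hE := hd R hR.1 hR.2
      have hdE : C1 * ((NR R : ℝ) * (YR R : ℝ) ^ (-(1/10) : ℝ)) = C1 * (t * t) * II q R := by
        rw [htt]; unfold del; field_simp
      rw [hdE] at hE
      have hMR : M R = ∑ n ∈ Finset.Ico 3 (NR R), q (aa n / R) * (gam (JY (YR R)) (Dz n) * OZ (YR R ^ 2) (Dz n)) ^ 2 := by rw [hM]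
      have hkey : |(∑ n ∈ Finset.Ico 3 (NR R), q (aa n / R) * ampA n ^ 2) - M R| ≤
          (1 + 1 / t) * ∑ n ∈ Finset.Ico 3 (NR R), q (aa n / R) * (ampA n - gam (JY (YR R)) (Dz n) * OZ (YR R ^ 2) (Dz n)) ^ 2 + t * M R := by
        rw [hMR, ← Finset.sum_sub_distrib, Finset.mul_sum, Finset.mul_sum, ← Finset.sum_add_distrib]
        refine (Finset.abs_sum_le_sum_abs _ _).trans (Finset.sum_le_sum ?_)
        intro n _
        obtain ⟨b, hb⟩ : ∃ b, b = gam (JY (YR R)) (Dz n) * OZ (YR R ^ 2) (Dz n) := ⟨_, rfl⟩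
        rw [← hb]
        have hqn := hq.nonneg (aa n / R)
        have e1 : q (aa n / R) * ampA n ^ 2 - q (aa n / R) * b ^ 2 = q (aa n / R) * (ampA n ^ 2 - b ^ 2) := by ring
        have e2 : (1 + 1 / t) * (q (aa n / R) * (ampA n - b) ^ 2) + t * (q (aa n / R) * b ^ 2) =
            q (aa n / R) * ((ampA n - b) ^ 2 + (ampA n - b) ^ 2 / t + t * b ^ 2) := by ring
        rw [e1, e2, abs_mul, abs_of_nonneg hqn]
        apply mul_le_mul_of_nonneg_left _ hqn
        obtain ⟨d, hd'⟩ : ∃ d, d = ampA n - b := ⟨_, rfl⟩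
        have e3 : ampA n = b + d := by rw [hd']; ring
        rw [← hd', e3]
        have e4 : (b + d) ^ 2 - b ^ 2 = d ^ 2 + 2 * b * d := by ring
        rw [e4]
        have h5 : |2 * b * d| ≤ d ^ 2 / t + t * b ^ 2 := by
          have h6 : d ^ 2 / t + t * b ^ 2 = t * ((d / t) ^ 2 + b ^ 2) := by field_simp
          have h7 : 2 * b * d = t * (2 * b * (d / t)) := by field_simp
          rw [h6, h7, abs_mul, abs_of_pos ht0]
          apply mul_le_mul_of_nonneg_left _ ht0.le
          rw [abs_le]; constructor <;> nlinarith [sq_nonneg (b - d / t), sq_nonneg (b + d / t)]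
        calc _ ≤ |d ^ 2| + |2 * b * d| := abs_add_le _ _
          _ ≤ _ := by rw [abs_of_nonneg (sq_nonneg d)]; linarith
      rw [Real.norm_eq_abs, ← sub_div, abs_div, abs_of_pos hp, div_le_iff₀ hp]
      refine hkey.trans ?_
      calc _ ≤ (1 + 1 / t) * (C1 * (t * t) * II q R) + t * M R := by gcongr
        _ = _ := by rw [← htt]; field_simp
    · have := ((hdel.const_mul C1).add (hs.const_mul C1)).add (hs.mul hMI)
      simpa using this
  simpa using h0.add hMI

end VA
end

section
namespace VA

lemma kappa_pos : 0 < kappa := by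
  unfold kappa
  apply mul_pos (by norm_num)
  by_cases h : Multipliable (fun p : {p : ℕ // p.Prime ∧ p ≠ 2} =>
    (1 + ((p.1 : ℝ) ^ 4 - 2 * (p.1 : ℝ) ^ 3 + 1) / ((p.1 : ℝ) ^ 2 - 1) ^ 3))
  · apply lt_of_lt_of_le zero_lt_one
    apply ge_of_tendsto h.hasProd
    refine Eventually.of_forall (fun s => ?_)
    apply Finset.prod_induction _ (fun x : ℝ => 1 ≤ x)
    · intro a b ha hb; exact one_le_mul_of_one_le_of_one_le ha hb
    · exact le_refl _
    · intro p _
      have hp : (2:ℝ) ≤ p.1 := by exact_mod_cast p.2.1.two_le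
      have h1 : 0 ≤ (p.1 : ℝ) ^ 4 - 2 * (p.1 : ℝ) ^ 3 + 1 := by
        have : (p.1 : ℝ) ^ 4 - 2 * (p.1 : ℝ) ^ 3 = (p.1:ℝ)^3 * (p.1 - 2) := by ring
        rw [this]
        have : 0 ≤ (p.1:ℝ) - 2 := by linarith
        positivity
      have h2 : 0 ≤ (p.1 : ℝ) ^ 2 - 1 := by nlinarith
      have : 0 ≤ ((p.1 : ℝ) ^ 4 - 2 * (p.1 : ℝ) ^ 3 + 1) / ((p.1 : ℝ) ^ 2 - 1) ^ 3 := by positivity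
      linarith
  · rw [tprod_eq_one_of_not_multipliable h]; norm_num

lemma g_vanish {g : ℝ → ℝ} (hg : Continuous g)
    (hs : sSup {r : ℝ | ∃ ξ : ℝ, g ξ ≠ 0 ∧ |ξ| = r} = 1) {x : ℝ} (hx : 1 ≤ x) : g x = 0 := by
  have hb : BddAbove {r : ℝ | ∃ ξ : ℝ, g ξ ≠ 0 ∧ |ξ| = r} := by
    by_contra h
    rw [Real.sSup_of_not_bddAbove h] at hs
    norm_num at hs
  have h1 : ∀ y, 1 < y → g y = 0 := by
    intro y hy
    by_contra h
    have := le_csSup hb ⟨y, h, rfl⟩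
    rw [hs, abs_of_pos (by linarith)] at this
    linarith
  rcases hx.lt_or_eq with h | h
  · exact h1 x h
  · have hcl : closure (Set.Ioi (1:ℝ)) ⊆ {y | g y = 0} :=
      closure_minimal (fun y hy => h1 y hy) (isClosed_eq hg continuous_const)
    rw [closure_Ioi] at hcl
    exact hcl hx

lemma g_Wt {g : ℝ → ℝ} (hg_smooth : ContDiff ℝ (⊤ : ℕ∞) g)
    (hg_supp : HasCompactSupport g)
    (hg_sup : sSup {r : ℝ | ∃ ξ : ℝ, g ξ ≠ 0 ∧ |ξ| = r} = 1) :
    ∃ Q Λ, Wt (fun x => g x ^ 2) Q Λ := by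
  have hc : HasCompactSupport (fun x => g x ^ 2) := by
    have : (fun x => g x ^ 2) = (fun y : ℝ => y ^ 2) ∘ g := rfl
    rw [this]
    exact hg_supp.comp_left (by norm_num)
  have hd : ContDiff ℝ (⊤ : ℕ∞) (fun x => g x ^ 2) := hg_smooth.pow 2
  obtain ⟨Q, hQ⟩ := hc.exists_bound_of_continuous hd.continuous
  obtain ⟨C, hC⟩ := hd.lipschitzWith_of_hasCompactSupport hc (by simp)
  refine ⟨Q, C, fun x => sq_nonneg _, fun x => (le_abs_self _).trans (hQ x), ?_, ?_⟩
  · intro x y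
    have := hC.dist_le_mul x y
    simpa [Real.dist_eq] using this
  · intro x hx
    simp [g_vanish hg_smooth.continuous hg_sup hx.le]

lemma II_cont_integrable {q : ℝ → ℝ} (hq : Continuous q) (hv : ∀ x, 1 ≤ x → q x = 0) {R : ℝ} (hR : 0 < R) :
    IntegrableOn (fun s => q (s / R) * Real.exp s) (Set.Ioi 0) := by
  have h1 : IntegrableOn (fun s => q (s / R) * Real.exp s) (Set.Ioc 0 R) := by
    apply (Continuous.integrableOn_Icc (a := 0) (b := R) (by fun_prop)).mono_set Set.Ioc_subset_Icc_self
  have h2 : IntegrableOn (fun s => q (s / R) * Real.exp s) (Set.Ioi R) := by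
    apply (integrableOn_zero (α := ℝ)).congr_fun _ measurableSet_Ioi
    intro s hs
    have : 1 ≤ s / R := by rw [le_div_iff₀ hR]; linarith [Set.mem_Ioi.mp hs]
    simp [hv _ this]
  rw [← Set.Ioc_union_Ioi_eq_Ioi hR.le]
  exact h1.union h2

lemma g_low {g : ℝ → ℝ} (hg : Continuous g) (hg_even : ∀ ξ, g (-ξ) = g ξ) (hg_zero : g 0 = 1)
    (hs : sSup {r : ℝ | ∃ ξ : ℝ, g ξ ≠ 0 ∧ |ξ| = r} = 1) :
    ∃ c : ℝ, 0 < c ∧ ∀ R, 1 ≤ R → c * Real.exp (999/1000 * R) ≤ II (fun x => g x ^ 2) R := by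
  have hne : {r : ℝ | ∃ ξ : ℝ, g ξ ≠ 0 ∧ |ξ| = r}.Nonempty := ⟨0, 0, by rw [hg_zero]; norm_num, by simp⟩
  obtain ⟨r, ⟨ξ, h1, h2⟩, h3⟩ := exists_lt_of_lt_csSup hne (show (9995/10000 : ℝ) < _ by rw [hs]; norm_num)
  have hr : g r ≠ 0 := by
    rcases abs_choice ξ with h | h
    · rw [← h2, h]; exact h1
    · rw [← h2, h, hg_even]; exact h1
  have hpos : 0 < g r ^ 2 := by positivity
  have hq : Continuous (fun x => g x ^ 2) := by fun_prop
  have hev : ∀ᶠ x in nhds r, g r ^ 2 / 2 < g x ^ 2 := hq.continuousAt.eventually_const_lt (by simp only; linarith)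
  obtain ⟨δ, hδ, hball⟩ := Metric.eventually_nhds_iff.mp hev
  obtain ⟨η, hη⟩ : ∃ η, η = min (δ / 2) (1/10000) := ⟨_, rfl⟩
  have hη0 : 0 < η := by rw [hη]; positivity
  have hη1 : η < δ := by rw [hη]; exact lt_of_le_of_lt (min_le_left _ _) (by linarith)
  have hη2 : η ≤ 1/10000 := by rw [hη]; exact min_le_right _ _
  refine ⟨g r ^ 2 / 2 * η, by positivity, ?_⟩
  intro R hR
  have hR0 : 0 < R := by linarith
  have hIntg := II_cont_integrable hq (fun x hx => by simp [g_vanish hg hs hx]) hR0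
  have hsub : Set.Icc (R * (r - η)) (R * r) ⊆ Set.Ioi 0 := by
    intro s hs
    rw [Set.mem_Icc] at hs
    have : 0 < R * (r - η) := mul_pos hR0 (by linarith)
    rw [Set.mem_Ioi]; linarith
  calc g r ^ 2 / 2 * η * Real.exp (999/1000 * R) ≤ (g r ^ 2 / 2 * Real.exp (999/1000*R)) * (R * η) := by
        have : 1 * η ≤ R * η := by gcongr
        have h0 : 0 ≤ g r ^ 2 / 2 * Real.exp (999/1000*R) := by positivity
        nlinarith
    _ = ∫ s in Set.Icc (R * (r - η)) (R * r), g r ^ 2 / 2 * Real.exp (999/1000*R) := by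
        rw [setIntegral_const, smul_eq_mul, Measure.real, Real.volume_Icc, ENNReal.toReal_ofReal (by nlinarith)]
        ring
    _ ≤ ∫ s in Set.Icc (R * (r - η)) (R * r), (fun x => g x ^ 2) (s / R) * Real.exp s := by
        apply setIntegral_mono_on (integrableOn_const (by simp)) (hIntg.mono_set hsub) measurableSet_Icc
        intro s hs
        rw [Set.mem_Icc] at hs
        have e1 : s / R ≤ r := by rw [div_le_iff₀ hR0]; linarith
        have e2 : r - η ≤ s / R := by rw [le_div_iff₀ hR0]; linarith
        have e3 : g r ^ 2 / 2 < g (s / R) ^ 2 := by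
          apply hball
          rw [Real.dist_eq, abs_lt]; constructor <;> linarith
        have e4 : Real.exp (999/1000*R) ≤ Real.exp s := by
          rw [Real.exp_le_exp]; nlinarith
        gcongr
    _ ≤ II (fun x => g x ^ 2) R := by
        unfold II
        apply setIntegral_mono_set hIntg
        · exact Eventually.of_forall (fun s => by simp only [Pi.zero_apply]; positivity)
        · exact hsub.eventuallyLE

lemma sigmaSq_eq (g : ℝ → ℝ) {L : ℝ} (hL : 0 < L) :
    sigmaSq g L = 2 * kappa / (Real.pi * L) ^ 2 * II (fun x => g x ^ 2) (Real.pi * L) := by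
  unfold sigmaSq II
  have hR : 0 < Real.pi * L := mul_pos Real.pi_pos hL
  obtain ⟨R, hRe⟩ : ∃ R, R = Real.pi * L := ⟨_, rfl⟩
  rw [← hRe] at hR ⊢
  have := integral_comp_mul_left_Ioi (fun s => (fun x => g x ^ 2) (s / R) * Real.exp s) 0 hR
  rw [mul_zero, smul_eq_mul] at this
  have e : ∀ x, (fun x => g x ^ 2) (R * x / R) * Real.exp (R * x) = g x ^ 2 * Real.exp (R * x) := by
    intro x; simp only; rw [mul_div_cancel_left₀ _ hR.ne']
  simp only [] at this
  rw [setIntegral_congr_fun measurableSet_Ioi (fun x _ => e x)] at this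
  rw [this]
  field_simp

end VA
end

section
namespace VA

lemma osc_decay (k : ℕ) : ∀ w : ℝ → ℝ, ContDiff ℝ (⊤ : ℕ∞) w → HasCompactSupport w →
    ∃ C : ℝ, 0 ≤ C ∧ ∀ y : ℝ, y ≠ 0 → |∫ s, Real.cos (y * s) * w s| ≤ C / |y| ^ k ∧
      |∫ s, Real.sin (y * s) * w s| ≤ C / |y| ^ k := by
  induction k with
  | zero =>
    intro w hw hc
    have hIntg : Integrable (fun s => |w s|) := (hw.continuous.integrable_of_hasCompactSupport hc).abs
    refine ⟨∫ s, |w s|, integral_nonneg (fun s => abs_nonneg _), fun y _ => ?_⟩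
    simp only [pow_zero, div_one]
    constructor
    · rw [← Real.norm_eq_abs]
      apply norm_integral_le_of_norm_le hIntg
      refine Eventually.of_forall (fun s => ?_)
      rw [Real.norm_eq_abs, abs_mul]
      exact mul_le_of_le_one_left (abs_nonneg _) (Real.abs_cos_le_one _)
    · rw [← Real.norm_eq_abs]
      apply norm_integral_le_of_norm_le hIntg
      refine Eventually.of_forall (fun s => ?_)
      rw [Real.norm_eq_abs, abs_mul]
      exact mul_le_of_le_one_left (abs_nonneg _) (Real.abs_sin_le_one _)
  | succ k ih =>
    intro w hw hc
    have hd : ContDiff ℝ (⊤ : ℕ∞) (deriv w) := (contDiff_infty_iff_deriv.mp hw).2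
    have hdc : HasCompactSupport (deriv w) := hc.deriv
    obtain ⟨C, hC0, hC⟩ := ih (deriv w) hd hdc
    refine ⟨C, hC0, fun y hy => ?_⟩
    obtain ⟨h1, h2⟩ := hC y hy
    have hder : ∀ s, HasDerivAt w (deriv w s) s := fun s =>
      ((hw.differentiable (by simp)) s).hasDerivAt
    have hlin : ∀ s : ℝ, HasDerivAt (fun s => y * s) y s := fun s => by
      simpa using (hasDerivAt_id s).const_mul y
    have hsin : ∀ s : ℝ, HasDerivAt (fun s => Real.sin (y * s) / y) (Real.cos (y * s)) s := by
      intro s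
      have := ((hlin s).sin).div_const y
      rw [mul_div_assoc, div_self hy, mul_one] at this
      exact this
    have hcos : ∀ s : ℝ, HasDerivAt (fun s => -Real.cos (y * s) / y) (Real.sin (y * s)) s := by
      intro s
      have := ((hlin s).cos).neg.div_const y
      apply this.congr_deriv
      field_simp
    have hw0 := hw.continuous
    have hd0 := hd.continuous
    have i1 : ∀ f : ℝ → ℝ, Continuous f → Integrable (fun s => f s * w s) := fun f hf =>
      (hf.mul hw0).integrable_of_hasCompactSupport hc.mul_left
    have i2 : ∀ f : ℝ → ℝ, Continuous f → Integrable (fun s => f s * deriv w s) := fun f hf =>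
      (hf.mul hd0).integrable_of_hasCompactSupport hdc.mul_left
    have e1 : ∫ s, Real.cos (y * s) * w s = - ((∫ s, Real.sin (y * s) * deriv w s) / y) := by
      have := integral_mul_deriv_eq_deriv_mul_of_integrable (u := fun s => Real.sin (y * s) / y) (v := w)
        (u' := fun s => Real.cos (y * s)) (v' := deriv w) (fun s _ => hsin s) (fun s _ => hder s)
        (i2 _ (by fun_prop)) (i1 _ (by fun_prop)) (i1 _ (by fun_prop))
      rw [← integral_div]
      have e : ∀ s, Real.sin (y * s) * deriv w s / y = Real.sin (y * s) / y * deriv w s := fun s => by ring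
      simp only [e]
      rw [this, neg_neg]
    have e2 : ∫ s, Real.sin (y * s) * w s = (∫ s, Real.cos (y * s) * deriv w s) / y := by
      have := integral_mul_deriv_eq_deriv_mul_of_integrable (u := fun s => -Real.cos (y * s) / y) (v := w)
        (u' := fun s => Real.sin (y * s)) (v' := deriv w) (fun s _ => hcos s) (fun s _ => hder s)
        (i2 _ (by fun_prop)) (i1 _ (by fun_prop)) (i1 _ (by fun_prop))
      rw [← integral_div]
      have e : ∀ s, Real.cos (y * s) * deriv w s / y = -(-Real.cos (y * s) / y * deriv w s) := fun s => by ring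
      simp only [e]
      rw [integral_neg, this, neg_neg]
    have hy0 : 0 < |y| := abs_pos.mpr hy
    constructor
    · rw [e1, abs_neg, abs_div, pow_succ, ← div_div]
      gcongr
    · rw [e2, abs_div, pow_succ, ← div_div]
      gcongr

/-- coefficients -/
noncomputable def cf (g : ℝ → ℝ) (R : ℝ) (n : ℕ) : ℝ := ampA n * g (aa n / R)

lemma SL_eq {g : ℝ → ℝ} (hv : ∀ x, 1 ≤ x → g x = 0) {L : ℝ} (hL : 1 ≤ Real.pi * L) (τ : ℝ) :
    SL g L τ = (1 / (Real.pi * L)) * ∑ n ∈ Finset.Ico 3 (NR (Real.pi * L)),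
      cf g (Real.pi * L) n * (2 * Real.cos (τ * (2 * aa n))) := by
  unfold SL
  congr 1
  have hR0 : 0 < Real.pi * L := by linarith
  have e0 : ∀ n, Real.log (Nnorm n) / (2 * Real.pi * L) = aa n / (Real.pi * L) := by
    intro n; rw [log_Nnorm, mul_assoc]; exact mul_div_mul_left _ _ (by norm_num)
  rw [tsum_eq_sum (s := Finset.Ico 3 (NR (Real.pi * L)))]
  · apply Finset.sum_congr rfl
    intro n hn
    rw [Finset.mem_Ico] at hn
    rw [if_pos (by omega), e0, log_Nnorm]; rfl
  · intro n hn
    rw [Finset.mem_Ico] at hn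
    by_cases h : 2 < n
    · rw [if_pos h, e0]
      have h1 : Real.pi * L ≤ aa n := (NR_cut hL).aa_ge (by omega)
      rw [hv _ (by rw [le_div_iff₀ hR0]; linarith)]; ring
    · rw [if_neg h]

lemma moment_eq {w : ℝ → ℝ} (hw : Continuous w) (hc : HasCompactSupport w) (s : Finset ℕ)
    (c x : ℕ → ℝ) {T : ℝ} (hT : 0 < T) (r : ℝ) :
    (1 / T) * ∫ τ : ℝ, (r * ∑ n ∈ s, c n * (2 * Real.cos (τ * x n))) ^ 2 * w (τ / T) =
      r ^ 2 * ∑ n ∈ s, ∑ m ∈ s, c n * c m * (2 * ((∫ t, Real.cos (T * (x n - x m) * t) * w t) +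
        ∫ t, Real.cos (T * (x n + x m) * t) * w t)) := by
  have h1 : ∫ τ : ℝ, (r * ∑ n ∈ s, c n * (2 * Real.cos (τ * x n))) ^ 2 * w (τ / T) =
      T * ∫ t : ℝ, (r * ∑ n ∈ s, c n * (2 * Real.cos (T * t * x n))) ^ 2 * w t := by
    have := Measure.integral_comp_div (fun t : ℝ => (r * ∑ n ∈ s, c n * (2 * Real.cos (T * t * x n))) ^ 2 * w t) T
    rw [smul_eq_mul, abs_of_pos hT] at this
    rw [← this]
    apply integral_congr_ae
    refine Eventually.of_forall (fun τ => ?_)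
    simp only
    rw [mul_div_cancel₀ _ hT.ne']
  rw [h1, ← mul_assoc, one_div, inv_mul_cancel₀ hT.ne', one_mul]
  have hi : ∀ y : ℝ, Integrable (fun t => Real.cos (y * t) * w t) := fun y =>
    ((by fun_prop : Continuous fun t => Real.cos (y * t) * w t)).integrable_of_hasCompactSupport hc.mul_left
  have h2 : ∀ t : ℝ, (r * ∑ n ∈ s, c n * (2 * Real.cos (T * t * x n))) ^ 2 * w t =
      r ^ 2 * ∑ n ∈ s, ∑ m ∈ s, c n * c m * (2 * (Real.cos (T * (x n - x m) * t) * w t + Real.cos (T * (x n + x m) * t) * w t)) := by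
    intro t
    rw [mul_pow, pow_two (∑ n ∈ s, _), Finset.sum_mul_sum, mul_assoc, Finset.sum_mul]
    congr 1
    apply Finset.sum_congr rfl; intro n _
    rw [Finset.sum_mul]
    apply Finset.sum_congr rfl; intro m _
    have e1 : T * (x n - x m) * t = T * t * x n - T * t * x m := by ring
    have e2 : T * (x n + x m) * t = T * t * x n + T * t * x m := by ring
    rw [e1, e2, Real.cos_sub, Real.cos_add]; ring
  simp only [h2]
  rw [integral_const_mul, integral_finset_sum]
  · congr 1
    apply Finset.sum_congr rfl; intro n _
    rw [integral_finset_sum]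
    · apply Finset.sum_congr rfl; intro m _
      rw [integral_const_mul, integral_const_mul, integral_add (hi _) (hi _)]
    · intro m _
      exact (((hi _).add (hi _)).const_mul _).const_mul _
  · intro n _
    apply integrable_finset_sum; intro m _
    exact (((hi _).add (hi _)).const_mul _).const_mul _

lemma offdiag_bound {I : ℝ → ℝ} (s : Finset ℕ) (c x : ℕ → ℝ) {T η : ℝ} (hη : 0 ≤ η) (N : ℝ) (hN : (s.card : ℝ) ≤ N)
    (h0 : I 0 = 1)
    (hd : ∀ n ∈ s, ∀ m ∈ s, n ≠ m → |I (T * (x n - x m))| ≤ η)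
    (hp : ∀ n ∈ s, ∀ m ∈ s, |I (T * (x n + x m))| ≤ η) :
    |∑ n ∈ s, ∑ m ∈ s, c n * c m * (2 * (I (T * (x n - x m)) + I (T * (x n + x m)))) -
      2 * ∑ n ∈ s, c n ^ 2| ≤ 4 * η * N * ∑ n ∈ s, c n ^ 2 := by
  have e : ∑ n ∈ s, ∑ m ∈ s, c n * c m * (2 * (I (T * (x n - x m)) + I (T * (x n + x m)))) -
      2 * ∑ n ∈ s, c n ^ 2 = ∑ n ∈ s, ∑ m ∈ s, c n * c m * (2 * (I (T * (x n - x m)) + I (T * (x n + x m))) - if n = m then 2 else 0) := by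
    rw [Finset.mul_sum, ← Finset.sum_sub_distrib]
    apply Finset.sum_congr rfl; intro n hn
    simp only [mul_sub]
    rw [Finset.sum_sub_distrib]
    simp [hn]; ring
  rw [e]
  have hb : ∀ n ∈ s, ∀ m ∈ s, |c n * c m * (2 * (I (T * (x n - x m)) + I (T * (x n + x m))) - if n = m then 2 else 0)| ≤
      (c n ^ 2 + c m ^ 2) / 2 * (4 * η) := by
    intro n hn m hm
    rw [abs_mul]
    have h1 : |c n * c m| ≤ (c n ^ 2 + c m ^ 2) / 2 := by
      rw [abs_le]; constructor <;> nlinarith [sq_nonneg (c n - c m), sq_nonneg (c n + c m)]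
    have h2 : |2 * (I (T * (x n - x m)) + I (T * (x n + x m))) - if n = m then 2 else 0| ≤ 4 * η := by
      have hpp := hp n hn m hm
      rw [abs_le] at hpp
      by_cases h : n = m
      · rw [if_pos h]
        subst h
        rw [sub_self, mul_zero, h0, abs_le]; constructor <;> linarith
      · rw [if_neg h]
        have := hd n hn m hm h
        rw [abs_le] at this
        rw [abs_le]; constructor <;> linarith
    gcongr
  calc _ ≤ ∑ n ∈ s, ∑ m ∈ s, (c n ^ 2 + c m ^ 2) / 2 * (4 * η) := by
        refine (Finset.abs_sum_le_sum_abs _ _).trans (Finset.sum_le_sum fun n hn => ?_)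
        exact (Finset.abs_sum_le_sum_abs _ _).trans (Finset.sum_le_sum fun m hm => hb n hn m hm)
    _ = 4 * η * s.card * ∑ n ∈ s, c n ^ 2 := by
        simp only [← Finset.sum_mul, ← Finset.sum_div, Finset.sum_add_distrib, Finset.sum_const, nsmul_eq_mul, ← Finset.mul_sum]
        ring
    _ ≤ _ := by gcongr

end VA
end

section
namespace VA

lemma gap_bound {n m N : ℕ} (hn : 3 ≤ n) (hm : 3 ≤ m) (hnN : n ≤ N) (hmN : m ≤ N) (hne : n ≠ m) :
    1 / (N:ℝ) ≤ |2 * aa n - 2 * aa m| := by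
  have key : ∀ a b : ℕ, 3 ≤ a → b ≤ N → a < b → 1 / (N:ℝ) ≤ |2 * aa a - 2 * aa b| := by
    intro a b ha hb hab
    have := aa_sep (show 2 ≤ a by omega) hab hb
    have h0 : (0:ℝ) < N := by exact_mod_cast (show 0 < N by omega)
    have e : 1 / (N:ℝ) = 2 * (1 / (2 * (N:ℝ))) := by field_simp
    rw [abs_sub_comm, e]
    refine le_trans ?_ (le_abs_self _)
    linarith
  rcases lt_or_gt_of_ne hne with h | h
  · exact key n m hn hmN h
  · rw [abs_sub_comm]; exact key m n hm hnN h

lemma decay_use {I : ℝ → ℝ} {C : ℝ} (hC : 0 ≤ C) {k : ℕ} (hI : ∀ y, y ≠ 0 → |I y| ≤ C / |y| ^ k)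
    {T N y : ℝ} (hT : 0 < T) (hN : 0 < N) (hy : 1 / N ≤ |y|) : |I (T * y)| ≤ C * (N / T) ^ k := by
  have h1 : T / N ≤ |T * y| := by
    rw [abs_mul, abs_of_pos hT]
    calc T / N = T * (1 / N) := by ring
      _ ≤ _ := by gcongr
  have h0 : 0 < T / N := by positivity
  have hne : T * y ≠ 0 := abs_pos.mp (lt_of_lt_of_le h0 h1)
  calc _ ≤ C / |T * y| ^ k := hI _ hne
    _ ≤ C / (T / N) ^ k := by gcongr
    _ = _ := by rw [div_eq_mul_inv, ← inv_pow, inv_div]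

lemma err_tendsto {L : ℝ → ℝ} {c : ℝ} (hc : c < 1) (h : ∀ᶠ T in atTop, Real.pi * L T / Real.log T ≤ c)
    (hL : Tendsto L atTop atTop) :
    ∃ k : ℕ, Tendsto (fun T => (NR (Real.pi * L T) : ℝ) * ((NR (Real.pi * L T) : ℝ) / T) ^ k) atTop (nhds 0) := by
  obtain ⟨b, hb⟩ : ∃ b, b = max c (1/2) := ⟨_, rfl⟩
  have hb1 : b < 1 := by rw [hb]; exact max_lt hc (by norm_num)
  have hcb : c ≤ b := by rw [hb]; exact le_max_left _ _
  obtain ⟨k, hk⟩ := exists_nat_gt (b / (1 - b))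
  have hkb : b * (k + 1) < k := by
    rw [div_lt_iff₀ (by linarith)] at hk; linarith
  refine ⟨k, ?_⟩
  have hlim : Tendsto (fun T : ℝ => 4 ^ (k+1) * T ^ (-((k:ℝ) - b * (k + 1)))) atTop (nhds 0) := by
    have := (tendsto_rpow_neg_atTop (show 0 < (k:ℝ) - b * (k + 1) by linarith)).const_mul ((4:ℝ) ^ (k+1))
    simpa using this
  apply squeeze_zero' _ _ hlim
  · filter_upwards [eventually_gt_atTop 0] with T hT; positivity
  · filter_upwards [h, eventually_gt_atTop 1, hL.eventually_ge_atTop 1] with T h1 hT hLT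
    have hT0 : 0 < T := by linarith
    have hlog : 0 < Real.log T := Real.log_pos hT
    rw [div_le_iff₀ hlog] at h1
    have hR : 1 ≤ Real.pi * L T := by nlinarith [Real.pi_gt_three]
    have h2 : (NR (Real.pi * L T) : ℝ) ≤ 4 * T ^ b := by
      refine (NR_cut hR).le.trans ?_
      rw [Real.rpow_def_of_pos hT0]
      have h3 : Real.pi * L T ≤ Real.log T * b := by nlinarith
      have h4 := Real.exp_le_exp.mpr h3
      linarith
    obtain ⟨N, hN⟩ : ∃ N : ℝ, N = (NR (Real.pi * L T) : ℝ) := ⟨_, rfl⟩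
    have hN0 : 0 ≤ N := by rw [hN]; positivity
    rw [← hN] at h2 ⊢
    calc N * (N / T) ^ k = N ^ (k+1) / T ^ k := by rw [div_pow, pow_succ]; ring
      _ ≤ (4 * T ^ b) ^ (k+1) / T ^ k := by gcongr
      _ = 4 ^ (k+1) * (T ^ (b * (k+1)) / T ^ (k:ℝ)) := by
          rw [mul_pow, ← Real.rpow_natCast (T ^ b), ← Real.rpow_mul hT0.le, Real.rpow_natCast T k]
          push_cast; ring
      _ = _ := by rw [← Real.rpow_sub hT0]; congr 2; ring

lemma final_main
    (g : ℝ → ℝ) (hg_smooth : ContDiff ℝ (⊤ : ℕ∞) g) (hg_even : ∀ ξ, g (-ξ) = g ξ)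
    (hg_supp : HasCompactSupport g) (hg_zero : g 0 = 1)
    (hg_sup : sSup {r : ℝ | ∃ ξ : ℝ, g ξ ≠ 0 ∧ |ξ| = r} = 1)
    (w : ℝ → ℝ) (hw_smooth : ContDiff ℝ (⊤ : ℕ∞) w)
    (hw_supp : HasCompactSupport w)
    (hw_mass : ∫ t : ℝ, w t = 1)
    (L : ℝ → ℝ)
    (hL_inf : Tendsto L atTop atTop)
    (hL_limsup : ∃ c : ℝ, c < 1 ∧ ∀ᶠ T in atTop, Real.pi * L T / Real.log T ≤ c) :
    Tendsto (fun T : ℝ =>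
        ((1 / T) * ∫ τ : ℝ, SL g (L T) τ ^ 2 * w (τ / T)) / sigmaSq g (L T))
      atTop (nhds 1) := by
  have hgc := hg_smooth.continuous
  have hv : ∀ x, 1 ≤ x → g x = 0 := fun x hx => g_vanish hgc hg_sup hx
  obtain ⟨Q, Λ, hW⟩ := g_Wt hg_smooth hg_supp hg_sup
  obtain ⟨c0, hc0, hlow⟩ := g_low hgc hg_even hg_zero hg_sup
  obtain ⟨c, hc, hlim⟩ := hL_limsup
  obtain ⟨k, hk⟩ := err_tendsto hc hlim hL_inf
  obtain ⟨C, hC0, hC⟩ := osc_decay k w hw_smooth hw_supp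
  have hmain := main_limit hW hc0 hlow
  have hRinf : Tendsto (fun T => Real.pi * L T) atTop atTop := hL_inf.const_mul_atTop Real.pi_pos
  have hm := hmain.comp hRinf
  obtain ⟨X, hX⟩ : ∃ X : ℝ → ℝ, X = fun T => (∑ n ∈ Finset.Ico 3 (NR (Real.pi * L T)), (fun x => g x ^ 2) (aa n / (Real.pi * L T)) * ampA n ^ 2) / II (fun x => g x ^ 2) (Real.pi * L T) / kappa := ⟨_, rfl⟩
  have hXlim : Tendsto X atTop (nhds 1) := by
    have := hm.div_const kappa
    rw [div_self kappa_pos.ne'] at this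
    rw [hX]; exact this
  have h0 : Tendsto (fun T : ℝ =>
        ((1 / T) * ∫ τ : ℝ, SL g (L T) τ ^ 2 * w (τ / T)) / sigmaSq g (L T) - X T) atTop (nhds 0) := by
    apply squeeze_zero_norm' (a := fun T => 2 * C * ((NR (Real.pi * L T) : ℝ) * ((NR (Real.pi * L T) : ℝ) / T) ^ k) * X T)
    · filter_upwards [eventually_gt_atTop 0, hL_inf.eventually_ge_atTop 1] with T hT hLT
      have hR1 : 1 ≤ Real.pi * L T := by nlinarith [Real.pi_gt_three]
      have hL0 : 0 < L T := by linarith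
      simp only [SL_eq hv hR1]
      rw [moment_eq hw_smooth.continuous hw_supp _ _ _ hT, sigmaSq_eq g hL0]
      have hXT : X T = (∑ n ∈ Finset.Ico 3 (NR (Real.pi * L T)), (fun x => g x ^ 2) (aa n / (Real.pi * L T)) * ampA n ^ 2) / II (fun x => g x ^ 2) (Real.pi * L T) / kappa := by rw [hX]
      have hIpos : 0 < II (fun x => g x ^ 2) (Real.pi * L T) := lt_of_lt_of_le (by positivity) (hlow _ hR1)
      have hcut := NR_cut hR1
      have hsum : ∑ n ∈ Finset.Ico 3 (NR (Real.pi * L T)), (fun x => g x ^ 2) (aa n / (Real.pi * L T)) * ampA n ^ 2 =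
          ∑ n ∈ Finset.Ico 3 (NR (Real.pi * L T)), cf g (Real.pi * L T) n ^ 2 := by
        apply Finset.sum_congr rfl; intro n _; unfold cf; ring
      rw [hsum] at hXT
      obtain ⟨R, hR⟩ : ∃ R, R = Real.pi * L T := ⟨_, rfl⟩
      rw [← hR] at hXT hIpos hcut hR1 ⊢
      have hR0 : 0 < R := by linarith
      obtain ⟨J, hJ⟩ : ∃ J, J = II (fun x => g x ^ 2) R := ⟨_, rfl⟩
      rw [← hJ] at hXT hIpos ⊢
      have hN3 := hcut.three
      obtain ⟨N, hN⟩ : ∃ N, N = NR R := ⟨_, rfl⟩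
      rw [← hN] at hXT hN3 ⊢
      have hN0 : (0:ℝ) < N := by exact_mod_cast (show 0 < N by omega)
      have hN1 : (1:ℝ) ≤ N := by exact_mod_cast (show 1 ≤ N by omega)
      have hb := offdiag_bound (I := fun y => ∫ t, Real.cos (y * t) * w t) (Finset.Ico 3 N) (cf g R) (fun n => 2 * aa n)
        (T := T) (η := C * ((N:ℝ) / T) ^ k) (by positivity) N
        (by rw [Nat.card_Ico]; exact_mod_cast Nat.sub_le N 3)
        (by simpa using hw_mass)
        (by
          intro n hn m hm hne
          rw [Finset.mem_Ico] at hn hm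
          exact decay_use (I := fun y => ∫ t, Real.cos (y * t) * w t) hC0 (fun y hy => (hC y hy).1) hT hN0
            (gap_bound hn.1 hm.1 hn.2.le hm.2.le hne))
        (by
          intro n hn m hm
          rw [Finset.mem_Ico] at hn hm
          apply decay_use (I := fun y => ∫ t, Real.cos (y * t) * w t) hC0 (fun y hy => (hC y hy).1) hT hN0
          have h1 := aa_three hn.1
          have h2 := aa_three hm.1
          refine le_trans ?_ (le_abs_self _)
          have : 1 / (N:ℝ) ≤ 1 := by rw [div_le_one hN0]; exact hN1
          linarith)
      obtain ⟨A, hA⟩ : ∃ A, A = ∑ n ∈ Finset.Ico 3 N, ∑ m ∈ Finset.Ico 3 N, cf g R n * cf g R m * (2 * ((∫ t, Real.cos (T * (2 * aa n - 2 * aa m) * t) * w t) +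
        ∫ t, Real.cos (T * (2 * aa n + 2 * aa m) * t) * w t)) := ⟨_, rfl⟩
      rw [← hA] at hb ⊢
      obtain ⟨B, hB⟩ : ∃ B, B = ∑ n ∈ Finset.Ico 3 N, cf g R n ^ 2 := ⟨_, rfl⟩
      rw [← hB] at hb hXT
      have hkp := kappa_pos
      have e1 : (1 / R) ^ 2 * A / (2 * kappa / R ^ 2 * J) - X T = (A - 2 * B) / (2 * kappa * J) := by
        rw [hXT]; field_simp
      have hp : 0 < 2 * kappa * J := by positivity
      rw [e1, Real.norm_eq_abs, abs_div, abs_of_pos hp, div_le_iff₀ hp]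
      refine hb.trans (le_of_eq ?_)
      rw [hXT]; field_simp; ring
    · have := (hk.const_mul (2 * C)).mul hXlim
      simpa using this
  simpa using h0.add hXlim

end VA
end

/-- **The variance of `S_L`** (Proposition in §5): if `L(T) → ∞` and
`limsup π·L(T)/log T < 1`, then `⟨(S_{L(T)})²⟩_{w,T} ∼ σ_{L(T)}²`. -/
theorem variance_asymptotics
    (g : ℝ → ℝ) (hg_smooth : ContDiff ℝ (⊤ : ℕ∞) g) (hg_even : ∀ ξ, g (-ξ) = g ξ)
    (hg_supp : HasCompactSupport g) (hg_zero : g 0 = 1)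
    (hg_sup : sSup {r : ℝ | ∃ ξ : ℝ, g ξ ≠ 0 ∧ |ξ| = r} = 1)
    (w : ℝ → ℝ) (hw_smooth : ContDiff ℝ (⊤ : ℕ∞) w) (hw_nonneg : ∀ t, 0 ≤ w t)
    (hw_supp : HasCompactSupport w) (hw_pos_supp : tsupport w ⊆ Set.Ioi 0)
    (hw_mass : ∫ t : ℝ, w t = 1)
    (L : ℝ → ℝ) (hL_pos : ∀ T : ℝ, 0 < T → 0 < L T)
    (hL_inf : Tendsto L atTop atTop)
    (hL_limsup : ∃ c : ℝ, c < 1 ∧ ∀ᶠ T in atTop, Real.pi * L T / Real.log T ≤ c) :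
    Tendsto (fun T : ℝ =>
        ((1 / T) * ∫ τ : ℝ, SL g (L T) τ ^ 2 * w (τ / T)) / sigmaSq g (L T))
      atTop (nhds 1) := by
  exact VA.final_main g hg_smooth hg_even hg_supp hg_zero hg_sup w hw_smooth hw_supp hw_mass L hL_inf hL_limsup
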